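/- Let n ≥ 2, 1 ≤ k < n/2, and let Λ_m be the n-linear form associated to a bounded function m on Γ, smooth away from a k-dimensional non-degenerate subspace Γ′ ⊆ Γ, satisfying |∂_ξ^a m(ξ)| ≤ B·dist(ξ,Γ′)^{−|a|} for all derivatives along Γ up to a sufficiently large finite order. Let θ₁,…,θₙ satisfy 0 < θᵢ < 1 and θ₁ + ⋯ + θₙ = n − 2k. Then there is N₀ depending on n, k and the θᵢ such that for all integers N ≥ N₀ the following holds: if f₁,…,fₙ satisfy ‖fᵢ‖_{L²} ≤ 1, if a₁,…,aₙ > 0, and if to each bounded interval I and each 1 ≤ i ≤ n is assigned a number λᵢ(I) ≥ 0 such that ‖fᵢ·χ̃_I^N‖_{L¹} ≤ aᵢλᵢ(I)|I|, ‖fᵢ·χ̃_I^{N/2}‖_{L²} ≤ λᵢ(I)^{1/2}|I|^{1/2}, and λₙ(I) ≤ (1 + λ₁(I) + ⋯ + λ_{n−1}(I))^{1−N} for all I, then |Λ_m(f₁,…,fₙ)| ≤ C·a₁^{θ₁}⋯aₙ^{θₙ}, with C depending only on n, k, N, the θᵢ, Γ′ and B. -/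

import Mathlib

open MeasureTheory Real Complex
open scoped FourierTransform ENNReal NNReal Classical
noncomputable section

def GammaSet (n : ℕ) : Set (Fin n → ℝ) := {ξ | ∑ i, ξ i = 0}

def gammaParam (n : ℕ) (η : Fin (n - 1) → ℝ) : Fin n → ℝ := fun i =>
  if h : (i : ℕ) < n - 1 then η ⟨i, h⟩ else -(∑ j, η j)

def Lam (n : ℕ) (m : (Fin n → ℝ) → ℂ) (f : Fin n → ℝ → ℂ) : ℂ :=
  ∫ η : Fin (n - 1) → ℝ, m (gammaParam n η) * ∏ i, 𝓕 (f i) (gammaParam n η i)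

def Tm (n : ℕ) (m : (Fin n → ℝ) → ℂ) (f : Fin (n - 1) → ℝ → ℂ) (x : ℝ) : ℂ :=
  ∫ η : Fin (n - 1) → ℝ, m (gammaParam n η) * (∏ i, 𝓕 (f i) (η i)) *
    Complex.exp (2 * Real.pi * Complex.I * x * (∑ i, η i))

def NonDegenerate (n k : ℕ) (Γ' : Submodule ℝ (Fin n → ℝ)) : Prop :=
  ∀ ι : Fin k → Fin n, StrictMono ι →
    Function.Bijective (fun (ξ : Γ') (s : Fin k) => (ξ : Fin n → ℝ) (ι s))

def SymbolEst (n : ℕ) (Γ' : Submodule ℝ (Fin n → ℝ)) (M : ℕ) (B : ℝ)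
    (m : (Fin n → ℝ) → ℂ) : Prop :=
  (∀ ξ ∈ GammaSet n, ‖m ξ‖ ≤ B) ∧
  ContDiffOn ℝ (M : ℕ∞) m ((Γ' : Set (Fin n → ℝ))ᶜ) ∧
  ∀ a : ℕ, a ≤ M → ∀ ξ ∈ ((Γ' : Set (Fin n → ℝ))ᶜ), ∀ v : Fin a → (Fin n → ℝ),
    (∀ s, v s ∈ GammaSet n) → (∀ s, ‖v s‖ ≤ 1) →
    ‖iteratedFDerivWithin ℝ a m ((Γ' : Set (Fin n → ℝ))ᶜ) ξ v‖ ≤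
      B / Metric.infDist ξ (Γ' : Set (Fin n → ℝ)) ^ a

def Admissible (n : ℕ) (a : Fin n → ℝ) : Prop :=
  (∀ i, a i < 1) ∧ ∑ i, a i = 1 ∧ ∀ i j, a i < 0 → a j < 0 → i = j

def RestrictedType (n : ℕ) (Λ : (Fin n → ℝ → ℂ) → ℂ) (a : Fin n → ℝ) (C : ℝ) : Prop :=
  ∀ E : Fin n → Set ℝ, (∀ i, MeasurableSet (E i)) → (∀ i, volume (E i) < ⊤) →
    ∃ E' : Fin n → Set ℝ, (∀ i, MeasurableSet (E' i)) ∧ (∀ i, E' i ⊆ E i) ∧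
      (∀ i, 0 ≤ a i → E' i = E i) ∧ (∀ i, volume (E i) ≤ 2 * volume (E' i)) ∧
      ∀ F : Fin n → ℝ → ℂ, (∀ i, Measurable (F i)) →
        (∀ i x, ‖F i x‖ ≤ 1) → (∀ i x, x ∉ E' i → F i x = 0) →
        ‖Λ F‖ ≤ C * ∏ i, (volume (E i)).toReal ^ a i

structure Iv where
  l : ℝ
  len : ℝ

def Iv.set (I : Iv) : Set ℝ := Set.Ioo I.l (I.l + I.len)

def Iv.dil (c : ℝ) (I : Iv) : Set ℝ :=
  Set.Ioo (I.l + I.len / 2 - c * I.len / 2) (I.l + I.len / 2 + c * I.len / 2)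

def Iv.chi (I : Iv) (x : ℝ) : ℝ := (1 + Metric.infDist x I.set / I.len)⁻¹

structure Tile where
  j : ℤ
  kt : ℤ
  kf : ℤ

def Tile.timeIv (P : Tile) : Iv := ⟨(2:ℝ)^P.j * P.kt, (2:ℝ)^P.j⟩

def Tile.freqIv (β : ℝ) (P : Tile) : Iv :=
  ⟨(2:ℝ)^(-P.j) * ((P.kf : ℝ) + (-1:ℝ)^(-P.j) * β), (2:ℝ)^(-P.j)⟩

def Tile.lt' (β : ℝ) (P' P : Tile) : Prop :=
  (P'.timeIv).set ⊂ (P.timeIv).set ∧ (P.freqIv β).set ⊆ (P'.freqIv β).dil 3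

def Tile.le' (β : ℝ) (P' P : Tile) : Prop := Tile.lt' β P' P ∨ P' = P

def Tile.lesim (β c : ℝ) (P' P : Tile) : Prop :=
  (P'.timeIv).set ⊆ (P.timeIv).set ∧ (P.freqIv β).set ⊆ (P'.freqIv β).dil c

def Tile.lesim' (β c : ℝ) (P' P : Tile) : Prop :=
  Tile.lesim β c P' P ∧ ¬ Tile.le' β P' P

structure MultiTile (n : ℕ) where
  j : ℤ
  kt : ℤ
  kf : Fin n → ℤ

def MultiTile.tile {n : ℕ} (P : MultiTile n) (i : Fin n) : Tile := ⟨P.j, P.kt, P.kf i⟩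

def MultiTile.timeIv {n : ℕ} (P : MultiTile n) : Iv := ⟨(2:ℝ)^P.j * P.kt, (2:ℝ)^P.j⟩

def MultiTile.freqCube {n : ℕ} (α : Fin n → ℝ) (P : MultiTile n) : Set (Fin n → ℝ) :=
  {ξ | ∀ i, ξ i ∈ ((P.tile i).freqIv (α i)).set}

def HasRank (n k : ℕ) (α : Fin n → ℝ) (c₃ csmall : ℝ) (Ps : Finset (MultiTile n)) : Prop :=
  ∀ P ∈ Ps, ∀ P' ∈ Ps, ∀ ι : Fin k → Fin n, StrictMono ι →
    (∀ s, Tile.le' (α (ι s)) (MultiTile.tile P' (ι s)) (MultiTile.tile P (ι s))) →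
    (∀ i, Tile.lesim (α i) c₃ (MultiTile.tile P' i) (MultiTile.tile P i)) ∧
    ((2:ℝ)^P'.j ≤ csmall * (2:ℝ)^P.j →
      ∃ i i' : Fin n, i ≠ i' ∧ Tile.lesim' (α i) c₃ (MultiTile.tile P' i) (MultiTile.tile P i) ∧
        Tile.lesim' (α i') c₃ (MultiTile.tile P' i') (MultiTile.tile P i'))

def AdaptedBump (w : Iv) (Ca : ℕ → ℝ) (M : ℕ) (ψ : ℝ → ℂ) : Prop :=
  ContDiff ℝ (⊤ : ℕ∞) ψ ∧ (∀ ξ, ξ ∉ w.set → ψ ξ = 0) ∧ (∀ ξ ∈ w.dil (9/10), ψ ξ = 1) ∧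
  ∀ a : ℕ, a ≤ M → ∀ ξ : ℝ, ‖iteratedDeriv a ψ ξ‖ ≤ Ca a / w.len ^ a

def mulOp (ψ : ℝ → ℂ) (f : ℝ → ℂ) (x : ℝ) : ℂ :=
  ∫ ξ : ℝ, ψ ξ * 𝓕 f ξ * Complex.exp (2 * Real.pi * Complex.I * ξ * x)

def tileNorm (N : ℕ) (ψ : ℝ → ℂ) (P : Tile) (f : ℝ → ℂ) : ℝ :=
  ((2:ℝ)^P.j)⁻¹ * ∫ x : ℝ, ‖mulOp ψ f x‖ * (P.timeIv).chi x ^ (2*N)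

def IsTree (n : ℕ) (α : Fin n → ℝ) (Ps T : Finset (MultiTile n)) (PT : MultiTile n)
    (jdx : Fin n) : Prop :=
  PT ∈ Ps ∧ T ⊆ Ps ∧ ∀ P ∈ T, Tile.le' (α jdx) (MultiTile.tile P jdx) (MultiTile.tile PT jdx)

def treeNorm (n N : ℕ) (ψ : Fin n → Tile → ℝ → ℂ) (i : Fin n) (f : ℝ → ℂ)
    (T : Finset (MultiTile n)) : ℝ :=
  ⨆ P ∈ T, tileNorm N (ψ i (MultiTile.tile P i)) (MultiTile.tile P i) f

def treeSize (n N : ℕ) (α : Fin n → ℝ) (c₃ : ℝ) (ψ : Fin n → Tile → ℝ → ℂ)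
    (i : Fin n) (f : ℝ → ℂ) (T : Finset (MultiTile n)) (PT : MultiTile n) : ℝ :=
  Real.sqrt (((2:ℝ)^PT.j)⁻¹ * ∑ P ∈ T,
      if Tile.lesim' (α i) c₃ (MultiTile.tile P i) (MultiTile.tile PT i)
      then (2:ℝ)^P.j * tileNorm N (ψ i (MultiTile.tile P i)) (MultiTile.tile P i) f ^ 2 else 0)
    + treeNorm n N ψ i f T

def StronglyDisjoint (n : ℕ) (α : Fin n → ℝ) (i : Fin n)
    (T : Finset (MultiTile n)) (PT : MultiTile n)
    (T' : Finset (MultiTile n)) (PT' : MultiTile n) : Prop :=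
  (∀ P ∈ T, ∀ P' ∈ T', MultiTile.tile P i ≠ MultiTile.tile P' i) ∧
  (∀ P ∈ T, ∀ P' ∈ T',
    ((MultiTile.tile P i).freqIv (α i)).set ⊂ ((MultiTile.tile P' i).freqIv (α i)).set →
    (MultiTile.timeIv P').set ∩ (MultiTile.timeIv PT).set = ∅) ∧
  (∀ P ∈ T, ∀ P' ∈ T',
    ((MultiTile.tile P' i).freqIv (α i)).set ⊂ ((MultiTile.tile P i).freqIv (α i)).set →
    (MultiTile.timeIv P).set ∩ (MultiTile.timeIv PT').set = ∅)

def setDist {E : Type*} [PseudoMetricSpace E] (s t : Set E) : ℝ :=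
  ⨅ x ∈ s, Metric.infDist x t

namespace MTT

/-- dyadic intervals -/
abbrev Dy := ℤ × ℤ
/-- tiles -/
abbrev Ti := Dy × ℤ

def len (I : Dy) : ℝ := (2:ℝ) ^ I.1
def lf (I : Dy) : ℝ := len I * I.2
def iv (I : Dy) : Set ℝ := Set.Ico (lf I) (lf I + len I)

lemma len_pos (I : Dy) : 0 < len I := by unfold len; positivity
lemma len_ne (I : Dy) : len I ≠ 0 := (len_pos I).ne'

lemma lf_mem (I : Dy) : lf I ∈ iv I := ⟨le_refl _, by linarith [len_pos I]⟩

lemma iv_nonempty (I : Dy) : (iv I).Nonempty := ⟨_, lf_mem I⟩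

lemma measurableSet_iv (I : Dy) : MeasurableSet (iv I) := measurableSet_Ico

lemma volume_iv (I : Dy) : volume.real (iv I) = len I := by
  unfold iv
  rw [Real.volume_real_Ico_of_le] <;> linarith [len_pos I]

lemma volume_iv' (I : Dy) : volume (iv I) = ENNReal.ofReal (len I) := by
  unfold iv
  rw [Real.volume_Ico]; congr 1; ring

lemma len_le_of_le {I J : Dy} (h : I.1 ≤ J.1) : len I ≤ len J :=
  zpow_le_zpow_right₀ (by norm_num) h

lemma len_lt_of_lt {I J : Dy} (h : I.1 < J.1) : len I < len J :=
  zpow_lt_zpow_right₀ (by norm_num) h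

lemma len_eq_mul {I J : Dy} (h : I.1 ≤ J.1) :
    len J = 2 ^ (J.1 - I.1).toNat * len I := by
  unfold len
  rw [← zpow_natCast, Int.toNat_of_nonneg (by omega), ← zpow_add₀ (by norm_num)]
  congr 1; ring

lemma iv_nested {I J : Dy} (h : I.1 ≤ J.1) (hx : (iv I ∩ iv J).Nonempty) : iv I ⊆ iv J := by
  obtain ⟨x, ⟨h1, h2⟩, h3, h4⟩ := hx
  have hlen := len_eq_mul h
  set d := (J.1 - I.1).toNat
  have hp := len_pos I
  unfold lf at *
  rw [hlen] at h3 h4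
  have e1 : (2 ^ d * J.2 : ℤ) < I.2 + 1 := by
    have : len I * ((2 ^ d * J.2 : ℤ) : ℝ) < len I * ((I.2 + 1 : ℤ) : ℝ) := by
      push_cast; nlinarith
    exact_mod_cast lt_of_mul_lt_mul_left this hp.le
  have e2 : (I.2 : ℤ) < 2 ^ d * J.2 + 2 ^ d := by
    have : len I * ((I.2 : ℤ) : ℝ) < len I * ((2 ^ d * J.2 + 2 ^ d : ℤ) : ℝ) := by
      push_cast; nlinarith
    exact_mod_cast lt_of_mul_lt_mul_left this hp.le
  have e1' : ((2:ℝ) ^ d * J.2 ) ≤ I.2 := by exact_mod_cast (by omega : (2 ^ d * J.2 : ℤ) ≤ I.2)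
  have e2' : (I.2 : ℝ) + 1 ≤ 2 ^ d * J.2 + 2 ^ d := by
    exact_mod_cast (by omega : (I.2 + 1 : ℤ) ≤ 2 ^ d * J.2 + 2 ^ d)
  rintro y ⟨y1, y2⟩
  unfold lf at y1 y2
  constructor
  · unfold lf; rw [hlen]; nlinarith
  · unfold lf; rw [hlen]; nlinarith

lemma le_of_subset {I J : Dy} (h : iv I ⊆ iv J) : I.1 ≤ J.1 := by
  by_contra hc
  push Not at hc
  have := len_lt_of_lt hc
  have h2 : volume.real (iv I) ≤ volume.real (iv J) := by
    exact measureReal_mono h (by rw [volume_iv']; exact ENNReal.ofReal_ne_top)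
  rw [volume_iv, volume_iv] at h2
  linarith

lemma len_le_of_subset {I J : Dy} (h : iv I ⊆ iv J) : len I ≤ len J := len_le_of_le (le_of_subset h)

lemma eq_of_scale {I J : Dy} (h : I.1 = J.1) (hx : (iv I ∩ iv J).Nonempty) : I = J := by
  have h1 := iv_nested h.le hx
  have h2 := iv_nested h.ge (by rwa [Set.inter_comm])
  have : lf I = lf J := by
    have a1 := h1 (lf_mem I)
    have a2 := h2 (lf_mem J)
    exact le_antisymm a2.1 a1.1
  have hl : len I = len J := by unfold len; rw [h]
  unfold lf at this
  rw [hl] at this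
  have := mul_left_cancel₀ (len_ne J) this
  exact Prod.ext h (by exact_mod_cast this)

lemma subset_or {I J : Dy} (hx : (iv I ∩ iv J).Nonempty) : iv I ⊆ iv J ∨ iv J ⊆ iv I := by
  rcases le_total I.1 J.1 with h | h
  · left; exact iv_nested h hx
  · right; exact iv_nested h (by rwa [Set.inter_comm])

/-- the weight -/
def kw (L c x : ℝ) : ℝ := 1 + |x - c| / L

lemma one_le_kw {L : ℝ} (hL : 0 < L) (c x : ℝ) : 1 ≤ kw L c x := by
  unfold kw; have := abs_nonneg (x - c); have : 0 ≤ |x - c| / L := by positivity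
  linarith

lemma kw_pos {L : ℝ} (hL : 0 < L) (c x : ℝ) : 0 < kw L c x := by
  linarith [one_le_kw hL c x]

lemma kw_comm (L c x : ℝ) : kw L c x = kw L x c := by unfold kw; rw [abs_sub_comm]

lemma kw_cont (L c : ℝ) : Continuous (kw L c) := by unfold kw; fun_prop

lemma kw_tri {L : ℝ} (hL : 0 < L) (c x y : ℝ) : kw L c y ≤ kw L c x + |x - y| / L := by
  unfold kw
  have : |y - c| ≤ |x - c| + |x - y| := by
    have := abs_sub_le y x c; rw [abs_sub_comm y x] at this; linarith
  have : |y - c| / L ≤ (|x - c| + |x - y|) / L := by gcongr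
  rw [add_div] at this; linarith

lemma kw_mul {L : ℝ} (hL : 0 < L) (c x y : ℝ) : kw L c y ≤ kw L c x * kw L x y := by
  have := kw_tri hL c x y
  have h1 := one_le_kw hL c x
  have : kw L x y = 1 + |x - y| / L := by unfold kw; rw [abs_sub_comm]
  have : 0 ≤ |x - y| / L := by positivity
  nlinarith

lemma kw_anti {L L' : ℝ} (hL : 0 < L') (h : L' ≤ L) (c x : ℝ) : kw L c x ≤ kw L' c x := by
  unfold kw; gcongr

lemma kw_inv_sq_le {L : ℝ} (hL : 0 < L) (c x : ℝ) :
    (kw L c x ^ 2)⁻¹ ≤ (1 + (L⁻¹ * (x - c)) ^ 2)⁻¹ := by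
  apply inv_anti₀ (by positivity)
  unfold kw
  have : (L⁻¹ * (x - c)) ^ 2 = (|x - c| / L) ^ 2 := by
    rw [div_pow, sq_abs]; field_simp
  rw [this]
  have : 0 ≤ |x - c| / L := by positivity
  nlinarith

lemma integrable_kw2 {L : ℝ} (hL : 0 < L) (c : ℝ) : Integrable (fun x => (kw L c x ^ 2)⁻¹) := by
  have h0 : Integrable (fun x : ℝ => (1 + (L⁻¹ * (x - c)) ^ 2)⁻¹) := by
    have := (integrable_inv_one_add_sq.comp_mul_left' (inv_ne_zero hL.ne')).comp_sub_right c
    exact this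
  refine h0.mono' ?_ ?_
  · have : Continuous (fun x => (kw L c x ^ 2)⁻¹) := by
      apply Continuous.inv₀
      · exact (kw_cont L c).pow 2
      · intro x; have := kw_pos hL c x; positivity
    exact this.aestronglyMeasurable
  · refine Filter.Eventually.of_forall fun x => ?_
    rw [Real.norm_of_nonneg (by have := kw_pos hL c x; positivity)]
    exact kw_inv_sq_le hL c x

lemma integral_kw2 {L : ℝ} (hL : 0 < L) (c : ℝ) : ∫ x, (kw L c x ^ 2)⁻¹ ≤ 4 * L := by
  have h0 : Integrable (fun x : ℝ => (1 + (L⁻¹ * (x - c)) ^ 2)⁻¹) := by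
    have := (integrable_inv_one_add_sq.comp_mul_left' (inv_ne_zero hL.ne')).comp_sub_right c
    exact this
  have h1 := integral_mono (integrable_kw2 hL c) h0 (fun x => kw_inv_sq_le hL c x)
  have h2 : ∫ x : ℝ, (1 + (L⁻¹ * (x - c)) ^ 2)⁻¹ = L * π := by
    rw [integral_sub_right_eq_self (fun x : ℝ => (1 + (L⁻¹ * x) ^ 2)⁻¹) c]
    rw [Measure.integral_comp_mul_left (fun x : ℝ => (1 + x ^ 2)⁻¹) L⁻¹]
    rw [integral_univ_inv_one_add_sq]
    simp [abs_of_pos hL]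
  have := Real.pi_lt_four
  nlinarith

lemma kw_pow_anti {L : ℝ} (hL : 0 < L) (c x : ℝ) {p q : ℕ} (h : p ≤ q) :
    (kw L c x ^ q)⁻¹ ≤ (kw L c x ^ p)⁻¹ := by
  apply inv_anti₀ (by have := kw_pos hL c x; positivity)
  exact pow_le_pow_right₀ (one_le_kw hL c x) h

lemma kw_inv_cont {L : ℝ} (hL : 0 < L) (c : ℝ) (p : ℕ) :
    Continuous (fun x => (kw L c x ^ p)⁻¹) := by
  apply Continuous.inv₀
  · exact (kw_cont L c).pow p
  · intro x; have := kw_pos hL c x; positivity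

lemma kw_inv_nonneg {L : ℝ} (hL : 0 < L) (c x : ℝ) (p : ℕ) : 0 ≤ (kw L c x ^ p)⁻¹ := by
  have := kw_pos hL c x; positivity

lemma kw_inv_le_one {L : ℝ} (hL : 0 < L) (c x : ℝ) (p : ℕ) : (kw L c x ^ p)⁻¹ ≤ 1 :=
  inv_le_one_of_one_le₀ (one_le_pow₀ (one_le_kw hL c x))

lemma integrable_kw {L : ℝ} (hL : 0 < L) (c : ℝ) {p : ℕ} (hp : 2 ≤ p) :
    Integrable (fun x => (kw L c x ^ p)⁻¹) := by
  refine (integrable_kw2 hL c).mono' (kw_inv_cont hL c p).aestronglyMeasurable ?_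
  refine Filter.Eventually.of_forall fun x => ?_
  rw [Real.norm_of_nonneg (kw_inv_nonneg hL c x p)]
  exact kw_pow_anti hL c x hp

lemma integral_kw {L : ℝ} (hL : 0 < L) (c : ℝ) {p : ℕ} (hp : 2 ≤ p) :
    ∫ x, (kw L c x ^ p)⁻¹ ≤ 4 * L :=
  (integral_mono (integrable_kw hL c hp) (integrable_kw2 hL c)
    (fun x => kw_pow_anti hL c x hp)).trans (integral_kw2 hL c)

/-- sums over families of intervals with bounded overlap are dominated by integrals -/
lemma sum_le_integral {α : Type*} (T : Finset α) (I : α → Dy) (E : Set ℝ)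
    (hE : MeasurableSet E) (m : ℝ) (L c : ℝ) (hL : 0 < L) {p : ℕ} (hp : 2 ≤ p)
    (hsub : ∀ P ∈ T, iv (I P) ⊆ E) (hlen : ∀ P ∈ T, len (I P) ≤ L)
    (hov : ∀ x, ((T.filter (fun P => x ∈ iv (I P))).card : ℝ) ≤ m) :
    ∑ P ∈ T, len (I P) * (kw L c (lf (I P)) ^ p)⁻¹ ≤
      2 ^ p * m * ∫ x in E, (kw L c x ^ p)⁻¹ := by
  have hintg := integrable_kw hL c hp
  have step : ∀ P ∈ T, len (I P) * (kw L c (lf (I P)) ^ p)⁻¹ ≤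
      ∫ x, (iv (I P)).indicator (fun x => 2 ^ p * (kw L c x ^ p)⁻¹) x := by
    intro P hP
    rw [integral_indicator (measurableSet_iv _)]
    have : len (I P) * (kw L c (lf (I P)) ^ p)⁻¹ =
        ∫ x in iv (I P), (kw L c (lf (I P)) ^ p)⁻¹ := by
      rw [setIntegral_const, volume_iv, smul_eq_mul]
    rw [this]
    apply setIntegral_mono_on
    · exact integrableOn_const (by rw [volume_iv']; exact ENNReal.ofReal_ne_top)
    · exact (hintg.const_mul _).integrableOn
    · exact measurableSet_iv _
    · intro x hx
      have h1 : kw L c x ≤ 2 * kw L c (lf (I P)) := by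
        have h2 := kw_tri hL c (lf (I P)) x
        have h3 : |lf (I P) - x| / L ≤ 1 := by
          rw [div_le_one hL, abs_sub_comm, abs_of_nonneg (by linarith [hx.1])]
          linarith [hx.2, hlen P hP]
        linarith [one_le_kw hL c (lf (I P))]
      have h4 := kw_pos hL c x
      have h5 := kw_pos hL c (lf (I P))
      rw [← div_eq_mul_inv, inv_le_comm₀ (by positivity) (by positivity), inv_div]
      rw [div_le_iff₀ (by positivity), ← mul_pow]
      rw [mul_comm] at h1
      gcongr
  refine (Finset.sum_le_sum step).trans ?_
  have hi : ∀ P ∈ T, Integrable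
      ((iv (I P)).indicator (fun x => 2 ^ p * (kw L c x ^ p)⁻¹)) := fun P _ =>
    (hintg.const_mul _).indicator (measurableSet_iv _)
  rw [← integral_finsetSum _ hi, ← integral_indicator hE, ← integral_const_mul]
  apply integral_mono (integrable_finsetSum _ hi) ((hintg.indicator hE).const_mul _)
  intro x
  simp only [Set.indicator_apply]
  rw [← Finset.sum_filter, Finset.sum_const, nsmul_eq_mul]
  by_cases hx : x ∈ E
  · rw [if_pos hx]
    have := kw_inv_nonneg hL c x p
    have h2 : ((T.filter (fun P => x ∈ iv (I P))).card : ℝ) ≤ m := hov x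
    calc _ ≤ (m:ℝ) * (2 ^ p * (kw L c x ^ p)⁻¹) := by gcongr
      _ = _ := by ring
  · rw [if_neg hx]
    have : T.filter (fun P => x ∈ iv (I P)) = ∅ := by
      rw [Finset.filter_eq_empty_iff]
      intro P hP hxP
      exact hx (hsub P hP hxP)
    rw [this]; simp

lemma filter_scale_card {α : Type*} (T : Finset α) (I : α → Dy) (hI : Set.InjOn I T) (j : ℤ)
    (hj : ∀ P ∈ T, (I P).1 = j) (x : ℝ) : (T.filter (fun P => x ∈ iv (I P))).card ≤ 1 := by
  rw [Finset.card_le_one]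
  intro P hP Q hQ
  simp only [Finset.mem_filter] at hP hQ
  exact hI hP.1 hQ.1 (eq_of_scale ((hj P hP.1).trans (hj Q hQ.1).symm) ⟨x, hP.2, hQ.2⟩)

/-- sum over one scale of dyadic intervals -/
lemma sum_scale (T : Finset Dy) (j : ℤ) (hj : ∀ I ∈ T, I.1 = j) (L c : ℝ)
    (hL : (2:ℝ) ^ j ≤ L) {p : ℕ} (hp : 2 ≤ p) :
    ∑ I ∈ T, len I * (kw L c (lf I) ^ p)⁻¹ ≤ 16 * L := by
  have hL0 : 0 < L := lt_of_lt_of_le (by positivity) hL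
  have h1 : ∑ I ∈ T, len I * (kw L c (lf I) ^ p)⁻¹ ≤ ∑ I ∈ T, len I * (kw L c (lf I) ^ 2)⁻¹ :=
    Finset.sum_le_sum fun I _ =>
      mul_le_mul_of_nonneg_left (kw_pow_anti hL0 c _ hp) (len_pos I).le
  refine h1.trans ?_
  have := sum_le_integral T id Set.univ MeasurableSet.univ 1 L c hL0 (le_refl 2)
    (fun _ _ => Set.subset_univ _) (fun I hI => by simp only [id, len, hj I hI]; exact hL)
    (fun x => by exact_mod_cast filter_scale_card T id Function.injective_id.injOn j hj x)
  simp only [id, Measure.restrict_univ] at this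
  have h2 := integral_kw2 hL0 c
  norm_num at this
  linarith

lemma sum_geom_le (T : Finset ℤ) (J : ℤ) (h : ∀ j ∈ T, j ≤ J) :
    ∑ j ∈ T, (2:ℝ) ^ j ≤ 2 * 2 ^ J := by
  have hs : HasSum (fun k : ℕ => (2:ℝ)^J * (1/2)^k) (2^J * 2) := hasSum_geometric_two.mul_left _
  have : ∑ j ∈ T, (2:ℝ) ^ j = ∑ k ∈ T.image (fun j => (J - j).toNat), (2:ℝ)^J * (1/2)^k := by
    rw [Finset.sum_image]
    · apply Finset.sum_congr rfl
      intro j hj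
      have := h j hj
      rw [one_div, inv_pow, ← zpow_natCast, Int.toNat_of_nonneg (by omega), ← zpow_neg,
        ← zpow_add₀ (by norm_num)]
      congr 1; ring
    · intro a ha b hb hab
      have h1 := h a ha; have h2 := h b hb
      simp only at hab
      omega
  rw [this]
  have := sum_le_hasSum (T.image (fun j => (J - j).toNat)) (fun k _ => by positivity) hs
  linarith

end MTT

namespace MTT

def fr (P : Ti) : ℝ := P.2 / len P.1
def near (K : ℝ) (P P' : Ti) : Prop := |fr P - fr P'| ≤ K * (1 / len P.1 + 1 / len P'.1)
def mx (P P' : Ti) : ℝ := max (len P.1) (len P'.1)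
def G (R : ℝ) (P P' : Ti) : ℝ :=
  if near R P P' then (mx P P')⁻¹ * (kw (mx P P') (lf P.1) (lf P'.1) ^ 4)⁻¹ else 0

lemma mx_pos (P P' : Ti) : 0 < mx P P' := lt_max_of_lt_left (len_pos _)

lemma near_symm {K : ℝ} {P P' : Ti} (h : near K P P') : near K P' P := by
  unfold near at *; rw [abs_sub_comm, add_comm]; exact h

lemma G_symm (R : ℝ) (P P' : Ti) : G R P P' = G R P' P := by
  unfold G mx
  rw [max_comm, kw_comm]
  by_cases h : near R P P'
  · rw [if_pos h, if_pos (near_symm h)]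
  · rw [if_neg h, if_neg (fun h' => h (near_symm h'))]

lemma G_nonneg (R : ℝ) (P P' : Ti) : 0 ≤ G R P P' := by
  unfold G
  split_ifs
  · exact mul_nonneg (inv_nonneg.2 (mx_pos P P').le) (kw_inv_nonneg (mx_pos P P') _ _ _)
  · exact le_refl _

/-- abstract Bessel property of coefficients -/
def Bes (R : ℝ) (c : Ti → ℝ) (S : Ti → Prop) (E : ℝ) : Prop :=
  ∀ T : Finset Ti, (∀ P ∈ T, S P) → ∀ a : Ti → ℝ, (∀ P, 0 ≤ a P) →
    (∑ P ∈ T, a P * c P) ^ 2 ≤ E * ∑ P ∈ T, ∑ P' ∈ T, a P * a P' * G R P P'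

lemma card_int_le (T : Finset ℤ) (x ρ : ℝ) (hρ : 0 ≤ ρ) (h : ∀ q ∈ T, |(q:ℝ) - x| ≤ ρ) :
    (T.card : ℝ) ≤ 2 * ρ + 1 := by
  have hsub : T ⊆ Finset.Icc ⌈x - ρ⌉ ⌊x + ρ⌋ := by
    intro q hq
    have := abs_le.1 (h q hq)
    rw [Finset.mem_Icc, Int.ceil_le, Int.le_floor]
    constructor <;> linarith
  have h1 := Finset.card_le_card hsub
  rw [Int.card_Icc] at h1
  have h2 : ((⌊x + ρ⌋ + 1 - ⌈x - ρ⌉).toNat : ℝ) ≤ 2 * ρ + 1 := by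
    have h3 : (((⌊x + ρ⌋ + 1 - ⌈x - ρ⌉).toNat : ℤ) : ℝ) =
      ((max (⌊x + ρ⌋ + 1 - ⌈x - ρ⌉) 0 : ℤ) : ℝ) := by rw [Int.toNat_eq_max]
    rw [Int.cast_natCast] at h3
    rw [h3]; push_cast
    apply max_le _ (by positivity)
    linarith [Int.floor_le (x + ρ), Int.le_ceil (x - ρ)]
  exact le_trans (by exact_mod_cast h1) h2

/-- generic bound of a sum by fibres over integers -/
lemma sum_fibre_le {α : Type*} (T : Finset α) (g : α → ℤ) (F : α → ℝ) (N K : ℝ) (hK : 0 ≤ K)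
    (hN : ((T.image g).card : ℝ) ≤ N)
    (hF : ∀ q, ∑ P ∈ T.filter (fun P => g P = q), F P ≤ K) : ∑ P ∈ T, F P ≤ N * K := by
  rw [← Finset.sum_fiberwise_of_maps_to (t := T.image g) (g := g)
    (fun P hP => Finset.mem_image_of_mem g hP)]
  calc _ ≤ ∑ _q ∈ T.image g, K := Finset.sum_le_sum fun q _ => hF q
    _ = (T.image g).card * K := by simp
    _ ≤ _ := by gcongr

lemma sum_count (T : Finset Ti) (j : ℤ) (hj : ∀ P ∈ T, P.1.1 = j) (x ρ : ℝ) (hρ : 0 ≤ ρ)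
    (hq : ∀ P ∈ T, |(P.2:ℝ) - x| ≤ ρ) (L c : ℝ) (hL : (2:ℝ) ^ j ≤ L) {p : ℕ} (hp : 2 ≤ p) :
    ∑ P ∈ T, len P.1 * (kw L c (lf P.1) ^ p)⁻¹ ≤ (2 * ρ + 1) * (16 * L) := by
  have hL0 : 0 < L := lt_of_lt_of_le (by positivity) hL
  apply sum_fibre_le T (fun P => P.2) _ _ _ (by positivity)
  · apply card_int_le _ x ρ hρ
    intro q hq'
    obtain ⟨P, hP, rfl⟩ := Finset.mem_image.1 hq'
    exact hq P hP
  · intro q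
    have hinj : Set.InjOn (fun P : Ti => P.1) (T.filter (fun P => P.2 = q)) := by
      intro a ha b hb hab
      simp only [Finset.coe_filter, Set.mem_ofPred_eq] at ha hb
      exact Prod.ext hab (ha.2.trans hb.2.symm)
    rw [← Finset.sum_image (f := fun I => len I * (kw L c (lf I) ^ p)⁻¹) hinj]
    apply sum_scale _ j _ L c hL hp
    intro I hI
    obtain ⟨P, hP, rfl⟩ := Finset.mem_image.1 hI
    exact hj P (Finset.mem_filter.1 hP).1

lemma two_mul_add_one_le (r : ℕ) : (2 * r + 1 : ℝ) ≤ 2 * 2 ^ r := by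
  have : ∀ r : ℕ, 2 * r + 1 ≤ 2 * 2 ^ r := by
    intro r
    induction r with
    | zero => norm_num
    | succ k ih => rw [pow_succ]; have := Nat.one_le_two_pow (n := k); omega
  exact_mod_cast this r

lemma len_ratio_le {I J : Dy} {r : ℕ} (h : I.1 - J.1 ≤ r) : len I ≤ 2 ^ r * len J := by
  unfold len
  rw [← zpow_natCast, ← zpow_add₀ (by norm_num)]
  exact zpow_le_zpow_right₀ (by norm_num) (by omega)

/-- Schur test -/
lemma schur (R : ℝ) (hR : 1 ≤ R) (r : ℕ) (P : Ti) (T : Finset Ti)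
    (hT : ∀ P' ∈ T, |P.1.1 - P'.1.1| ≤ r) :
    ∑ P' ∈ T, len P'.1 * G R P P' ≤ 160 * R * 4 ^ r := by
  have h2r : (1:ℝ) ≤ 2 ^ r := one_le_pow₀ (by norm_num)
  have key : ∑ P' ∈ T, len P'.1 * G R P P' ≤ (2 * r + 1 : ℝ) * (80 * R * 2 ^ r) := by
    apply sum_fibre_le T (fun P => P.1.1) _ _ _ (by positivity)
    · apply card_int_le _ (P.1.1 : ℝ) r (by positivity)
      intro q hq
      obtain ⟨P', hP', rfl⟩ := Finset.mem_image.1 hq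
      rw [abs_sub_comm]
      exact_mod_cast hT P' hP'
    · intro j
      set T1 := T.filter (fun P => P.1.1 = j) with hT1
      set T2 := T1.filter (fun P' => near R P P') with hT2
      by_cases hemp : T1 = ∅
      · rw [hemp]; simp; positivity
      obtain ⟨P0, hP0⟩ := Finset.nonempty_iff_ne_empty.2 hemp
      have hj0 : |P.1.1 - j| ≤ r := by
        have h := Finset.mem_filter.1 hP0
        rw [← h.2]; exact hT P0 h.1
      have hjl : (2:ℝ) ^ j ≤ 2 ^ r * len P.1 := by
        have := @len_ratio_le (j, 0) P.1 r (by simp only; have := abs_le.1 hj0; omega)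
        exact this
      set M := max (len P.1) ((2:ℝ) ^ j)
      have hM : 0 < M := lt_max_of_lt_left (len_pos _)
      have e1 : ∑ P' ∈ T1, len P'.1 * G R P P' =
          ∑ P' ∈ T2, M⁻¹ * (len P'.1 * (kw M (lf P.1) (lf P'.1) ^ 4)⁻¹) := by
        conv_rhs => rw [hT2, Finset.sum_filter]
        apply Finset.sum_congr rfl
        intro P' hP'
        have hlen : len P'.1 = 2 ^ j := by unfold len; rw [(Finset.mem_filter.1 hP').2]
        unfold G mx
        split_ifs
        · rw [hlen]; ring
        · simp
      rw [e1, ← Finset.mul_sum]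
      have e2 := sum_count T2 j
        (fun P' hP' => (Finset.mem_filter.1 (Finset.mem_filter.1 hP').1).2)
        ((2:ℝ) ^ j * fr P) (R * (1 + 2 ^ r)) (by positivity) (by
          intro P' hP'
          have hj' := (Finset.mem_filter.1 (Finset.mem_filter.1 hP').1).2
          have hn := (Finset.mem_filter.1 hP').2
          have hlen : len P'.1 = 2 ^ j := by unfold len; rw [hj']
          unfold near at hn
          have hfr : (P'.2 : ℝ) = 2 ^ j * fr P' := by
            unfold fr; rw [hlen]; field_simp
          rw [hfr, ← mul_sub, abs_mul, abs_of_pos (by positivity), abs_sub_comm]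
          rw [hlen] at hn
          calc (2:ℝ) ^ j * |fr P - fr P'| ≤ 2 ^ j * (R * (1 / len P.1 + 1 / 2 ^ j)) := by gcongr
            _ = R * (1 + 2 ^ j / len P.1) := by field_simp; ring
            _ ≤ R * (1 + 2 ^ r) := by
              gcongr
              rw [div_le_iff₀ (len_pos _)]; exact hjl)
        M (lf P.1) (le_max_right _ _) (p := 4) (by norm_num)
      calc _ ≤ M⁻¹ * ((2 * (R * (1 + 2 ^ r)) + 1) * (16 * M)) := by gcongr
        _ = 16 * (2 * (R * (1 + 2 ^ r)) + 1) := by field_simp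
        _ ≤ 80 * R * 2 ^ r := by nlinarith
  refine key.trans ?_
  have h4 : (4:ℝ) ^ r = 2 ^ r * 2 ^ r := by rw [← mul_pow]; norm_num
  rw [h4]
  have := two_mul_add_one_le r
  calc (2 * r + 1 : ℝ) * (80 * R * 2 ^ r) ≤ (2 * 2 ^ r) * (80 * R * 2 ^ r) := by gcongr
    _ = _ := by ring

lemma schur_pairs (R : ℝ) (hR : 1 ≤ R) (r : ℕ) (T : Finset Ti) (c : Ti → ℝ) :
    ∑ P ∈ T, ∑ P' ∈ T.filter (fun P' => |P.1.1 - P'.1.1| ≤ r),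
      (len P.1 * c P) * (len P'.1 * c P') * G R P P' ≤
      160 * R * 4 ^ r * ∑ P ∈ T, len P.1 * c P ^ 2 := by
  have h1 : ∀ P P' : Ti, (len P.1 * c P) * (len P'.1 * c P') * G R P P' ≤
      (1/2) * ((len P.1 * c P ^ 2) * (len P'.1 * G R P P')) +
      (1/2) * ((len P'.1 * c P' ^ 2) * (len P.1 * G R P' P)) := by
    intro P P'
    rw [G_symm R P' P]
    have h := G_nonneg R P P'
    have hl := len_pos P.1
    have hl' := len_pos P'.1
    have : 0 ≤ (len P.1 * len P'.1 * G R P P') * (c P - c P') ^ 2 := by positivity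
    nlinarith
  have hA : ∀ P ∈ T, ∑ P' ∈ T.filter (fun P' => |P.1.1 - P'.1.1| ≤ r),
      (len P.1 * c P ^ 2) * (len P'.1 * G R P P') ≤ 160 * R * 4 ^ r * (len P.1 * c P ^ 2) := by
    intro P _
    rw [← Finset.mul_sum, mul_comm]
    have := schur R hR r P (T.filter (fun P' => |P.1.1 - P'.1.1| ≤ r))
      (fun P' hP' => (Finset.mem_filter.1 hP').2)
    have hl := len_pos P.1
    gcongr
  have hB : ∑ P ∈ T, ∑ P' ∈ T.filter (fun P' => |P.1.1 - P'.1.1| ≤ r),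
      (len P'.1 * c P' ^ 2) * (len P.1 * G R P' P) =
      ∑ P ∈ T, ∑ P' ∈ T.filter (fun P' => |P.1.1 - P'.1.1| ≤ r),
      (len P.1 * c P ^ 2) * (len P'.1 * G R P P') := by
    simp_rw [Finset.sum_filter]
    rw [Finset.sum_comm]
    simp_rw [abs_sub_comm]
  calc _ ≤ ∑ P ∈ T, ∑ P' ∈ T.filter (fun P' => |P.1.1 - P'.1.1| ≤ r),
      ((1/2) * ((len P.1 * c P ^ 2) * (len P'.1 * G R P P')) +
      (1/2) * ((len P'.1 * c P' ^ 2) * (len P.1 * G R P' P))) :=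
        Finset.sum_le_sum fun P _ => Finset.sum_le_sum fun P' _ => h1 P P'
    _ = ∑ P ∈ T, ∑ P' ∈ T.filter (fun P' => |P.1.1 - P'.1.1| ≤ r),
      (len P.1 * c P ^ 2) * (len P'.1 * G R P P') := by
        generalize hF : (fun P P' : Ti => (len P.1 * c P ^ 2) * (len P'.1 * G R P P')) = F at *
        have hF' : ∀ P P' : Ti, (len P.1 * c P ^ 2) * (len P'.1 * G R P P') = F P P' := by
          intro P P'; rw [← hF]
        simp only [hF'] at hB ⊢
        simp only [Finset.sum_add_distrib, ← Finset.mul_sum]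
        rw [hB]; ring
    _ ≤ ∑ P ∈ T, 160 * R * 4 ^ r * (len P.1 * c P ^ 2) := Finset.sum_le_sum hA
    _ = _ := by rw [Finset.mul_sum]

/-- lacunary condition -/
def bb (R : ℝ) : ℝ := 4 * R + 2
def rat (ξ : ℝ) (P : Ti) : ℝ := P.2 - len P.1 * ξ
def Lac (R : ℝ) (s : ℝ) (r : ℕ) (ξ : ℝ) (P : Ti) : Prop :=
  bb R ≤ s * rat ξ P ∧ s * rat ξ P ≤ 2 ^ r

lemma fr_sub (ξ : ℝ) (P P' : Ti) :
    len P'.1 * (fr P - fr P') = len P'.1 / len P.1 * rat ξ P - rat ξ P' := by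
  unfold fr rat
  have := len_ne P.1
  have := len_ne P'.1
  field_simp
  ring

/-- nearness of a finer tile -/
lemma near_rat {K : ℝ} (hK : 0 ≤ K) {r : ℕ} {ξ : ℝ} {P P' : Ti} (hn : near K P P')
    (hj : P'.1.1 < P.1.1 - r) (hrat : |rat ξ P| ≤ 2 ^ r) :
    |rat ξ P'| ≤ 2 * K + 1 := by
  have hl := len_pos P.1
  have hl' := len_pos P'.1
  have h1 : 2 ^ r * len P'.1 ≤ len P.1 := by
    unfold len
    rw [← zpow_natCast, ← zpow_add₀ (by norm_num)]
    exact zpow_le_zpow_right₀ (by norm_num) (by omega)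
  have h2r : (1:ℝ) ≤ 2 ^ r := one_le_pow₀ (by norm_num)
  have hle : len P'.1 ≤ len P.1 := by nlinarith
  have e := fr_sub ξ P P'
  have h3 : |len P'.1 * (fr P - fr P')| ≤ 2 * K := by
    rw [abs_mul, abs_of_pos hl']
    unfold near at hn
    calc len P'.1 * |fr P - fr P'| ≤ len P'.1 * (K * (1 / len P.1 + 1 / len P'.1)) := by gcongr
      _ = K * (len P'.1 / len P.1 + 1) := by field_simp
      _ ≤ K * (1 + 1) := by gcongr; rw [div_le_one hl]; exact hle
      _ = _ := by ring
  rw [e] at h3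
  have h4 : |len P'.1 / len P.1 * rat ξ P| ≤ 1 := by
    rw [abs_mul, abs_of_pos (by positivity), div_mul_eq_mul_div, div_le_one hl]
    calc _ ≤ len P'.1 * 2 ^ r := by gcongr
      _ ≤ _ := by linarith
  have := abs_sub_abs_le_abs_sub (rat ξ P') (len P'.1 / len P.1 * rat ξ P)
  rw [abs_sub_comm] at this
  linarith

lemma Lac.abs_le {R s : ℝ} (hR : 0 ≤ R) (hs : |s| = 1) {r : ℕ} {ξ : ℝ} {P : Ti}
    (h : Lac R s r ξ P) : |rat ξ P| ≤ 2 ^ r ∧ bb R ≤ |rat ξ P| := by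
  have h1 : |rat ξ P| = s * rat ξ P := by
    have : |s * rat ξ P| = |rat ξ P| := by rw [abs_mul, hs, one_mul]
    rw [← this, abs_of_nonneg]
    have := h.1; unfold bb at this; linarith
  rw [h1]; exact ⟨h.2, h.1⟩

/-- E1: lacunary trees -/
lemma lac_bessel {R : ℝ} (hR : 1 ≤ R) {c : Ti → ℝ} {S : Ti → Prop} {E : ℝ}
    (hB : Bes R c S E) (hc : ∀ P, 0 ≤ c P) (hE : 0 ≤ E) (T : Finset Ti) (hT : ∀ P ∈ T, S P)
    {s : ℝ} (hs : |s| = 1) {r : ℕ} {ξ : ℝ} (hL : ∀ P ∈ T, Lac R s r ξ P) :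
    ∑ P ∈ T, len P.1 * c P ^ 2 ≤ 160 * R * 4 ^ r * E := by
  have h := hB T hT (fun P => len P.1 * c P) (fun P => mul_nonneg (len_pos _).le (hc P))
  have hG : ∀ P ∈ T, ∀ P' ∈ T, ¬ (|P.1.1 - P'.1.1| ≤ r) → G R P P' = 0 := by
    have aux : ∀ P ∈ T, ∀ P' ∈ T, P'.1.1 < P.1.1 - r → G R P P' = 0 := by
      intro P hP P' hP' hj
      unfold G
      rw [if_neg]
      intro hn
      have h1 := near_rat (ξ := ξ) (by linarith) hn hj ((hL P hP).abs_le (by linarith) hs).1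
      have h2 := ((hL P' hP').abs_le (by linarith) hs).2
      unfold bb at h2
      linarith
    intro P hP P' hP' hj
    rw [abs_le] at hj
    by_cases h1 : P'.1.1 < P.1.1 - r
    · exact aux P hP P' hP' h1
    · rw [G_symm]; exact aux P' hP' P hP (by omega)
  have h2 : ∑ P ∈ T, ∑ P' ∈ T, (len P.1 * c P) * (len P'.1 * c P') * G R P P' =
      ∑ P ∈ T, ∑ P' ∈ T.filter (fun P' => |P.1.1 - P'.1.1| ≤ r),
      (len P.1 * c P) * (len P'.1 * c P') * G R P P' := by
    apply Finset.sum_congr rfl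
    intro P hP
    rw [Finset.sum_filter]
    apply Finset.sum_congr rfl
    intro P' hP'
    split_ifs with hh
    · rfl
    · rw [hG P hP P' hP' hh, mul_zero]
  rw [h2] at h
  have h3 := schur_pairs R hR r T c
  set X := ∑ P ∈ T, len P.1 * c P ^ 2 with hX
  have hX0 : 0 ≤ X := Finset.sum_nonneg fun P _ => mul_nonneg (len_pos _).le (sq_nonneg _)
  have h4 : ∑ P ∈ T, len P.1 * c P * c P = X := by
    rw [hX]; apply Finset.sum_congr rfl; intro P _; ring
  rw [h4] at h
  by_contra hcon
  push Not at hcon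
  have h5 : X ^ 2 ≤ E * (160 * R * 4 ^ r * X) := h.trans (by gcongr)
  have h6 : 0 ≤ 160 * R * 4 ^ r * E := by positivity
  nlinarith

end MTT

namespace MTT

lemma tail_scale (T : Finset Ti) (j : ℤ) (hj : ∀ P ∈ T, P.1.1 = j) (x ρ : ℝ) (hρ : 0 ≤ ρ)
    (hq : ∀ P ∈ T, |(P.2:ℝ) - x| ≤ ρ) (I : Dy) (hI : ∀ P ∈ T, iv P.1 ⊆ iv I) :
    ∑ P ∈ T, ∫ y in (iv I)ᶜ, (kw (len P.1) (lf P.1) y ^ 4)⁻¹ ≤ (2 * ρ + 1) * 128 * 2 ^ j := by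
  have hL : (0:ℝ) < 2 ^ j := by positivity
  set L := (2:ℝ) ^ j with hLdef
  have hlen : ∀ P ∈ T, len P.1 = L := fun P hP => by unfold len; rw [hj P hP]
  have e1 : ∑ P ∈ T, ∫ y in (iv I)ᶜ, (kw (len P.1) (lf P.1) y ^ 4)⁻¹ =
      ∫ y in (iv I)ᶜ, ∑ P ∈ T, (kw L (lf P.1) y ^ 4)⁻¹ := by
    rw [integral_finsetSum _ (fun P _ => (integrable_kw hL _ (by norm_num)).integrableOn)]
    apply Finset.sum_congr rfl
    intro P hP; rw [hlen P hP]
  rw [e1]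
  set A := fun y => (kw L (lf I) y ^ 2)⁻¹ with hA
  set B := fun y => (kw L (lf I + len I) y ^ 2)⁻¹ with hB
  have hAB : Integrable (fun y => ((2 * ρ + 1) * 16) * (A y + B y)) :=
    ((integrable_kw2 hL _).add (integrable_kw2 hL _)).const_mul _
  have e2 : ∫ y in (iv I)ᶜ, ∑ P ∈ T, (kw L (lf P.1) y ^ 4)⁻¹ ≤
      ∫ y in (iv I)ᶜ, ((2 * ρ + 1) * 16) * (A y + B y) := by
    apply setIntegral_mono_on
    · exact (integrable_finsetSum _
        (fun P _ => (integrable_kw hL _ (by norm_num)))).integrableOn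
    · exact hAB.integrableOn
    · exact (measurableSet_iv I).compl
    · intro y hy
      have h1 : ∀ P ∈ T, (kw L (lf P.1) y ^ 4)⁻¹ ≤ (A y + B y) * (L⁻¹ *
          (len P.1 * (kw L y (lf P.1) ^ 2)⁻¹)) := by
        intro P hP
        rw [hlen P hP]
        have h2 : (kw L (lf P.1) y ^ 4)⁻¹ = (kw L (lf P.1) y ^ 2)⁻¹ * (kw L (lf P.1) y ^ 2)⁻¹ := by
          rw [← mul_inv, ← pow_add]
        have h3 : L⁻¹ * (L * (kw L y (lf P.1) ^ 2)⁻¹) = (kw L (lf P.1) y ^ 2)⁻¹ := by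
          rw [kw_comm L y]; field_simp
        rw [h2, h3]
        apply mul_le_mul_of_nonneg_right _ (kw_inv_nonneg hL _ _ _)
        have hm := hI P hP (lf_mem P.1)
        have hA0 : 0 ≤ A y := kw_inv_nonneg hL _ _ _
        have hB0 : 0 ≤ B y := kw_inv_nonneg hL _ _ _
        by_cases hy1 : y < lf I
        · have : (kw L (lf P.1) y ^ 2)⁻¹ ≤ A y := by
            apply inv_anti₀ (by have := kw_pos hL (lf I) y; positivity)
            have := kw_pos hL (lf I) y
            apply pow_le_pow_left₀ this.le
            unfold kw
            have : |y - lf I| ≤ |y - lf P.1| := by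
              rw [abs_of_neg (by linarith), abs_of_neg (by linarith [hm.1])]
              linarith [hm.1]
            gcongr
          linarith
        · have hy2 : lf I + len I ≤ y := by
            by_contra hcon
            exact hy ⟨by linarith, by linarith⟩
          have : (kw L (lf P.1) y ^ 2)⁻¹ ≤ B y := by
            apply inv_anti₀ (by have := kw_pos hL (lf I + len I) y; positivity)
            have := kw_pos hL (lf I + len I) y
            apply pow_le_pow_left₀ this.le
            unfold kw
            have : |y - (lf I + len I)| ≤ |y - lf P.1| := by
              rw [abs_of_nonneg (by linarith), abs_of_nonneg (by linarith [hm.2])]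
              linarith [hm.2]
            gcongr
          linarith
      refine (Finset.sum_le_sum h1).trans ?_
      rw [← Finset.mul_sum, ← Finset.mul_sum, mul_comm]
      have h5 := sum_count T j hj x ρ hρ hq L y (le_refl _) (p := 2) (le_refl _)
      have hA0 : 0 ≤ A y := kw_inv_nonneg hL _ _ _
      have hB0 : 0 ≤ B y := kw_inv_nonneg hL _ _ _
      apply mul_le_mul_of_nonneg_right _ (by positivity)
      calc _ ≤ L⁻¹ * ((2 * ρ + 1) * (16 * L)) := by gcongr
        _ = _ := by field_simp
  refine e2.trans ?_
  have e3 : ∫ y in (iv I)ᶜ, ((2 * ρ + 1) * 16) * (A y + B y) ≤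
      ∫ y, ((2 * ρ + 1) * 16) * (A y + B y) := by
    apply setIntegral_le_integral hAB
    refine Filter.Eventually.of_forall fun y => ?_
    have hA0 : 0 ≤ A y := kw_inv_nonneg hL _ _ _
    have hB0 : 0 ≤ B y := kw_inv_nonneg hL _ _ _
    simp only [Pi.zero_apply]; positivity
  refine e3.trans ?_
  rw [integral_const_mul, integral_add (integrable_kw2 hL _) (integrable_kw2 hL _)]
  have i1 := integral_kw2 hL (lf I)
  have i2 := integral_kw2 hL (lf I + len I)
  calc _ ≤ (2 * ρ + 1) * 16 * (4 * L + 4 * L) := by gcongr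
    _ = _ := by ring

/-- sum of the tails in a tree -/
lemma tail_tree (T : Finset Ti) (ξ : ℝ) (r : ℕ) (hq : ∀ P ∈ T, |rat ξ P| ≤ 2 ^ r)
    (I : Dy) (hI : ∀ P ∈ T, iv P.1 ⊆ iv I) :
    ∑ P ∈ T, ∫ y in (iv I)ᶜ, (kw (len P.1) (lf P.1) y ^ 4)⁻¹ ≤ 768 * 2 ^ r * len I := by
  have h2r : (1:ℝ) ≤ 2 ^ r := one_le_pow₀ (by norm_num)
  rw [← Finset.sum_fiberwise_of_maps_to (t := T.image (fun P => P.1.1)) (g := fun P => P.1.1)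
    (fun P hP => Finset.mem_image_of_mem _ hP)]
  calc _ ≤ ∑ j ∈ T.image (fun P => P.1.1), (2 * (2:ℝ) ^ r + 1) * 128 * 2 ^ j := by
        apply Finset.sum_le_sum
        intro j _
        apply tail_scale _ j (fun P hP => (Finset.mem_filter.1 hP).2) ((2:ℝ) ^ j * ξ) (2 ^ r)
          (by positivity)
        · intro P hP
          have h := Finset.mem_filter.1 hP
          have := hq P h.1
          unfold rat len at this; rw [h.2] at this; exact this
        · intro P hP; exact hI P (Finset.mem_filter.1 hP).1
    _ = (2 * (2:ℝ) ^ r + 1) * 128 * ∑ j ∈ T.image (fun P => P.1.1), (2:ℝ) ^ j := by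
        rw [Finset.mul_sum]
    _ ≤ (2 * (2:ℝ) ^ r + 1) * 128 * (2 * 2 ^ I.1) := by
        gcongr
        apply sum_geom_le
        intro j hj
        obtain ⟨P, hP, rfl⟩ := Finset.mem_image.1 hj
        exact le_of_subset (hI P hP)
    _ ≤ _ := by
        have := len_pos I
        change _ * 128 * (2 * len I) ≤ _
        nlinarith

/-- a forest of trees -/
structure Forest (R : ℝ) (s : ℝ) (r : ℕ) (S : Ti → Prop) {ι : Type} (F : Finset ι)
    (I : ι → Dy) (ξ : ι → ℝ) (T : ι → Finset Ti) : Prop where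
  lac : ∀ τ ∈ F, ∀ P ∈ T τ, Lac R s r (ξ τ) P
  sub : ∀ τ ∈ F, ∀ P ∈ T τ, iv P.1 ⊆ iv (I τ)
  mem : ∀ τ ∈ F, ∀ P ∈ T τ, S P
  disj : ∀ τ ∈ F, ∀ τ' ∈ F, τ ≠ τ' → Disjoint (T τ) (T τ')
  sd : ∀ τ ∈ F, ∀ τ' ∈ F, ∀ P ∈ T τ, ∀ P' ∈ T τ', P'.1.1 < P.1.1 - r → near (2 * R) P P' →
    iv P'.1 ∩ iv (I τ) = ∅

lemma near_finer {R : ℝ} (hR : 0 ≤ R) {P P' P'' : Ti} (h1 : near R P P') (h2 : near R P P'')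
    (hj1 : P'.1.1 ≤ P.1.1) (hj2 : P''.1.1 ≤ P.1.1) : near (2 * R) P' P'' := by
  unfold near at *
  have l1 : 1 / len P.1 ≤ 1 / len P'.1 := one_div_le_one_div_of_le (len_pos _) (len_le_of_le hj1)
  have l2 : 1 / len P.1 ≤ 1 / len P''.1 := one_div_le_one_div_of_le (len_pos _) (len_le_of_le hj2)
  have h3 : |fr P' - fr P''| ≤ |fr P - fr P'| + |fr P - fr P''| := by
    rw [abs_sub_comm (fr P) (fr P')]; exact abs_sub_le _ _ _
  nlinarith

lemma succ_le_two_pow (r : ℕ) : (r:ℝ) + 1 ≤ 2 ^ r := by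
  exact_mod_cast Nat.lt_two_pow_self (n := r)

lemma forest_overlap {R s : ℝ} (hR : 1 ≤ R) {r : ℕ} {S : Ti → Prop} {ι : Type} {F : Finset ι}
    {I : ι → Dy} {ξ : ι → ℝ} {T : ι → Finset Ti} (hF : Forest R s r S F I ξ T)
    (P : Ti) (N : Finset Ti) (hN : ∀ P' ∈ N, (∃ τ ∈ F, P' ∈ T τ) ∧ P'.1.1 < P.1.1 - r ∧ near R P P')
    (x : ℝ) : ((N.filter (fun P' => x ∈ iv P'.1)).card : ℝ) ≤ 5 * R * 2 ^ r := by
  set N1 := N.filter (fun P' => x ∈ iv P'.1) with hN1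
  have hmem : ∀ P' ∈ N1, P' ∈ N ∧ x ∈ iv P'.1 := fun P' h => Finset.mem_filter.1 h
  by_cases hemp : N1.Nonempty
  swap
  · rw [Finset.not_nonempty_iff_eq_empty] at hemp
    rw [hemp]; simp; positivity
  obtain ⟨P0, hP0, hmax⟩ := Finset.exists_max_image N1 (fun P => P.1.1) hemp
  have h1 : (N1.card : ℝ) = ∑ P' ∈ N1, (1:ℝ) := by simp
  rw [h1]
  have key : ∑ P' ∈ N1, (1:ℝ) ≤ ((r:ℝ) + 1) * (4 * R + 1) := by
    apply sum_fibre_le N1 (fun P => P.1.1) _ _ _ (by positivity)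
    · have := card_int_le (N1.image (fun P => P.1.1)) ((P0.1.1 : ℝ) - r / 2) (r / 2)
        (by positivity) (by
          intro j hj
          obtain ⟨P', hP', rfl⟩ := Finset.mem_image.1 hj
          have a1 := hmax P' hP'
          have a2 : P0.1.1 - r ≤ P'.1.1 := by
            by_contra hcon
            push Not at hcon
            obtain ⟨⟨τ, hτ, hPτ⟩, b1, b2⟩ := hN P0 (hmem P0 hP0).1
            obtain ⟨⟨τ', hτ', hPτ'⟩, b1', b2'⟩ := hN P' (hmem P' hP').1
            have hn := near_finer (by linarith) b2 b2' (by omega) (by omega)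
            have := hF.sd τ hτ τ' hτ' P0 hPτ P' hPτ' hcon hn
            have hx : x ∈ iv P'.1 ∩ iv (I τ) :=
              ⟨(hmem P' hP').2, hF.sub τ hτ P0 hPτ (hmem P0 hP0).2⟩
            rw [this] at hx; exact hx
          have a1' : (P'.1.1 : ℝ) ≤ P0.1.1 := by exact_mod_cast a1
          have a2' : (P0.1.1 : ℝ) - r ≤ P'.1.1 := by exact_mod_cast a2
          rw [abs_le]; constructor <;> linarith)
      linarith
    · intro j
      have hinj : Set.InjOn (fun P : Ti => P.2) (N1.filter (fun P => P.1.1 = j)) := by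
        intro a ha b hb hab
        have ha' := Finset.mem_filter.1 (Finset.mem_coe.1 ha)
        have hb' := Finset.mem_filter.1 (Finset.mem_coe.1 hb)
        exact Prod.ext (eq_of_scale (ha'.2.trans hb'.2.symm)
          ⟨x, (hmem a ha'.1).2, (hmem b hb'.1).2⟩) hab
      have : ∑ P' ∈ N1.filter (fun P => P.1.1 = j), (1:ℝ) =
          ((N1.filter (fun P => P.1.1 = j)).image (fun P => P.2)).card := by
        rw [Finset.card_image_of_injOn hinj]; simp
      rw [this]
      have := card_int_le ((N1.filter (fun P => P.1.1 = j)).image (fun P => P.2))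
        ((2:ℝ) ^ j * fr P) (2 * R) (by linarith) (by
          intro q hq
          obtain ⟨P', hP', rfl⟩ := Finset.mem_image.1 hq
          obtain ⟨hP'1, hP'2⟩ := Finset.mem_filter.1 hP'
          obtain ⟨-, b1, b2⟩ := hN P' (hmem P' hP'1).1
          have hlen : len P'.1 = 2 ^ j := by unfold len; rw [hP'2]
          have hfr : (P'.2 : ℝ) = 2 ^ j * fr P' := by
            unfold fr; rw [hlen]; field_simp
          have hle : len P'.1 ≤ len P.1 := len_le_of_le (by omega)
          rw [hfr, ← mul_sub, abs_mul, abs_of_pos (by positivity), abs_sub_comm]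
          unfold near at b2
          rw [hlen] at b2 hle
          have hl := len_pos P.1
          calc (2:ℝ) ^ j * |fr P - fr P'| ≤ 2 ^ j * (R * (1 / len P.1 + 1 / 2 ^ j)) := by gcongr
            _ = R * (2 ^ j / len P.1 + 1) := by field_simp
            _ ≤ R * (1 + 1) := by gcongr; rw [div_le_one hl]; exact hle
            _ = 2 * R := by ring)
      linarith
  refine key.trans ?_
  have := succ_le_two_pow r
  calc ((r:ℝ) + 1) * (4 * R + 1) ≤ 2 ^ r * (5 * R) := by gcongr; linarith
    _ = _ := by ring

/-- E2: packing of forests -/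
lemma forest_packing {R s : ℝ} (hR : 1 ≤ R) (hs : |s| = 1) {r : ℕ} {S : Ti → Prop} {ι : Type}
    {F : Finset ι}
    {I : ι → Dy} {ξ : ι → ℝ} {T : ι → Finset Ti} (hF : Forest R s r S F I ξ T)
    {c : Ti → ℝ} {E σ : ℝ} (hE : 0 ≤ E) (hσ : 0 ≤ σ) (hc : ∀ P, 0 ≤ c P)
    (hB : Bes R c S E)
    (hmass : ∀ τ ∈ F, σ ^ 2 * len (I τ) ≤ ∑ P ∈ T τ, len P.1 * c P ^ 2)
    (hsing : ∀ τ ∈ F, ∀ P ∈ T τ, c P ≤ 2 * σ) :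
    σ ^ 2 * ∑ τ ∈ F, len (I τ) ≤ 500000 * R * 4 ^ r * E := by
  set U := F.biUnion T with hU
  have hUmem : ∀ P ∈ U, ∃ τ ∈ F, P ∈ T τ := fun P hP => by
    simpa [hU, Finset.mem_biUnion] using hP
  have hsumU : ∀ g : Ti → ℝ, ∑ P ∈ U, g P = ∑ τ ∈ F, ∑ P ∈ T τ, g P := by
    intro g
    rw [hU, Finset.sum_biUnion]
    intro a ha b hb hab
    exact hF.disj a ha b hb hab
  have h := hB U (fun P hP => by obtain ⟨τ, hτ, h⟩ := hUmem P hP; exact hF.mem τ hτ P h)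
    (fun P => len P.1 * c P) (fun P => mul_nonneg (len_pos _).le (hc P))
  set X := ∑ P ∈ U, len P.1 * c P ^ 2 with hX
  have h4 : ∑ P ∈ U, len P.1 * c P * c P = X := by
    rw [hX]; apply Finset.sum_congr rfl; intro P _; ring
  rw [h4] at h
  have hX0 : 0 ≤ X := Finset.sum_nonneg fun P _ => mul_nonneg (len_pos _).le (sq_nonneg _)
  have hσX : σ ^ 2 * ∑ τ ∈ F, len (I τ) ≤ X := by
    rw [hX, hsumU, Finset.mul_sum]
    exact Finset.sum_le_sum hmass
  set W := fun P P' : Ti => (len P.1 * c P) * (len P'.1 * c P') * G R P P' with hW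
  have hWn : ∀ P P', 0 ≤ W P P' := fun P P' => by
    have := len_pos P.1; have := len_pos P'.1; have := hc P; have := hc P'
    have := G_nonneg R P P'
    simp only [hW]; positivity
  -- splitting
  have hsplit : ∑ P ∈ U, ∑ P' ∈ U, W P P' ≤
      ∑ P ∈ U, ∑ P' ∈ U.filter (fun P' => |P.1.1 - P'.1.1| ≤ r), W P P' +
      2 * ∑ P ∈ U, ∑ P' ∈ U.filter (fun P' => P'.1.1 < P.1.1 - r), W P P' := by
    have hsym : ∑ P ∈ U, ∑ P' ∈ U.filter (fun P' => P.1.1 < P'.1.1 - r), W P P' =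
        ∑ P ∈ U, ∑ P' ∈ U.filter (fun P' => P'.1.1 < P.1.1 - r), W P P' := by
      simp only [Finset.sum_filter]
      rw [Finset.sum_comm]
      apply Finset.sum_congr rfl; intro P _
      apply Finset.sum_congr rfl; intro P' _
      have : W P' P = W P P' := by simp only [hW]; rw [G_symm R P' P]; ring
      rw [this]
    rw [two_mul]
    nth_rewrite 2 [← hsym]
    rw [← add_assoc, ← Finset.sum_add_distrib, ← Finset.sum_add_distrib]
    apply Finset.sum_le_sum
    intro P _
    simp only [Finset.sum_filter]
    rw [← Finset.sum_add_distrib, ← Finset.sum_add_distrib]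
    apply Finset.sum_le_sum
    intro P' _
    have := hWn P P'
    have htri : |P.1.1 - P'.1.1| ≤ r ∨ P'.1.1 < P.1.1 - r ∨ P.1.1 < P'.1.1 - r := by
      by_cases hh : |P.1.1 - P'.1.1| ≤ r
      · exact Or.inl hh
      · rw [abs_le] at hh; omega
    rcases htri with hh | hh | hh <;> rw [if_pos hh] <;> split_ifs <;> linarith
  have hfar : ∑ P ∈ U, ∑ P' ∈ U.filter (fun P' => P'.1.1 < P.1.1 - r), W P P' ≤
      245760 * R * 4 ^ r * (σ ^ 2 * ∑ τ ∈ F, len (I τ)) := by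
    rw [hsumU, Finset.mul_sum, Finset.mul_sum]
    apply Finset.sum_le_sum
    intro τ hτ
    have hPb : ∀ P ∈ T τ, ∑ P' ∈ U.filter (fun P' => P'.1.1 < P.1.1 - r), W P P' ≤
        320 * R * 2 ^ r * σ ^ 2 * ∫ y in (iv (I τ))ᶜ, (kw (len P.1) (lf P.1) y ^ 4)⁻¹ := by
      intro P hP
      set N := (U.filter (fun P' => P'.1.1 < P.1.1 - r)).filter (fun P' => near R P P') with hN
      have hNm : ∀ P' ∈ N, (∃ τ ∈ F, P' ∈ T τ) ∧ P'.1.1 < P.1.1 - r ∧ near R P P' := by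
        intro P' hP'
        simp only [hN, Finset.mem_filter] at hP'
        exact ⟨hUmem P' hP'.1.1, hP'.1.2, hP'.2⟩
      have s1 : ∑ P' ∈ U.filter (fun P' => P'.1.1 < P.1.1 - r), W P P' ≤
          ∑ P' ∈ N, 4 * σ ^ 2 * (len P'.1 * (kw (len P.1) (lf P.1) (lf P'.1) ^ 4)⁻¹) := by
        conv_rhs => rw [hN, Finset.sum_filter]
        apply Finset.sum_le_sum
        intro P' hP'
        obtain ⟨hP'1, hP'2⟩ := Finset.mem_filter.1 hP'
        simp only [hW, G]
        split_ifs with hn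
        · have hmx : mx P P' = len P.1 := max_eq_left (len_le_of_le (by omega))
          rw [hmx]
          have hl := len_pos P.1
          have hl' := len_pos P'.1
          have hk := kw_inv_nonneg hl (lf P.1) (lf P'.1) 4
          obtain ⟨τ', hτ', hPτ'⟩ := hUmem P' hP'1
          have c1 := hsing τ hτ P hP
          have c2 := hsing τ' hτ' P' hPτ'
          have c3 : c P * c P' ≤ (2 * σ) * (2 * σ) :=
            mul_le_mul c1 c2 (hc _) (by positivity)
          have : len P.1 * c P * (len P'.1 * c P') *
              ((len P.1)⁻¹ * (kw (len P.1) (lf P.1) (lf P'.1) ^ 4)⁻¹) =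
              (c P * c P') * (len P'.1 * (kw (len P.1) (lf P.1) (lf P'.1) ^ 4)⁻¹) := by
            generalize (kw (len P.1) (lf P.1) (lf P'.1) ^ 4)⁻¹ = z
            field_simp
          rw [this]
          apply mul_le_mul_of_nonneg_right _ (by positivity)
          linarith
        · simp
      refine s1.trans ?_
      rw [← Finset.mul_sum]
      have s2 := sum_le_integral N (fun P => P.1) (iv (I τ))ᶜ (measurableSet_iv _).compl
        (5 * R * 2 ^ r) (len P.1) (lf P.1) (len_pos _) (p := 4) (by norm_num)
        (by
          intro P' hP'
          obtain ⟨⟨τ', hτ', hPτ'⟩, b1, b2⟩ := hNm P' hP'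
          have hn : near (2 * R) P P' := by
            unfold near at *
            have l1 := one_div_pos.2 (len_pos P.1)
            have l2 := one_div_pos.2 (len_pos P'.1)
            nlinarith
          have := hF.sd τ hτ τ' hτ' P hP P' hPτ' b1 hn
          intro y hy hy'
          have : y ∈ iv P'.1 ∩ iv (I τ) := ⟨hy, hy'⟩
          simp_all)
        (by
          intro P' hP'
          exact len_le_of_le (by have := (hNm P' hP').2.1; omega))
        (forest_overlap hR hF P N hNm)
      calc _ ≤ 4 * σ ^ 2 * (2 ^ 4 * (5 * R * 2 ^ r) *
            ∫ y in (iv (I τ))ᶜ, (kw (len P.1) (lf P.1) y ^ 4)⁻¹) := by gcongr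
        _ = _ := by ring
    refine (Finset.sum_le_sum hPb).trans ?_
    rw [← Finset.mul_sum]
    have ht := tail_tree (T τ) (ξ τ) r (fun P hP => ((hF.lac τ hτ P hP).abs_le (by linarith) hs).1)
      (I τ) (hF.sub τ hτ)
    have h4 : (4:ℝ) ^ r = 2 ^ r * 2 ^ r := by rw [← mul_pow]; norm_num
    calc _ ≤ 320 * R * 2 ^ r * σ ^ 2 * (768 * 2 ^ r * len (I τ)) := by gcongr
      _ = _ := by rw [h4]; ring
  have hnear := schur_pairs R hR r U c
  have h5 : X ^ 2 ≤ E * (500000 * R * 4 ^ r * X) := by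
    refine h.trans ?_
    apply mul_le_mul_of_nonneg_left _ hE
    have h6 : 245760 * R * 4 ^ r * (σ ^ 2 * ∑ τ ∈ F, len (I τ)) ≤ 245760 * R * 4 ^ r * X := by
      gcongr
    have h7 : 0 ≤ R * 4 ^ r * X := by positivity
    linarith
  refine hσX.trans ?_
  by_contra hcon
  push Not at hcon
  have h6 : 0 ≤ 500000 * R * 4 ^ r * E := by positivity
  nlinarith

end MTT

namespace MTT

/-- selected trees -/
abbrev Tr := Dy × ℝ × Finset Ti

def lacset (R s : ℝ) (r : ℕ) (I : Dy) (ξ : ℝ) (Q : Finset Ti) : Finset Ti :=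
  Q.filter (fun P => Lac R s r ξ P ∧ iv P.1 ⊆ iv I)

def lsum (R s : ℝ) (c : Ti → ℝ) (r : ℕ) (I : Dy) (ξ : ℝ) (Q : Finset Ti) : ℝ :=
  ∑ P ∈ lacset R s r I ξ Q, len P.1 * c P ^ 2

def SizeLe (R : ℝ) (c : Ti → ℝ) (D : Finset Dy) (Q : Finset Ti) (s : ℝ) (r : ℕ) (σ : ℝ) : Prop :=
  ∀ I ∈ D, ∀ ξ, lsum R s c r I ξ Q ≤ σ ^ 2 * len I

/-- the region removed with a tree -/
def Rem (r : ℕ) (τ : Tr) (P : Ti) : Prop := iv P.1 ⊆ iv τ.1 ∧ |rat τ.2.1 P| ≤ 2 ^ r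

lemma lsum_mono {R s : ℝ} {c : Ti → ℝ} {r : ℕ} {I : Dy} {ξ : ℝ} {Q Q' : Finset Ti}
    (h : Q ⊆ Q') : lsum R s c r I ξ Q ≤ lsum R s c r I ξ Q' := by
  unfold lsum lacset
  apply Finset.sum_le_sum_of_subset_of_nonneg (Finset.filter_subset_filter _ h)
  intro P _ _
  exact mul_nonneg (len_pos _).le (sq_nonneg _)

lemma SizeLe.mono {R : ℝ} {c : Ti → ℝ} {D : Finset Dy} {Q Q' : Finset Ti} {s : ℝ} {r : ℕ} {σ : ℝ}
    (h : SizeLe R c D Q' s r σ) (hQ : Q ⊆ Q') : SizeLe R c D Q s r σ :=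
  fun I hI ξ => (lsum_mono hQ).trans (h I hI ξ)

lemma SizeLe.mono_const {R : ℝ} {c : Ti → ℝ} {D : Finset Dy} {Q : Finset Ti} {s : ℝ} {r : ℕ}
    {σ σ' : ℝ} (h : SizeLe R c D Q s r σ) (h0 : 0 ≤ σ) (hσ : σ ≤ σ') : SizeLe R c D Q s r σ' :=
  fun I hI ξ => (h I hI ξ).trans (by have := len_pos I; gcongr)

def cand (R s : ℝ) (P : Ti) : ℝ := (P.2 - s * bb R) / len P.1

lemma s_sq {s : ℝ} (hs : |s| = 1) : s * s = 1 := by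
  have := sq_abs s; rw [hs] at this; nlinarith

lemma exists_cand (R s : ℝ) (hs : |s| = 1) (r : ℕ) (I : Dy) (ξ : ℝ) (Q : Finset Ti)
    (hne : (lacset R s r I ξ Q).Nonempty) :
    ∃ P0 ∈ Q, lacset R s r I ξ Q ⊆ lacset R s r I (cand R s P0) Q := by
  obtain ⟨P0, hP0, hmin⟩ := Finset.exists_min_image _
    (fun P : Ti => (s * rat ξ P - bb R) / len P.1) hne
  have hss := s_sq hs
  set δ := (s * rat ξ P0 - bb R) / len P0.1 with hδ
  have hP0' := Finset.mem_filter.1 hP0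
  refine ⟨P0, hP0'.1, ?_⟩
  have hδ0 : 0 ≤ δ := div_nonneg (by linarith [hP0'.2.1.1]) (len_pos _).le
  have hc : cand R s P0 = ξ + s * δ := by
    have hl := len_ne P0.1
    rw [hδ]; unfold cand rat
    rw [div_eq_iff hl]
    have : (ξ + s * ((s * (P0.2 - len P0.1 * ξ) - bb R) / len P0.1)) * len P0.1 =
      ξ * len P0.1 + (s * s) * (P0.2 - len P0.1 * ξ) - s * bb R := by field_simp; ring
    rw [this, hss]; ring
  intro P hP
  have hP' := Finset.mem_filter.1 hP
  have hm := hmin P hP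
  have hr : s * rat (cand R s P0) P = s * rat ξ P - len P.1 * δ := by
    rw [hc]; unfold rat
    have : s * (P.2 - len P.1 * (ξ + s * δ)) =
      s * (P.2 - len P.1 * ξ) - (s * s) * (len P.1 * δ) := by ring
    rw [this, hss]; ring
  have hl := len_pos P.1
  refine Finset.mem_filter.2 ⟨hP'.1, ⟨?_, ?_⟩, hP'.2.2⟩
  · rw [hr]
    rw [le_div_iff₀ hl] at hm
    linarith
  · rw [hr]
    have := hP'.2.1.2
    nlinarith

/-- packing statement for a set of selected trees -/
def Pack (R : ℝ) (c : Ti → ℝ) (r : ℕ) (σ : ℝ) (F : Finset Tr) : Prop :=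
  (∀ E, 0 ≤ E → Bes R c (fun _ => True) E →
    σ ^ 2 * ∑ τ ∈ F, len τ.1 ≤ 500000 * R * 4 ^ r * E) ∧
  ∀ J E, 0 ≤ E → Bes R c (fun P => iv P.1 ⊆ iv J) E →
    σ ^ 2 * ∑ τ ∈ F.filter (fun τ => iv τ.1 ⊆ iv J), len τ.1 ≤ 500000 * R * 4 ^ r * E

lemma select_aux {R : ℝ} (hR : 1 ≤ R) {s : ℝ} (hs : |s| = 1) {r : ℕ} (hr : bb R ≤ 2 ^ r)
    (c : Ti → ℝ) (D : Finset Dy) {σ : ℝ} (TT : Finset Ti) :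
    ∀ Q : Finset Ti, Q ⊆ TT → ∃ (F : Finset Tr) (Q' : Finset Ti), Q' ⊆ Q ∧
      Forest R s r (fun P => P ∈ Q) F (fun τ => τ.1) (fun τ => τ.2.1) (fun τ => τ.2.2) ∧
      (∀ τ ∈ F, τ.1 ∈ D ∧ τ.2.1 ∈ TT.image (cand R s) ∧
        σ ^ 2 * len τ.1 < ∑ P ∈ τ.2.2, len P.1 * c P ^ 2 ∧
        σ ^ 2 * len τ.1 < lsum R s c r τ.1 τ.2.1 Q) ∧
      SizeLe R c D Q' s r σ ∧ ∀ P ∈ Q, P ∉ Q' → ∃ τ ∈ F, Rem r τ P := by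
  intro Q
  induction Q using Finset.strongInduction with
  | H Q ih =>
  intro hQT
  set C := (D ×ˢ TT.image (cand R s)).filter
    (fun p => σ ^ 2 * len p.1 < lsum R s c r p.1 p.2 Q) with hC
  by_cases hne : C.Nonempty
  swap
  · refine ⟨∅, Q, subset_rfl, ⟨by simp, by simp, by simp, by simp, by simp⟩, by simp, ?_, ?_⟩
    · intro I hI ξ
      by_cases hl : (lacset R s r I ξ Q).Nonempty
      · obtain ⟨P0, hP0, hsub⟩ := exists_cand R s hs r I ξ Q hl
        have h1 : lsum R s c r I ξ Q ≤ lsum R s c r I (cand R s P0) Q :=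
          Finset.sum_le_sum_of_subset_of_nonneg hsub
            (fun P _ _ => mul_nonneg (len_pos _).le (sq_nonneg _))
        refine h1.trans ?_
        by_contra hcon
        push Not at hcon
        exact hne ⟨(I, cand R s P0), by
          rw [hC, Finset.mem_filter]
          exact ⟨Finset.mem_product.2 ⟨hI, Finset.mem_image_of_mem _ (hQT hP0)⟩, hcon⟩⟩
      · rw [Finset.not_nonempty_iff_eq_empty] at hl
        unfold lsum; rw [hl]
        have := len_pos I
        simp; positivity
    · intro P hP hP'; exact absurd hP hP'
  obtain ⟨⟨I0, ξ0⟩, h0, hmax⟩ := Finset.exists_max_image C (fun p => s * p.2) hne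
  have h0' := Finset.mem_filter.1 h0
  have h0p := Finset.mem_product.1 h0'.1
  simp only at h0p h0' hmax
  set T0 := lacset R s r I0 ξ0 Q with hT0
  set τ0 : Tr := (I0, ξ0, T0) with hτ0
  set Q1 := Q.filter (fun P => ¬ Rem r τ0 P) with hQ1
  have hT0m : ∀ P ∈ T0, P ∈ Q ∧ Lac R s r ξ0 P ∧ iv P.1 ⊆ iv I0 := fun P hP =>
    Finset.mem_filter.1 hP
  have hT0rem : ∀ P ∈ T0, Rem r τ0 P := fun P hP =>
    ⟨(hT0m P hP).2.2, ((hT0m P hP).2.1.abs_le (by linarith) hs).1⟩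
  have hss : Q1 ⊂ Q := by
    rw [Finset.ssubset_iff_of_subset (Finset.filter_subset _ _)]
    have : T0.Nonempty := by
      rw [Finset.nonempty_iff_ne_empty]
      intro he
      have h2 := h0'.2
      unfold lsum at h2
      rw [← hT0, he] at h2
      have := len_pos I0
      simp at h2
      nlinarith [sq_nonneg σ]
    obtain ⟨P, hP⟩ := this
    refine ⟨P, (hT0m P hP).1, ?_⟩
    rw [Finset.mem_filter]
    push Not
    intro _; exact hT0rem P hP
  obtain ⟨F, Q', hQ', hF, hprop, hsize, hrem⟩ := ih Q1 hss (hss.subset.trans hQT)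
  have hξ : ∀ τ ∈ F, s * τ.2.1 ≤ s * ξ0 := by
    intro τ hτ
    obtain ⟨a1, a2, a3, a4⟩ := hprop τ hτ
    exact hmax (τ.1, τ.2.1) (Finset.mem_filter.2 ⟨Finset.mem_product.2 ⟨a1, a2⟩,
      a4.trans_le (lsum_mono hss.subset)⟩)
  have hQ1m : ∀ P ∈ Q1, P ∈ Q ∧ ¬ Rem r τ0 P := fun P hP => Finset.mem_filter.1 hP
  have hbb : bb R = 4 * R + 2 := rfl
  refine ⟨insert τ0 F, Q', hQ'.trans hss.subset, ⟨?_, ?_, ?_, ?_, ?_⟩, ?_, hsize, ?_⟩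
  · intro τ hτ
    rcases Finset.mem_insert.1 hτ with rfl | hτ
    · intro P hP; exact (hT0m P hP).2.1
    · exact hF.lac τ hτ
  · intro τ hτ
    rcases Finset.mem_insert.1 hτ with rfl | hτ
    · intro P hP; exact (hT0m P hP).2.2
    · exact hF.sub τ hτ
  · intro τ hτ
    rcases Finset.mem_insert.1 hτ with rfl | hτ
    · intro P hP; exact (hT0m P hP).1
    · intro P hP; exact (hQ1m P (hF.mem τ hτ P hP)).1
  · intro τ hτ τ' hτ' hneq
    rcases Finset.mem_insert.1 hτ with rfl | hτ <;> rcases Finset.mem_insert.1 hτ' with rfl | hτ'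
    · exact absurd rfl hneq
    · rw [Finset.disjoint_left]
      intro P hP hP'
      exact (hQ1m P (hF.mem τ' hτ' P hP')).2 (hT0rem P hP)
    · rw [Finset.disjoint_left]
      intro P hP hP'
      exact (hQ1m P (hF.mem τ hτ P hP)).2 (hT0rem P hP')
    · exact hF.disj τ hτ τ' hτ' hneq
  · intro τ hτ τ' hτ' P hP P' hP' hj hn
    by_contra hcon
    have hsubI : ∀ J : Dy, iv P.1 ⊆ iv J → (iv P'.1 ∩ iv J).Nonempty → iv P'.1 ⊆ iv J := by
      intro J hJ hx
      have := le_of_subset hJ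
      exact iv_nested (by omega) hx
    have hx : (iv P'.1 ∩ iv τ.1).Nonempty := Set.nonempty_iff_ne_empty.2 hcon
    rcases Finset.mem_insert.1 hτ with rfl | hτ
    · have hP1 := hT0m P hP
      have hrat := near_rat (ξ := ξ0) (by linarith) hn hj (hP1.2.1.abs_le (by linarith) hs).1
      rcases Finset.mem_insert.1 hτ' with rfl | hτ'
      · have := ((hT0m P' hP').2.1.abs_le (by linarith) hs).2
        linarith
      · have := (hQ1m P' (hF.mem τ' hτ' P' hP')).2
        exact this ⟨hsubI I0 hP1.2.2 hx, by simp only [hτ0]; linarith⟩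
    · have hP1 := hF.lac τ hτ P hP
      rcases Finset.mem_insert.1 hτ' with rfl | hτ'
      · have hrat := near_rat (ξ := τ.2.1) (by linarith) hn hj (hP1.abs_le (by linarith) hs).1
        have h1 := (hT0m P' hP').2.1.1
        have h2 := hξ τ hτ
        have h3 : s * rat τ.2.1 P' ≤ 4 * R + 1 := by
          have : |s * rat τ.2.1 P'| ≤ 2 * (2 * R) + 1 := by rwa [abs_mul, hs, one_mul]
          linarith [le_abs_self (s * rat τ.2.1 P')]
        have hl := len_pos P'.1
        unfold rat at h1 h3
        nlinarith
      · exact hcon (hF.sd τ hτ τ' hτ' P hP P' hP' hj hn)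
  · intro τ hτ
    rcases Finset.mem_insert.1 hτ with rfl | hτ
    · exact ⟨h0p.1, h0p.2, h0'.2, h0'.2⟩
    · obtain ⟨a1, a2, a3, a4⟩ := hprop τ hτ
      exact ⟨a1, a2, a3, a4.trans_le (lsum_mono hss.subset)⟩
  · intro P hP hP'
    by_cases hr0 : Rem r τ0 P
    · exact ⟨τ0, Finset.mem_insert_self _ _, hr0⟩
    · obtain ⟨τ, hτ, h⟩ := hrem P (Finset.mem_filter.2 ⟨hP, hr0⟩) hP'
      exact ⟨τ, Finset.mem_insert_of_mem hτ, h⟩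

lemma select {R : ℝ} (hR : 1 ≤ R) {s : ℝ} (hs : |s| = 1) {r : ℕ} (hr : bb R ≤ 2 ^ r)
    (c : Ti → ℝ) (hc : ∀ P, 0 ≤ c P) (D : Finset Dy) {σ : ℝ} (hσ : 0 ≤ σ)
    (Q : Finset Ti) (hQ : ∀ P ∈ Q, c P ≤ 2 * σ) :
    ∃ (F : Finset Tr) (Q' : Finset Ti), Q' ⊆ Q ∧ (∀ τ ∈ F, τ.1 ∈ D) ∧
      Pack R c r σ F ∧ SizeLe R c D Q' s r σ ∧ ∀ P ∈ Q, P ∉ Q' → ∃ τ ∈ F, Rem r τ P := by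
  obtain ⟨F, Q', hQ', hF, hprop, hsize, hrem⟩ := select_aux hR hs hr c D (σ := σ) Q Q subset_rfl
  refine ⟨F, Q', hQ', fun τ hτ => (hprop τ hτ).1, ⟨?_, ?_⟩, hsize, hrem⟩
  · intro E hE hB
    have hF' : Forest R s r (fun _ => True) F (fun τ => τ.1) (fun τ => τ.2.1) (fun τ => τ.2.2) :=
      ⟨hF.lac, hF.sub, fun _ _ _ _ => trivial, hF.disj, hF.sd⟩
    exact forest_packing hR hs hF' hE hσ hc hB (fun τ hτ => (hprop τ hτ).2.2.1.le)
      (fun τ hτ P hP => hQ P (hF.mem τ hτ P hP))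
  · intro J E hE hB
    have hm : ∀ τ ∈ F.filter (fun τ => iv τ.1 ⊆ iv J), τ ∈ F ∧ iv τ.1 ⊆ iv J :=
      fun τ hτ => Finset.mem_filter.1 hτ
    have hF' : Forest R s r (fun P => iv P.1 ⊆ iv J) (F.filter (fun τ => iv τ.1 ⊆ iv J))
        (fun τ => τ.1) (fun τ => τ.2.1) (fun τ => τ.2.2) :=
      ⟨fun τ hτ => hF.lac τ (hm τ hτ).1, fun τ hτ => hF.sub τ (hm τ hτ).1,
        fun τ hτ P hP => (hF.sub τ (hm τ hτ).1 P hP).trans (hm τ hτ).2,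
        fun τ hτ τ' hτ' => hF.disj τ (hm τ hτ).1 τ' (hm τ' hτ').1,
        fun τ hτ τ' hτ' => hF.sd τ (hm τ hτ).1 τ' (hm τ' hτ').1⟩
    exact forest_packing hR hs hF' hE hσ hc hB (fun τ hτ => (hprop τ (hm τ hτ).1).2.2.1.le)
      (fun τ hτ P hP => hQ P (hF.mem τ (hm τ hτ).1 P hP))

/-- single tiles are bounded by the size -/
lemma single_le {R : ℝ} {s : ℝ} (hs : |s| = 1) {r : ℕ} (hr : bb R ≤ 2 ^ r)
    {c : Ti → ℝ} {D : Finset Dy} {σ : ℝ} (hσ : 0 ≤ σ) {Q : Finset Ti}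
    (hsz : SizeLe R c D Q s r σ) (P : Ti) (hP : P ∈ Q) (hD : P.1 ∈ D) : c P ≤ σ := by
  have h := hsz P.1 hD (cand R s P)
  have hmem : P ∈ lacset R s r P.1 (cand R s P) Q := by
    refine Finset.mem_filter.2 ⟨hP, ?_, subset_rfl⟩
    have : s * rat (cand R s P) P = bb R := by
      unfold rat cand
      have hl := len_ne P.1
      have : s * (P.2 - len P.1 * ((P.2 - s * bb R) / len P.1)) = (s * s) * bb R := by
        field_simp; ring
      rw [this, s_sq hs, one_mul]
    unfold Lac
    rw [this]; exact ⟨le_refl _, hr⟩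
  have h1 : len P.1 * c P ^ 2 ≤ lsum R s c r P.1 (cand R s P) Q :=
    Finset.single_le_sum (f := fun P : Ti => len P.1 * c P ^ 2)
      (fun P _ => mul_nonneg (len_pos _).le (sq_nonneg _)) hmem
  have hl := len_pos P.1
  have h2 : c P ^ 2 ≤ σ ^ 2 := by
    have : len P.1 * c P ^ 2 ≤ len P.1 * σ ^ 2 := by linarith
    exact le_of_mul_le_mul_left this hl
  exact (abs_le_of_sq_le_sq' h2 hσ).2

/-- selection for several ranges at once -/
lemma select_many {R : ℝ} (hR : 1 ≤ R)
    (c : Ti → ℝ) (hc : ∀ P, 0 ≤ c P) (D : Finset Dy) {σ : ℕ → ℝ} (hσ : ∀ r, 0 ≤ σ r)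
    (A : Finset (ℝ × ℕ)) (hA : ∀ p ∈ A, |p.1| = 1 ∧ bb R ≤ 2 ^ p.2)
    (Q : Finset Ti) (hQ : ∀ P ∈ Q, ∀ p ∈ A, c P ≤ 2 * σ p.2) :
    ∃ (F : ℝ × ℕ → Finset Tr) (Q' : Finset Ti), Q' ⊆ Q ∧ (∀ p, ∀ τ ∈ F p, τ.1 ∈ D) ∧
      (∀ p ∈ A, Pack R c p.2 (σ p.2) (F p)) ∧ (∀ p ∈ A, SizeLe R c D Q' p.1 p.2 (σ p.2)) ∧
      ∀ P ∈ Q, P ∉ Q' → ∃ p ∈ A, ∃ τ ∈ F p, Rem p.2 τ P := by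
  induction A using Finset.induction_on with
  | empty =>
    exact ⟨fun _ => ∅, Q, subset_rfl, by simp, by simp, by simp, fun P h h' => absurd h h'⟩
  | insert p A hpA ih =>
    obtain ⟨F, Q1, h1, h2, h3, h4, h5⟩ := ih (fun p hp => hA p (Finset.mem_insert_of_mem hp))
      (fun P hP p hp => hQ P hP p (Finset.mem_insert_of_mem hp))
    obtain ⟨hp1, hp2⟩ := hA p (Finset.mem_insert_self _ _)
    obtain ⟨F0, Q2, k1, k2, k3, k4, k5⟩ := select hR hp1 hp2 c hc D (hσ p.2) Q1
      (fun P hP => hQ P (h1 hP) p (Finset.mem_insert_self _ _))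
    refine ⟨Function.update F p F0, Q2, k1.trans h1, ?_, ?_, ?_, ?_⟩
    · intro p' τ hτ
      by_cases hpp : p' = p
      · subst hpp; rw [Function.update_self] at hτ; exact k2 τ hτ
      · rw [Function.update_of_ne hpp] at hτ; exact h2 p' τ hτ
    · intro p' hp'
      rcases Finset.mem_insert.1 hp' with hpe | hpA2
      · rw [hpe, Function.update_self]; exact k3
      · rw [Function.update_of_ne (by rintro rfl; exact hpA hpA2)]; exact h3 p' hpA2
    · intro p' hp'
      rcases Finset.mem_insert.1 hp' with hpe | hpA2
      · rw [hpe]; exact k4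
      · exact (h4 p' hpA2).mono k1
    · intro P hP hP'
      by_cases hP1 : P ∈ Q1
      · obtain ⟨τ, hτ, h⟩ := k5 P hP1 hP'
        exact ⟨p, Finset.mem_insert_self _ _, τ, by rwa [Function.update_self], h⟩
      · obtain ⟨p', hp', τ, hτ, h⟩ := h5 P hP hP1
        exact ⟨p', Finset.mem_insert_of_mem hp', τ, by
          rwa [Function.update_of_ne (by rintro rfl; exact hpA hp')], h⟩

end MTT

namespace MTT

/-- size at level `m` -/
def lev (β : ℕ) (σ : ℝ) (m r : ℕ) : ℝ := 2 ^ (β * r) * (1 / 2) ^ m * σ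

lemma lev_nonneg {β : ℕ} {σ : ℝ} (hσ : 0 ≤ σ) (m r : ℕ) : 0 ≤ lev β σ m r := by
  unfold lev; positivity

lemma lev_succ (β : ℕ) (σ : ℝ) (m r : ℕ) : 2 * lev β σ (m + 1) r = lev β σ m r := by
  unfold lev; rw [pow_succ]; ring

lemma lev_mono {β : ℕ} {σ : ℝ} (hσ : 0 ≤ σ) (m : ℕ) {r r' : ℕ} (h : r ≤ r') :
    lev β σ m r ≤ lev β σ m r' := by
  unfold lev
  have : (2:ℝ) ^ (β * r) ≤ 2 ^ (β * r') :=
    pow_le_pow_right₀ (by norm_num) (Nat.mul_le_mul_left _ h)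
  gcongr

/-- merged packing for both signs -/
def Pack2 (R : ℝ) (c : Ti → ℝ) (r : ℕ) (σ : ℝ) (F : Finset Tr) : Prop :=
  (∀ E, 0 ≤ E → Bes R c (fun _ => True) E →
    σ ^ 2 * ∑ τ ∈ F, len τ.1 ≤ 1000000 * R * 4 ^ r * E) ∧
  ∀ J E, 0 ≤ E → Bes R c (fun P => iv P.1 ⊆ iv J) E →
    σ ^ 2 * ∑ τ ∈ F.filter (fun τ => iv τ.1 ⊆ iv J), len τ.1 ≤ 1000000 * R * 4 ^ r * E

lemma sum_union_le' {α : Type*} [DecidableEq α] (A B : Finset α) (f : α → ℝ) (hf : ∀ a, 0 ≤ f a) :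
    ∑ a ∈ A ∪ B, f a ≤ ∑ a ∈ A, f a + ∑ a ∈ B, f a := by
  have := Finset.sum_union_inter (s₁ := A) (s₂ := B) (f := f)
  have h2 : 0 ≤ ∑ a ∈ A ∩ B, f a := Finset.sum_nonneg (fun a _ => hf a)
  linarith

lemma Pack.union {R : ℝ} {c : Ti → ℝ} {r : ℕ} {σ : ℝ} {F F' : Finset Tr}
    (h : Pack R c r σ F) (h' : Pack R c r σ F') : Pack2 R c r σ (F ∪ F') := by
  refine ⟨fun E hE hB => ?_, fun J E hE hB => ?_⟩
  · have h1 := h.1 E hE hB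
    have h2 := h'.1 E hE hB
    have h3 := sum_union_le' F F' (fun τ : Tr => len τ.1) (fun τ => (len_pos _).le)
    have h4 := mul_le_mul_of_nonneg_left h3 (sq_nonneg σ)
    rw [mul_add] at h4
    linarith
  · have h1 := h.2 J E hE hB
    have h2 := h'.2 J E hE hB
    rw [Finset.filter_union]
    have h3 := sum_union_le' (F.filter (fun τ => iv τ.1 ⊆ iv J))
      (F'.filter (fun τ => iv τ.1 ⊆ iv J)) (fun τ : Tr => len τ.1) (fun τ => (len_pos _).le)
    have h4 := mul_le_mul_of_nonneg_left h3 (sq_nonneg σ)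
    rw [mul_add] at h4
    linarith

def GoodLev (R : ℝ) (c : Ti → ℝ) (D : Finset Dy) (β r0 : ℕ) (σ : ℝ) (m : ℕ) (Q : Finset Ti) : Prop :=
  ∀ s : ℝ, |s| = 1 → ∀ r, r0 ≤ r → SizeLe R c D Q s r (lev β σ m r)

lemma lev_step {R : ℝ} (hR : 1 ≤ R) (c : Ti → ℝ) (hc : ∀ P, 0 ≤ c P) (D : Finset Dy)
    (T : Finset Ti) (hT : ∀ P ∈ T, P.1 ∈ D) {σ : ℝ} (hσ : 0 ≤ σ) {κ δ r0 : ℕ}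
    (hr0 : bb R ≤ 2 ^ r0) (hδ : 1 ≤ δ)
    (hap : ∀ s : ℝ, |s| = 1 → ∀ r, SizeLe R c D T s r (2 ^ (κ * r) * σ))
    (m : ℕ) (Q : Finset Ti) (hQT : Q ⊆ T) (hQ : GoodLev R c D (κ + δ) r0 σ m Q) :
    ∃ (F : ℕ → Finset Tr) (Q' : Finset Ti), Q' ⊆ Q ∧ (∀ r, ∀ τ ∈ F r, τ.1 ∈ D) ∧
      GoodLev R c D (κ + δ) r0 σ (m + 1) Q' ∧
      (∀ r, r0 ≤ r → δ * r ≤ m + 1 → Pack2 R c r (lev (κ + δ) σ (m + 1) r) (F r)) ∧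
      ∀ P ∈ Q, P ∉ Q' → ∃ r, r0 ≤ r ∧ δ * r ≤ m + 1 ∧ ∃ τ ∈ F r, Rem r τ P := by
  set A : Finset (ℝ × ℕ) := ({1, -1} : Finset ℝ) ×ˢ
    (Finset.range (m + 2)).filter (fun r => r0 ≤ r ∧ δ * r ≤ m + 1) with hA
  have hmem : ∀ p : ℝ × ℕ, p ∈ A ↔ (p.1 = 1 ∨ p.1 = -1) ∧ r0 ≤ p.2 ∧ δ * p.2 ≤ m + 1 := by
    intro p
    rw [hA, Finset.mem_product, Finset.mem_filter, Finset.mem_range]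
    simp only [Finset.mem_insert, Finset.mem_singleton]
    constructor
    · rintro ⟨h1, h2, h3⟩; exact ⟨h1, h3⟩
    · rintro ⟨h1, h3⟩
      refine ⟨h1, ?_, h3⟩
      have : 1 * p.2 ≤ δ * p.2 := Nat.mul_le_mul_right _ hδ
      omega
  have habs : ∀ s : ℝ, |s| = 1 ↔ s = 1 ∨ s = -1 := fun s => abs_eq (by norm_num)
  have hpow : ∀ r, r0 ≤ r → bb R ≤ 2 ^ r := fun r hr =>
    hr0.trans (pow_le_pow_right₀ (by norm_num) hr)
  obtain ⟨F, Q', h1, h2, h3, h4, h5⟩ := select_many hR c hc D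
    (σ := fun r => lev (κ + δ) σ (m + 1) r) (fun r => lev_nonneg hσ _ _) A
    (fun p hp => ⟨(habs _).2 ((hmem p).1 hp).1, hpow _ ((hmem p).1 hp).2.1⟩) Q (by
      intro P hP p hp
      have hp' := (hmem p).1 hp
      have hone : |(1:ℝ)| = 1 := abs_one
      have := single_le hone hr0 (lev_nonneg hσ _ _) (hQ 1 hone r0 le_rfl) P hP (hT P (hQT hP))
      rw [lev_succ]
      exact this.trans (lev_mono hσ _ hp'.2.1))
  refine ⟨fun r => F (1, r) ∪ F (-1, r), Q', h1, ?_, ?_, ?_, ?_⟩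
  · intro r τ hτ
    rcases Finset.mem_union.1 hτ with h | h
    · exact h2 _ τ h
    · exact h2 _ τ h
  · intro s hs r hr
    by_cases hd : δ * r ≤ m + 1
    · exact h4 (s, r) ((hmem _).2 ⟨(habs s).1 hs, hr, hd⟩)
    · refine ((hap s hs r).mono (h1.trans hQT)).mono_const (by positivity) ?_
      unfold lev
      have e1 : (2:ℝ) ^ ((κ + δ) * r) = 2 ^ (κ * r) * 2 ^ (δ * r) := by
        rw [← pow_add]; congr 1; ring
      have e2 : (2:ℝ) ^ (m + 1) ≤ 2 ^ (δ * r) := pow_le_pow_right₀ (by norm_num) (by omega)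
      have e3 : (1:ℝ) ≤ 2 ^ (δ * r) * (1 / 2) ^ (m + 1) := by
        rw [one_div, inv_pow, ← div_eq_mul_inv, le_div_iff₀ (by positivity)]; linarith
      rw [e1]
      calc 2 ^ (κ * r) * σ = 2 ^ (κ * r) * σ * 1 := by ring
        _ ≤ 2 ^ (κ * r) * σ * (2 ^ (δ * r) * (1 / 2) ^ (m + 1)) := by gcongr
        _ = _ := by ring
  · intro r hr hd
    exact (h3 (1, r) ((hmem _).2 ⟨Or.inl rfl, hr, hd⟩)).union
      (h3 (-1, r) ((hmem _).2 ⟨Or.inr rfl, hr, hd⟩))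
  · intro P hP hP'
    obtain ⟨p, hp, τ, hτ, hrem⟩ := h5 P hP hP'
    have hp' := (hmem p).1 hp
    refine ⟨p.2, hp'.2.1, hp'.2.2, τ, ?_, hrem⟩
    rcases p with ⟨p1, p2⟩
    rcases hp'.1 with h | h
    · simp only at h; subst h; exact Finset.mem_union_left _ hτ
    · simp only at h; subst h; exact Finset.mem_union_right _ hτ

structure Levels (R : ℝ) (c : Ti → ℝ) (D : Finset Dy) (T : Finset Ti) (κ δ r0 : ℕ) (σ : ℝ) where
  Q : ℕ → Finset Ti
  F : ℕ → ℕ → Finset Tr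
  zero : Q 0 = T
  anti : ∀ m, Q (m + 1) ⊆ Q m
  good : ∀ m, GoodLev R c D (κ + δ) r0 σ m (Q m)
  top : ∀ m r, ∀ τ ∈ F m r, τ.1 ∈ D
  pack : ∀ m r, r0 ≤ r → δ * r ≤ m + 1 → Pack2 R c r (lev (κ + δ) σ (m + 1) r) (F m r)
  cov : ∀ m, ∀ P ∈ Q m, P ∉ Q (m + 1) → ∃ r, r0 ≤ r ∧ δ * r ≤ m + 1 ∧ ∃ τ ∈ F m r, Rem r τ P

lemma exists_levels {R : ℝ} (hR : 1 ≤ R) (c : Ti → ℝ) (hc : ∀ P, 0 ≤ c P) (D : Finset Dy)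
    (T : Finset Ti) (hT : ∀ P ∈ T, P.1 ∈ D) {σ : ℝ} (hσ : 0 ≤ σ) {κ δ r0 : ℕ}
    (hr0 : bb R ≤ 2 ^ r0) (hδ : 1 ≤ δ)
    (hap : ∀ s : ℝ, |s| = 1 → ∀ r, SizeLe R c D T s r (2 ^ (κ * r) * σ)) :
    Nonempty (Levels R c D T κ δ r0 σ) := by
  have step := lev_step hR c hc D T hT hσ hr0 hδ hap
  have h0 : GoodLev R c D (κ + δ) r0 σ 0 T := by
    intro s hs r hr
    refine (hap s hs r).mono_const (by positivity) ?_
    unfold lev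
    have : (2:ℝ) ^ (κ * r) ≤ 2 ^ ((κ + δ) * r) :=
      pow_le_pow_right₀ (by norm_num) (Nat.mul_le_mul_right _ (by omega))
    rw [pow_zero, mul_one]
    gcongr
  let X : ℕ → Type := fun m => {Q : Finset Ti // Q ⊆ T ∧ GoodLev R c D (κ + δ) r0 σ m Q}
  have step' : ∀ m, ∀ Q : X m, ∃ (F : ℕ → Finset Tr) (Q' : X (m+1)), Q'.1 ⊆ Q.1 ∧
      (∀ r, ∀ τ ∈ F r, τ.1 ∈ D) ∧
      (∀ r, r0 ≤ r → δ * r ≤ m + 1 → Pack2 R c r (lev (κ + δ) σ (m + 1) r) (F r)) ∧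
      ∀ P ∈ Q.1, P ∉ Q'.1 → ∃ r, r0 ≤ r ∧ δ * r ≤ m + 1 ∧ ∃ τ ∈ F r, Rem r τ P := by
    intro m Q
    obtain ⟨F, Q', h1, h2, h3, h4, h5⟩ := step m Q.1 Q.2.1 Q.2.2
    exact ⟨F, ⟨Q', h1.trans Q.2.1, h3⟩, h1, h2, h4, h5⟩
  choose FF QQ a1 a2 a3 a4 using step'
  let S : (m : ℕ) → X m := fun m => Nat.rec ⟨T, subset_rfl, h0⟩ (fun m Q => QQ m Q) m
  exact ⟨⟨fun m => (S m).1, fun m => FF m (S m), rfl, fun m => a1 m (S m), fun m => (S m).2.2,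
    fun m => a2 m (S m), fun m => a3 m (S m), fun m => a4 m (S m)⟩⟩

lemma Levels.single {R : ℝ} {c : Ti → ℝ} {D : Finset Dy} {T : Finset Ti} {κ δ r0 : ℕ} {σ : ℝ}
    (X : Levels R c D T κ δ r0 σ) (hT : ∀ P ∈ T, P.1 ∈ D) (hσ : 0 ≤ σ) (hr0 : bb R ≤ 2 ^ r0)
    (m : ℕ) (P : Ti) (hP : P ∈ X.Q m) : c P ≤ lev (κ + δ) σ m r0 := by
  have hsub : ∀ m, X.Q m ⊆ T := by
    intro m
    induction m with
    | zero => rw [X.zero]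
    | succ m ih => exact (X.anti m).trans ih
  have hone : |(1:ℝ)| = 1 := abs_one
  exact single_le hone hr0 (lev_nonneg hσ _ _) (X.good m 1 hone r0 le_rfl) P hP (hT P (hsub m hP))

/-- every tile with nonzero coefficient has a level -/
lemma Levels.exists_level {R : ℝ} {c : Ti → ℝ} {D : Finset Dy} {T : Finset Ti} {κ δ r0 : ℕ} {σ : ℝ}
    (X : Levels R c D T κ δ r0 σ) (hT : ∀ P ∈ T, P.1 ∈ D) (hσ : 0 ≤ σ) (hr0 : bb R ≤ 2 ^ r0)
    (P : Ti) (hP : P ∈ T) (hc : 0 < c P) : ∃ m, P ∈ X.Q m ∧ P ∉ X.Q (m + 1) := by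
  by_contra hcon
  push Not at hcon
  have hall : ∀ m, P ∈ X.Q m := by
    intro m
    induction m with
    | zero => rw [X.zero]; exact hP
    | succ m ih => exact hcon m ih
  have hle : ∀ m, c P ≤ lev (κ + δ) σ m r0 := fun m => X.single hT hσ hr0 m P (hall m)
  have hlim : Filter.Tendsto (fun m => lev (κ + δ) σ m r0) Filter.atTop (nhds 0) := by
    unfold lev
    have := (tendsto_pow_atTop_nhds_zero_of_lt_one (r := (1/2:ℝ)) (by norm_num) (by norm_num)).const_mul
      ((2:ℝ) ^ ((κ + δ) * r0))
    simpa using this.mul_const σ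
  have := ge_of_tendsto' hlim hle
  linarith

end MTT

namespace MTT

/-- multitiles -/
abbrev MT (n : ℕ) := Dy × (Fin n → ℤ)

def tl {n : ℕ} (P : MT n) (i : Fin n) : Ti := (P.1, P.2 i)

lemma fibre_card {n : ℕ} (W : Finset (MT n)) (γ : Fin n → ℝ) (r : ℕ)
    (hr : ∀ P ∈ W, ∀ i, |rat (γ i) (tl P i)| ≤ 2 ^ r) (I : Dy) (hI : ∀ P ∈ W, P.1 = I) :
    (W.card : ℝ) ≤ (3 * 2 ^ r) ^ n := by
  set A : Fin n → Finset ℤ := fun i =>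
    Finset.Icc ⌈len I * γ i - 2 ^ r⌉ ⌊len I * γ i + 2 ^ r⌋ with hA
  have hcard : ∀ i, ((A i).card : ℝ) ≤ 3 * 2 ^ r := by
    intro i
    have h1 : (1:ℝ) ≤ 2 ^ r := one_le_pow₀ (by norm_num)
    have := card_int_le (A i) (len I * γ i) (2 ^ r) (by positivity) (by
      intro q hq
      have := Finset.mem_Icc.1 hq
      rw [abs_le]
      have a1 := Int.ceil_le.1 this.1
      have a2 := Int.le_floor.1 this.2
      constructor <;> linarith)
    linarith
  have hle : W.card ≤ (Fintype.piFinset A).card := by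
    apply Finset.card_le_card_of_injOn (fun P => P.2)
    · intro P hP
      rw [Finset.mem_coe, Fintype.mem_piFinset]
      intro i
      have h1 := hr P hP i
      unfold rat tl at h1
      simp only [hI P hP] at h1
      have := abs_le.1 h1
      exact Finset.mem_Icc.2 ⟨Int.ceil_le.2 (by linarith), Int.le_floor.2 (by linarith)⟩
    · intro P hP P' hP' h
      exact Prod.ext ((hI P hP).trans (hI P' hP').symm) h
  calc (W.card : ℝ) ≤ ((Fintype.piFinset A).card : ℝ) := by exact_mod_cast hle
    _ = ∏ i, ((A i).card : ℝ) := by rw [Fintype.card_piFinset]; push_cast; rfl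
    _ ≤ ∏ _i : Fin n, (3 * 2 ^ r : ℝ) := Finset.prod_le_prod (fun _ _ => by positivity) (fun i _ => hcard i)
    _ = _ := by simp

lemma lac_mult {n : ℕ} {R : ℝ} (c : Ti → ℝ) (W : Finset (MT n)) (γ : Fin n → ℝ) (r : ℕ)
    (hr : ∀ P ∈ W, ∀ i, |rat (γ i) (tl P i)| ≤ 2 ^ r) (D : Finset Dy) (Q : Finset Ti) (i : Fin n)
    (hQ : ∀ P ∈ W, tl P i ∈ Q) (J : Dy) (hJD : J ∈ D) (hJ : ∀ P ∈ W, iv P.1 ⊆ iv J)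
    (s : ℝ) (hs : |s| = 1) (hl : ∀ P ∈ W, bb R ≤ s * rat (γ i) (tl P i)) {b : ℝ}
    (hsz : SizeLe R c D Q s r b) :
    ∑ P ∈ W, len P.1 * c (tl P i) ^ 2 ≤ (3 * 2 ^ r) ^ n * (b ^ 2 * len J) := by
  have hmaps : ∀ P ∈ W, tl P i ∈ lacset R s r J (γ i) Q := by
    intro P hP
    refine Finset.mem_filter.2 ⟨hQ P hP, ⟨hl P hP, ?_⟩, hJ P hP⟩
    refine (le_abs_self _).trans ?_
    rw [abs_mul, hs, one_mul]; exact hr P hP i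
  rw [← Finset.sum_fiberwise_of_maps_to hmaps]
  calc ∑ p ∈ lacset R s r J (γ i) Q, ∑ P ∈ W.filter (fun P => tl P i = p), len P.1 * c (tl P i) ^ 2
      ≤ ∑ p ∈ lacset R s r J (γ i) Q, (3 * 2 ^ r) ^ n * (len p.1 * c p ^ 2) := by
        apply Finset.sum_le_sum
        intro p _
        have h1 : ∑ P ∈ W.filter (fun P => tl P i = p), len P.1 * c (tl P i) ^ 2 =
            ∑ P ∈ W.filter (fun P => tl P i = p), len p.1 * c p ^ 2 := by
          apply Finset.sum_congr rfl
          intro P hP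
          have := (Finset.mem_filter.1 hP).2
          rw [this, ← this]; rfl
        rw [h1, Finset.sum_const, nsmul_eq_mul]
        apply mul_le_mul_of_nonneg_right _ (mul_nonneg (len_pos _).le (sq_nonneg _))
        apply fibre_card _ γ r (fun P hP => hr P (Finset.mem_filter.1 hP).1) p.1
        intro P hP
        rw [← (Finset.mem_filter.1 hP).2]; rfl
    _ = (3 * 2 ^ r) ^ n * lsum R s c r J (γ i) Q := by rw [← Finset.mul_sum]; rfl
    _ ≤ _ := by
        apply mul_le_mul_of_nonneg_left (hsz J hJD _) (by positivity)

lemma tree_pair {n : ℕ} {R : ℝ} (c : Fin n → Ti → ℝ) (hc : ∀ i P, 0 ≤ c i P) (W : Finset (MT n))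
    (γ : Fin n → ℝ) (r : ℕ)
    (hr : ∀ P ∈ W, ∀ i, |rat (γ i) (tl P i)| ≤ 2 ^ r) (D : Finset Dy) (Q : Fin n → Finset Ti)
    (hQ : ∀ P ∈ W, ∀ i, tl P i ∈ Q i) (J : Dy) (hJD : J ∈ D) (hJ : ∀ P ∈ W, iv P.1 ⊆ iv J)
    (X Y : ℝ) (hX : 0 ≤ X) (hY : 1 ≤ Y) (σ : Fin n → ℝ) (hσ : ∀ i, 0 ≤ σ i)
    (hsz : ∀ i (s : ℝ), |s| = 1 → SizeLe R (c i) D (Q i) s r (X * σ i))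
    (hsing : ∀ P ∈ W, ∀ i, c i (tl P i) ≤ Y * σ i)
    (i i' : Fin n) (hii : i ≠ i') (s s' : ℝ) (hs : |s| = 1) (hs' : |s'| = 1)
    (hl : ∀ P ∈ W, bb R ≤ s * rat (γ i) (tl P i)) (hl' : ∀ P ∈ W, bb R ≤ s' * rat (γ i') (tl P i')) :
    ∑ P ∈ W, len P.1 * ∏ i, c i (tl P i) ≤
      (3 * 2 ^ r) ^ n * X ^ 2 * Y ^ n * (∏ i, σ i) * len J := by
  have h1 := lac_mult (c i) W γ r hr D (Q i) i (fun P hP => hQ P hP i) J hJD hJ s hs hl (hsz i s hs)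
  have h2 := lac_mult (c i') W γ r hr D (Q i') i' (fun P hP => hQ P hP i') J hJD hJ s' hs' hl'
    (hsz i' s' hs')
  have hCS := Finset.sum_sq_le_sum_mul_sum_of_sq_le_mul W
    (r := fun P => len P.1 * (c i (tl P i) * c i' (tl P i')))
    (f := fun P => len P.1 * c i (tl P i) ^ 2) (g := fun P => len P.1 * c i' (tl P i') ^ 2)
    (fun P _ => mul_nonneg (len_pos _).le (sq_nonneg _))
    (fun P _ => mul_nonneg (len_pos _).le (sq_nonneg _)) (fun P _ => le_of_eq (by ring))
  have hJ0 := len_pos J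
  set N : ℝ := (3 * 2 ^ r) ^ n with hN
  have hN0 : 0 ≤ N := by rw [hN]; positivity
  have hmain : ∑ P ∈ W, len P.1 * (c i (tl P i) * c i' (tl P i')) ≤
      N * X ^ 2 * σ i * σ i' * len J := by
    have h3 : (∑ P ∈ W, len P.1 * (c i (tl P i) * c i' (tl P i'))) ^ 2 ≤
        (N * X ^ 2 * σ i * σ i' * len J) ^ 2 := by
      refine hCS.trans ?_
      calc _ ≤ N * ((X * σ i) ^ 2 * len J) * (N * ((X * σ i') ^ 2 * len J)) := by
            apply mul_le_mul h1 h2 (Finset.sum_nonneg fun P _ => mul_nonneg (len_pos _).le (sq_nonneg _))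
            positivity
        _ = _ := by ring
    exact (abs_le_of_sq_le_sq' h3 (by have := hσ i; have := hσ i'; positivity)).2
  have hi' : i' ∈ Finset.univ.erase i := Finset.mem_erase.2 ⟨hii.symm, Finset.mem_univ _⟩
  have hprod : ∀ g : Fin n → ℝ, ∏ l, g l = (g i * g i') * ∏ l ∈ (Finset.univ.erase i).erase i', g l := by
    intro g
    rw [← Finset.mul_prod_erase Finset.univ g (Finset.mem_univ i), ← Finset.mul_prod_erase _ g hi',
      mul_assoc]
  set Z := ∏ l ∈ (Finset.univ.erase i).erase i', σ l with hZ
  have hZ0 : 0 ≤ Z := Finset.prod_nonneg (fun l _ => hσ l)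
  calc ∑ P ∈ W, len P.1 * ∏ i, c i (tl P i)
      ≤ ∑ P ∈ W, len P.1 * (c i (tl P i) * c i' (tl P i')) * (Y ^ n * Z) := by
        apply Finset.sum_le_sum
        intro P hP
        rw [hprod (fun l => c l (tl P l)), ← mul_assoc]
        apply mul_le_mul_of_nonneg_left _ (mul_nonneg (len_pos _).le (mul_nonneg (hc _ _) (hc _ _)))
        calc ∏ l ∈ (Finset.univ.erase i).erase i', c l (tl P l)
            ≤ ∏ l ∈ (Finset.univ.erase i).erase i', (Y * σ l) :=
              Finset.prod_le_prod (fun l _ => hc _ _) (fun l _ => hsing P hP l)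
          _ = Y ^ ((Finset.univ.erase i).erase i').card * Z := by
              rw [Finset.prod_mul_distrib, Finset.prod_const]
          _ ≤ Y ^ n * Z := by
              apply mul_le_mul_of_nonneg_right _ hZ0
              apply pow_le_pow_right₀ hY
              calc _ ≤ (Finset.univ : Finset (Fin n)).card := Finset.card_le_card (Finset.subset_univ _)
                _ = n := by simp
    _ = (∑ P ∈ W, len P.1 * (c i (tl P i) * c i' (tl P i'))) * (Y ^ n * Z) := by
        rw [Finset.sum_mul]
    _ ≤ (N * X ^ 2 * σ i * σ i' * len J) * (Y ^ n * Z) := by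
        apply mul_le_mul_of_nonneg_right hmain; positivity
    _ = _ := by rw [hprod σ]; ring

lemma sum_le_cover {α β : Type*} (W : Finset α) (B : Finset β) (g : α → ℝ)
    (hg : ∀ a, 0 ≤ g a)
    (p : β → α → Prop) (hp : ∀ a ∈ W, ∃ b ∈ B, p b a) (K : β → ℝ)
    (hK : ∀ b ∈ B, ∀ W' : Finset α, W' ⊆ W → (∀ a ∈ W', p b a) → ∑ a ∈ W', g a ≤ K b) :
    ∑ a ∈ W, g a ≤ ∑ b ∈ B, K b := by
  have h1 : ∑ a ∈ W, g a ≤ ∑ b ∈ B, ∑ a ∈ W.filter (p b), g a := by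
    simp only [Finset.sum_filter]
    rw [Finset.sum_comm]
    apply Finset.sum_le_sum
    intro a ha
    obtain ⟨b, hb, hpb⟩ := hp a ha
    calc g a = (if p b a then g a else 0) := by rw [if_pos hpb]
      _ ≤ _ := Finset.single_le_sum (f := fun b => if p b a then g a else 0)
        (fun b _ => by split_ifs; exacts [hg a, le_rfl]) hb
  refine h1.trans (Finset.sum_le_sum fun b hb => hK b hb _ (Finset.filter_subset _ _)
    fun a ha => (Finset.mem_filter.1 ha).2)

lemma tree_est {n : ℕ} {R : ℝ} (c : Fin n → Ti → ℝ) (hc : ∀ i P, 0 ≤ c i P) (W : Finset (MT n))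
    (γ : Fin n → ℝ) (r : ℕ)
    (hr : ∀ P ∈ W, ∀ i, |rat (γ i) (tl P i)| ≤ 2 ^ r)
    (h2 : ∀ P ∈ W, ∃ i i', i ≠ i' ∧ bb R ≤ |rat (γ i) (tl P i)| ∧ bb R ≤ |rat (γ i') (tl P i')|)
    (D : Finset Dy) (Q : Fin n → Finset Ti)
    (hQ : ∀ P ∈ W, ∀ i, tl P i ∈ Q i) (J : Dy) (hJD : J ∈ D) (hJ : ∀ P ∈ W, iv P.1 ⊆ iv J)
    (X Y : ℝ) (hX : 0 ≤ X) (hY : 1 ≤ Y) (σ : Fin n → ℝ) (hσ : ∀ i, 0 ≤ σ i)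
    (hsz : ∀ i (s : ℝ), |s| = 1 → SizeLe R (c i) D (Q i) s r (X * σ i))
    (hsing : ∀ P ∈ W, ∀ i, c i (tl P i) ≤ Y * σ i) :
    ∑ P ∈ W, len P.1 * ∏ i, c i (tl P i) ≤
      (4 * n ^ 2) * (3 * 2 ^ r) ^ n * X ^ 2 * Y ^ n * (∏ i, σ i) * len J := by
  set B : Finset ((Fin n × ℝ) × (Fin n × ℝ)) :=
    (Finset.univ ×ˢ ({1, -1} : Finset ℝ)) ×ˢ (Finset.univ ×ˢ ({1, -1} : Finset ℝ)) with hB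
  set p : (Fin n × ℝ) × (Fin n × ℝ) → MT n → Prop := fun b P => b.1.1 ≠ b.2.1 ∧
    bb R ≤ b.1.2 * rat (γ b.1.1) (tl P b.1.1) ∧ bb R ≤ b.2.2 * rat (γ b.2.1) (tl P b.2.1) with hp
  have hsgn : ∀ x : ℝ, bb R ≤ |x| → ∃ s ∈ ({1, -1} : Finset ℝ), bb R ≤ s * x := by
    intro x hx
    rcases abs_cases x with ⟨h, _⟩ | ⟨h, _⟩
    · exact ⟨1, by simp, by rw [h] at hx; linarith⟩
    · exact ⟨-1, by simp, by rw [h] at hx; linarith⟩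
  have hsgn' : ∀ s ∈ ({1, -1} : Finset ℝ), |s| = 1 := by
    intro s hs; simp at hs; rcases hs with rfl | rfl <;> simp
  have hJ0 := len_pos J
  have hS : 0 ≤ ∏ i, σ i := Finset.prod_nonneg fun i _ => hσ i
  refine (sum_le_cover W B _ (fun P => mul_nonneg (len_pos _).le
    (Finset.prod_nonneg fun i _ => hc _ _)) p ?_
    (fun _ => (3 * 2 ^ r) ^ n * X ^ 2 * Y ^ n * (∏ i, σ i) * len J) ?_).trans ?_
  · intro P hP
    obtain ⟨i, i', hne, h, h'⟩ := h2 P hP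
    obtain ⟨s, hs, hs2⟩ := hsgn _ h
    obtain ⟨s', hs', hs2'⟩ := hsgn _ h'
    exact ⟨((i, s), (i', s')), by simp only [hB, Finset.mem_product]; exact ⟨⟨Finset.mem_univ _, hs⟩, Finset.mem_univ _, hs'⟩,
      hne, hs2, hs2'⟩
  · intro b hb W' hW' hf
    simp only [hB, Finset.mem_product] at hb
    by_cases hne : b.1.1 = b.2.1
    · rw [Finset.sum_eq_zero]
      · positivity
      · intro P hP; exact absurd hne (hf P hP).1
    exact tree_pair c hc _ γ r (fun P hP => hr P (hW' hP)) D Q (fun P hP => hQ P (hW' hP))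
      J hJD (fun P hP => hJ P (hW' hP)) X Y hX hY σ hσ hsz (fun P hP => hsing P (hW' hP))
      b.1.1 b.2.1 hne b.1.2 b.2.2 (hsgn' _ hb.1.2) (hsgn' _ hb.2.2)
      (fun P hP => (hf P hP).2.1) (fun P hP => (hf P hP).2.2)
  · have hcardB : (B.card : ℝ) ≤ 4 * n ^ 2 := by
      rw [hB, Finset.card_product, Finset.card_product, Finset.card_univ, Fintype.card_fin]
      have h12 : ({1, -1} : Finset ℝ).card ≤ 2 := Finset.card_le_two
      have : n * ({1, -1} : Finset ℝ).card * (n * ({1, -1} : Finset ℝ).card) ≤ n * 2 * (n * 2) := by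
        gcongr
      calc _ ≤ ((n * 2 * (n * 2) : ℕ) : ℝ) := by exact_mod_cast this
        _ = _ := by push_cast; ring
    calc _ = B.card * ((3 * 2 ^ r) ^ n * X ^ 2 * Y ^ n * (∏ i, σ i) * len J) := by
          rw [Finset.sum_const, nsmul_eq_mul]
      _ ≤ (4 * n ^ 2) * ((3 * 2 ^ r) ^ n * X ^ 2 * Y ^ n * (∏ i, σ i) * len J) := by
          gcongr
      _ = _ := by ring

end MTT

namespace MTT

def Chain {n : ℕ} (F : Fin n → Finset Tr) (ρ : Fin n → ℕ) : List (Fin n) → Dy → MT n → Prop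
  | [], J, P => iv P.1 ⊆ iv J
  | s :: l, J, P => ∃ τ ∈ F s, iv τ.1 ⊆ iv J ∧ Rem (ρ s) τ (tl P s) ∧ Chain F ρ l τ.1 P

lemma chain_of_pairwise {n : ℕ} {F : Fin n → Finset Tr} {ρ : Fin n → ℕ} {P : MT n} (τ : Fin n → Tr) :
    ∀ (l : List (Fin n)), l.Pairwise (fun a b => iv (τ b).1 ⊆ iv (τ a).1) →
      (∀ s ∈ l, τ s ∈ F s ∧ Rem (ρ s) (τ s) (tl P s)) → ∀ J, (∀ s ∈ l, iv (τ s).1 ⊆ iv J) →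
      iv P.1 ⊆ iv J → Chain F ρ l J P := by
  intro l
  induction l with
  | nil => intro _ _ J _ h; exact h
  | cons s l ih =>
    intro hp hm J hJ _
    rw [List.pairwise_cons] at hp
    have hs := hm s List.mem_cons_self
    refine ⟨τ s, hs.1, hJ s List.mem_cons_self, hs.2, ?_⟩
    exact ih hp.2 (fun s' hs' => hm s' (List.mem_cons_of_mem _ hs')) _ hp.1 hs.2.1

lemma chain_bound {n : ℕ} {F : Fin n → Finset Tr} {ρ : Fin n → ℕ} (g : MT n → ℝ) (hg : ∀ P, 0 ≤ g P)
    (D : Finset Dy) (hD : ∀ s, ∀ τ ∈ F s, τ.1 ∈ D) (W : Fin n → ℝ) (hW : ∀ s, 0 ≤ W s)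
    (hloc : ∀ s, ∀ J ∈ D, ∑ τ ∈ (F s).filter (fun τ => iv τ.1 ⊆ iv J), len τ.1 ≤ W s * len J)
    (S : Finset (Fin n)) (V0 : Finset (MT n)) (K : ℝ) (hK : 0 ≤ K)
    (hbase : ∀ (ξ : Fin n → ℝ), ∀ J ∈ D, ∀ V ⊆ V0, (∀ P ∈ V, iv P.1 ⊆ iv J) →
      (∀ P ∈ V, ∀ s ∈ S, |rat (ξ s) (tl P s)| ≤ 2 ^ ρ s) → ∑ P ∈ V, g P ≤ K * len J) :
    ∀ (l : List (Fin n)) (ξ : Fin n → ℝ), ∀ J ∈ D, ∀ V ⊆ V0,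
      (∀ P ∈ V, ∀ s ∈ S, s ∉ l → |rat (ξ s) (tl P s)| ≤ 2 ^ ρ s) →
      (∀ P ∈ V, Chain F ρ l J P) → ∑ P ∈ V, g P ≤ K * (l.map W).prod * len J := by
  intro l
  induction l with
  | nil =>
    intro ξ J hJ V hV h1 h2
    simpa using hbase ξ J hJ V hV h2 (fun P hP s hs => h1 P hP s hs (by simp))
  | cons s l ih =>
    intro ξ J hJ V hV h1 h2
    have hprod : 0 ≤ (l.map W).prod := List.prod_nonneg (by
      intro x hx; obtain ⟨a, _, rfl⟩ := List.mem_map.1 hx; exact hW a)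
    refine (sum_le_cover V ((F s).filter (fun τ => iv τ.1 ⊆ iv J)) g hg
      (fun τ P => Rem (ρ s) τ (tl P s) ∧ Chain F ρ l τ.1 P) ?_
      (fun τ => K * (l.map W).prod * len τ.1) ?_).trans ?_
    · intro P hP
      obtain ⟨τ, hτ, hJτ, hr, hch⟩ := h2 P hP
      exact ⟨τ, Finset.mem_filter.2 ⟨hτ, hJτ⟩, hr, hch⟩
    · intro τ hτ V' hV' hp
      have hτ' := Finset.mem_filter.1 hτ
      refine ih (Function.update ξ s τ.2.1) τ.1 (hD s τ hτ'.1) V' (hV'.trans hV) ?_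
        (fun P hP => (hp P hP).2)
      intro P hP s' hs' hl
      by_cases hss : s' = s
      · subst hss; rw [Function.update_self]; exact (hp P hP).1.2
      · rw [Function.update_of_ne hss]
        exact h1 P (hV' hP) s' hs' (by simp [hss, hl])
    · rw [← Finset.mul_sum, List.map_cons, List.prod_cons]
      calc _ ≤ K * (l.map W).prod * (W s * len J) := by
            apply mul_le_mul_of_nonneg_left (hloc s J hJ); positivity
        _ = _ := by ring

lemma chain_global {n : ℕ} {F : Fin n → Finset Tr} {ρ : Fin n → ℕ} (g : MT n → ℝ) (hg : ∀ P, 0 ≤ g P)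
    (D : Finset Dy) (hD : ∀ s, ∀ τ ∈ F s, τ.1 ∈ D) (W : Fin n → ℝ) (hW : ∀ s, 0 ≤ W s)
    (hglob : ∀ s, ∑ τ ∈ F s, len τ.1 ≤ W s)
    (hloc : ∀ s, ∀ J ∈ D, ∑ τ ∈ (F s).filter (fun τ => iv τ.1 ⊆ iv J), len τ.1 ≤ W s * len J)
    (S : Finset (Fin n)) (V0 : Finset (MT n)) (K : ℝ) (hK : 0 ≤ K)
    (hbase : ∀ (ξ : Fin n → ℝ), ∀ J ∈ D, ∀ V ⊆ V0, (∀ P ∈ V, iv P.1 ⊆ iv J) →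
      (∀ P ∈ V, ∀ s ∈ S, |rat (ξ s) (tl P s)| ≤ 2 ^ ρ s) → ∑ P ∈ V, g P ≤ K * len J)
    (hS : S.Nonempty)
    (hcov : ∀ P ∈ V0, ∀ s ∈ S, ∃ τ ∈ F s, Rem (ρ s) τ (tl P s)) :
    ∑ P ∈ V0, g P ≤ S.card.factorial * (K * ∏ s ∈ S, W s) := by
  have hprodS : 0 ≤ ∏ s ∈ S, W s := Finset.prod_nonneg fun s _ => hW s
  set B := S.toList.permutations.toFinset with hB
  have hcb := chain_bound (ρ := ρ) g hg D hD W hW hloc S V0 K hK hbase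
  refine (sum_le_cover V0 B g hg
    (fun l P => ∃ s l', l = s :: l' ∧ ∃ τ ∈ F s, Rem (ρ s) τ (tl P s) ∧ Chain F ρ l' τ.1 P) ?_
    (fun _ => K * ∏ s ∈ S, W s) ?_).trans ?_
  · intro P hP
    have hex : ∀ s, ∃ τ : Tr, s ∈ S → τ ∈ F s ∧ Rem (ρ s) τ (tl P s) := by
      intro s
      by_cases hs : s ∈ S
      · obtain ⟨τ, h1, h2⟩ := hcov P hP s hs
        exact ⟨τ, fun _ => ⟨h1, h2⟩⟩
      · exact ⟨((0, 0), 0, ∅), fun h => absurd h hs⟩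
    choose τ hτ using hex
    set l := S.toList.mergeSort (fun a b => decide ((τ b).1.1 ≤ (τ a).1.1)) with hl
    have hperm : l.Perm S.toList := List.mergeSort_perm _ _
    have hmem : ∀ s, s ∈ l ↔ s ∈ S := fun s => by rw [hperm.mem_iff, Finset.mem_toList]
    have hpw : l.Pairwise (fun a b => iv (τ b).1 ⊆ iv (τ a).1) := by
      have h1 : l.Pairwise (fun a b => decide ((τ b).1.1 ≤ (τ a).1.1) = true) :=
        List.pairwise_mergeSort (le := fun a b => decide ((τ b).1.1 ≤ (τ a).1.1))
          (by intro a b c; simp only [decide_eq_true_eq]; intro h h'; exact h'.trans h)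
          (by intro a b; simp only [Bool.or_eq_true, decide_eq_true_eq]; exact le_total _ _) _
      refine (List.Pairwise.imp_of_mem ?_ h1)
      intro a b ha hb hab
      have ha' := (hτ a ((hmem a).1 ha)).2.1
      have hb' := (hτ b ((hmem b).1 hb)).2.1
      exact iv_nested (by simpa using hab) ⟨lf P.1, hb' (lf_mem _), ha' (lf_mem _)⟩
    refine ⟨l, by rw [hB, List.mem_toFinset, List.mem_permutations]; exact hperm, ?_⟩
    cases hll : l with
    | nil =>
      obtain ⟨s, hs⟩ := hS
      have := (hmem s).2 hs
      rw [hll] at this; simp at this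
    | cons s l' =>
      have hs : s ∈ S := (hmem s).1 (by rw [hll]; exact List.mem_cons_self)
      rw [hll, List.pairwise_cons] at hpw
      refine ⟨s, l', rfl, τ s, (hτ s hs).1, (hτ s hs).2, ?_⟩
      exact chain_of_pairwise τ l' hpw.2 (fun s' hs' => hτ s' ((hmem s').1 (by
        rw [hll]; exact List.mem_cons_of_mem _ hs'))) _ hpw.1 (hτ s hs).2.1
  · intro l hl V hV hp
    rw [hB, List.mem_toFinset, List.mem_permutations] at hl
    have hWl : (l.map W).prod = ∏ s ∈ S, W s := by
      rw [(hl.map W).prod_eq, Finset.prod_map_toList]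
    rcases l with _ | ⟨s, l'⟩
    · obtain ⟨s, hs⟩ := hS
      have := (hl.mem_iff (a := s)).2 (Finset.mem_toList.2 hs)
      simp at this
    have hprod : 0 ≤ (l'.map W).prod := List.prod_nonneg (by
      intro x hx; obtain ⟨a, _, rfl⟩ := List.mem_map.1 hx; exact hW a)
    refine (sum_le_cover V (F s) g hg
      (fun τ P => Rem (ρ s) τ (tl P s) ∧ Chain F ρ l' τ.1 P) ?_
      (fun τ => K * (l'.map W).prod * len τ.1) ?_).trans ?_
    · intro P hP
      obtain ⟨s1, l1, he, τ, hτ, h⟩ := hp P hP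
      rw [List.cons.injEq] at he
      obtain ⟨rfl, rfl⟩ := he
      exact ⟨τ, hτ, h⟩
    · intro τ hτ V' hV' hp'
      refine hcb l' (fun _ => τ.2.1) τ.1 (hD s τ hτ) V' (hV'.trans hV) ?_ (fun P hP => (hp' P hP).2)
      intro P hP s' hs' hl'
      have : s' ∈ s :: l' := hl.mem_iff.2 (Finset.mem_toList.2 hs')
      rcases List.mem_cons.1 this with rfl | h
      · exact (hp' P hP).1.2
      · exact absurd h hl'
    · rw [← Finset.mul_sum, ← hWl, List.map_cons, List.prod_cons]
      calc _ ≤ K * (l'.map W).prod * W s := by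
            apply mul_le_mul_of_nonneg_left (hglob s); positivity
        _ = _ := by ring
  · rw [Finset.sum_const, nsmul_eq_mul]
    apply mul_le_mul_of_nonneg_right _ (by positivity)
    have h1 : B.card ≤ S.toList.permutations.length := List.toFinset_card_le _
    rw [List.length_permutations, Finset.length_toList] at h1
    exact_mod_cast h1

lemma exists_top {n : ℕ} (s : Fin n → ℝ) : ∀ k, k ≤ n →
    ∃ S : Finset (Fin n), S.card = k ∧ ∀ i ∈ S, ∀ j, j ∉ S → s j ≤ s i := by
  intro k
  induction k with
  | zero => intro _; exact ⟨∅, by simp⟩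
  | succ k ih =>
    intro hk
    obtain ⟨S, hS, h⟩ := ih (by omega)
    have hne : (Finset.univ \ S).Nonempty := by
      rw [← Finset.card_pos, Finset.card_sdiff_of_subset (Finset.subset_univ _), hS, Finset.card_univ,
        Fintype.card_fin]
      omega
    obtain ⟨a, ha, hmax⟩ := Finset.exists_max_image _ s hne
    have ha' : a ∉ S := by simpa using ha
    refine ⟨insert a S, by rw [Finset.card_insert_of_notMem ha', hS], ?_⟩
    intro i hi j hj
    have hjS : j ∉ S := fun h => hj (Finset.mem_insert_of_mem h)
    rcases Finset.mem_insert.1 hi with rfl | hi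
    · exact hmax j (by simpa using hjS)
    · exact h i hi j hjS

lemma rearr {n k : ℕ} (s : Fin n → ℝ) (hs : ∀ i, 0 < s i) (θ : Fin n → ℝ) (hθ0 : ∀ i, 0 < θ i)
    (hθ1 : ∀ i, θ i < 1) (hθs : (∑ i, θ i) = (n : ℝ) - 2 * k) (S : Finset (Fin n)) (hS : S.card = k)
    (hk : 1 ≤ k) (htop : ∀ i ∈ S, ∀ j, j ∉ S → s j ≤ s i) :
    (∏ i, s i) * (∏ i ∈ S, (s i ^ 2)⁻¹) ≤ ∏ i, s i ^ θ i := by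
  have hSne : S.Nonempty := by rw [← Finset.card_pos]; omega
  obtain ⟨a, ha, hmin⟩ := Finset.exists_min_image S s hSne
  set L : Fin n → ℝ := fun i => Real.log (s i) with hL
  have e1 : ∏ i, s i = Real.exp (∑ i, L i) := by
    rw [Real.exp_sum]; exact Finset.prod_congr rfl fun i _ => (Real.exp_log (hs i)).symm
  have e2 : ∏ i ∈ S, (s i ^ 2)⁻¹ = Real.exp (∑ i ∈ S, -(2 * L i)) := by
    rw [Real.exp_sum]
    refine Finset.prod_congr rfl fun i _ => ?_
    rw [Real.exp_neg, two_mul, Real.exp_add, hL, Real.exp_log (hs i), sq]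
  have e3 : ∏ i, s i ^ θ i = Real.exp (∑ i, θ i * L i) := by
    rw [Real.exp_sum]
    refine Finset.prod_congr rfl fun i _ => ?_
    rw [Real.rpow_def_of_pos (hs i), mul_comm]
  rw [e1, e2, e3, ← Real.exp_add, Real.exp_le_exp]
  have hlog : ∀ i j, s j ≤ s i → L j ≤ L i := fun i j h => Real.log_le_log (hs j) h
  have key : ∑ i, (1 - θ i) * (L i - L a) ≤ ∑ i ∈ S, 2 * (L i - L a) := by
    have : ∑ i ∈ S, 2 * (L i - L a) = ∑ i, if i ∈ S then 2 * (L i - L a) else 0 := by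
      rw [← Finset.sum_filter]; congr 1; ext; simp
    rw [this]
    apply Finset.sum_le_sum
    intro i _
    have h0 := hθ0 i; have h1 := hθ1 i
    split_ifs with hi
    · have := hlog i a (hmin i hi); nlinarith
    · have := hlog a i (htop a ha i hi); nlinarith
  have k1 : ∑ i, (1 - θ i) * (L i - L a) = ∑ i, L i - ∑ i, θ i * L i - 2 * k * L a := by
    have : ∀ i, (1 - θ i) * (L i - L a) = L i - θ i * L i - L a + θ i * L a := fun i => by ring
    simp only [this]
    rw [Finset.sum_add_distrib, Finset.sum_sub_distrib, Finset.sum_sub_distrib, ← Finset.sum_mul, hθs]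
    simp; ring
  have k2 : ∑ i ∈ S, 2 * (L i - L a) = -(∑ i ∈ S, -(2 * L i)) - 2 * k * L a := by
    simp only [mul_sub]
    rw [Finset.sum_sub_distrib, Finset.sum_neg_distrib]
    simp [hS]; ring
  rw [k1, k2] at key
  linarith

end MTT

namespace MTT

def Geo (n k : ℕ) (R : ℝ) (r1 : ℕ) (PP : Finset (MT n)) : Prop :=
  ∀ S : Finset (Fin n), S.card = k → ∀ ξ : Fin n → ℝ, ∃ γ : Fin n → ℝ, ∀ P ∈ PP, ∀ r : ℕ,
    (∀ s ∈ S, |rat (ξ s) (tl P s)| ≤ 2 ^ r) →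
    (∀ i, |rat (γ i) (tl P i)| ≤ 2 ^ (r1 + r)) ∧
    ∃ i i', i ≠ i' ∧ bb R ≤ |rat (γ i) (tl P i)| ∧ bb R ≤ |rat (γ i') (tl P i')|

def Wc (R Λ : ℝ) (β : ℕ) (t : ℝ) (ρ : ℕ) : ℝ :=
  4000000 * R * Λ * 4 ^ ρ * (4 ^ (β * ρ))⁻¹ * (t ^ 2)⁻¹

lemma Wc_nonneg {R Λ : ℝ} (hR : 1 ≤ R) (hΛ : 1 ≤ Λ) (β : ℕ) (t : ℝ) (ρ : ℕ) : 0 ≤ Wc R Λ β t ρ := by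
  unfold Wc; positivity

lemma four_pow (a : ℕ) : (4:ℝ) ^ a = (2 ^ a) ^ 2 := by
  rw [← pow_mul, mul_comm, pow_mul]; norm_num

lemma pack_le {R Λ : ℝ} {β : ℕ} {σ : ℝ} {m ρ : ℕ} (hσ : 0 < σ) {x E : ℝ}
    (h : lev β σ (m + 1) ρ ^ 2 * x ≤ 1000000 * R * 4 ^ ρ * (Λ * E)) :
    x ≤ Wc R Λ β ((1 / 2) ^ m * σ) ρ * E := by
  set t := (1 / 2 : ℝ) ^ m * σ with ht
  have htp : 0 < t := by positivity
  have e : lev β σ (m + 1) ρ ^ 2 = 4 ^ (β * ρ) * t ^ 2 / 4 := by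
    unfold lev; rw [ht, four_pow, pow_succ]; ring
  rw [e] at h
  have hp : 0 < 4 ^ (β * ρ) * t ^ 2 := by positivity
  have : x * (4 ^ (β * ρ) * t ^ 2) ≤ 4000000 * R * Λ * 4 ^ ρ * E := by linarith
  rw [← le_div_iff₀ hp] at this
  refine this.trans (le_of_eq ?_)
  unfold Wc; field_simp

lemma range_sum_le (N a : ℕ) (A : Finset ℕ) (hA : ∀ r ∈ A, r ≤ N) :
    ∑ r ∈ A, (2:ℝ) ^ (a * r) ≤ 2 ^ ((a + 1) * N) := by
  calc ∑ r ∈ A, (2:ℝ) ^ (a * r) ≤ ∑ r ∈ A, (2:ℝ) ^ (a * N) := by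
        apply Finset.sum_le_sum; intro r hr
        exact pow_le_pow_right₀ (by norm_num) (Nat.mul_le_mul_left _ (hA r hr))
    _ = A.card * (2:ℝ) ^ (a * N) := by simp
    _ ≤ 2 ^ N * (2:ℝ) ^ (a * N) := by
        gcongr
        have : A.card ≤ N + 1 := by
          have : A ⊆ Finset.range (N + 1) := fun r hr => Finset.mem_range.2 (by have := hA r hr; omega)
          simpa using Finset.card_le_card this
        calc (A.card : ℝ) ≤ (N:ℝ) + 1 := by exact_mod_cast this
          _ ≤ 2 ^ N := succ_le_two_pow N
    _ = _ := by rw [← pow_add]; congr 1; ring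

lemma level_est {n k : ℕ} (hk : 1 ≤ k) (hkn : k ≤ n) (θ : Fin n → ℝ) (hθ0 : ∀ i, 0 < θ i)
    (hθ1 : ∀ i, θ i < 1) (hθs : (∑ i, θ i) = (n : ℝ) - 2 * k) {R : ℝ} (hR : 1 ≤ R) {κ δ r0 r1 : ℕ}
    (hδ : 1 ≤ δ) (hr0 : bb R ≤ 2 ^ r0) {Λ : ℝ} (hΛ : 1 ≤ Λ) (σ : Fin n → ℝ) (hσ : ∀ i, 0 < σ i)
    (c : Fin n → Ti → ℝ) (hc : ∀ i P, 0 ≤ c i P) (PP : Finset (MT n)) (hgeo : Geo n k R r1 PP)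
    (D : Finset Dy) (hD : ∀ P ∈ PP, P.1 ∈ D)
    (hB1 : ∀ i, Bes R (c i) (fun _ => True) 1)
    (hB2 : ∀ i, ∀ J ∈ D, Bes R (c i) (fun P => iv P.1 ⊆ iv J) (Λ * len J))
    (X : ∀ i, Levels R (c i) D (PP.image (fun P => tl P i)) κ δ r0 (σ i))
    (m : Fin n → ℕ) (V : Finset (MT n)) (hV : V ⊆ PP)
    (hlev : ∀ P ∈ V, ∀ i, tl P i ∈ (X i).Q (m i) ∧ tl P i ∉ (X i).Q (m i + 1)) :
    ∑ P ∈ V, len P.1 * ∏ i, c i (tl P i) ≤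
      (k.factorial * ((4 * n ^ 2) * 3 ^ n * 2 ^ (n * r1) * 4 ^ ((κ + δ) * r1) *
        (2 ^ ((κ + δ) * r0)) ^ n) * (4000000 * R * Λ) ^ k) *
      ((∏ i, ((1 / 2) ^ m i * σ i) ^ θ i) * ∏ i, 2 ^ ((n + 3) * ((m i + 1) / δ))) := by
  set β := κ + δ with hβ
  set t : Fin n → ℝ := fun i => (1 / 2 : ℝ) ^ m i * σ i with ht
  have htp : ∀ i, 0 < t i := fun i => by have := hσ i; simp only [ht]; positivity
  have hlevt : ∀ i r, lev β (σ i) (m i) r = 2 ^ (β * r) * t i := fun i r => by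
    unfold lev; simp only [ht]; ring
  obtain ⟨S, hS, htop⟩ := exists_top t k hkn
  have hTD : ∀ i, ∀ P ∈ PP.image (fun P => tl P i), P.1 ∈ D := by
    intro i P hP
    obtain ⟨P', hP', rfl⟩ := Finset.mem_image.1 hP
    exact hD P' hP'
  set g : MT n → ℝ := fun P => len P.1 * ∏ i, c i (tl P i) with hg
  have hg0 : ∀ P, 0 ≤ g P := fun P => mul_nonneg (len_pos _).le (Finset.prod_nonneg fun i _ => hc _ _)
  set A : Fin n → Finset ℕ := fun i => if i ∈ S then
    (Finset.range ((m i + 1) / δ + 1)).filter (fun r => r0 ≤ r) else {0} with hA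
  have hAmem : ∀ i ∈ S, ∀ r, r ∈ A i ↔ r0 ≤ r ∧ δ * r ≤ m i + 1 := by
    intro i hi r
    simp only [hA, if_pos hi, Finset.mem_filter, Finset.mem_range]
    rw [Nat.lt_succ_iff, Nat.le_div_iff_mul_le (by omega), mul_comm r δ]
    tauto
  set Kc : ℝ := (4 * n ^ 2) * 3 ^ n * 2 ^ (n * r1) * 4 ^ (β * r1) * (2 ^ (β * r0)) ^ n with hKc
  set K : (Fin n → ℕ) → ℝ := fun ρ => Kc * (2 ^ (n * ∑ s ∈ S, ρ s) * 4 ^ (β * ∑ s ∈ S, ρ s)) *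
    ∏ i, t i with hK
  have hprodt : 0 ≤ ∏ i, t i := Finset.prod_nonneg fun i _ => (htp i).le
  have hK0 : ∀ ρ, 0 ≤ K ρ := fun ρ => by simp only [hK, hKc]; positivity
  have hSne : S.Nonempty := by rw [← Finset.card_pos]; omega
  have hmain : ∑ P ∈ V, g P ≤ ∑ ρ ∈ Fintype.piFinset A,
      k.factorial * (K ρ * ∏ s ∈ S, Wc R Λ β (t s) (ρ s)) := by
    refine sum_le_cover V _ g hg0
      (fun ρ P => ∀ s ∈ S, ∃ τ ∈ (X s).F (m s) (ρ s), Rem (ρ s) τ (tl P s)) ?_ _ ?_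
    · intro P hP
      have hex : ∀ s, ∃ r, r ∈ A s ∧ (s ∈ S → ∃ τ ∈ (X s).F (m s) r, Rem r τ (tl P s)) := by
        intro s
        by_cases hs : s ∈ S
        · obtain ⟨r, h1, h2, h3⟩ := (X s).cov (m s) (tl P s) (hlev P hP s).1 (hlev P hP s).2
          exact ⟨r, (hAmem s hs r).2 ⟨h1, h2⟩, fun _ => h3⟩
        · exact ⟨0, by simp [hA, hs], fun h => absurd h hs⟩
      choose ρ h1 h2 using hex
      exact ⟨ρ, Fintype.mem_piFinset.2 h1, h2⟩
    · intro ρ hρ V' hV' hcov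
      have hρ' : ∀ s ∈ S, r0 ≤ ρ s ∧ δ * ρ s ≤ m s + 1 := fun s hs =>
        (hAmem s hs _).1 (Fintype.mem_piFinset.1 hρ s)
      have hFin : ∀ s, s ∈ S → (if s ∈ S then (X s).F (m s) (ρ s) else ∅) = (X s).F (m s) (ρ s) :=
        fun s hs => if_pos hs
      have hFout : ∀ s, s ∉ S → (if s ∈ S then (X s).F (m s) (ρ s) else ∅) = ∅ :=
        fun s hs => if_neg hs
      have hW0 : ∀ s, 0 ≤ Wc R Λ β (t s) (ρ s) := fun s => Wc_nonneg hR hΛ _ _ _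
      rw [← hS]
      refine chain_global (F := fun s => if s ∈ S then (X s).F (m s) (ρ s) else ∅) (ρ := ρ) g hg0 D ?_
        (fun s => Wc R Λ β (t s) (ρ s)) hW0 ?_ ?_ S V' (K ρ) (hK0 ρ) ?_ hSne ?_
      · intro s τ hτ
        by_cases hs : s ∈ S
        · rw [hFin s hs] at hτ; exact (X s).top _ _ τ hτ
        · rw [hFout s hs] at hτ; simp at hτ
      · intro s
        by_cases hs : s ∈ S
        · rw [hFin s hs]
          have h1 := ((X s).pack (m s) (ρ s) (hρ' s hs).1 (hρ' s hs).2).1 1 (by norm_num) (hB1 s)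
          have h2 := pack_le (R := R) (Λ := Λ) (E := 1) (hσ s) (h1.trans (by
            have : 0 ≤ 1000000 * R * 4 ^ ρ s := by positivity
            nlinarith))
          rwa [mul_one] at h2
        · rw [hFout s hs]; simpa using hW0 s
      · intro s J hJ
        by_cases hs : s ∈ S
        · rw [hFin s hs]
          have hJ0 := len_pos J
          have h1 := ((X s).pack (m s) (ρ s) (hρ' s hs).1 (hρ' s hs).2).2 J (Λ * len J)
            (by positivity) (hB2 s J hJ)
          exact pack_le (hσ s) h1
        · rw [hFout s hs]
          have := hW0 s
          have hJ0 := len_pos J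
          simp; positivity
      · intro ξ J hJ V2 hV2 hin hrat
        obtain ⟨γ, hγ⟩ := hgeo S hS ξ
        set rr := ∑ s ∈ S, ρ s with hrr
        have hρrr : ∀ s ∈ S, ρ s ≤ rr := fun s hs =>
          Finset.single_le_sum (f := ρ) (fun _ _ => Nat.zero_le _) hs
        have hle : ∀ P ∈ V2, ∀ s ∈ S, |rat (ξ s) (tl P s)| ≤ 2 ^ rr := fun P hP s hs =>
          (hrat P hP s hs).trans (pow_le_pow_right₀ (by norm_num) (hρrr s hs))
        have hV2P : ∀ P ∈ V2, P ∈ PP := fun P hP => hV (hV' (hV2 hP))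
        have hr0r : r0 ≤ r1 + rr := by
          obtain ⟨s, hs⟩ := hSne
          have := hρrr s hs
          have := (hρ' s hs).1
          omega
        have hte := tree_est (R := R) c hc V2 γ (r1 + rr)
          (fun P hP => (hγ P (hV2P P hP) rr (hle P hP)).1)
          (fun P hP => (hγ P (hV2P P hP) rr (hle P hP)).2) D (fun i => (X i).Q (m i))
          (fun P hP i => (hlev P (hV' (hV2 hP)) i).1) J hJ hin (2 ^ (β * (r1 + rr))) (2 ^ (β * r0))
          (by positivity) (one_le_pow₀ (by norm_num)) t (fun i => (htp i).le)
          (by intro i s hs; rw [← hlevt]; exact (X i).good (m i) s hs _ hr0r)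
          (by intro P hP i; rw [← hlevt]
              exact (X i).single (hTD i) (hσ i).le hr0 (m i) _ (hlev P (hV' (hV2 hP)) i).1)
        refine hte.trans (le_of_eq ?_)
        simp only [hK, hKc]
        rw [mul_pow 3, ← pow_mul 2 (r1 + rr) n, ← pow_mul 2 (β * (r1 + rr)) 2, four_pow (β * r1), four_pow (β * rr)]
        rw [show (r1 + rr) * n = n * r1 + n * rr by ring, pow_add,
          show β * (r1 + rr) * 2 = (β * r1) * 2 + (β * rr) * 2 by ring, pow_add, pow_mul 2 (β * r1),
          pow_mul 2 (β * rr)]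
        ring
      · intro P hP s hs
        rw [hFin s hs]
        exact hcov P hP s hs
  refine hmain.trans ?_
  have hterm : ∀ ρ ∈ Fintype.piFinset A, (k.factorial : ℝ) * (K ρ * ∏ s ∈ S, Wc R Λ β (t s) (ρ s)) =
      (k.factorial * Kc * (4000000 * R * Λ) ^ k) * ((∏ i, t i) * ∏ i ∈ S, (t i ^ 2)⁻¹) *
        ∏ i, (if i ∈ S then (2:ℝ) ^ ((n + 2) * ρ i) else 1) := by
    intro ρ _
    have e1 : ∏ s ∈ S, Wc R Λ β (t s) (ρ s) = (4000000 * R * Λ) ^ k * (∏ s ∈ S, (4:ℝ) ^ ρ s) *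
        (∏ s ∈ S, (4:ℝ) ^ (β * ρ s))⁻¹ * ∏ s ∈ S, (t s ^ 2)⁻¹ := by
      unfold Wc
      rw [Finset.prod_mul_distrib, Finset.prod_mul_distrib, Finset.prod_mul_distrib, Finset.prod_const, hS,
        Finset.prod_inv_distrib]
    have e2 : (4:ℝ) ^ (β * ∑ s ∈ S, ρ s) = ∏ s ∈ S, (4:ℝ) ^ (β * ρ s) := by
      rw [Finset.mul_sum, Finset.prod_pow_eq_pow_sum]
    have e3 : ∏ i, (if i ∈ S then (2:ℝ) ^ ((n + 2) * ρ i) else 1) =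
        2 ^ (n * ∑ s ∈ S, ρ s) * ∏ s ∈ S, (4:ℝ) ^ ρ s := by
      rw [Finset.prod_ite_mem, Finset.univ_inter, Finset.mul_sum, ← Finset.prod_pow_eq_pow_sum,
        ← Finset.prod_mul_distrib]
      refine Finset.prod_congr rfl fun s _ => ?_
      rw [add_mul, pow_add, pow_mul 2 2]; norm_num
    rw [e1, e3]
    simp only [hK]
    rw [e2]
    have hne : (∏ s ∈ S, (4:ℝ) ^ (β * ρ s)) ≠ 0 := Finset.prod_ne_zero_iff.2 fun s _ => by positivity
    field_simp
  rw [Finset.sum_congr rfl hterm, ← Finset.mul_sum]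
  have hsum : ∑ ρ ∈ Fintype.piFinset A, ∏ i, (if i ∈ S then (2:ℝ) ^ ((n + 2) * ρ i) else 1) ≤
      ∏ i, (2:ℝ) ^ ((n + 3) * ((m i + 1) / δ)) := by
    rw [← Finset.prod_univ_sum A (fun i r => if i ∈ S then (2:ℝ) ^ ((n + 2) * r) else 1)]
    apply Finset.prod_le_prod
    · intro i _
      exact Finset.sum_nonneg fun r _ => by split_ifs <;> positivity
    · intro i _
      by_cases hi : i ∈ S
      · simp only [if_pos hi]
        apply range_sum_le ((m i + 1) / δ) (n + 2)
        intro r hr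
        rw [Nat.le_div_iff_mul_le (by omega), mul_comm r δ]
        exact ((hAmem i hi r).1 hr).2
      · simp only [if_neg hi, hA, Finset.sum_singleton]
        exact one_le_pow₀ (by norm_num)
  have hre := rearr t htp θ hθ0 hθ1 hθs S hS hk htop
  rw [mul_assoc]
  apply mul_le_mul_of_nonneg_left _ (by simp only [hKc]; positivity)
  apply mul_le_mul hre hsum
  · exact Finset.sum_nonneg fun ρ _ => Finset.prod_nonneg fun i _ => by split_ifs <;> positivity
  · exact Finset.prod_nonneg fun i _ => Real.rpow_nonneg (htp i).le _

end MTT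

namespace MTT

lemma level_factor {θ : ℝ} (hθ0 : 0 < θ) (hθ1 : θ < 1) {σ : ℝ} (hσ : 0 < σ) {a δ : ℕ} (hδ : 1 ≤ δ)
    (had : (a:ℝ) ≤ θ / 2 * δ) (m : ℕ) :
    ((1 / 2) ^ m * σ) ^ θ * 2 ^ (a * ((m + 1) / δ)) ≤ σ ^ θ * (2 * ((2:ℝ) ^ (-(θ / 2))) ^ m) := by
  have h2 : (0:ℝ) < 2 := by norm_num
  have hδ' : (0:ℝ) < δ := by exact_mod_cast (by omega : 0 < δ)
  have e1 : ((1 / 2 : ℝ) ^ m * σ) ^ θ = σ ^ θ * 2 ^ (-(θ * m)) := by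
    rw [Real.mul_rpow (by positivity) hσ.le, mul_comm, one_div, inv_pow, Real.inv_rpow (by positivity),
      ← Real.rpow_natCast, ← Real.rpow_mul h2.le, Real.rpow_neg h2.le, mul_comm θ]
  have e2 : (2:ℝ) ^ (a * ((m + 1) / δ)) ≤ 2 ^ (θ / 2 * (m + 1)) := by
    rw [← Real.rpow_natCast]
    apply Real.rpow_le_rpow_of_exponent_le (by norm_num)
    push_cast
    have : (((m + 1) / δ : ℕ) : ℝ) ≤ ((m + 1 : ℕ) : ℝ) / δ := Nat.cast_div_le
    calc (a:ℝ) * (((m + 1) / δ : ℕ) : ℝ) ≤ (θ / 2 * δ) * (((m + 1 : ℕ) : ℝ) / δ) := by gcongr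
      _ = _ := by push_cast; field_simp
  have e3 : ((2:ℝ) ^ (-(θ / 2))) ^ m = 2 ^ (-(θ / 2 * m)) := by
    rw [← Real.rpow_natCast, ← Real.rpow_mul h2.le]; congr 1; ring
  rw [e1, e3, mul_assoc]
  apply mul_le_mul_of_nonneg_left _ (Real.rpow_nonneg hσ.le _)
  calc (2:ℝ) ^ (-(θ * m)) * 2 ^ (a * ((m + 1) / δ)) ≤ 2 ^ (-(θ * m)) * 2 ^ (θ / 2 * (m + 1)) := by
        gcongr
    _ = 2 ^ (θ / 2) * 2 ^ (-(θ / 2 * m)) := by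
        rw [← Real.rpow_add h2, ← Real.rpow_add h2]; congr 1; ring
    _ ≤ 2 * 2 ^ (-(θ / 2 * m)) := by
        gcongr
        calc (2:ℝ) ^ (θ / 2) ≤ 2 ^ (1:ℝ) :=
              Real.rpow_le_rpow_of_exponent_le (by norm_num) (by linarith)
          _ = 2 := Real.rpow_one 2

lemma tuple_sum {n : ℕ} (ω : Fin n → ℝ) (h0 : ∀ i, 0 ≤ ω i) (h1 : ∀ i, ω i < 1)
    (B : Finset (Fin n → ℕ)) :
    ∑ m ∈ B, ∏ i, (2 * ω i ^ m i) ≤ ∏ i, (2 * (1 - ω i)⁻¹) := by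
  calc ∑ m ∈ B, ∏ i, (2 * ω i ^ m i)
      ≤ ∑ m ∈ Fintype.piFinset (fun i => B.image (fun m => m i)), ∏ i, (2 * ω i ^ m i) := by
        apply Finset.sum_le_sum_of_subset_of_nonneg
        · intro m hm
          exact Fintype.mem_piFinset.2 fun i => Finset.mem_image_of_mem (fun m : Fin n → ℕ => m i) hm
        · intro m _ _
          exact Finset.prod_nonneg fun i _ => mul_nonneg (by norm_num) (pow_nonneg (h0 i) _)
    _ = ∏ i, ∑ j ∈ B.image (fun m => m i), 2 * ω i ^ j := by
        rw [Finset.prod_univ_sum]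
    _ ≤ _ := by
        apply Finset.prod_le_prod
        · intro i _
          exact Finset.sum_nonneg fun j _ => mul_nonneg (by norm_num) (pow_nonneg (h0 i) _)
        · intro i _
          rw [← Finset.mul_sum, ← tsum_geometric_of_lt_one (h0 i) (h1 i)]
          apply mul_le_mul_of_nonneg_left _ (by norm_num)
          exact (summable_geometric_of_lt_one (h0 i) (h1 i)).sum_le_tsum _
            (fun j _ => pow_nonneg (h0 i) _)

theorem core {n k : ℕ} (hk : 1 ≤ k) (hkn : k ≤ n) (θ : Fin n → ℝ) (hθ0 : ∀ i, 0 < θ i)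
    (hθ1 : ∀ i, θ i < 1) (hθs : (∑ i, θ i) = (n : ℝ) - 2 * k) {R : ℝ} (hR : 1 ≤ R) (κ r1 : ℕ) :
    ∃ C : ℝ, 0 ≤ C ∧ ∀ Λ : ℝ, 1 ≤ Λ → ∀ σ : Fin n → ℝ, (∀ i, 0 < σ i) →
      ∀ c : Fin n → Ti → ℝ, (∀ i P, 0 ≤ c i P) → ∀ PP : Finset (MT n), Geo n k R r1 PP →
      (∀ i, Bes R (c i) (fun _ => True) 1) →
      (∀ i, ∀ P ∈ PP, Bes R (c i) (fun P' => iv P'.1 ⊆ iv P.1) (Λ * len P.1)) →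
      (∀ i, ∀ s : ℝ, |s| = 1 → ∀ r, SizeLe R (c i) (PP.image Prod.fst) (PP.image (fun P => tl P i)) s r
        (2 ^ (κ * r) * σ i)) →
      ∑ P ∈ PP, len P.1 * ∏ i, c i (tl P i) ≤ C * Λ ^ k * ∏ i, σ i ^ θ i := by
  obtain ⟨r0, hr0⟩ := pow_unbounded_of_one_lt (bb R) (by norm_num : (1:ℝ) < 2)
  have hr0 := hr0.le
  set δ : ℕ := ∑ i, ⌈2 * ((n:ℝ) + 3) / θ i⌉₊ + 1 with hδdef
  have hδ : 1 ≤ δ := by omega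
  have hδθ : ∀ i, (((n + 3 : ℕ)) : ℝ) ≤ θ i / 2 * δ := by
    intro i
    have h1 : 2 * ((n:ℝ) + 3) / θ i ≤ δ := by
      refine (Nat.le_ceil _).trans ?_
      have : ⌈2 * ((n:ℝ) + 3) / θ i⌉₊ ≤ ∑ i, ⌈2 * ((n:ℝ) + 3) / θ i⌉₊ :=
        Finset.single_le_sum (f := fun i => ⌈2 * ((n:ℝ) + 3) / θ i⌉₊) (fun _ _ => Nat.zero_le _)
          (Finset.mem_univ i)
      exact_mod_cast this.trans (by omega)
    have h2 := hθ0 i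
    rw [div_le_iff₀ h2] at h1
    push_cast; linarith
  set C0 : ℝ := k.factorial * ((4 * n ^ 2) * 3 ^ n * 2 ^ (n * r1) * 4 ^ ((κ + δ) * r1) *
        (2 ^ ((κ + δ) * r0)) ^ n) * (4000000 * R) ^ k with hC0
  set ω : Fin n → ℝ := fun i => (2:ℝ) ^ (-(θ i / 2)) with hω
  have hω0 : ∀ i, 0 ≤ ω i := fun i => by simp only [hω]; positivity
  have hω1 : ∀ i, ω i < 1 := fun i => by
    simp only [hω]; exact Real.rpow_lt_one_of_one_lt_of_neg (by norm_num) (by linarith [hθ0 i])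
  have hC00 : 0 ≤ C0 := by rw [hC0]; positivity
  have hωp : 0 ≤ ∏ i, (2 * (1 - ω i)⁻¹) := Finset.prod_nonneg fun i _ =>
    mul_nonneg (by norm_num) (inv_nonneg.2 (by linarith [hω1 i]))
  refine ⟨C0 * ∏ i, (2 * (1 - ω i)⁻¹), by positivity, ?_⟩
  intro Λ hΛ σ hσ c hc PP hgeo hB1 hB2 hap
  set D := PP.image Prod.fst with hD
  have hTD : ∀ i, ∀ P ∈ PP.image (fun P => tl P i), P.1 ∈ D := by
    intro i P hP
    obtain ⟨P', hP', rfl⟩ := Finset.mem_image.1 hP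
    exact Finset.mem_image_of_mem Prod.fst hP'
  have hX : ∀ i, Nonempty (Levels R (c i) D (PP.image (fun P => tl P i)) κ δ r0 (σ i)) := fun i =>
    exists_levels hR (c i) (hc i) D _ (hTD i) (hσ i).le hr0 hδ (hap i)
  let X := fun i => (hX i).some
  set PP' := PP.filter (fun P => ∀ i, 0 < c i (tl P i)) with hPP'
  have hg0 : ∀ P : MT n, 0 ≤ len P.1 * ∏ i, c i (tl P i) := fun P =>
    mul_nonneg (len_pos _).le (Finset.prod_nonneg fun i _ => hc _ _)
  have hred : ∑ P ∈ PP, len P.1 * ∏ i, c i (tl P i) = ∑ P ∈ PP', len P.1 * ∏ i, c i (tl P i) := by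
    symm
    apply Finset.sum_subset (Finset.filter_subset _ _)
    intro P hP hP'
    have : ¬ ∀ i, 0 < c i (tl P i) := fun h => hP' (Finset.mem_filter.2 ⟨hP, h⟩)
    push Not at this
    obtain ⟨i, hi⟩ := this
    rw [Finset.prod_eq_zero (Finset.mem_univ i) (le_antisymm hi (hc _ _)), mul_zero]
  rw [hred]
  have hexl : ∀ P : MT n, ∃ m : Fin n → ℕ, P ∈ PP' →
      ∀ i, tl P i ∈ (X i).Q (m i) ∧ tl P i ∉ (X i).Q (m i + 1) := by
    intro P
    by_cases hP : P ∈ PP'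
    · have hP1 := Finset.mem_filter.1 hP
      have : ∀ i, ∃ m, tl P i ∈ (X i).Q m ∧ tl P i ∉ (X i).Q (m + 1) := fun i =>
        (X i).exists_level (hTD i) (hσ i).le hr0 (tl P i) (Finset.mem_image_of_mem (fun P => tl P i) hP1.1)
          (hP1.2 i)
      choose m hm using this
      exact ⟨m, fun _ => hm⟩
    · exact ⟨0, fun h => absurd h hP⟩
  choose lv hlv using hexl
  refine (sum_le_cover PP' (PP'.image lv) _ hg0 (fun m P => lv P = m)
    (fun P hP => ⟨lv P, Finset.mem_image_of_mem _ hP, rfl⟩)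
    (fun m => C0 * Λ ^ k * ((∏ i, σ i ^ θ i) * ∏ i, (2 * ω i ^ m i))) ?_).trans ?_
  · intro m _ V hV hm
    have h1 := level_est hk hkn θ hθ0 hθ1 hθs hR (r1 := r1) hδ hr0 hΛ σ hσ c hc PP hgeo D
      (fun P hP => Finset.mem_image_of_mem Prod.fst hP) hB1 (by
        intro i J hJ
        obtain ⟨P, hP, rfl⟩ := Finset.mem_image.1 hJ
        exact hB2 i P hP) X m V (hV.trans (Finset.filter_subset _ _)) (by
        intro P hP i
        rw [← hm P hP]; exact hlv P (hV hP) i)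
    refine h1.trans ?_
    have e : k.factorial * ((4 * n ^ 2) * 3 ^ n * 2 ^ (n * r1) * 4 ^ ((κ + δ) * r1) *
        (2 ^ ((κ + δ) * r0)) ^ n) * (4000000 * R * Λ) ^ k = C0 * Λ ^ k := by
      rw [hC0, mul_pow (4000000 * R) Λ k]; ring
    rw [e]
    apply mul_le_mul_of_nonneg_left _ (by positivity)
    rw [← Finset.prod_mul_distrib, ← Finset.prod_mul_distrib]
    apply Finset.prod_le_prod
    · intro i _
      have := hσ i
      positivity
    · intro i _
      exact level_factor (hθ0 i) (hθ1 i) (hσ i) hδ (hδθ i) (m i)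
  · rw [← Finset.mul_sum, ← Finset.mul_sum]
    have hσp : 0 ≤ ∏ i, σ i ^ θ i := Finset.prod_nonneg fun i _ => Real.rpow_nonneg (hσ i).le _
    calc _ ≤ C0 * Λ ^ k * ((∏ i, σ i ^ θ i) * ∏ i, (2 * (1 - ω i)⁻¹)) := by
          have := tuple_sum ω hω0 hω1 (PP'.image lv)
          gcongr
      _ = _ := by ring

end MTT

namespace MTT

def ee (t : ℝ) : ℂ := Complex.exp (((2 * π * t : ℝ) : ℂ) * Complex.I)

lemma norm_ee (t : ℝ) : ‖ee t‖ = 1 := Complex.norm_exp_ofReal_mul_I _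

lemma ee_add (s t : ℝ) : ee (s + t) = ee s * ee t := by
  unfold ee; rw [← Complex.exp_add]; congr 1; push_cast; ring

lemma ee_zero : ee 0 = 1 := by simp [ee]

lemma ee_neg_mul (t : ℝ) : ee (-t) * ee t = 1 := by rw [← ee_add]; simp [ee_zero]

lemma ee_conj (t : ℝ) : (starRingEnd ℂ) (ee t) = ee (-t) := by
  unfold ee; rw [← Complex.exp_conj]; congr 1
  rw [map_mul, Complex.conj_ofReal, Complex.conj_I]; push_cast; ring

lemma ee_cont : Continuous ee := by unfold ee; fun_prop

lemma ee_hasDeriv (c x : ℝ) :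
    HasDerivAt (fun x : ℝ => ee (c * x)) ((2 * π * c : ℝ) * Complex.I * ee (c * x)) x := by
  unfold ee
  have h1 : HasDerivAt (fun x : ℝ => (((2 * π * (c * x) : ℝ) : ℂ)) * Complex.I)
      ((2 * π * c : ℝ) * Complex.I) x := by
    have : HasDerivAt (fun x : ℝ => 2 * π * (c * x)) (2 * π * c) x := by
      simpa [mul_assoc] using (hasDerivAt_id x).const_mul (2 * π * c)
    exact this.ofReal_comp.mul_const _
  convert h1.cexp using 1
  ring

lemma fourier_ee (f : ℝ → ℂ) (w : ℝ) : 𝓕 f w = ∫ v, ee (-(v * w)) * f v := by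
  rw [Real.fourier_real_eq_integral_exp_smul]
  congr 1; ext v
  unfold ee; rw [smul_eq_mul]; congr 3; push_cast; ring

lemma fourierInv_ee (f : ℝ → ℂ) (w : ℝ) : 𝓕⁻ f w = ∫ v, ee (v * w) * f v := by
  rw [Real.fourierInv_eq_fourier_neg, fourier_ee]; simp

lemma fourier_cont {f : ℝ → ℂ} (hf : Integrable f) : Continuous (𝓕 f) :=
  VectorFourier.fourierIntegral_continuous Real.continuous_fourierChar
    (by exact continuous_inner) hf

lemma fourier_flip {f g : ℝ → ℂ} (hf : Integrable f) (hg : Integrable g) :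
    ∫ x, 𝓕 f x * g x = ∫ x, f x * 𝓕 g x := by
  have := VectorFourier.integral_fourierIntegral_smul_eq_flip (L := innerₗ ℝ)
      (μ := volume) (ν := volume) Real.continuous_fourierChar (by exact continuous_inner) hf hg
  simp only [smul_eq_mul] at this
  refine this.trans ?_
  rw [flip_innerₗ]; rfl

/-- orthogonality from disjoint Fourier supports -/
lemma orth0 {f g : ℝ → ℂ} (hc : Continuous f) (hf : Integrable f) (hF : Integrable (𝓕 f))
    (hg : Integrable g) (h : ∀ ξ, 𝓕 f ξ * 𝓕 g (-ξ) = 0) : ∫ x, f x * g x = 0 := by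
  have h1 : ∀ x, f x = 𝓕 (fun ξ => 𝓕 f (-ξ)) x := by
    intro x
    have := congrFun (hc.fourierInv_fourier_eq hf hF) x
    rw [← this, Real.fourierInv_eq_fourier_comp_neg]
  simp_rw [h1]
  rw [fourier_flip hF.comp_neg hg]
  have : ∀ x, 𝓕 f (-x) * 𝓕 g x = 0 := fun x => by simpa using h (-x)
  simp [this]

structure Prof (d : ℕ) (R A : ℝ) (φ : ℝ → ℂ) : Prop where
  cd : ContDiff ℝ 1 φ
  b0 : ∀ z, ‖φ z‖ ≤ A * (kw 1 0 z ^ d)⁻¹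
  b1 : ∀ z, ‖deriv φ z‖ ≤ A * (kw 1 0 z ^ d)⁻¹
  sp : ∀ ξ, R < |ξ| → 𝓕 φ ξ = 0

lemma Prof.A_nonneg {d : ℕ} {R A : ℝ} {φ : ℝ → ℂ} (h : Prof d R A φ) : 0 ≤ A := by
  have := (norm_nonneg _).trans (h.b0 0)
  simpa [kw] using this

def pk (φ : ℝ → ℂ) (P : Ti) (y : ℝ) : ℂ :=
  ee (-(fr P * y)) * (((len P.1)⁻¹ : ℝ) * φ ((y - lf P.1) / len P.1))

lemma kw_scale {L : ℝ} (hL : 0 < L) (c x : ℝ) : kw 1 0 ((x - c) / L) = kw L c x := by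
  unfold kw; rw [sub_zero, div_one, abs_div, abs_of_pos hL]


lemma Prof.norm_pk {d : ℕ} {R A : ℝ} {φ : ℝ → ℂ} (hφ : Prof d R A φ) (P : Ti) (y : ℝ) :
    ‖pk φ P y‖ ≤ A * (len P.1)⁻¹ * (kw (len P.1) (lf P.1) y ^ d)⁻¹ := by
  unfold pk
  rw [norm_mul, norm_mul, norm_ee, one_mul, Complex.norm_real, Real.norm_of_nonneg
    (inv_nonneg.2 (len_pos _).le)]
  have := hφ.b0 ((y - lf P.1) / len P.1)
  rw [kw_scale (len_pos _)] at this
  have hp := len_pos P.1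
  calc _ ≤ (len P.1)⁻¹ * (A * (kw (len P.1) (lf P.1) y ^ d)⁻¹) := by gcongr
    _ = _ := by ring

lemma Prof.cont_pk {d : ℕ} {R A : ℝ} {φ : ℝ → ℂ} (hφ : Prof d R A φ) (P : Ti) : Continuous (pk φ P) := by
  have := hφ.cd.continuous
  have := ee_cont
  unfold pk; fun_prop

lemma Prof.int_pk {d : ℕ} {R A : ℝ} {φ : ℝ → ℂ} (hφ : Prof d R A φ) (hd : 2 ≤ d) (P : Ti) : Integrable (pk φ P) := by
  refine ((integrable_kw (len_pos P.1) (lf P.1) hd).const_mul (A * (len P.1)⁻¹)).mono'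
    (hφ.cont_pk P).aestronglyMeasurable (Filter.Eventually.of_forall fun y => hφ.norm_pk P y)

lemma Prof.integrable {d : ℕ} {R A : ℝ} {φ : ℝ → ℂ} (hφ : Prof d R A φ) (hd : 2 ≤ d) : Integrable φ := by
  refine ((integrable_kw one_pos 0 hd).const_mul A).mono'
    hφ.cd.continuous.aestronglyMeasurable (Filter.Eventually.of_forall fun y => hφ.b0 y)

lemma fourier_pk (φ : ℝ → ℂ) (P : Ti) (ξ : ℝ) :
    𝓕 (pk φ P) ξ = ee (-((fr P + ξ) * lf P.1)) * 𝓕 φ (len P.1 * (fr P + ξ)) := by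
  have hp := len_pos P.1
  rw [fourier_ee, fourier_ee]
  have h1 : ∀ v, ee (-(v * ξ)) * pk φ P v =
      ((len P.1)⁻¹ : ℝ) • (fun z : ℝ => ee (-((fr P + ξ) * lf P.1)) *
        (ee (-(z * (len P.1 * (fr P + ξ)))) * φ z)) ((v - lf P.1) / len P.1) := by
    intro v
    unfold pk
    simp only
    rw [Complex.real_smul]
    have : ee (-(v * ξ)) * ee (-(fr P * v)) = ee (-((fr P + ξ) * lf P.1)) *
      ee (-((v - lf P.1) / len P.1 * (len P.1 * (fr P + ξ)))) := by
      rw [← ee_add, ← ee_add]; congr 1; field_simp; ring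
    rw [← mul_assoc, this]; ring
  simp_rw [h1]
  rw [integral_smul, integral_sub_right_eq_self (fun v => (fun z : ℝ => ee (-((fr P + ξ) * lf P.1)) *
        (ee (-(z * (len P.1 * (fr P + ξ)))) * φ z)) (v / len P.1)), Measure.integral_comp_div (fun z : ℝ => ee (-((fr P + ξ) * lf P.1)) *
        (ee (-(z * (len P.1 * (fr P + ξ)))) * φ z)), smul_smul, abs_of_pos hp, inv_mul_cancel₀ hp.ne', one_smul,
    integral_const_mul]

lemma Prof.fourier_pk_zero {d : ℕ} {R A : ℝ} {φ : ℝ → ℂ} (hφ : Prof d R A φ) (P : Ti) (ξ : ℝ) (h : R < |len P.1 * (fr P + ξ)|) : 𝓕 (pk φ P) ξ = 0 := by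
  rw [fourier_pk φ, hφ.sp _ h, mul_zero]

lemma Prof.int_fourier_pk {d : ℕ} {R A : ℝ} {φ : ℝ → ℂ} (hφ : Prof d R A φ) (hd : 2 ≤ d) (P : Ti) : Integrable (𝓕 (pk φ P)) := by
  have hp := len_pos P.1
  apply (fourier_cont (hφ.int_pk hd P)).integrable_of_hasCompactSupport
  apply HasCompactSupport.of_support_subset_isCompact
    (K := Set.Icc (-(fr P) - R / len P.1) (-(fr P) + R / len P.1)) isCompact_Icc
  intro ξ hξ
  by_contra hc
  apply hξ
  apply hφ.fourier_pk_zero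
  rw [abs_mul, abs_of_pos hp, mul_comm, ← div_lt_iff₀ hp]
  by_contra h2
  push Not at h2
  have := abs_le.1 h2
  exact hc ⟨by linarith, by linarith⟩

lemma Prof.orth1 {d : ℕ} {R A : ℝ} {φ : ℝ → ℂ} (hφ : Prof d R A φ) (hd : 2 ≤ d) {P P' : Ti} {ζ : ℝ}
    (h : R * (1 / len P.1 + 1 / len P'.1) < |fr P - fr P' + ζ|) :
    𝓕 (fun x => pk φ P x * (starRingEnd ℂ) (pk φ P' x)) ζ = 0 := by
  have hp := len_pos P.1
  have hp' := len_pos P'.1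
  rw [fourier_ee]
  have e1 : ∀ v, ee (-(v * ζ)) * (pk φ P v * (starRingEnd ℂ) (pk φ P' v)) =
      pk φ P v * (ee (-(v * ζ)) * (starRingEnd ℂ) (pk φ P' v)) := fun v => by ring
  simp_rw [e1]
  apply orth0 (hφ.cont_pk P) (hφ.int_pk hd P) (hφ.int_fourier_pk hd P)
  · refine (hφ.int_pk hd P').norm.mono' ?_ ?_
    · have := hφ.cont_pk P'
      have := ee_cont
      apply Continuous.aestronglyMeasurable
      apply Continuous.mul (by fun_prop)
      exact Complex.continuous_conj.comp (hφ.cont_pk P')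
    · exact Filter.Eventually.of_forall fun y => by simp [norm_ee]
  · intro ξ
    have e2 : 𝓕 (fun v => ee (-(v * ζ)) * (starRingEnd ℂ) (pk φ P' v)) (-ξ) =
        (starRingEnd ℂ) (𝓕 (pk φ P') (ξ - ζ)) := by
      rw [fourier_ee, fourier_ee, ← integral_conj]
      congr 1; ext v
      rw [map_mul, ee_conj, ← mul_assoc, ← ee_add]; congr 2; ring
    rw [e2]
    by_cases h1 : R < |len P.1 * (fr P + ξ)|
    · rw [hφ.fourier_pk_zero P ξ h1, zero_mul]
    by_cases h2 : R < |len P'.1 * (fr P' + (ξ - ζ))|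
    · rw [hφ.fourier_pk_zero P' _ h2]; simp
    exfalso
    push Not at h1 h2
    rw [abs_mul, abs_of_pos hp, mul_comm, ← le_div_iff₀ hp] at h1
    rw [abs_mul, abs_of_pos hp', mul_comm, ← le_div_iff₀ hp'] at h2
    have : |fr P - fr P' + ζ| ≤ |fr P + ξ| + |fr P' + (ξ - ζ)| := by
      have := abs_sub (fr P + ξ) (fr P' + (ξ - ζ))
      rwa [show fr P + ξ - (fr P' + (ξ - ζ)) = fr P - fr P' + ζ by ring] at this
    have e3 : R * (1 / len P.1 + 1 / len P'.1) = R / len P.1 + R / len P'.1 := by ring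
    linarith

end MTT

namespace MTT

def wq (s : ℕ) (J : Dy) (x : ℝ) : ℝ := (1 + ((x - lf J) / len J) ^ 2) ^ s

lemma one_le_wq (s : ℕ) (J : Dy) (x : ℝ) : 1 ≤ wq s J x :=
  one_le_pow₀ (by have := sq_nonneg ((x - lf J) / len J); linarith)

lemma wq_pos (s : ℕ) (J : Dy) (x : ℝ) : 0 < wq s J x := by linarith [one_le_wq s J x]

lemma wq_cont (s : ℕ) (J : Dy) : Continuous (wq s J) := by unfold wq; fun_prop

lemma kw_sub {I J : Dy} (h : iv I ⊆ iv J) (x : ℝ) :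
    kw (len J) (lf J) x ≤ 2 * kw (len I) (lf I) x := by
  have hJ := len_pos J
  have h1 := kw_mul hJ (lf J) (lf I) x
  have h2 := kw_anti (len_pos I) (len_le_of_subset h) (lf I) x
  have h3 : kw (len J) (lf J) (lf I) ≤ 2 := by
    have := h (lf_mem I)
    unfold kw
    have h4 : |lf I - lf J| / len J ≤ 1 := by
      rw [div_le_one hJ, abs_le]
      constructor <;> linarith [this.1, this.2]
    linarith
  have := kw_pos hJ (lf I) x
  calc _ ≤ _ := h1
    _ ≤ 2 * kw (len J) (lf I) x := by gcongr
    _ ≤ _ := by gcongr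

lemma wq_le_kw (s : ℕ) (J : Dy) (x : ℝ) : wq s J x ≤ kw (len J) (lf J) x ^ (2 * s) := by
  unfold wq kw
  rw [pow_mul]
  apply pow_le_pow_left₀ (by positivity)
  have : ((x - lf J) / len J) ^ 2 = (|x - lf J| / len J) ^ 2 := by
    rw [← sq_abs, abs_div, abs_of_pos (len_pos J)]
  rw [this]
  have : 0 ≤ |x - lf J| / len J := div_nonneg (abs_nonneg _) (len_pos J).le
  nlinarith

lemma kw_le_wq (s : ℕ) (J : Dy) (x : ℝ) : kw (len J) (lf J) x ^ (2 * s) ≤ 2 ^ s * wq s J x := by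
  unfold wq kw
  rw [pow_mul, ← mul_pow]
  apply pow_le_pow_left₀ (by positivity)
  have : ((x - lf J) / len J) ^ 2 = (|x - lf J| / len J) ^ 2 := by
    rw [← sq_abs, abs_div, abs_of_pos (len_pos J)]
  rw [this]
  nlinarith [sq_nonneg (1 - |x - lf J| / len J)]

lemma wq_le {I J : Dy} (h : iv I ⊆ iv J) (s : ℕ) (x : ℝ) :
    wq s J x ≤ 4 ^ s * kw (len I) (lf I) x ^ (2 * s) := by
  refine (wq_le_kw s J x).trans ?_
  refine (pow_le_pow_left₀ (kw_pos (len_pos J) _ _).le (kw_sub h x) _).trans (le_of_eq ?_)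
  rw [mul_pow, pow_mul 2]; norm_num

lemma pow_cancel {k : ℝ} (hk : 1 ≤ k) {a b d : ℕ} (h : a + b ≤ d) : k ^ a * (k ^ d)⁻¹ ≤ (k ^ b)⁻¹ := by
  have h0 : 0 < k := by linarith
  rw [← div_eq_mul_inv, div_le_iff₀ (by positivity), inv_mul_eq_div, le_div_iff₀ (by positivity),
    ← pow_add]
  exact pow_le_pow_right₀ hk h

/-- vanishing moments -/
lemma moment {h : ℝ → ℂ} {N : ℕ} (hi : ∀ n : ℕ, n ≤ N → Integrable (fun x : ℝ => x ^ n • h x))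
    (h0 : 𝓕 h =ᶠ[nhds 0] 0) : ∀ n ≤ N, ∫ x : ℝ, (x : ℂ) ^ n * h x = 0 := by
  intro n hn
  have h1 := Real.iteratedDeriv_fourier (N := (N : ℕ∞)) (fun n hn => hi n (by exact_mod_cast hn))
    (by exact_mod_cast hn : (n : ℕ∞) ≤ N)
  have h2 : iteratedDeriv n (𝓕 h) 0 = 0 := by
    rw [(h0.iteratedDeriv n).self_of_nhds]
    simp
  rw [h1, fourier_ee] at h2
  have e : ∀ v : ℝ, ee (-(v * 0)) * ((-2 * π * Complex.I * v) ^ n • h v) =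
      (-2 * π * Complex.I) ^ n * ((v : ℂ) ^ n * h v) := by
    intro v
    rw [mul_zero, neg_zero, ee_zero, one_mul, smul_eq_mul, mul_pow]; ring
  simp_rw [e] at h2
  rw [integral_const_mul] at h2
  rcases mul_eq_zero.1 h2 with h3 | h3
  · exfalso
    have : (-2 * π * Complex.I : ℂ) ≠ 0 := by
      simp [Real.pi_ne_zero]
    exact pow_ne_zero n this h3
  · exact h3

lemma poly_moment {h : ℝ → ℂ} {N : ℕ} (hi : ∀ n : ℕ, n ≤ N → Integrable (fun x : ℝ => x ^ n • h x))
    (h0 : 𝓕 h =ᶠ[nhds 0] 0) (p : Polynomial ℝ) (hp : p.natDegree ≤ N) :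
    ∫ x : ℝ, ((p.eval x : ℝ) : ℂ) * h x = 0 := by
  have e : ∀ x : ℝ, ((p.eval x : ℝ) : ℂ) * h x =
      ∑ i ∈ Finset.range (p.natDegree + 1), (p.coeff i : ℂ) * ((x : ℂ) ^ i * h x) := by
    intro x
    rw [Polynomial.eval_eq_sum_range]
    push_cast
    rw [Finset.sum_mul]
    exact Finset.sum_congr rfl fun i _ => by ring
  simp_rw [e]
  rw [integral_finsetSum]
  · apply Finset.sum_eq_zero
    intro i hi'
    rw [integral_const_mul, moment hi h0 i (by have := Finset.mem_range.1 hi'; omega), mul_zero]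
  · intro i hi'
    have := hi i (by have := Finset.mem_range.1 hi'; omega)
    refine Integrable.const_mul ?_ _
    have e' : (fun x : ℝ => x ^ i • h x) = fun x : ℝ => (x : ℂ) ^ i * h x := by
      ext x; rw [Complex.real_smul]; push_cast; rfl
    rwa [e'] at this

lemma cs_real {f g : ℝ → ℝ} (hf0 : ∀ x, 0 ≤ f x) (hg0 : ∀ x, 0 ≤ g x) (hf : MemLp f 2) (hg : MemLp g 2) :
    (∫ x, f x * g x) ^ 2 ≤ (∫ x, f x ^ 2) * ∫ x, g x ^ 2 := by
  have h := integral_mul_le_Lp_mul_Lq_of_nonneg (μ := (volume : Measure ℝ)) (p := 2) (q := 2)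
    (by constructor <;> norm_num) (Filter.Eventually.of_forall hf0) (Filter.Eventually.of_forall hg0)
    (by simpa using hf) (by simpa using hg)
  have h0 : 0 ≤ ∫ x, f x * g x := integral_nonneg fun x => mul_nonneg (hf0 x) (hg0 x)
  have hF : 0 ≤ ∫ x, f x ^ 2 := integral_nonneg fun x => by positivity
  have hG : 0 ≤ ∫ x, g x ^ 2 := integral_nonneg fun x => by positivity
  simp only [Real.rpow_two] at h
  rw [← Real.sqrt_eq_rpow, ← Real.sqrt_eq_rpow] at h
  calc _ ≤ (√(∫ x, f x ^ 2) * √(∫ x, g x ^ 2)) ^ 2 := pow_le_pow_left₀ h0 h 2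
    _ = _ := by rw [mul_pow, Real.sq_sqrt hF, Real.sq_sqrt hG]

/-- abstract Bessel via Gram matrix -/
lemma gram_bessel {ι : Type*} (T : Finset ι) (F : ℝ → ℂ) (hF : MemLp F 2) (g : ι → ℝ → ℂ)
    (hg : ∀ i ∈ T, MemLp (g i) 2) (a : ι → ℝ) (ha : ∀ i, 0 ≤ a i) :
    (∑ i ∈ T, a i * ‖∫ x, F x * g i x‖) ^ 2 ≤ (∫ x, ‖F x‖ ^ 2) *
      ∑ i ∈ T, ∑ j ∈ T, a i * a j * ‖∫ x, g i x * (starRingEnd ℂ) (g j x)‖ := by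
  have hu : ∀ i, ∃ u : ℂ, ‖u‖ = 1 ∧ u * (∫ x, F x * g i x) = ‖∫ x, F x * g i x‖ := by
    intro i
    set z := ∫ x, F x * g i x
    by_cases hz : z = 0
    · exact ⟨1, by simp, by simp [hz]⟩
    · refine ⟨(starRingEnd ℂ) z / ‖z‖, ?_, ?_⟩
      · have : ‖z‖ ≠ 0 := norm_ne_zero_iff.2 hz
        simp [this]
      · have : (‖z‖ : ℂ) ≠ 0 := by simpa using hz
        rw [div_mul_eq_mul_div, div_eq_iff this, mul_comm, Complex.mul_conj, Complex.normSq_eq_norm_sq]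
        push_cast; ring
  choose u hu1 hu2 using hu
  set H : ℝ → ℂ := fun x => ∑ i ∈ T, (a i * u i) * g i x with hH
  have hHm : MemLp H 2 := by
    have := memLp_finsetSum' (p := 2) (μ := (volume : Measure ℝ)) T
      (f := fun i x => ((a i * u i : ℂ)) * g i x) (fun i hi => (hg i hi).const_mul _)
    convert this using 1
    ext x; simp [hH]
  have hintg : ∀ i ∈ T, Integrable (fun x => F x * g i x) := fun i hi => by
    exact hF.integrable_mul (hg i hi)
  have e1 : ((∑ i ∈ T, a i * ‖∫ x, F x * g i x‖ : ℝ) : ℂ) = ∫ x, F x * H x := by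
    have : ∀ x, F x * H x = ∑ i ∈ T, (a i * u i) * (F x * g i x) := by
      intro x; rw [hH, Finset.mul_sum]; exact Finset.sum_congr rfl fun i _ => by ring
    simp_rw [this]
    rw [integral_finsetSum _ (fun i hi => (hintg i hi).const_mul _)]
    push_cast
    refine Finset.sum_congr rfl fun i _ => ?_
    rw [integral_const_mul, mul_assoc, hu2]
  have h1 : ∑ i ∈ T, a i * ‖∫ x, F x * g i x‖ ≤ ∫ x, ‖F x‖ * ‖H x‖ := by
    have h0 : 0 ≤ ∑ i ∈ T, a i * ‖∫ x, F x * g i x‖ :=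
      Finset.sum_nonneg fun i _ => mul_nonneg (ha i) (norm_nonneg _)
    calc _ = ‖((∑ i ∈ T, a i * ‖∫ x, F x * g i x‖ : ℝ) : ℂ)‖ := by
          rw [Complex.norm_real, Real.norm_of_nonneg h0]
      _ ≤ _ := by
          rw [e1]; refine (norm_integral_le_integral_norm _).trans (le_of_eq ?_)
          simp_rw [norm_mul]
  have h2 : ∫ x, ‖H x‖ ^ 2 ≤
      ∑ i ∈ T, ∑ j ∈ T, a i * a j * ‖∫ x, g i x * (starRingEnd ℂ) (g j x)‖ := by
    have hconj : ∀ j ∈ T, MemLp (fun x => (starRingEnd ℂ) (g j x)) 2 := fun j hj => (hg j hj).star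
    have hint2 : ∀ i ∈ T, ∀ j ∈ T, Integrable (fun x => g i x * (starRingEnd ℂ) (g j x)) :=
      fun i hi j hj => (hg i hi).integrable_mul (hconj j hj)
    have e2 : ((∫ x, ‖H x‖ ^ 2 : ℝ) : ℂ) = ∑ i ∈ T, ∑ j ∈ T,
        (a i * u i * (a j * (starRingEnd ℂ) (u j))) * ∫ x, g i x * (starRingEnd ℂ) (g j x) := by
      rw [← integral_complex_ofReal]
      have : ∀ x, ((‖H x‖ ^ 2 : ℝ) : ℂ) = ∑ i ∈ T, ∑ j ∈ T,
          (a i * u i * (a j * (starRingEnd ℂ) (u j))) * (g i x * (starRingEnd ℂ) (g j x)) := by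
        intro x
        rw [← Complex.normSq_eq_norm_sq, ← Complex.mul_conj, hH]
        simp only [map_sum, map_mul, Complex.conj_ofReal]
        rw [Finset.sum_mul_sum]
        exact Finset.sum_congr rfl fun i _ => Finset.sum_congr rfl fun j _ => by ring
      rw [integral_congr_ae (Filter.Eventually.of_forall this)]
      rw [integral_finsetSum _ (fun i hi => integrable_finsetSum _ fun j hj =>
        (hint2 i hi j hj).const_mul _)]
      refine Finset.sum_congr rfl fun i hi => ?_
      rw [integral_finsetSum _ (fun j hj => (hint2 i hi j hj).const_mul _)]
      refine Finset.sum_congr rfl fun j hj => ?_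
      rw [integral_const_mul]
    have h0 : 0 ≤ ∫ x, ‖H x‖ ^ 2 := integral_nonneg fun x => by positivity
    calc _ = ‖((∫ x, ‖H x‖ ^ 2 : ℝ) : ℂ)‖ := by rw [Complex.norm_real, Real.norm_of_nonneg h0]
      _ ≤ _ := by
        rw [e2]
        refine (norm_sum_le _ _).trans (Finset.sum_le_sum fun i _ => ?_)
        refine (norm_sum_le _ _).trans (Finset.sum_le_sum fun j _ => ?_)
        simp only [norm_mul, Complex.norm_real, hu1, RCLike.norm_conj, Real.norm_of_nonneg (ha _), mul_one]
        exact le_refl _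
  have h3 := cs_real (fun x => norm_nonneg (F x)) (fun x => norm_nonneg (H x)) hF.norm hHm.norm
  have h0 : 0 ≤ ∑ i ∈ T, a i * ‖∫ x, F x * g i x‖ :=
      Finset.sum_nonneg fun i _ => mul_nonneg (ha i) (norm_nonneg _)
  calc _ ≤ (∫ x, ‖F x‖ * ‖H x‖) ^ 2 := pow_le_pow_left₀ h0 h1 2
    _ ≤ _ := h3
    _ ≤ _ := mul_le_mul_of_nonneg_left h2 (integral_nonneg fun x => by positivity)

lemma sep_bound {L L' : ℝ} (hL' : 0 < L') (hLL : L' ≤ L) (c c' x : ℝ) :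
    (kw L c x ^ 4)⁻¹ * (kw L' c' x ^ 4)⁻¹ ≤ (kw L c c' ^ 4)⁻¹ := by
  have hL : 0 < L := by linarith
  rw [← mul_inv, ← mul_pow]
  apply inv_anti₀ (by have := kw_pos hL c c'; positivity)
  apply pow_le_pow_left₀ (kw_pos hL _ _).le
  have h1 := kw_mul hL c x c'
  have h2 := kw_anti hL' hLL c' x
  rw [kw_comm L c' x] at h2
  have := kw_pos hL c x
  exact h1.trans (by gcongr)

lemma pk_gram_aux {L L' : ℝ} (hL' : 0 < L') (hLL : L' ≤ L) (c c' : ℝ) :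
    ∫ x, (L⁻¹ * (kw L c x ^ 6)⁻¹) * (L'⁻¹ * (kw L' c' x ^ 6)⁻¹) ≤ 4 * (L⁻¹ * (kw L c c' ^ 4)⁻¹) := by
  have hL : 0 < L := by linarith
  have hb : ∀ x, (L⁻¹ * (kw L c x ^ 6)⁻¹) * (L'⁻¹ * (kw L' c' x ^ 6)⁻¹) ≤
      (L⁻¹ * L'⁻¹ * (kw L c c' ^ 4)⁻¹) * (kw L' c' x ^ 2)⁻¹ := by
    intro x
    have h1 := sep_bound hL' hLL c c' x
    have h2 := kw_pow_anti hL c x (show 4 ≤ 6 by norm_num)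
    have e : (kw L' c' x ^ 6)⁻¹ = (kw L' c' x ^ 4)⁻¹ * (kw L' c' x ^ 2)⁻¹ := by
      rw [← mul_inv, ← pow_add]
    have p1 := kw_inv_nonneg hL' c' x 4
    have p2 := kw_inv_nonneg hL' c' x 2
    have p3 := kw_inv_nonneg hL c x 4
    rw [e]
    calc _ = L⁻¹ * L'⁻¹ * ((kw L c x ^ 6)⁻¹ * (kw L' c' x ^ 4)⁻¹) * (kw L' c' x ^ 2)⁻¹ := by ring
      _ ≤ L⁻¹ * L'⁻¹ * ((kw L c x ^ 4)⁻¹ * (kw L' c' x ^ 4)⁻¹) * (kw L' c' x ^ 2)⁻¹ := by gcongr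
      _ ≤ _ := by gcongr
  have hmaj := (integrable_kw hL' c' (le_refl 2)).const_mul (L⁻¹ * L'⁻¹ * (kw L c c' ^ 4)⁻¹)
  have h1 : ∫ x, (L⁻¹ * (kw L c x ^ 6)⁻¹) * (L'⁻¹ * (kw L' c' x ^ 6)⁻¹) ≤
      ∫ x, (L⁻¹ * L'⁻¹ * (kw L c c' ^ 4)⁻¹) * (kw L' c' x ^ 2)⁻¹ := by
    apply integral_mono_of_nonneg _ hmaj (Filter.Eventually.of_forall hb)
    refine Filter.Eventually.of_forall fun x => ?_
    have := kw_inv_nonneg hL' c' x 6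
    have := kw_inv_nonneg hL c x 6
    simp only [Pi.zero_apply]
    positivity
  refine h1.trans ?_
  rw [integral_const_mul]
  have h2 := integral_kw2 hL' c'
  have := kw_inv_nonneg hL c c' 4
  calc _ ≤ L⁻¹ * L'⁻¹ * (kw L c c' ^ 4)⁻¹ * (4 * L') := by gcongr
    _ = _ := by field_simp

end MTT

namespace MTT

lemma Prof.norm_wpk {d : ℕ} {R A : ℝ} {φ : ℝ → ℂ} (hφ : Prof d R A φ) {s e : ℕ} (hd : 2 * s + e ≤ d)
    {J : Dy} {P : Ti} {x : ℝ} (hw : wq s J x ≤ 4 ^ s * kw (len P.1) (lf P.1) x ^ (2 * s)) :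
    ‖(wq s J x : ℂ) * pk φ P x‖ ≤ 4 ^ s * A * ((len P.1)⁻¹ * (kw (len P.1) (lf P.1) x ^ e)⁻¹) := by
  rw [norm_mul, Complex.norm_real, Real.norm_of_nonneg (wq_pos s J x).le]
  have h1 := hφ.norm_pk P x
  have hA := hφ.A_nonneg
  have hp := len_pos P.1
  have hk := one_le_kw hp (lf P.1) x
  calc _ ≤ (4 ^ s * kw (len P.1) (lf P.1) x ^ (2 * s)) *
        (A * (len P.1)⁻¹ * (kw (len P.1) (lf P.1) x ^ d)⁻¹) := by gcongr
    _ = 4 ^ s * A * ((len P.1)⁻¹ * (kw (len P.1) (lf P.1) x ^ (2 * s) *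
        (kw (len P.1) (lf P.1) x ^ d)⁻¹)) := by ring
    _ ≤ _ := by gcongr; exact pow_cancel hk hd

lemma Prof.cont_wpk {d : ℕ} {R A : ℝ} {φ : ℝ → ℂ} (hφ : Prof d R A φ) (s : ℕ) (J : Dy) (P : Ti) :
    Continuous (fun x => (wq s J x : ℂ) * pk φ P x) :=
  (Complex.continuous_ofReal.comp (wq_cont s J)).mul (hφ.cont_pk P)

lemma memLp_of_kw {g : ℝ → ℂ} (hg : Continuous g) {L c K : ℝ} (hL : 0 < L) {e : ℕ} (he : 2 ≤ e)
    (hb : ∀ x, ‖g x‖ ≤ K * (kw L c x ^ e)⁻¹) : MemLp g 2 := by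
  rw [memLp_two_iff_integrable_sq_norm hg.aestronglyMeasurable]
  refine ((integrable_kw hL c he).const_mul (K ^ 2)).mono' (by fun_prop) ?_
  refine Filter.Eventually.of_forall fun x => ?_
  rw [Real.norm_of_nonneg (by positivity)]
  have h0 := kw_inv_nonneg hL c x e
  have h1 := kw_inv_le_one hL c x e
  calc ‖g x‖ ^ 2 ≤ (K * (kw L c x ^ e)⁻¹) ^ 2 := pow_le_pow_left₀ (norm_nonneg _) (hb x) 2
    _ = K ^ 2 * ((kw L c x ^ e)⁻¹ * (kw L c x ^ e)⁻¹) := by ring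
    _ ≤ K ^ 2 * ((kw L c x ^ e)⁻¹ * 1) := by gcongr
    _ = _ := by ring

def wpoly (s : ℕ) (J : Dy) : Polynomial ℝ :=
  (1 + (Polynomial.C (len J)⁻¹ * (Polynomial.X - Polynomial.C (lf J))) ^ 2) ^ (2 * s)

lemma wpoly_eval (s : ℕ) (J : Dy) (x : ℝ) : (wpoly s J).eval x = wq s J x * wq s J x := by
  unfold wpoly wq
  rw [← pow_add, ← two_mul]
  simp only [Polynomial.eval_pow, Polynomial.eval_add, Polynomial.eval_one, Polynomial.eval_mul,
    Polynomial.eval_C, Polynomial.eval_sub, Polynomial.eval_X]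
  congr 2; ring

lemma wpoly_deg (s : ℕ) (J : Dy) : (wpoly s J).natDegree ≤ 4 * s := by
  unfold wpoly
  have h1 : (Polynomial.C (len J)⁻¹ * (Polynomial.X - Polynomial.C (lf J))).natDegree ≤ 1 := by
    refine (Polynomial.natDegree_C_mul_le _ _).trans ?_
    exact (Polynomial.natDegree_X_sub_C (lf J)).le
  have h2 : ((Polynomial.C (len J)⁻¹ * (Polynomial.X - Polynomial.C (lf J))) ^ 2).natDegree ≤ 2 := by
    refine Polynomial.natDegree_pow_le.trans ?_
    omega
  have h3 : (1 + (Polynomial.C (len J)⁻¹ * (Polynomial.X - Polynomial.C (lf J))) ^ 2).natDegree ≤ 2 := by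
    refine (Polynomial.natDegree_add_le _ _).trans ?_
    simp only [Polynomial.natDegree_one]
    omega
  refine Polynomial.natDegree_pow_le.trans ?_
  calc _ ≤ 2 * s * 2 := Nat.mul_le_mul_left _ h3
    _ = _ := by ring

lemma Prof.wgram_zero {d : ℕ} {R A : ℝ} {φ : ℝ → ℂ} (hφ : Prof d R A φ) {s : ℕ} (hd : 4 * s + 6 ≤ d)
    (J : Dy) {P P' : Ti} (h : ¬ near R P P') :
    ∫ x, ((wq s J x : ℂ) * pk φ P x) * (starRingEnd ℂ) ((wq s J x : ℂ) * pk φ P' x) = 0 := by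
  have e : ∀ x, ((wq s J x : ℂ) * pk φ P x) * (starRingEnd ℂ) ((wq s J x : ℂ) * pk φ P' x) =
      (((wpoly s J).eval x : ℝ) : ℂ) * (pk φ P x * (starRingEnd ℂ) (pk φ P' x)) := by
    intro x
    rw [wpoly_eval, map_mul, Complex.conj_ofReal]; push_cast; ring
  simp_rw [e]
  have hp := len_pos P.1
  have hp' := len_pos P'.1
  have hA := hφ.A_nonneg
  apply poly_moment (N := 4 * s) _ _ _ (wpoly_deg s J)
  · intro n hn
    have hc : Continuous (fun x : ℝ => x ^ n • (pk φ P x * (starRingEnd ℂ) (pk φ P' x))) := by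
      have h1 := hφ.cont_pk P
      have h2 := Complex.continuous_conj.comp (hφ.cont_pk P')
      exact (continuous_pow n).smul (h1.mul h2)
    refine ((integrable_kw hp (lf P.1) (le_refl 2)).const_mul ((|lf P.1| + len P.1) ^ n *
      (A * (len P.1)⁻¹) * (A * (len P'.1)⁻¹))).mono' hc.aestronglyMeasurable ?_
    refine Filter.Eventually.of_forall fun x => ?_
    rw [norm_smul, norm_mul, RCLike.norm_conj, norm_pow, Real.norm_eq_abs]
    have h1 := hφ.norm_pk P x
    have h2 := hφ.norm_pk P' x
    have h3 : |x| ≤ (|lf P.1| + len P.1) * kw (len P.1) (lf P.1) x := by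
      have h4 : |x| ≤ |lf P.1| + |x - lf P.1| := by
        have := abs_add_le (lf P.1) (x - lf P.1)
        simpa using this
      unfold kw
      have h5 : 0 ≤ |lf P.1| * (|x - lf P.1| / len P.1) := by positivity
      have h6 : len P.1 * (|x - lf P.1| / len P.1) = |x - lf P.1| := by field_simp
      nlinarith
    have h4 : ‖pk φ P' x‖ ≤ A * (len P'.1)⁻¹ := by
      refine h2.trans (mul_le_of_le_one_right (by positivity) (kw_inv_le_one hp' _ _ _))
    have hk := one_le_kw hp (lf P.1) x
    calc _ ≤ ((|lf P.1| + len P.1) * kw (len P.1) (lf P.1) x) ^ n *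
          ((A * (len P.1)⁻¹ * (kw (len P.1) (lf P.1) x ^ d)⁻¹) * (A * (len P'.1)⁻¹)) := by gcongr
      _ = (|lf P.1| + len P.1) ^ n * (A * (len P.1)⁻¹) * (A * (len P'.1)⁻¹) *
          (kw (len P.1) (lf P.1) x ^ n * (kw (len P.1) (lf P.1) x ^ d)⁻¹) := by rw [mul_pow]; ring
      _ ≤ _ := by gcongr; exact pow_cancel hk (by omega)
  · unfold near at h
    push Not at h
    have hcont : Filter.Tendsto (fun ζ : ℝ => |fr P - fr P' + ζ|) (nhds 0) (nhds |fr P - fr P'|) := by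
      have : Continuous (fun ζ : ℝ => |fr P - fr P' + ζ|) := by fun_prop
      simpa using this.tendsto 0
    filter_upwards [hcont.eventually (lt_mem_nhds h)] with ζ hζ
    exact hφ.orth1 (by omega) hζ

lemma Prof.wgram {d : ℕ} {R A : ℝ} {φ : ℝ → ℂ} (hφ : Prof d R A φ) {s : ℕ} (hd : 4 * s + 6 ≤ d)
    (J : Dy) {P P' : Ti} (hP : ∀ x, wq s J x ≤ 4 ^ s * kw (len P.1) (lf P.1) x ^ (2 * s))
    (hP' : ∀ x, wq s J x ≤ 4 ^ s * kw (len P'.1) (lf P'.1) x ^ (2 * s)) :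
    ‖∫ x, ((wq s J x : ℂ) * pk φ P x) * (starRingEnd ℂ) ((wq s J x : ℂ) * pk φ P' x)‖ ≤
      4 * 16 ^ s * A ^ 2 * G R P P' := by
  by_cases hn : near R P P'
  swap
  · rw [hφ.wgram_zero hd J hn]; simp only [norm_zero]
    have := G_nonneg R P P'; positivity
  have hp := len_pos P.1
  have hp' := len_pos P'.1
  have hA := hφ.A_nonneg
  have hprod : ∀ x, ‖((wq s J x : ℂ) * pk φ P x) * (starRingEnd ℂ) ((wq s J x : ℂ) * pk φ P' x)‖ ≤
      (16 ^ s * A ^ 2) * (((len P.1)⁻¹ * (kw (len P.1) (lf P.1) x ^ 6)⁻¹) *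
      ((len P'.1)⁻¹ * (kw (len P'.1) (lf P'.1) x ^ 6)⁻¹)) := by
    intro x
    rw [norm_mul, RCLike.norm_conj]
    have h1 := hφ.norm_wpk (e := 6) (by omega) (hP x)
    have h2 := hφ.norm_wpk (e := 6) (by omega) (hP' x)
    have p1 := kw_inv_nonneg hp (lf P.1) x 6
    calc _ ≤ _ := mul_le_mul h1 h2 (norm_nonneg _) (by positivity)
      _ = _ := by
        have : (16:ℝ) ^ s = 4 ^ s * 4 ^ s := by rw [← mul_pow]; norm_num
        rw [this]; ring
  have hintg : Integrable (fun x => (16 ^ s * A ^ 2) * (((len P.1)⁻¹ * (kw (len P.1) (lf P.1) x ^ 6)⁻¹) *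
      ((len P'.1)⁻¹ * (kw (len P'.1) (lf P'.1) x ^ 6)⁻¹))) := by
    apply Integrable.const_mul
    refine ((integrable_kw hp (lf P.1) (by norm_num : 2 ≤ 6)).const_mul ((len P.1)⁻¹ * (len P'.1)⁻¹)).mono'
      ?_ ?_
    · have := kw_inv_cont hp (lf P.1) 6
      have := kw_inv_cont hp' (lf P'.1) 6
      apply Continuous.aestronglyMeasurable
      fun_prop
    · refine Filter.Eventually.of_forall fun x => ?_
      have p1 := kw_inv_nonneg hp (lf P.1) x 6
      have p2 := kw_inv_nonneg hp' (lf P'.1) x 6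
      have p3 := kw_inv_le_one hp' (lf P'.1) x 6
      rw [Real.norm_of_nonneg (by positivity)]
      calc _ ≤ ((len P.1)⁻¹ * (kw (len P.1) (lf P.1) x ^ 6)⁻¹) * ((len P'.1)⁻¹ * 1) := by gcongr
        _ = _ := by ring
  refine (norm_integral_le_of_norm_le hintg (Filter.Eventually.of_forall hprod)).trans ?_
  rw [integral_const_mul]
  have key : ∫ x, ((len P.1)⁻¹ * (kw (len P.1) (lf P.1) x ^ 6)⁻¹) *
      ((len P'.1)⁻¹ * (kw (len P'.1) (lf P'.1) x ^ 6)⁻¹) ≤ 4 * G R P P' := by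
    unfold G mx
    rw [if_pos hn]
    rcases le_total (len P'.1) (len P.1) with h | h
    · rw [max_eq_left h]; exact pk_gram_aux hp' h _ _
    · rw [max_eq_right h, kw_comm]
      refine (le_of_eq ?_).trans (pk_gram_aux hp h _ _)
      congr 1; ext x; ring
  calc _ ≤ (16 ^ s * A ^ 2) * (4 * G R P P') := by gcongr
    _ = _ := by ring

lemma Prof.bes {d : ℕ} {R A : ℝ} {φ : ℝ → ℂ} (hφ : Prof d R A φ) {s : ℕ} (hd : 4 * s + 6 ≤ d)
    (J : Dy) (S : Ti → Prop)
    (hS : ∀ P, S P → ∀ x, wq s J x ≤ 4 ^ s * kw (len P.1) (lf P.1) x ^ (2 * s))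
    (F : ℝ → ℂ) (hF : MemLp F 2) :
    Bes R (fun P => ‖∫ x, F x * ((wq s J x : ℂ) * pk φ P x)‖) S
      (4 * 16 ^ s * A ^ 2 * ∫ x, ‖F x‖ ^ 2) := by
  intro T hT a ha
  have hA := hφ.A_nonneg
  refine (gram_bessel T F hF (fun P x => (wq s J x : ℂ) * pk φ P x) ?_ a ha).trans ?_
  · intro P hP
    refine memLp_of_kw (L := len P.1) (c := lf P.1) (K := 4 ^ s * A * (len P.1)⁻¹) (hφ.cont_wpk s J P)
      (len_pos P.1) (e := 6) (by norm_num) fun x => ?_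
    refine (hφ.norm_wpk (e := 6) (by omega) (hS P (hT P hP) x)).trans (le_of_eq ?_)
    ring
  · have hF0 : 0 ≤ ∫ x, ‖F x‖ ^ 2 := integral_nonneg fun x => by positivity
    calc _ ≤ (∫ x, ‖F x‖ ^ 2) * ∑ P ∈ T, ∑ P' ∈ T, a P * a P' * (4 * 16 ^ s * A ^ 2 * G R P P') := by
          gcongr with P hP P' hP'
          · exact mul_nonneg (ha _) (ha _)
          · exact hφ.wgram hd J (hS P (hT P hP)) (hS P' (hT P' hP'))
      _ = _ := by
          simp_rw [Finset.mul_sum]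
          refine Finset.sum_congr rfl fun P _ => Finset.sum_congr rfl fun P' _ => ?_
          ring

/-- wave packet coefficient -/
def cf (φ f : ℝ → ℂ) (P : Ti) : ℝ := ‖∫ x, f x * pk φ P x‖

lemma cf_nonneg (φ f : ℝ → ℂ) (P : Ti) : 0 ≤ cf φ f P := norm_nonneg _

def fw (s : ℕ) (J : Dy) (f : ℝ → ℂ) (x : ℝ) : ℂ := f x / (wq s J x : ℂ)

lemma fw_norm (s : ℕ) (J : Dy) (f : ℝ → ℂ) (x : ℝ) : ‖fw s J f x‖ = ‖f x‖ / wq s J x := by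
  unfold fw; rw [norm_div, Complex.norm_real, Real.norm_of_nonneg (wq_pos s J x).le]

lemma fw_norm_le (s : ℕ) (J : Dy) (f : ℝ → ℂ) (x : ℝ) : ‖fw s J f x‖ ≤ ‖f x‖ := by
  rw [fw_norm]; exact div_le_self (norm_nonneg _) (one_le_wq s J x)

lemma fw_meas {s : ℕ} {J : Dy} {f : ℝ → ℂ} (hf : Measurable f) : Measurable (fw s J f) :=
  hf.div (Complex.continuous_ofReal.comp (wq_cont s J)).measurable

lemma fw_mul (s : ℕ) (J : Dy) (f : ℝ → ℂ) (x : ℝ) (z : ℂ) :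
    fw s J f x * ((wq s J x : ℂ) * z) = f x * z := by
  unfold fw
  have : (wq s J x : ℂ) ≠ 0 := by exact_mod_cast (wq_pos s J x).ne'
  field_simp

lemma fw_memLp {s : ℕ} {J : Dy} {f : ℝ → ℂ} (hm : Measurable f) (hf : MemLp f 2) : MemLp (fw s J f) 2 :=
  hf.mono (fw_meas hm).aestronglyMeasurable (Filter.Eventually.of_forall (fw_norm_le s J f))

lemma fw_int {s : ℕ} {J : Dy} {f : ℝ → ℂ} (hm : Measurable f) (hf : Integrable f) :
    Integrable (fw s J f) :=
  hf.mono (fw_meas hm).aestronglyMeasurable (Filter.Eventually.of_forall (fw_norm_le s J f))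

lemma Prof.bes_loc {d : ℕ} {R A : ℝ} {φ : ℝ → ℂ} (hφ : Prof d R A φ) {s : ℕ} (hd : 4 * s + 6 ≤ d)
    (J : Dy) {f : ℝ → ℂ} (hm : Measurable f) (hf : MemLp f 2) :
    Bes R (cf φ f) (fun P => iv P.1 ⊆ iv J) (4 * 16 ^ s * A ^ 2 * ∫ x, ‖fw s J f x‖ ^ 2) := by
  have := hφ.bes hd J (fun P => iv P.1 ⊆ iv J) (fun P hP x => wq_le hP s x) (fw s J f) (fw_memLp hm hf)
  simp_rw [fw_mul] at this
  exact this

lemma Prof.bes_glob {d : ℕ} {R A : ℝ} {φ : ℝ → ℂ} (hφ : Prof d R A φ) (hd : 6 ≤ d)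
    {f : ℝ → ℂ} (hm : Measurable f) (hf : MemLp f 2) :
    Bes R (cf φ f) (fun _ => True) (4 * A ^ 2 * ∫ x, ‖f x‖ ^ 2) := by
  have := hφ.bes (s := 0) (by omega) (0, 0) (fun _ => True) (fun P _ x => by simp [wq]) f hf
  simp [wq] at this
  exact this

end MTT

namespace MTT

def dy (j : ℤ) (x : ℝ) : Dy := (j, ⌊x / 2 ^ j⌋)

lemma mem_dy (j : ℤ) (x : ℝ) : x ∈ iv (dy j x) := by
  have hp : (0:ℝ) < 2 ^ j := by positivity
  unfold iv lf len dy
  have h1 := Int.floor_le (x / 2 ^ j)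
  have h2 := Int.lt_floor_add_one (x / 2 ^ j)
  rw [le_div_iff₀ hp] at h1
  rw [div_lt_iff₀ hp] at h2
  constructor
  · simp only; linarith
  · simp only; linarith

lemma dy_eq {I : Dy} {x : ℝ} (h : x ∈ iv I) : dy I.1 x = I :=
  eq_of_scale rfl ⟨x, mem_dy _ _, h⟩

lemma dy_eq' {j : ℤ} {x y : ℝ} (h : y ∈ iv (dy j x)) : dy j y = dy j x := dy_eq h

lemma dy_mono {j j' : ℤ} (h : j ≤ j') (x : ℝ) : iv (dy j x) ⊆ iv (dy j' x) :=
  iv_nested h ⟨x, mem_dy _ _, mem_dy _ _⟩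

lemma len_dy (j : ℤ) (x : ℝ) : len (dy j x) = 2 ^ j := rfl

def hav (H : ℝ → ℝ) (j : ℤ) (x : ℝ) : ℝ := ∫ y in iv (dy j x), H y

def badset (H : ℝ → ℝ) (τ : ℝ) (j0 j1 : ℤ) (x : ℝ) : Finset ℤ :=
  (Finset.Icc j0 j1).filter (fun j => τ * 2 ^ j < hav H j x)

def jj (H : ℝ → ℝ) (τ : ℝ) (j0 j1 : ℤ) (x : ℝ) : ℤ :=
  (insert j0 (badset H τ j0 j1 x)).max' (Finset.insert_nonempty _ _)

def JJ (H : ℝ → ℝ) (τ : ℝ) (j0 j1 : ℤ) (x : ℝ) : Dy := dy (jj H τ j0 j1 x) x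

lemma mem_JJ (H : ℝ → ℝ) (τ : ℝ) (j0 j1 : ℤ) (x : ℝ) : x ∈ iv (JJ H τ j0 j1 x) := mem_dy _ _

lemma jj_mem (H : ℝ → ℝ) (τ : ℝ) (j0 j1 : ℤ) (x : ℝ) :
    jj H τ j0 j1 x = j0 ∨ jj H τ j0 j1 x ∈ badset H τ j0 j1 x :=
  Finset.mem_insert.1 (Finset.max'_mem _ (Finset.insert_nonempty _ _))

lemma le_jj (H : ℝ → ℝ) (τ : ℝ) (j0 j1 : ℤ) (x : ℝ) : j0 ≤ jj H τ j0 j1 x :=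
  Finset.le_max' _ _ (Finset.mem_insert_self _ _)

lemma bad_le_jj {H : ℝ → ℝ} {τ : ℝ} {j0 j1 : ℤ} {x : ℝ} {j : ℤ} (h : j ∈ badset H τ j0 j1 x) :
    j ≤ jj H τ j0 j1 x :=
  Finset.le_max' _ _ (Finset.mem_insert_of_mem h)

lemma jj_const {H : ℝ → ℝ} {τ : ℝ} {j0 j1 : ℤ} {x y : ℝ} (hy : y ∈ iv (JJ H τ j0 j1 x)) :
    jj H τ j0 j1 y = jj H τ j0 j1 x := by
  have hdy : ∀ j, jj H τ j0 j1 x ≤ j → dy j y = dy j x := fun j hj => dy_eq' (dy_mono hj x hy)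
  have hb : ∀ j, jj H τ j0 j1 x ≤ j → (j ∈ badset H τ j0 j1 y ↔ j ∈ badset H τ j0 j1 x) := by
    intro j hj
    unfold badset hav
    rw [Finset.mem_filter, Finset.mem_filter, hdy j hj]
  have h1 : jj H τ j0 j1 x ≤ jj H τ j0 j1 y := by
    rcases jj_mem H τ j0 j1 x with h | h
    · rw [h]; exact le_jj _ _ _ _ _
    · exact bad_le_jj ((hb _ le_rfl).2 h)
  rcases jj_mem H τ j0 j1 y with h | h
  · have := le_jj H τ j0 j1 x; omega
  · exact le_antisymm (bad_le_jj ((hb _ h1).1 h)) h1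

lemma JJ_const {H : ℝ → ℝ} {τ : ℝ} {j0 j1 : ℤ} {x y : ℝ} (hy : y ∈ iv (JJ H τ j0 j1 x)) :
    JJ H τ j0 j1 y = JJ H τ j0 j1 x := by
  unfold JJ; rw [jj_const hy]; exact dy_eq' hy

lemma mem_JJ_symm {H : ℝ → ℝ} {τ : ℝ} {j0 j1 : ℤ} {x y : ℝ} (hy : y ∈ iv (JJ H τ j0 j1 x)) :
    x ∈ iv (JJ H τ j0 j1 y) := by rw [JJ_const hy]; exact mem_JJ _ _ _ _ _

lemma jj_avg {H : ℝ → ℝ} (hH : Integrable H) (hH0 : ∀ x, 0 ≤ H x) {τ : ℝ} (hτ : 0 ≤ τ) {j0 j1 : ℤ}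
    (h01 : j0 ≤ j1) (htot : ∫ x, H x ≤ τ * 2 ^ j1) (x : ℝ) :
    ∫ y in iv (JJ H τ j0 j1 x), H y ≤ 2 * τ * len (JJ H τ j0 j1 x) := by
  set j := jj H τ j0 j1 x with hj
  have h1 : ∫ y in iv (JJ H τ j0 j1 x), H y ≤ hav H (j + 1) x := by
    apply setIntegral_mono_set hH.integrableOn (Filter.Eventually.of_forall hH0)
    exact (dy_mono (by omega) x).eventuallyLE
  have h2 : hav H (j + 1) x ≤ τ * 2 ^ (j + 1) := by
    by_cases hle : j + 1 ≤ j1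
    · by_contra hc
      push Not at hc
      have : j + 1 ∈ badset H τ j0 j1 x := by
        unfold badset
        rw [Finset.mem_filter, Finset.mem_Icc]
        have := le_jj H τ j0 j1 x
        exact ⟨⟨by omega, hle⟩, hc⟩
      have := bad_le_jj this
      omega
    · have h3 : hav H (j + 1) x ≤ ∫ x, H x :=
        setIntegral_le_integral hH (Filter.Eventually.of_forall hH0)
      refine (h3.trans htot).trans ?_
      apply mul_le_mul_of_nonneg_left _ hτ
      exact zpow_le_zpow_right₀ (by norm_num) (by omega)
  refine (h1.trans h2).trans (le_of_eq ?_)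
  unfold JJ; rw [len_dy, zpow_add₀ (by norm_num)]; ring

lemma jj_level_meas (H : ℝ → ℝ) (τ : ℝ) (j0 j1 : ℤ) (I : Dy) :
    MeasurableSet {x | JJ H τ j0 j1 x = I} := by
  by_cases h : jj H τ j0 j1 (lf I) = I.1
  · have : {x | JJ H τ j0 j1 x = I} = iv I := by
      have hI : JJ H τ j0 j1 (lf I) = I := by unfold JJ; rw [h]; exact dy_eq (lf_mem I)
      ext x
      rw [Set.mem_ofPred_eq]
      constructor
      · intro hx; rw [← hx]; exact mem_JJ _ _ _ _ _
      · intro hx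
        rw [← hI] at hx
        rw [JJ_const hx, hI]
    rw [this]; exact measurableSet_iv I
  · have : {x | JJ H τ j0 j1 x = I} = ∅ := by
      ext x
      rw [Set.mem_ofPred_eq]
      refine ⟨fun hx => h ?_, fun hx => absurd hx (Set.notMem_empty _)⟩
      have h1 : lf I ∈ iv (JJ H τ j0 j1 x) := by rw [hx]; exact lf_mem I
      rw [jj_const h1]
      have := congrArg Prod.fst hx
      exact this
    rw [this]; exact MeasurableSet.empty

/-- averaging kernel -/
def Kn (H : ℝ → ℝ) (τ : ℝ) (j0 j1 : ℤ) (x y : ℝ) : ℝ :=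
  if y ∈ iv (JJ H τ j0 j1 x) then (len (JJ H τ j0 j1 x))⁻¹ else 0

lemma Kn_symm (H : ℝ → ℝ) (τ : ℝ) (j0 j1 : ℤ) (x y : ℝ) :
    Kn H τ j0 j1 x y = Kn H τ j0 j1 y x := by
  unfold Kn
  by_cases h : y ∈ iv (JJ H τ j0 j1 x)
  · rw [if_pos h, if_pos (mem_JJ_symm h), JJ_const h]
  · rw [if_neg h, if_neg (fun h' => h (mem_JJ_symm h'))]

lemma Kn_nonneg (H : ℝ → ℝ) (τ : ℝ) (j0 j1 : ℤ) (x y : ℝ) : 0 ≤ Kn H τ j0 j1 x y := by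
  unfold Kn; split_ifs
  · exact inv_nonneg.2 (len_pos _).le
  · exact le_rfl

lemma Kn_eq_ind (H : ℝ → ℝ) (τ : ℝ) (j0 j1 : ℤ) (x : ℝ) :
    Kn H τ j0 j1 x = (iv (JJ H τ j0 j1 x)).indicator (fun _ => (len (JJ H τ j0 j1 x))⁻¹) := by
  ext y; unfold Kn; rw [Set.indicator_apply]

lemma Kn_meas (H : ℝ → ℝ) (τ : ℝ) (j0 j1 : ℤ) :
    Measurable (fun p : ℝ × ℝ => Kn H τ j0 j1 p.1 p.2) := by
  have hJ : Measurable (JJ H τ j0 j1) := measurable_to_countable' (fun I => jj_level_meas H τ j0 j1 I)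
  have hset : MeasurableSet {p : ℝ × ℝ | p.2 ∈ iv (JJ H τ j0 j1 p.1)} := by
    have : {p : ℝ × ℝ | p.2 ∈ iv (JJ H τ j0 j1 p.1)} =
        ⋃ I : Dy, {x | JJ H τ j0 j1 x = I} ×ˢ iv I := by
      ext p
      simp only [Set.mem_ofPred_eq, Set.mem_iUnion, Set.mem_prod]
      constructor
      · intro h; exact ⟨_, rfl, h⟩
      · rintro ⟨I, h1, h2⟩; rw [h1]; exact h2
    rw [this]
    exact MeasurableSet.iUnion fun I => (jj_level_meas H τ j0 j1 I).prod (measurableSet_iv I)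
  unfold Kn
  refine Measurable.ite hset ?_ measurable_const
  have h1 : Measurable (fun I : Dy => (len I)⁻¹) := measurable_of_countable _
  exact h1.comp (hJ.comp measurable_fst)

lemma Kn_integral (H : ℝ → ℝ) (τ : ℝ) (j0 j1 : ℤ) (x : ℝ) : ∫ y, Kn H τ j0 j1 x y = 1 := by
  have : ∀ y, Kn H τ j0 j1 x y = Kn H τ j0 j1 x y := fun _ => rfl
  rw [show (∫ y, Kn H τ j0 j1 x y) = ∫ y, (Kn H τ j0 j1 x) y from rfl, Kn_eq_ind,
    integral_indicator (measurableSet_iv _), setIntegral_const, volume_iv, smul_eq_mul,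
    mul_inv_cancel₀ (len_ne _)]

lemma Kn_integrable (H : ℝ → ℝ) (τ : ℝ) (j0 j1 : ℤ) (x : ℝ) : Integrable (Kn H τ j0 j1 x) := by
  rw [Kn_eq_ind]
  apply (integrable_indicator_iff (measurableSet_iv _)).2
  apply integrableOn_const
  · rw [volume_iv']; exact ENNReal.ofReal_ne_top
  · exact ENNReal.coe_ne_top

/-- integrability on the product -/
lemma Kn_prod (H : ℝ → ℝ) (τ : ℝ) (j0 j1 : ℤ) {u b : ℝ → ℂ} (hu : Integrable u) (hum : Measurable u)
    (hb : Measurable b) {B : ℝ} (hB : ∀ x, ‖b x‖ ≤ B) :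
    Integrable (fun p : ℝ × ℝ => ((Kn H τ j0 j1 p.1 p.2 : ℝ) : ℂ) * u p.2 * b p.1)
      (volume.prod volume) := by
  have hB0 : 0 ≤ B := (norm_nonneg _).trans (hB 0)
  have hm : Measurable (fun p : ℝ × ℝ => ((Kn H τ j0 j1 p.1 p.2 : ℝ) : ℂ) * u p.2 * b p.1) :=
    ((Complex.measurable_ofReal.comp (Kn_meas H τ j0 j1)).mul (hum.comp measurable_snd)).mul
      (hb.comp measurable_fst)
  have hbd : ∀ x y, ‖((Kn H τ j0 j1 x y : ℝ) : ℂ) * u y * b x‖ ≤ ‖u y‖ * B * Kn H τ j0 j1 y x := by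
    intro x y
    rw [norm_mul, norm_mul, Complex.norm_real, Real.norm_of_nonneg (Kn_nonneg _ _ _ _ _ _),
      Kn_symm]
    have := Kn_nonneg H τ j0 j1 y x
    calc _ ≤ Kn H τ j0 j1 y x * ‖u y‖ * B := by gcongr; exact hB x
      _ = _ := by ring
  have hmaj : ∀ y, Integrable (fun x => ‖u y‖ * B * Kn H τ j0 j1 y x) := fun y =>
    (Kn_integrable H τ j0 j1 y).const_mul _
  rw [integrable_prod_iff' hm.aestronglyMeasurable]
  constructor
  · refine Filter.Eventually.of_forall fun y => ?_
    refine (hmaj y).mono' ?_ (Filter.Eventually.of_forall fun x => hbd x y)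
    exact (hm.comp (measurable_id.prodMk measurable_const)).aestronglyMeasurable
  · refine (hu.norm.mul_const B).mono' ?_ ?_
    · exact (hm.norm.stronglyMeasurable.integral_prod_left').aestronglyMeasurable
    · refine Filter.Eventually.of_forall fun y => ?_
      rw [Real.norm_of_nonneg (integral_nonneg fun x => norm_nonneg _)]
      calc _ ≤ ∫ x, ‖u y‖ * B * Kn H τ j0 j1 y x :=
            integral_mono_of_nonneg (Filter.Eventually.of_forall fun x => norm_nonneg _) (hmaj y)
              (Filter.Eventually.of_forall fun x => hbd x y)
        _ = _ := by rw [integral_const_mul, Kn_integral, mul_one]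

def EE (H : ℝ → ℝ) (τ : ℝ) (j0 j1 : ℤ) (u : ℝ → ℂ) (x : ℝ) : ℂ :=
  ∫ y, ((Kn H τ j0 j1 x y : ℝ) : ℂ) * u y

lemma EE_int (H : ℝ → ℝ) (τ : ℝ) (j0 j1 : ℤ) {u : ℝ → ℂ} (hu : Integrable u) (hum : Measurable u) :
    Integrable (EE H τ j0 j1 u) := by
  have := (Kn_prod H τ j0 j1 hu hum (b := fun _ => 1) measurable_const (B := 1) (by simp)).integral_prod_left
  simpa [EE] using! this

lemma EE_meas (H : ℝ → ℝ) (τ : ℝ) (j0 j1 : ℤ) {u : ℝ → ℂ} (hum : Measurable u) :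
    Measurable (EE H τ j0 j1 u) := by
  have hm : Measurable (fun p : ℝ × ℝ => ((Kn H τ j0 j1 p.1 p.2 : ℝ) : ℂ) * u p.2) :=
    ((Complex.measurable_ofReal.comp (Kn_meas H τ j0 j1)).mul (hum.comp measurable_snd))
  exact (hm.stronglyMeasurable.integral_prod_right').measurable

lemma EE_L1 (H : ℝ → ℝ) (τ : ℝ) (j0 j1 : ℤ) {u : ℝ → ℂ} (hu : Integrable u) (hum : Measurable u) :
    ∫ x, ‖EE H τ j0 j1 u x‖ ≤ ∫ x, ‖u x‖ := by
  have hp := (Kn_prod H τ j0 j1 hu hum (b := fun _ => 1) measurable_const (B := 1) (by simp)).norm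
  have hn : ∀ x y, ‖((Kn H τ j0 j1 x y : ℝ) : ℂ) * u y * (1:ℂ)‖ = ‖u y‖ * Kn H τ j0 j1 y x := by
    intro x y
    rw [mul_one, norm_mul, Complex.norm_real, Real.norm_of_nonneg (Kn_nonneg _ _ _ _ _ _),
      Kn_symm]; ring
  simp only [hn] at hp
  have e := integral_integral_swap (f := fun x y => ‖u y‖ * Kn H τ j0 j1 y x) hp
  have h1 : ∫ x, ‖EE H τ j0 j1 u x‖ ≤ ∫ x, ∫ y, ‖u y‖ * Kn H τ j0 j1 y x := by
    apply integral_mono_of_nonneg (Filter.Eventually.of_forall fun x => norm_nonneg _)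
    · exact hp.integral_prod_left
    · refine Filter.Eventually.of_forall fun x => ?_
      refine (norm_integral_le_integral_norm _).trans (le_of_eq ?_)
      congr 1; ext y
      rw [← hn, mul_one]
  refine h1.trans (le_of_eq ?_)
  rw [e]
  congr 1; ext y
  rw [integral_const_mul, Kn_integral, mul_one]

lemma EE_adj (H : ℝ → ℝ) (τ : ℝ) (j0 j1 : ℤ) {u b : ℝ → ℂ} (hu : Integrable u) (hum : Measurable u)
    (hb : Measurable b) {B : ℝ} (hB : ∀ x, ‖b x‖ ≤ B) :
    ∫ x, EE H τ j0 j1 u x * b x = ∫ y, u y * EE H τ j0 j1 b y := by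
  have hp := Kn_prod H τ j0 j1 hu hum hb hB
  have e := integral_integral_swap (f := fun x y => ((Kn H τ j0 j1 x y : ℝ) : ℂ) * u y * b x) hp
  have e1 : ∀ x, EE H τ j0 j1 u x * b x = ∫ y, ((Kn H τ j0 j1 x y : ℝ) : ℂ) * u y * b x := by
    intro x; unfold EE; rw [integral_mul_const]
  simp_rw [e1, e]
  congr 1; ext y
  unfold EE
  rw [← integral_const_mul]
  congr 1; ext x
  rw [Kn_symm]; ring

lemma EE_bound {H : ℝ → ℝ} (hH : Integrable H) (hH0 : ∀ x, 0 ≤ H x) {τ : ℝ} (hτ : 0 ≤ τ) {j0 j1 : ℤ}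
    (h01 : j0 ≤ j1) (htot : ∫ x, H x ≤ τ * 2 ^ j1) {u : ℝ → ℂ} (huH : ∀ x, ‖u x‖ = H x) (x : ℝ) :
    ‖EE H τ j0 j1 u x‖ ≤ 2 * τ := by
  have hp := len_pos (JJ H τ j0 j1 x)
  calc _ ≤ ∫ y, ‖((Kn H τ j0 j1 x y : ℝ) : ℂ) * u y‖ := norm_integral_le_integral_norm _
    _ = ∫ y, (iv (JJ H τ j0 j1 x)).indicator (fun y => (len (JJ H τ j0 j1 x))⁻¹ * H y) y := by
        congr 1; ext y
        rw [norm_mul, Complex.norm_real, Real.norm_of_nonneg (Kn_nonneg _ _ _ _ _ _), huH, Kn_eq_ind,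
          Set.indicator_apply, Set.indicator_apply]
        split_ifs <;> simp
    _ = (len (JJ H τ j0 j1 x))⁻¹ * ∫ y in iv (JJ H τ j0 j1 x), H y := by
        rw [integral_indicator (measurableSet_iv _), integral_const_mul]
    _ ≤ (len (JJ H τ j0 j1 x))⁻¹ * (2 * τ * len (JJ H τ j0 j1 x)) := by
        gcongr; exact jj_avg hH hH0 hτ h01 htot x
    _ = _ := by field_simp

lemma EE_diff (H : ℝ → ℝ) (τ : ℝ) (j0 j1 : ℤ) {b : ℝ → ℂ} (hb : Measurable b) {B D : ℝ}
    (hB : ∀ x, ‖b x‖ ≤ B) (y : ℝ) (hD : ∀ x ∈ iv (JJ H τ j0 j1 y), ‖b y - b x‖ ≤ D) :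
    ‖b y - EE H τ j0 j1 b y‖ ≤ D := by
  have hK := Kn_integrable H τ j0 j1 y
  have hK' : Integrable (fun x => ((Kn H τ j0 j1 y x : ℝ) : ℂ)) := hK.ofReal
  have hintg : Integrable (fun x => ((Kn H τ j0 j1 y x : ℝ) : ℂ) * b x) :=
    hK'.mul_bdd hb.aestronglyMeasurable (Filter.Eventually.of_forall hB)
  have e : b y - EE H τ j0 j1 b y = ∫ x, ((Kn H τ j0 j1 y x : ℝ) : ℂ) * (b y - b x) := by
    unfold EE
    simp_rw [mul_sub]
    rw [integral_sub (hK'.mul_const _) hintg, integral_mul_const, integral_complex_ofReal, Kn_integral]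
    simp
  rw [e]
  calc _ ≤ ∫ x, Kn H τ j0 j1 y x * D := by
        refine norm_integral_le_of_norm_le (hK.mul_const D) (Filter.Eventually.of_forall fun x => ?_)
        rw [norm_mul, Complex.norm_real, Real.norm_of_nonneg (Kn_nonneg _ _ _ _ _ _)]
        by_cases hx : x ∈ iv (JJ H τ j0 j1 y)
        · exact mul_le_mul_of_nonneg_left (hD x hx) (Kn_nonneg _ _ _ _ _ _)
        · unfold Kn; rw [if_neg hx]; simp
    _ = D := by rw [integral_mul_const, Kn_integral, one_mul]

end MTT

namespace MTT

def psi (w : ℕ) (I : Dy) (ξ : ℝ) (φ : ℝ → ℂ) (P : Ti) (x : ℝ) : ℂ :=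
  ee (ξ * x) * ((wq w I x : ℂ) * pk φ P x)

lemma Prof.cont_psi {d : ℕ} {R A : ℝ} {φ : ℝ → ℂ} (hφ : Prof d R A φ) (w : ℕ) (I : Dy) (ξ : ℝ) (P : Ti) :
    Continuous (psi w I ξ φ P) := by
  have := hφ.cont_wpk w I P
  have := ee_cont
  unfold psi; fun_prop

lemma Prof.norm_psi {d : ℕ} {R A : ℝ} {φ : ℝ → ℂ} (hφ : Prof d R A φ) {w e : ℕ} (hd : 2 * w + e ≤ d)
    {I : Dy} {P : Ti} (hP : iv P.1 ⊆ iv I) (ξ x : ℝ) :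
    ‖psi w I ξ φ P x‖ ≤ 4 ^ w * A * ((len P.1)⁻¹ * (kw (len P.1) (lf P.1) x ^ e)⁻¹) := by
  unfold psi
  rw [norm_mul, norm_ee, one_mul]
  exact hφ.norm_wpk hd (wq_le hP w x)

lemma wq_hasDeriv (w : ℕ) (I : Dy) (x : ℝ) :
    ∃ D : ℝ, HasDerivAt (wq w I) D x ∧ |D| ≤ w * wq w I x * (len I)⁻¹ := by
  have hp := len_pos I
  set z := (x - lf I) / len I with hz
  have h1 : HasDerivAt (fun x => 1 + ((x - lf I) / len I) ^ 2) (2 * z * (len I)⁻¹) x := by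
    have := ((((hasDerivAt_id x).sub_const (lf I)).div_const (len I)).pow 2).const_add 1
    exact this.congr_deriv (by simp [hz])
  have h2 := h1.pow w
  refine ⟨_, h2, ?_⟩
  rw [← hz]
  have hab : |2 * z| ≤ 1 + z ^ 2 := by
    rw [abs_le]; constructor <;> nlinarith [sq_nonneg (z - 1), sq_nonneg (z + 1)]
  have h0 : 0 < 1 + z ^ 2 := by positivity
  rw [abs_mul, abs_mul, abs_mul (2 * z), abs_of_nonneg (by positivity : (0:ℝ) ≤ (w:ℝ)),
    abs_of_nonneg (pow_nonneg h0.le _), abs_of_pos (inv_pos.2 hp)]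
  unfold wq
  rw [← hz]
  rcases Nat.eq_zero_or_pos w with h | h
  · subst h; simp
  · obtain ⟨v, rfl⟩ : ∃ v, w = v + 1 := ⟨w - 1, by omega⟩
    simp only [Nat.add_sub_cancel]
    rw [pow_succ (1 + z ^ 2) v]
    have : 0 ≤ (((v + 1 : ℕ) : ℝ)) * (1 + z ^ 2) ^ v * (len I)⁻¹ := by positivity
    nlinarith

lemma Prof.psi_deriv {d : ℕ} {R A : ℝ} {φ : ℝ → ℂ} (hφ : Prof d R A φ) {w e : ℕ} (hd : 2 * w + e ≤ d)
    {I : Dy} {P : Ti} (hP : iv P.1 ⊆ iv I) {ξ : ℝ} {r : ℕ} (hr : |rat ξ P| ≤ 2 ^ r) (x : ℝ) :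
    ∃ D : ℂ, HasDerivAt (psi w I ξ φ P) D x ∧
      ‖D‖ ≤ (w + 8) * 2 ^ r * 4 ^ w * A * ((len P.1)⁻¹ ^ 2 * (kw (len P.1) (lf P.1) x ^ e)⁻¹) := by
  have hp := len_pos P.1
  set L := len P.1 with hL
  obtain ⟨W, hW, hWb⟩ := wq_hasDeriv w I x
  have hA := hφ.A_nonneg
  have e1 : psi w I ξ φ P = fun x => ((wq w I x : ℝ) : ℂ) * (ee ((ξ - fr P) * x) *
      (((L⁻¹ : ℝ) : ℂ) * φ ((x - lf P.1) / L))) := by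
    ext x
    unfold psi pk
    rw [show (ξ - fr P) * x = ξ * x + -(fr P * x) by ring, ee_add]; ring
  have h1 : HasDerivAt (fun x => φ ((x - lf P.1) / L)) (((L⁻¹ : ℝ) : ℂ) * deriv φ ((x - lf P.1) / L)) x := by
    have h2 : HasDerivAt (fun x : ℝ => (x - lf P.1) / L) (L⁻¹) x := by
      have := ((hasDerivAt_id x).sub_const (lf P.1)).div_const L
      simpa using this
    have h3 : HasDerivAt φ (deriv φ ((x - lf P.1) / L)) ((x - lf P.1) / L) :=
      (hφ.cd.differentiable (by norm_num)).differentiableAt.hasDerivAt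
    have := h3.scomp x h2
    simpa [Function.comp_def] using this
  have h4 := (hW.ofReal_comp).mul ((ee_hasDeriv (ξ - fr P) x).mul (h1.const_mul ((L⁻¹ : ℝ) : ℂ)))
  rw [e1]
  refine ⟨(W : ℂ) * (ee ((ξ - fr P) * x) * (((L⁻¹ : ℝ) : ℂ) * φ ((x - lf P.1) / L))) +
    ((wq w I x : ℝ) : ℂ) * ((((2 * π * (ξ - fr P) : ℝ) : ℂ) * Complex.I * ee ((ξ - fr P) * x)) *
      (((L⁻¹ : ℝ) : ℂ) * φ ((x - lf P.1) / L)) + ee ((ξ - fr P) * x) *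
      (((L⁻¹ : ℝ) : ℂ) * (((L⁻¹ : ℝ) : ℂ) * deriv φ ((x - lf P.1) / L)))), h4, ?_⟩
  set κ := (kw L (lf P.1) x ^ d)⁻¹ with hκ
  have hκ0 : 0 ≤ κ := kw_inv_nonneg hp _ _ _
  have b0 : ‖φ ((x - lf P.1) / L)‖ ≤ A * κ := by
    have := hφ.b0 ((x - lf P.1) / L); rwa [kw_scale hp] at this
  have b1 : ‖deriv φ ((x - lf P.1) / L)‖ ≤ A * κ := by
    have := hφ.b1 ((x - lf P.1) / L); rwa [kw_scale hp] at this
  have hlen : (len I)⁻¹ ≤ L⁻¹ := inv_anti₀ hp (len_le_of_subset hP)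
  have hWb' : |W| ≤ w * wq w I x * L⁻¹ := hWb.trans (by
    have := wq_pos w I x; gcongr)
  have hfr : |ξ - fr P| ≤ 2 ^ r * L⁻¹ := by
    have : ξ - fr P = -(rat ξ P) * L⁻¹ := by unfold fr rat; rw [← hL]; field_simp; ring
    rw [this, abs_mul, abs_neg, abs_of_pos (inv_pos.2 hp)]; gcongr
  have hfr2 : |2 * π * (ξ - fr P)| ≤ 7 * (2 ^ r * L⁻¹) := by
    rw [abs_mul, abs_of_pos (by positivity)]
    have := Real.pi_lt_d2
    have h0 := abs_nonneg (ξ - fr P)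
    nlinarith [Real.pi_pos]
  have hwp := wq_pos w I x
  have h2r : (1:ℝ) ≤ 2 ^ r := one_le_pow₀ (by norm_num)
  have hLi : 0 < L⁻¹ := inv_pos.2 hp
  calc _ ≤ |W| * (1 * (L⁻¹ * ‖φ ((x - lf P.1) / L)‖)) + wq w I x *
        (|2 * π * (ξ - fr P)| * (L⁻¹ * ‖φ ((x - lf P.1) / L)‖) +
          1 * (L⁻¹ * (L⁻¹ * ‖deriv φ ((x - lf P.1) / L)‖))) := by
        refine (norm_add_le _ _).trans ?_
        rw [norm_mul, norm_mul, norm_mul, norm_mul, norm_ee, Complex.norm_real, Complex.norm_real,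
          Complex.norm_real, Real.norm_eq_abs, Real.norm_of_nonneg hLi.le, Real.norm_of_nonneg hwp.le]
        gcongr
        refine (norm_add_le _ _).trans (le_of_eq ?_)
        rw [norm_mul, norm_mul, norm_mul, norm_mul, norm_mul, norm_mul, norm_mul, norm_ee, Complex.norm_real, Complex.norm_real,
          Complex.norm_I, Real.norm_eq_abs, Real.norm_of_nonneg hLi.le]
        ring
    _ ≤ (w * wq w I x * L⁻¹) * (1 * (L⁻¹ * (A * κ))) + wq w I x *
        (7 * (2 ^ r * L⁻¹) * (L⁻¹ * (A * κ)) + 1 * (L⁻¹ * (L⁻¹ * (A * κ)))) := by gcongr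
    _ = (w + 7 * 2 ^ r + 1) * (L⁻¹ ^ 2 * A) * (wq w I x * κ) := by ring
    _ ≤ (w * 2 ^ r + 7 * 2 ^ r + 2 ^ r) * (L⁻¹ ^ 2 * A) * (4 ^ w * (kw L (lf P.1) x ^ e)⁻¹) := by
        have hwκ : wq w I x * κ ≤ 4 ^ w * (kw L (lf P.1) x ^ e)⁻¹ := by
          calc _ ≤ (4 ^ w * kw L (lf P.1) x ^ (2 * w)) * κ := by
                gcongr; exact wq_le hP w x
            _ = 4 ^ w * (kw L (lf P.1) x ^ (2 * w) * κ) := by ring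
            _ ≤ _ := by
                gcongr; exact pow_cancel (one_le_kw hp _ _) hd
        gcongr
        exact le_mul_of_one_le_right (by positivity) h2r
    _ = _ := by ring

lemma geo2 (T : Finset ℤ) (J : ℤ) : ∑ j ∈ T, (2:ℝ) ^ (-|j - J|) ≤ 4 := by
  have key : ∀ T' : Finset ℤ, (∀ j ∈ T', j ≤ 0) → ∑ j ∈ T', (2:ℝ) ^ j ≤ 2 := fun T' h => by
    simpa using sum_geom_le T' 0 h
  rw [← Finset.sum_filter_add_sum_filter_not T (fun j => j ≤ J)]
  have h1 : ∑ j ∈ T.filter (fun j => j ≤ J), (2:ℝ) ^ (-|j - J|) ≤ 2 := by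
    refine le_trans (le_of_eq ?_) (key ((T.filter (fun j => j ≤ J)).image (fun j => j - J)) ?_)
    · rw [Finset.sum_image (by intro a _ b _ h; simpa using h)]
      apply Finset.sum_congr rfl
      intro j hj
      have := (Finset.mem_filter.1 hj).2
      rw [abs_of_nonpos (by omega), neg_neg]
    · intro j hj
      obtain ⟨i, hi, rfl⟩ := Finset.mem_image.1 hj
      have := (Finset.mem_filter.1 hi).2
      omega
  have h2 : ∑ j ∈ T.filter (fun j => ¬ j ≤ J), (2:ℝ) ^ (-|j - J|) ≤ 2 := by
    refine le_trans (le_of_eq ?_) (key ((T.filter (fun j => ¬ j ≤ J)).image (fun j => J - j)) ?_)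
    · rw [Finset.sum_image (by intro a _ b _ h; simpa using h)]
      apply Finset.sum_congr rfl
      intro j hj
      have := (Finset.mem_filter.1 hj).2
      rw [abs_of_nonneg (by omega), neg_sub]
    · intro j hj
      obtain ⟨i, hi, rfl⟩ := Finset.mem_image.1 hj
      have := (Finset.mem_filter.1 hi).2
      omega
  linarith

/-- summation over tiles of a lacunary type family -/
lemma tile_sum (T : Finset Ti) (ξ ρ : ℝ) (hρ : 0 ≤ ρ) (hT : ∀ P ∈ T, |rat ξ P| ≤ ρ) (x : ℝ) (J : ℤ) :
    ∑ P ∈ T, (2:ℝ) ^ (-|P.1.1 - J|) * (kw (len P.1) (lf P.1) x ^ 2)⁻¹ ≤ 64 * (2 * ρ + 1) := by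
  rw [← Finset.sum_fiberwise_of_maps_to (t := T.image (fun P => P.1.1)) (g := fun P => P.1.1)
    (fun P hP => Finset.mem_image_of_mem _ hP)]
  have h1 : ∀ j, ∑ P ∈ T.filter (fun P => P.1.1 = j), (2:ℝ) ^ (-|P.1.1 - J|) * (kw (len P.1) (lf P.1) x ^ 2)⁻¹
      ≤ (2:ℝ) ^ (-|j - J|) * (16 * (2 * ρ + 1)) := by
    intro j
    have hs := sum_count (T.filter (fun P => P.1.1 = j)) j (fun P hP => (Finset.mem_filter.1 hP).2)
      (2 ^ j * ξ) ρ hρ (by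
        intro P hP
        obtain ⟨h1, h2⟩ := Finset.mem_filter.1 hP
        have := hT P h1
        unfold rat len at this; rwa [h2] at this) (2 ^ j) x le_rfl (p := 2) le_rfl
    have h2j : (0:ℝ) < 2 ^ j := by positivity
    have e : ∑ P ∈ T.filter (fun P => P.1.1 = j), (2:ℝ) ^ (-|P.1.1 - J|) * (kw (len P.1) (lf P.1) x ^ 2)⁻¹
        = (2:ℝ) ^ (-|j - J|) * (2 ^ j)⁻¹ * ∑ P ∈ T.filter (fun P => P.1.1 = j),
          len P.1 * (kw (2 ^ j) x (lf P.1) ^ 2)⁻¹ := by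
      rw [Finset.mul_sum]
      apply Finset.sum_congr rfl
      intro P hP
      have h2 := (Finset.mem_filter.1 hP).2
      have h3 : len P.1 = 2 ^ j := by unfold len; rw [h2]
      rw [h2, h3, kw_comm]
      field_simp
    rw [e]
    calc _ ≤ (2:ℝ) ^ (-|j - J|) * (2 ^ j)⁻¹ * ((2 * ρ + 1) * (16 * 2 ^ j)) := by gcongr
      _ = _ := by field_simp
  calc _ ≤ ∑ j ∈ T.image (fun P => P.1.1), (2:ℝ) ^ (-|j - J|) * (16 * (2 * ρ + 1)) :=
        Finset.sum_le_sum fun j _ => h1 j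
    _ ≤ 4 * (16 * (2 * ρ + 1)) := by
        rw [← Finset.sum_mul]
        gcongr
        exact geo2 _ _
    _ = _ := by ring

def BadJ (H : ℝ → ℝ) (τ : ℝ) (j0 j1 : ℤ) (J : Dy) : Prop :=
  j0 ≤ J.1 ∧ J.1 ≤ j1 ∧ τ * len J < ∫ y in iv J, H y

def BadP (H : ℝ → ℝ) (τ : ℝ) (j0 j1 : ℤ) (I : Dy) : Prop :=
  ∃ J, BadJ H τ j0 j1 J ∧ I.1 ≤ J.1 ∧ |(dy J.1 (lf I)).2 - J.2| ≤ 1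

lemma far_of_good {I J : Dy} (hIJ : I.1 ≤ J.1) (h : ¬ |(dy J.1 (lf I)).2 - J.2| ≤ 1) {y : ℝ}
    (hy : y ∈ iv J) : len J ≤ |y - lf I| := by
  have h1 := mem_dy J.1 (lf I)
  set K := dy J.1 (lf I) with hK
  have hKJ : len K = len J := rfl
  have hp := len_pos J
  unfold iv lf at h1 hy
  rw [hKJ] at h1
  obtain ⟨a1, a2⟩ := h1
  obtain ⟨b1, b2⟩ := hy
  have h' : 2 ≤ K.2 - J.2 ∨ K.2 - J.2 ≤ -2 := by
    rw [abs_le] at h; omega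
  change len J * (K.2:ℝ) ≤ lf I at a1
  change lf I < len J * (K.2:ℝ) + len J at a2
  rcases h' with h' | h'
  · have h2 : (2:ℝ) ≤ K.2 - J.2 := by exact_mod_cast h'
    rw [abs_sub_comm]
    refine le_trans ?_ (le_abs_self _)
    nlinarith
  · have h2 : (K.2:ℝ) - J.2 ≤ -2 := by exact_mod_cast h'
    refine le_trans ?_ (le_abs_self _)
    nlinarith

lemma Prof.good_diff {d : ℕ} {R A : ℝ} {φ : ℝ → ℂ} (hφ : Prof d R A φ) {w : ℕ} (hd : 2 * w + 3 ≤ d)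
    {I : Dy} {P : Ti} (hP : iv P.1 ⊆ iv I) {ξ : ℝ} {r : ℕ} (hr : |rat ξ P| ≤ 2 ^ r)
    {H : ℝ → ℝ} {τ : ℝ} {j0 j1 : ℤ} (hj : j0 ≤ P.1.1) (hgood : ¬ BadP H τ j0 j1 P.1) (x : ℝ) :
    len P.1 * ‖psi w I ξ φ P x - EE H τ j0 j1 (psi w I ξ φ P) x‖ ≤
      8 * (w + 8) * 2 ^ r * 4 ^ w * A *
        ((2:ℝ) ^ (-|P.1.1 - (JJ H τ j0 j1 x).1|) * (kw (len P.1) (lf P.1) x ^ 2)⁻¹) := by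
  set J := JJ H τ j0 j1 x with hJ
  have hxJ : x ∈ iv J := mem_JJ _ _ _ _ _
  have hp := len_pos P.1
  have hpJ := len_pos J
  have hA := hφ.A_nonneg
  set L := len P.1 with hL
  have hdist : ∀ y ∈ iv J, |x - y| ≤ len J := by
    intro y hy
    obtain ⟨a1, a2⟩ := hxJ
    obtain ⟨b1, b2⟩ := hy
    rw [abs_le]; constructor <;> linarith
  set k0 := kw L (lf P.1) x with hk0
  have hk0p : 0 < k0 := kw_pos hp _ _
  have h2r : (1:ℝ) ≤ 2 ^ r := one_le_pow₀ (by norm_num)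
  have hB : ∀ y, ‖psi w I ξ φ P y‖ ≤ 4 ^ w * A * L⁻¹ := by
    intro y
    refine (hφ.norm_psi (e := 0) (by omega) hP ξ y).trans (le_of_eq ?_)
    simp [hL]
  have main : ∀ D, (∀ y ∈ iv J, ‖psi w I ξ φ P x - psi w I ξ φ P y‖ ≤ D) →
      ‖psi w I ξ φ P x - EE H τ j0 j1 (psi w I ξ φ P) x‖ ≤ D := fun D hD =>
    EE_diff H τ j0 j1 (hφ.cont_psi w I ξ P).measurable hB x hD
  have hsq : ∀ y, k0 ≤ 2 * kw L (lf P.1) y → (kw L (lf P.1) y ^ 2)⁻¹ ≤ 4 * (k0 ^ 2)⁻¹ := by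
    intro y hy
    have hky := kw_pos hp (lf P.1) y
    rw [← div_eq_mul_inv, le_div_iff₀ (by positivity), inv_mul_le_iff₀ (by positivity)]
    nlinarith
  rcases le_or_gt J.1 P.1.1 with hle | hgt
  · -- small J
    have hJL : len J ≤ L := len_le_of_le hle
    have hcmp : ∀ y ∈ iv J, k0 ≤ 2 * kw L (lf P.1) y := by
      intro y hy
      have h1 := kw_tri hp (lf P.1) y x
      have h2 : |y - x| / L ≤ 1 := by
        rw [div_le_one hp, abs_sub_comm]; exact (hdist y hy).trans hJL
      have := one_le_kw hp (lf P.1) y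
      linarith
    have hD := main ((w + 8) * 2 ^ r * 4 ^ w * A * (L⁻¹ ^ 2 * (4 * (k0 ^ 2)⁻¹)) * len J) (by
      intro y hy
      choose D hD1 hD2 using fun z => hφ.psi_deriv (w := w) (e := 2) (by omega) hP hr z
      have := (convex_Ico (lf J) (lf J + len J)).norm_image_sub_le_of_norm_hasDerivWithin_le
        (f := psi w I ξ φ P) (f' := D) (C := (w + 8) * 2 ^ r * 4 ^ w * A * (L⁻¹ ^ 2 * (4 * (k0 ^ 2)⁻¹)))
        (fun z _ => (hD1 z).hasDerivWithinAt) (fun z hz => (hD2 z).trans (by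
          have := hsq z (hcmp z hz)
          gcongr)) hy hxJ
      refine this.trans ?_
      rw [Real.norm_eq_abs]
      gcongr
      exact hdist y hy)
    have hz : (2:ℝ) ^ (-|P.1.1 - J.1|) = len J * L⁻¹ := by
      rw [abs_of_nonneg (by omega), neg_sub, zpow_sub₀ (by norm_num), div_eq_mul_inv]; rfl
    rw [hz]
    calc _ ≤ L * ((w + 8) * 2 ^ r * 4 ^ w * A * (L⁻¹ ^ 2 * (4 * (k0 ^ 2)⁻¹)) * len J) := by gcongr
      _ = 4 * (w + 8) * 2 ^ r * 4 ^ w * A * (len J * L⁻¹ * (k0 ^ 2)⁻¹) := by field_simp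
      _ ≤ _ := by gcongr; norm_num
  · -- large J
    have hbad : BadJ H τ j0 j1 J := by
      rcases jj_mem H τ j0 j1 x with h | h
      · exfalso
        have : J.1 = jj H τ j0 j1 x := rfl
        omega
      · unfold badset at h
        rw [Finset.mem_filter, Finset.mem_Icc] at h
        exact ⟨h.1.1, h.1.2, h.2⟩
    have hfar : ∀ y ∈ iv J, len J ≤ |y - lf P.1| := fun y hy =>
      far_of_good hgt.le (fun h => hgood ⟨J, hbad, hgt.le, h⟩) hy
    have hkJ : ∀ y ∈ iv J, len J / L ≤ kw L (lf P.1) y := by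
      intro y hy
      have : len J / L ≤ |y - lf P.1| / L := by gcongr; exact hfar y hy
      unfold kw; linarith
    have hcmp : ∀ y ∈ iv J, k0 ≤ 2 * kw L (lf P.1) y := by
      intro y hy
      have h1 := kw_tri hp (lf P.1) y x
      have h2 : |y - x| / L ≤ len J / L := by
        gcongr; rw [abs_sub_comm]; exact hdist y hy
      have := hkJ y hy
      linarith
    have hps : ∀ y ∈ iv J, ‖psi w I ξ φ P y‖ ≤ 4 ^ w * A * (L⁻¹ * (L * (len J)⁻¹ * (4 * (k0 ^ 2)⁻¹))) := by
      intro y hy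
      refine (hφ.norm_psi hd hP ξ y).trans ?_
      have hky := kw_pos hp (lf P.1) y
      have : (kw L (lf P.1) y ^ 3)⁻¹ ≤ L * (len J)⁻¹ * (4 * (k0 ^ 2)⁻¹) := by
        rw [show kw L (lf P.1) y ^ 3 = kw L (lf P.1) y * kw L (lf P.1) y ^ 2 by ring, mul_inv]
        have h1 : (kw L (lf P.1) y)⁻¹ ≤ L * (len J)⁻¹ := by
          rw [← div_eq_mul_inv, ← inv_div]
          exact inv_anti₀ (by positivity) (hkJ y hy)
        have := hsq y (hcmp y hy)
        gcongr
      rw [← hL]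
      gcongr
    have hD := main (2 * (4 ^ w * A * (L⁻¹ * (L * (len J)⁻¹ * (4 * (k0 ^ 2)⁻¹))))) (by
      intro y hy
      refine (norm_sub_le _ _).trans ?_
      have h1 := hps y hy
      have h2 := hps x hxJ
      linarith)
    have hz : (2:ℝ) ^ (-|P.1.1 - J.1|) = L * (len J)⁻¹ := by
      rw [abs_of_neg (by omega), neg_neg, zpow_sub₀ (by norm_num), div_eq_mul_inv]; rfl
    rw [hz]
    calc _ ≤ L * (2 * (4 ^ w * A * (L⁻¹ * (L * (len J)⁻¹ * (4 * (k0 ^ 2)⁻¹))))) := by gcongr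
      _ = 8 * 1 * 1 * 4 ^ w * A * (L * (len J)⁻¹ * (k0 ^ 2)⁻¹) := by field_simp; ring
      _ ≤ _ := by
        gcongr
        have : (0:ℝ) ≤ w := by positivity
        linarith

end MTT

namespace MTT

lemma max_intervals (W : Finset Dy) : ∃ M ⊆ W, (∀ I ∈ W, ∃ J ∈ M, iv I ⊆ iv J) ∧
    ∀ I ∈ M, ∀ J ∈ M, I ≠ J → Disjoint (iv I) (iv J) := by
  refine ⟨W.filter (fun I => ∀ J ∈ W, iv I ⊆ iv J → J = I), Finset.filter_subset _ _, ?_, ?_⟩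
  · intro I hI
    obtain ⟨J, hJ, hmax⟩ := Finset.exists_max_image (W.filter (fun J => iv I ⊆ iv J)) (fun J => J.1)
      ⟨I, Finset.mem_filter.2 ⟨hI, le_rfl⟩⟩
    rw [Finset.mem_filter] at hJ
    refine ⟨J, Finset.mem_filter.2 ⟨hJ.1, ?_⟩, hJ.2⟩
    intro J' hJ' hs
    have h1 := hmax J' (Finset.mem_filter.2 ⟨hJ', hJ.2.trans hs⟩)
    have h2 := le_of_subset hs
    exact eq_of_scale (le_antisymm h1 h2) ⟨lf J, hs (lf_mem J), lf_mem J⟩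
  · intro I hI J hJ hne
    rw [Finset.mem_filter] at hI hJ
    by_contra hc
    rw [Set.not_disjoint_iff_nonempty_inter] at hc
    rcases subset_or hc with h | h
    · exact hne (hI.2 J hJ.1 h).symm
    · exact hne (hJ.2 I hI.1 h)

lemma disj_sum_le (M : Finset Dy) (hM : ∀ I ∈ M, ∀ J ∈ M, I ≠ J → Disjoint (iv I) (iv J)) (E : Set ℝ)
    (hE : volume E ≠ ⊤) (hs : ∀ I ∈ M, iv I ⊆ E) : ∑ I ∈ M, len I ≤ volume.real E := by
  have h1 : volume.real (⋃ I ∈ M, iv I) = ∑ I ∈ M, volume.real (iv I) :=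
    measureReal_biUnion_finset (fun I hI J hJ hne => hM I hI J hJ hne) (fun I _ => measurableSet_iv I)
      (fun I _ => by rw [volume_iv']; exact ENNReal.ofReal_ne_top)
  simp only [volume_iv] at h1
  rw [← h1]
  exact measureReal_mono (Set.iUnion₂_subset hs) hE

lemma disj_sum_int (M : Finset Dy) (hM : ∀ I ∈ M, ∀ J ∈ M, I ≠ J → Disjoint (iv I) (iv J)) {H : ℝ → ℝ}
    (hH : Integrable H) (hH0 : ∀ x, 0 ≤ H x) : ∑ I ∈ M, ∫ x in iv I, H x ≤ ∫ x, H x := by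
  rw [← integral_biUnion_finset M (fun I _ => measurableSet_iv I) (fun I hI J hJ hne => hM I hI J hJ hne)
    (fun I _ => hH.integrableOn)]
  exact setIntegral_le_integral hH (Filter.Eventually.of_forall hH0)

def tri (J : Dy) : Set ℝ := Set.Ico (lf J - len J) (lf J + 2 * len J)

lemma tri_mono {I J : Dy} (h : iv I ⊆ iv J) : tri I ⊆ tri J := by
  have h1 := len_le_of_subset h
  have hp := len_pos I
  have h2 := (Set.Ico_subset_Ico_iff (by linarith : lf I < lf I + len I)).1 h
  apply Set.Ico_subset_Ico <;> linarith

lemma bad_sub_tri {I J : Dy} (hIJ : I.1 ≤ J.1) (h : |(dy J.1 (lf I)).2 - J.2| ≤ 1) : iv I ⊆ tri J := by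
  have h1 : iv I ⊆ iv (dy J.1 (lf I)) := iv_nested hIJ ⟨lf I, lf_mem I, mem_dy _ _⟩
  refine h1.trans ?_
  set K := dy J.1 (lf I)
  have hKJ : len K = len J := rfl
  have hp := len_pos J
  unfold iv tri lf
  rw [hKJ]
  rw [abs_le] at h
  have h2 : (-1:ℝ) ≤ K.2 - J.2 := by exact_mod_cast h.1
  have h3 : (K.2:ℝ) - J.2 ≤ 1 := by exact_mod_cast h.2
  apply Set.Ico_subset_Ico <;> nlinarith

lemma bad_cover {H : ℝ → ℝ} (hH : Integrable H) (hH0 : ∀ x, 0 ≤ H x) {τ : ℝ} (hτ : 0 < τ) {j0 j1 : ℤ}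
    (W : Finset Dy) (hW : ∀ I ∈ W, ∀ J ∈ W, I ≠ J → Disjoint (iv I) (iv J))
    (hb : ∀ I ∈ W, BadP H τ j0 j1 I) : τ * ∑ I ∈ W, len I ≤ 3 * ∫ x, H x := by
  have hch : ∀ I : Dy, ∃ J, I ∈ W → (BadJ H τ j0 j1 J ∧ I.1 ≤ J.1 ∧ |(dy J.1 (lf I)).2 - J.2| ≤ 1) := by
    intro I
    by_cases h : I ∈ W
    · obtain ⟨J, hJ⟩ := hb I h; exact ⟨J, fun _ => hJ⟩
    · exact ⟨I, fun h' => absurd h' h⟩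
  choose ch hch using hch
  obtain ⟨M, hMsub, hMcov, hMdis⟩ := max_intervals (W.image ch)
  have h1 : ∑ I ∈ W, len I ≤ ∑ J ∈ M, 3 * len J := by
    apply sum_le_cover W M len (fun I => (len_pos I).le) (fun J I => iv I ⊆ tri J)
    · intro I hI
      obtain ⟨J, hJ, hs⟩ := hMcov (ch I) (Finset.mem_image_of_mem _ hI)
      exact ⟨J, hJ, (bad_sub_tri (hch I hI).2.1 (hch I hI).2.2).trans (tri_mono hs)⟩
    · intro J _ W' hW' hs
      have hp := len_pos J
      refine (disj_sum_le W' (fun I hI K hK => hW I (hW' hI) K (hW' hK)) (tri J) ?_ hs).trans (le_of_eq ?_)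
      · unfold tri; rw [Real.volume_Ico]; exact ENNReal.ofReal_ne_top
      · unfold tri; rw [Real.volume_real_Ico_of_le (by linarith)]; ring
  have h2 : ∑ J ∈ M, τ * len J ≤ ∑ J ∈ M, ∫ x in iv J, H x := by
    apply Finset.sum_le_sum
    intro J hJ
    obtain ⟨I, hI, rfl⟩ := Finset.mem_image.1 (hMsub hJ)
    exact (hch I hI).1.2.2.le
  have h3 := disj_sum_int M hMdis hH hH0
  rw [← Finset.mul_sum] at h1 h2
  nlinarith

/-- crude bound of coefficients -/
lemma Prof.cf_le {d : ℕ} {R A : ℝ} {φ : ℝ → ℂ} (hφ : Prof d R A φ) {w : ℕ} (hd : 2 * w ≤ d)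
    {f : ℝ → ℂ} (hm : Measurable f) (hf : Integrable f) {a : ℝ} (P : Ti)
    (ha : ∫ x, ‖fw w P.1 f x‖ ≤ a * len P.1) : cf φ f P ≤ 4 ^ w * A * a := by
  have hp := len_pos P.1
  have hA := hφ.A_nonneg
  have hi := (fw_int (s := w) (J := P.1) hm hf).norm
  have : cf φ f P ≤ ∫ x, (4 ^ w * A * (len P.1)⁻¹) * ‖fw w P.1 f x‖ := by
    unfold cf
    apply norm_integral_le_of_norm_le (hi.const_mul _)
    refine Filter.Eventually.of_forall fun x => ?_
    rw [← fw_mul w P.1 f x, norm_mul, mul_comm]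
    have := hφ.norm_wpk (s := w) (e := 0) (by omega) (J := P.1) (P := P) (x := x) (wq_le le_rfl w x)
    gcongr
    simpa using this
  rw [integral_const_mul] at this
  refine this.trans ?_
  calc _ ≤ (4 ^ w * A * (len P.1)⁻¹) * (a * len P.1) := by gcongr
    _ = _ := by field_simp

lemma Prof.good_part {d : ℕ} {R A : ℝ} {φ : ℝ → ℂ} (hφ : Prof d R A φ) {w : ℕ} (hd : 4 * w + 6 ≤ d)
    (hR : 1 ≤ R) {s : ℝ} (hs : |s| = 1) {r : ℕ} {f : ℝ → ℂ} (hm : Measurable f) (hf : Integrable f)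
    {a : ℝ} (ha : 0 < a) {I : Dy} (hI : ∫ x, ‖fw w I f x‖ ≤ a * len I) {ξ : ℝ} {j0 : ℤ} (hj0 : j0 ≤ I.1)
    (T : Finset Ti) (hT : ∀ P ∈ T, Lac R s r ξ P ∧ iv P.1 ⊆ iv I ∧ j0 ≤ P.1.1 ∧
      ∫ x, ‖fw w P.1 f x‖ ≤ a * len P.1)
    (hgood : ∀ P ∈ T, ¬ BadP (fun x => ‖fw w I f x‖) (12 * a) j0 I.1 P.1) :
    ∑ P ∈ T, len P.1 * cf φ f P ^ 2 ≤ 400000 * (R + w + 8) * 16 ^ w * 4 ^ r * A ^ 2 * a ^ 2 * len I := by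
  have hp := len_pos I
  have hA := hφ.A_nonneg
  set τ := 12 * a with hτ
  set H : ℝ → ℝ := fun x => ‖fw w I f x‖ with hH
  have hHi : Integrable H := (fw_int hm hf).norm
  have hH0 : ∀ x, 0 ≤ H x := fun x => norm_nonneg _
  set u : ℝ → ℂ := fun x => fw w I f x * ee (-(ξ * x)) with hu
  have hum : Measurable u := (fw_meas hm).mul (ee_cont.comp (by fun_prop : Continuous fun x : ℝ => -(ξ * x))).measurable
  have hun : ∀ x, ‖u x‖ = H x := fun x => by simp only [hu, hH, norm_mul, norm_ee, mul_one]
  have hui : Integrable u := by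
    refine hHi.mono' hum.aestronglyMeasurable (Filter.Eventually.of_forall fun x => (hun x).le)
  have htot : ∫ x, H x ≤ τ * 2 ^ I.1 := by
    refine hI.trans ?_
    have : (0:ℝ) < 2 ^ I.1 := by positivity
    change a * (2:ℝ) ^ I.1 ≤ _
    nlinarith
  set g := EE H τ j0 I.1 u with hg
  have hgm : Measurable g := EE_meas H τ j0 I.1 hum
  have hgi : Integrable g := EE_int H τ j0 I.1 hui hum
  have hgb : ∀ x, ‖g x‖ ≤ 2 * τ := EE_bound hHi hH0 (by positivity) hj0 htot hun
  have hgL1 : ∫ x, ‖g x‖ ≤ a * len I := by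
    refine (EE_L1 H τ j0 I.1 hui hum).trans ?_
    simp_rw [hun]; exact hI
  -- energy of g
  set F : ℝ → ℂ := fun x => g x * ee (ξ * x) with hF
  have hFn : ∀ x, ‖F x‖ = ‖g x‖ := fun x => by simp only [hF, norm_mul, norm_ee, mul_one]
  have hFm : Measurable F := hgm.mul (ee_cont.comp (by fun_prop : Continuous fun x : ℝ => ξ * x)).measurable
  have hF2 : Integrable (fun x => ‖F x‖ ^ 2) := by
    refine (hgi.norm.const_mul (2 * τ)).mono' (hFm.norm.pow_const 2).aestronglyMeasurable
      (Filter.Eventually.of_forall fun x => ?_)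
    rw [hFn, Real.norm_of_nonneg (by positivity), sq]
    exact mul_le_mul_of_nonneg_right (hgb x) (norm_nonneg _)
  have hFL : MemLp F 2 := (memLp_two_iff_integrable_sq_norm hFm.aestronglyMeasurable).2 hF2
  have hE : ∫ x, ‖F x‖ ^ 2 ≤ 24 * a ^ 2 * len I := by
    calc _ ≤ ∫ x, (2 * τ) * ‖g x‖ := by
          apply integral_mono hF2 (hgi.norm.const_mul (2 * τ))
          intro x
          change ‖F x‖ ^ 2 ≤ 2 * τ * ‖g x‖
          rw [hFn, sq]
          exact mul_le_mul_of_nonneg_right (hgb x) (norm_nonneg _)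
      _ = 2 * τ * ∫ x, ‖g x‖ := integral_const_mul _ _
      _ ≤ 2 * τ * (a * len I) := by gcongr
      _ = _ := by rw [hτ]; ring
  have hE0 : 0 ≤ ∫ x, ‖F x‖ ^ 2 := integral_nonneg fun x => by positivity
  set cg : Ti → ℝ := fun P => ‖∫ x, F x * ((wq w I x : ℂ) * pk φ P x)‖ with hcg
  have hgsum : ∑ P ∈ T, len P.1 * cg P ^ 2 ≤ 160 * R * 4 ^ r * (4 * 16 ^ w * A ^ 2 * (24 * a ^ 2 * len I)) := by
    have hB := hφ.bes hd I (fun P => iv P.1 ⊆ iv I) (fun P hP x => wq_le hP w x) F hFL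
    have := lac_bessel hR hB (fun P => norm_nonneg _) (by positivity) T (fun P hP => (hT P hP).2.1) hs
      (fun P hP => (hT P hP).1)
    refine this.trans ?_
    gcongr
  -- bad part coefficients
  set D : Ti → ℝ → ℂ := fun P x => psi w I ξ φ P x - EE H τ j0 I.1 (psi w I ξ φ P) x with hD
  set cb : Ti → ℝ := fun P => ‖∫ x, u x * D P x‖ with hcb
  have hψb : ∀ P ∈ T, ∀ x, ‖psi w I ξ φ P x‖ ≤ 4 ^ w * A * (len P.1)⁻¹ := by
    intro P hP x
    refine (hφ.norm_psi (e := 0) (by omega) (hT P hP).2.1 ξ x).trans (le_of_eq (by simp))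
  have hψm : ∀ P, Measurable (psi w I ξ φ P) := fun P => (hφ.cont_psi w I ξ P).measurable
  have hDm : ∀ P, Measurable (D P) := fun P => (hψm P).sub (EE_meas H τ j0 I.1 (hψm P))
  have hDb : ∀ P ∈ T, ∀ x, ‖D P x‖ ≤ 2 * (4 ^ w * A * (len P.1)⁻¹) := by
    intro P hP x
    apply EE_diff H τ j0 I.1 (hψm P) (hψb P hP) x
    intro y _
    refine (norm_sub_le _ _).trans ?_
    have h1 := hψb P hP x
    have h2 := hψb P hP y
    linarith
  have huψ : ∀ P ∈ T, Integrable (fun x => u x * psi w I ξ φ P x) := fun P hP =>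
    hui.mul_bdd (hψm P).aestronglyMeasurable (Filter.Eventually.of_forall (hψb P hP))
  have huD : ∀ P ∈ T, Integrable (fun x => u x * D P x) := fun P hP =>
    hui.mul_bdd (hDm P).aestronglyMeasurable (Filter.Eventually.of_forall (hDb P hP))
  have hcfu : ∀ P, cf φ f P = ‖∫ x, u x * psi w I ξ φ P x‖ := by
    intro P
    unfold cf
    congr 2; ext x
    simp only [hu, psi]
    rw [← fw_mul w I f x]
    have := ee_neg_mul (ξ * x)
    calc _ = (ee (-(ξ * x)) * ee (ξ * x)) * (fw w I f x * ((wq w I x : ℂ) * pk φ P x)) := by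
          rw [this, one_mul]
      _ = _ := by ring
  have hcgψ : ∀ P, cg P = ‖∫ x, g x * psi w I ξ φ P x‖ := by
    intro P
    simp only [hcg]
    congr 2; ext x
    simp only [hF, psi]; ring
  have hsplit : ∀ P ∈ T, (∫ x, u x * psi w I ξ φ P x) = (∫ x, g x * psi w I ξ φ P x) + ∫ x, u x * D P x := by
    intro P hP
    rw [hg, EE_adj H τ j0 I.1 hui hum (hψm P) (hψb P hP)]
    have h3 : Integrable (fun x => u x * EE H τ j0 I.1 (psi w I ξ φ P) x) := by
      have := (huψ P hP).sub (huD P hP)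
      refine this.congr (Filter.Eventually.of_forall fun x => ?_)
      simp only [hD, Pi.sub_apply]; ring
    rw [← integral_add h3 (huD P hP)]
    congr 1; ext x
    simp only [hD]; ring
  have hle1 : ∀ P ∈ T, cf φ f P ≤ cg P + cb P := by
    intro P hP
    rw [hcfu, hcgψ, hsplit P hP]
    exact norm_add_le _ _
  have hle2 : ∀ P ∈ T, cb P ≤ cf φ f P + cg P := by
    intro P hP
    rw [hcfu, hcgψ, hsplit P hP]
    have := norm_sub_le ((∫ x, g x * psi w I ξ φ P x) + ∫ x, u x * D P x) (∫ x, g x * psi w I ξ φ P x)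
    rwa [add_sub_cancel_left] at this
  have hcgle : ∀ P ∈ T, cg P ≤ 96 * 4 ^ w * A * a := by
    intro P hP
    have hpP := len_pos P.1
    rw [hcgψ]
    have : ‖∫ x, g x * psi w I ξ φ P x‖ ≤ ∫ x, (2 * τ * (4 ^ w * A * (len P.1)⁻¹)) * (kw (len P.1) (lf P.1) x ^ 2)⁻¹ := by
      apply norm_integral_le_of_norm_le ((integrable_kw2 hpP _).const_mul _)
      refine Filter.Eventually.of_forall fun x => ?_
      rw [norm_mul]
      have h1 := hφ.norm_psi (w := w) (e := 2) (by omega) (hT P hP).2.1 ξ x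
      have h2 := hgb x
      calc _ ≤ (2 * τ) * (4 ^ w * A * ((len P.1)⁻¹ * (kw (len P.1) (lf P.1) x ^ 2)⁻¹)) := by gcongr
        _ = _ := by ring
    rw [integral_const_mul] at this
    refine this.trans ?_
    calc _ ≤ (2 * τ * (4 ^ w * A * (len P.1)⁻¹)) * (4 * len P.1) := by
          gcongr; exact integral_kw2 hpP _
      _ = _ := by rw [hτ]; field_simp; ring
  have hcble : ∀ P ∈ T, cb P ≤ 97 * 4 ^ w * A * a := by
    intro P hP
    have h1 := hle2 P hP
    have h2 := hcgle P hP
    have h3 := hφ.cf_le (w := w) (by omega) hm hf P (hT P hP).2.2.2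
    linarith
  have hcb0 : ∀ P, 0 ≤ cb P := fun P => norm_nonneg _
  have hbsum : ∑ P ∈ T, len P.1 * cb P ≤ 1536 * (w + 8) * 4 ^ r * 4 ^ w * A * (a * len I) := by
    calc _ ≤ ∑ P ∈ T, ∫ x, len P.1 * ‖u x * D P x‖ := by
          apply Finset.sum_le_sum
          intro P _
          rw [integral_const_mul]
          exact mul_le_mul_of_nonneg_left (norm_integral_le_integral_norm _) (len_pos _).le
      _ = ∫ x, ∑ P ∈ T, len P.1 * ‖u x * D P x‖ :=
          (integral_finsetSum _ fun P hP => (huD P hP).norm.const_mul _).symm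
      _ ≤ ∫ x, (1536 * (w + 8) * 4 ^ r * 4 ^ w * A) * H x := by
          apply integral_mono (integrable_finsetSum _ fun P hP => (huD P hP).norm.const_mul _)
            (hHi.const_mul _)
          intro x
          change ∑ P ∈ T, len P.1 * ‖u x * D P x‖ ≤ (1536 * (w + 8) * 4 ^ r * 4 ^ w * A) * H x
          have h1 : ∀ P ∈ T, len P.1 * ‖u x * D P x‖ ≤ H x * (8 * (w + 8) * 2 ^ r * 4 ^ w * A) *
              ((2:ℝ) ^ (-|P.1.1 - (JJ H τ j0 I.1 x).1|) * (kw (len P.1) (lf P.1) x ^ 2)⁻¹) := by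
            intro P hP
            have := hφ.good_diff (w := w) (by omega) (hT P hP).2.1 (((hT P hP).1.abs_le (by linarith) hs).1) (hT P hP).2.2.1
              (hgood P hP) x
            rw [norm_mul, hun]
            calc _ = H x * (len P.1 * ‖D P x‖) := by ring
              _ ≤ H x * _ := mul_le_mul_of_nonneg_left this (hH0 x)
              _ = _ := by ring
          refine (Finset.sum_le_sum h1).trans ?_
          rw [← Finset.mul_sum]
          have h2 := tile_sum T ξ (2 ^ r) (by positivity) (fun P hP => ((hT P hP).1.abs_le (by linarith) hs).1) x
            (JJ H τ j0 I.1 x).1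
          have h2r : (1:ℝ) ≤ 2 ^ r := one_le_pow₀ (by norm_num)
          have hHx := hH0 x
          calc _ ≤ H x * (8 * (w + 8) * 2 ^ r * 4 ^ w * A) * (64 * (2 * 2 ^ r + 2 ^ r)) := by
                gcongr
                refine h2.trans ?_
                gcongr
            _ = _ := by rw [four_pow r]; ring
      _ = (1536 * (w + 8) * 4 ^ r * 4 ^ w * A) * ∫ x, H x := integral_const_mul _ _
      _ ≤ _ := by gcongr
  have hbsum2 : ∑ P ∈ T, len P.1 * cb P ^ 2 ≤ 97 * 4 ^ w * A * a *
      (1536 * (w + 8) * 4 ^ r * 4 ^ w * A * (a * len I)) := by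
    calc _ ≤ ∑ P ∈ T, 97 * 4 ^ w * A * a * (len P.1 * cb P) := by
          apply Finset.sum_le_sum
          intro P hP
          have h1 := hcble P hP
          have h2 := mul_nonneg (len_pos P.1).le (hcb0 P)
          calc _ = (len P.1 * cb P) * cb P := by ring
            _ ≤ (len P.1 * cb P) * (97 * 4 ^ w * A * a) := by gcongr
            _ = _ := by ring
      _ ≤ _ := by
          rw [← Finset.mul_sum]
          gcongr
  have hfin : ∑ P ∈ T, len P.1 * cf φ f P ^ 2 ≤ 2 * ∑ P ∈ T, len P.1 * cg P ^ 2 + 2 * ∑ P ∈ T, len P.1 * cb P ^ 2 := by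
    rw [Finset.mul_sum, Finset.mul_sum, ← Finset.sum_add_distrib]
    apply Finset.sum_le_sum
    intro P hP
    have h1 := hle1 P hP
    have h0 := cf_nonneg φ f P
    have hpP := len_pos P.1
    have : cf φ f P ^ 2 ≤ 2 * cg P ^ 2 + 2 * cb P ^ 2 := by nlinarith [sq_nonneg (cg P - cb P)]
    nlinarith
  have h16 : (16:ℝ) ^ w = 4 ^ w * 4 ^ w := by rw [← mul_pow]; norm_num
  set X := 16 ^ w * 4 ^ r * A ^ 2 * a ^ 2 * len I with hX
  have hX0 : 0 ≤ X := by positivity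
  have e1 : 160 * R * 4 ^ r * (4 * 16 ^ w * A ^ 2 * (24 * a ^ 2 * len I)) = 15360 * R * X := by rw [hX]; ring
  have e2 : 97 * 4 ^ w * A * a * (1536 * (w + 8) * 4 ^ r * 4 ^ w * A * (a * len I)) = 148992 * (w + 8) * X := by
    rw [hX, h16]; ring
  rw [e1] at hgsum
  rw [e2] at hbsum2
  have e3 : 400000 * (R + w + 8) * 16 ^ w * 4 ^ r * A ^ 2 * a ^ 2 * len I = 400000 * (R + w + 8) * X := by
    rw [hX]; ring
  rw [e3]
  have hw0 : (0:ℝ) ≤ w := by positivity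
  nlinarith [mul_nonneg hX0 hw0, mul_nonneg hX0 (by linarith : 0 ≤ R)]

lemma Prof.size_step {d : ℕ} {R A : ℝ} {φ : ℝ → ℂ} (hφ : Prof d R A φ) {w : ℕ} (hd : 4 * w + 6 ≤ d)
    (hR : 1 ≤ R) {s : ℝ} (hs : |s| = 1) {r : ℕ} {f : ℝ → ℂ} (hm : Measurable f) (hf : Integrable f)
    {a : ℝ} (ha : 0 < a) {D : Finset Dy} {Q : Finset Ti} (hD : ∀ I ∈ D, ∫ x, ‖fw w I f x‖ ≤ a * len I)
    (hQ : ∀ P ∈ Q, P.1 ∈ D) {S : ℝ} (hS0 : 0 ≤ S)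
    (hS : ∀ I ∈ D, ∀ ξ, lsum R s (cf φ f) r I ξ Q ≤ S * len I) :
    ∀ I ∈ D, ∀ ξ, lsum R s (cf φ f) r I ξ Q ≤
      (400000 * (R + w + 8) * 16 ^ w * 4 ^ r * A ^ 2 * a ^ 2 + S / 4) * len I := by
  intro I hI ξ
  have hp := len_pos I
  set T := lacset R s r I ξ Q with hT
  have hTm : ∀ P ∈ T, P ∈ Q ∧ Lac R s r ξ P ∧ iv P.1 ⊆ iv I := fun P hP => Finset.mem_filter.1 hP
  obtain ⟨j0, hj0I, hj0⟩ : ∃ j0, j0 ≤ I.1 ∧ ∀ P ∈ T, j0 ≤ P.1.1 := by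
    refine ⟨(insert I.1 (T.image (fun P => P.1.1))).min' (Finset.insert_nonempty _ _), ?_, ?_⟩
    · exact Finset.min'_le _ _ (Finset.mem_insert_self _ _)
    · intro P hP
      exact Finset.min'_le _ _ (Finset.mem_insert_of_mem (Finset.mem_image_of_mem _ hP))
  set H : ℝ → ℝ := fun x => ‖fw w I f x‖ with hH
  have hHi : Integrable H := (fw_int hm hf).norm
  unfold lsum
  rw [← hT, ← Finset.sum_filter_add_sum_filter_not T (fun P => BadP H (12 * a) j0 I.1 P.1)]
  have h1 : ∑ P ∈ T.filter (fun P => ¬ BadP H (12 * a) j0 I.1 P.1), len P.1 * cf φ f P ^ 2 ≤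
      400000 * (R + w + 8) * 16 ^ w * 4 ^ r * A ^ 2 * a ^ 2 * len I := by
    apply hφ.good_part hd hR hs hm hf ha (hD I hI) (ξ := ξ) hj0I
    · intro P hP
      have hP' := (Finset.mem_filter.1 hP).1
      exact ⟨(hTm P hP').2.1, (hTm P hP').2.2, hj0 P hP', hD _ (hQ P (hTm P hP').1)⟩
    · intro P hP
      exact (Finset.mem_filter.1 hP).2
  have h2 : ∑ P ∈ T.filter (fun P => BadP H (12 * a) j0 I.1 P.1), len P.1 * cf φ f P ^ 2 ≤ S / 4 * len I := by
    set TB := T.filter (fun P => BadP H (12 * a) j0 I.1 P.1) with hTB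
    obtain ⟨M, hMsub, hMcov, hMdis⟩ := max_intervals (TB.image (fun P => P.1))
    have hMb : ∀ J ∈ M, ∃ P ∈ TB, P.1 = J := fun J hJ => Finset.mem_image.1 (hMsub hJ)
    have h3 : ∑ P ∈ TB, len P.1 * cf φ f P ^ 2 ≤ ∑ J ∈ M, S * len J := by
      apply sum_le_cover TB M _ (fun P => mul_nonneg (len_pos _).le (sq_nonneg _)) (fun J P => iv P.1 ⊆ iv J)
      · intro P hP
        exact hMcov P.1 (Finset.mem_image_of_mem _ hP)
      · intro J hJ W' hW' hs'
        obtain ⟨P0, hP0, rfl⟩ := hMb J hJ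
        have hP0' := (Finset.mem_filter.1 hP0).1
        refine le_trans ?_ (hS P0.1 (hQ P0 (hTm P0 hP0').1) ξ)
        unfold lsum
        apply Finset.sum_le_sum_of_subset_of_nonneg
        · intro P hP
          have hP' := hTm P (Finset.mem_filter.1 (hW' hP)).1
          exact Finset.mem_filter.2 ⟨hP'.1, hP'.2.1, hs' P hP⟩
        · intro P _ _
          exact mul_nonneg (len_pos _).le (sq_nonneg _)
    have h4 := bad_cover hHi (fun x => norm_nonneg _) (by positivity : 0 < 12 * a) M hMdis (by
      intro J hJ
      obtain ⟨P0, hP0, rfl⟩ := hMb J hJ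
      exact (Finset.mem_filter.1 hP0).2)
    have h5 : ∑ J ∈ M, len J ≤ len I / 4 := by
      have h6 := hD I hI
      have h7 : 12 * a * ∑ J ∈ M, len J ≤ 3 * (a * len I) := h4.trans (by gcongr)
      have : a * (12 * ∑ J ∈ M, len J) ≤ a * (3 * len I) := by linarith
      have := le_of_mul_le_mul_left this ha
      linarith
    rw [← Finset.mul_sum] at h3
    nlinarith
  linarith

theorem Prof.sizeLe {d : ℕ} {R A : ℝ} {φ : ℝ → ℂ} (hφ : Prof d R A φ) {w : ℕ} (hd : 4 * w + 6 ≤ d)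
    (hR : 1 ≤ R) {s : ℝ} (hs : |s| = 1) (r : ℕ) {f : ℝ → ℂ} (hm : Measurable f) (hf : Integrable f)
    {a : ℝ} (ha : 0 < a) {D : Finset Dy} {Q : Finset Ti} (hD : ∀ I ∈ D, ∫ x, ‖fw w I f x‖ ≤ a * len I)
    (hQ : ∀ P ∈ Q, P.1 ∈ D) :
    SizeLe R (cf φ f) D Q s r (2 ^ r * (900 * (R + w + 8) * 4 ^ w * A * a)) := by
  have hA := hφ.A_nonneg
  set K := 400000 * (R + w + 8) * 16 ^ w * 4 ^ r * A ^ 2 * a ^ 2 with hK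
  have hw0 : (0:ℝ) ≤ w := by positivity
  have hK0 : 0 ≤ K := by positivity
  -- initial bound
  obtain ⟨S, hS0, hS⟩ : ∃ S : ℝ, 0 ≤ S ∧ ∀ I ∈ D, ∀ ξ, lsum R s (cf φ f) r I ξ Q ≤ S * len I := by
    set V := ∑ P ∈ Q, len P.1 * cf φ f P ^ 2 with hV
    have hnn : ∀ P : Ti, 0 ≤ len P.1 * cf φ f P ^ 2 := fun P => mul_nonneg (len_pos _).le (sq_nonneg _)
    have hV0 : 0 ≤ V := Finset.sum_nonneg fun P _ => hnn P
    have hq : ∀ I : Dy, 0 ≤ V / len I := fun I => div_nonneg hV0 (len_pos I).le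
    refine ⟨∑ I ∈ D, V / len I, Finset.sum_nonneg fun I _ => hq I, ?_⟩
    intro I hI ξ
    have h1 : lsum R s (cf φ f) r I ξ Q ≤ V :=
      Finset.sum_le_sum_of_subset_of_nonneg (Finset.filter_subset _ _) (fun P _ _ => hnn P)
    have h2 : V / len I ≤ ∑ I ∈ D, V / len I := Finset.single_le_sum (fun I _ => hq I) hI
    have h3 : V = V / len I * len I := by have := len_ne I; field_simp
    have := mul_le_mul_of_nonneg_right h2 (len_pos I).le
    linarith
  have hit : ∀ n : ℕ, ∀ I ∈ D, ∀ ξ, lsum R s (cf φ f) r I ξ Q ≤ (2 * K + S * (1 / 4) ^ n) * len I := by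
    intro n
    induction n with
    | zero =>
      intro I hI ξ
      refine (hS I hI ξ).trans ?_
      have := len_pos I
      gcongr
      simp; linarith
    | succ n ih =>
      intro I hI ξ
      refine (hφ.size_step hd hR hs hm hf ha hD hQ (by positivity) ih I hI ξ).trans ?_
      have := len_pos I
      apply mul_le_mul_of_nonneg_right _ this.le
      rw [pow_succ (1 / 4 : ℝ) n, ← hK]; linarith
  intro I hI ξ
  have hlim : Filter.Tendsto (fun n : ℕ => (2 * K + S * (1 / 4) ^ n) * len I) Filter.atTop
      (nhds ((2 * K + S * 0) * len I)) := by
    apply Filter.Tendsto.mul_const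
    apply Filter.Tendsto.const_add
    apply Filter.Tendsto.const_mul
    exact tendsto_pow_atTop_nhds_zero_of_lt_one (by norm_num) (by norm_num)
  have h1 := ge_of_tendsto' hlim (fun n => hit n I hI ξ)
  refine h1.trans ?_
  apply mul_le_mul_of_nonneg_right _ (len_pos I).le
  have h16 : (16:ℝ) ^ w = 4 ^ w * 4 ^ w := by rw [← mul_pow]; norm_num
  set Y := 4 ^ w * 4 ^ w * (2 ^ r) ^ 2 * A ^ 2 * a ^ 2 with hY
  have hY0 : 0 ≤ Y := by positivity
  have e1 : 2 * K + S * 0 = 800000 * (R + w + 8) * Y := by rw [hK, h16, four_pow r, hY]; ring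
  have e2 : (2 ^ r * (900 * (R + w + 8) * 4 ^ w * A * a)) ^ 2 = 810000 * ((R + w + 8) * (R + w + 8)) * Y := by
    rw [hY]; ring
  rw [e1, e2]
  apply mul_le_mul_of_nonneg_right _ hY0
  have h9 : 1 ≤ R + w + 8 := by linarith
  nlinarith

end MTT

namespace MTT

lemma Bes.scale {R : ℝ} {c : Ti → ℝ} {S : Ti → Prop} {E : ℝ} (h : Bes R c S E) {b : ℝ} :
    Bes R (fun P => c P / b) S (E / b ^ 2) := by
  intro T hT a ha
  have h1 := h T hT a ha
  have h2 : ∑ P ∈ T, a P * (c P / b) = (∑ P ∈ T, a P * c P) / b := by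
    rw [Finset.sum_div]; exact Finset.sum_congr rfl fun P _ => by ring
  rw [h2, div_pow, div_mul_eq_mul_div]
  exact div_le_div_of_nonneg_right h1 (sq_nonneg b)

lemma Bes.mono {R : ℝ} {c : Ti → ℝ} {S : Ti → Prop} {E E' : ℝ} (h : Bes R c S E) (hE : E ≤ E') :
    Bes R c S E' := by
  intro T hT a ha
  refine (h T hT a ha).trans (mul_le_mul_of_nonneg_right hE ?_)
  exact Finset.sum_nonneg fun P _ => Finset.sum_nonneg fun P' _ =>
    mul_nonneg (mul_nonneg (ha P) (ha P')) (G_nonneg R P P')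

lemma SizeLe.scale {R : ℝ} {c : Ti → ℝ} {D : Finset Dy} {Q : Finset Ti} {s : ℝ} {r : ℕ} {σ : ℝ}
    (h : SizeLe R c D Q s r σ) {b : ℝ} : SizeLe R (fun P => c P / b) D Q s r (σ / b) := by
  intro I hI ξ
  have h1 := h I hI ξ
  have h2 : lsum R s (fun P => c P / b) r I ξ Q = lsum R s c r I ξ Q / b ^ 2 := by
    unfold lsum
    rw [Finset.sum_div]; exact Finset.sum_congr rfl fun P _ => by ring
  rw [h2, div_pow, div_mul_eq_mul_div]
  exact div_le_div_of_nonneg_right h1 (sq_nonneg b)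

lemma geom_half (T : Finset ℕ) : ∑ g ∈ T, ((1:ℝ) / 2) ^ g ≤ 2 := by
  have h := Summable.sum_le_tsum T (fun i _ => by positivity) summable_geometric_two
  rw [tsum_geometric_two] at h
  exact h

lemma geo_mono {n k : ℕ} {R : ℝ} {r1 : ℕ} {PP PP' : Finset (MT n)} (h : Geo n k R r1 PP) (hs : PP' ⊆ PP) :
    Geo n k R r1 PP' := by
  intro S hS ξ
  obtain ⟨γ, hγ⟩ := h S hS ξ
  exact ⟨γ, fun P hP => hγ P (hs hP)⟩

theorem model {n k : ℕ} (hk : 1 ≤ k) (hkn : k ≤ n) (θ : Fin n → ℝ) (hθ0 : ∀ i, 0 < θ i)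
    (hθ1 : ∀ i, θ i < 1) (hθs : (∑ i, θ i) = (n : ℝ) - 2 * k) {R : ℝ} (hR : 1 ≤ R) (r1 w K0 : ℕ)
    (e : Fin n) (hK : (n + k + 1 : ℝ) ≤ K0 * θ e) {C0 : ℝ} (hC0 : 1 ≤ C0) :
    ∃ C : ℝ, 0 ≤ C ∧ ∀ (f : Fin n → ℝ → ℂ) (aa : Fin n → ℝ) (L : Dy → Fin n → ℝ),
      (∀ i, Measurable (f i)) → (∀ i, Integrable (f i)) → (∀ i, MemLp (f i) 2) →
      (∀ i, ∫ x, ‖f i x‖ ^ 2 ≤ 1) → (∀ i, 0 < aa i) → (∀ I i, 0 ≤ L I i) →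
      (∀ I i, ∫ x, ‖fw w I (f i) x‖ ≤ aa i * L I i * len I) →
      (∀ I i, ∫ x, ‖fw w I (f i) x‖ ^ 2 ≤ L I i * len I) →
      (∀ I, L I e ≤ C0 * ((1 + ∑ i ∈ Finset.univ.erase e, L I i) ^ K0)⁻¹) →
      ∀ (φ : Fin n → ℝ → ℂ) (A : Fin n → ℝ), (∀ i, Prof (4 * w + 6) R (A i) (φ i)) → (∀ i, 0 < A i) →
      ∀ PP : Finset (MT n), Geo n k R r1 PP →
      ∑ P ∈ PP, len P.1 * ∏ i, cf (φ i) (f i) (tl P i) ≤ C * (∏ i, A i) * ∏ i, aa i ^ θ i := by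
  obtain ⟨C, hC, hcore⟩ := core hk hkn θ hθ0 hθ1 hθs hR 1 r1
  set H : ℝ := 450 * (R + w + 8) with hH
  have hw0 : (0:ℝ) ≤ w := by positivity
  have hHp : 0 < H := by rw [hH]; linarith
  set b : ℝ := 2 * 4 ^ w with hb
  have hbp : 0 < b := by positivity
  refine ⟨b ^ n * (C * (1 + C0) ^ k * (∏ i, H ^ θ i) * C0 * 2 ^ (n + k)) * 2, by positivity, ?_⟩
  intro f aa L hm hi h2 h21 haa hL0 hL1 hL2 hLe φ A hφ hA PP hG
  have hS1 : ∀ I, 1 ≤ 1 + ∑ i ∈ Finset.univ.erase e, L I i := fun I => by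
    have : 0 ≤ ∑ i ∈ Finset.univ.erase e, L I i := Finset.sum_nonneg fun i _ => hL0 I i
    linarith
  choose gr hgr1 hgr2 using fun I => exists_nat_pow_near (hS1 I) (by norm_num : (1:ℝ) < 2)
  have key : ∀ g : ℕ, ∑ P ∈ PP with gr P.1 = g, len P.1 * ∏ i, cf (φ i) (f i) (tl P i) ≤
      (b ^ n * (C * (1 + C0) ^ k * (∏ i, H ^ θ i) * C0 * 2 ^ (n + k)) * (∏ i, A i) * ∏ i, aa i ^ θ i) *
        (1 / 2) ^ g := by
    intro g
    set PG := PP.filter (fun P => gr P.1 = g) with hPG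
    have hgP : ∀ P ∈ PG, gr P.1 = g := fun P hP => (Finset.mem_filter.1 hP).2
    set bt : Fin n → ℝ := fun i => if i = e then C0 * ((2 ^ g) ^ K0)⁻¹ else 2 ^ (g + 1) with hbt
    have hbtp : ∀ i, 0 < bt i := by intro i; simp only [hbt]; split_ifs <;> positivity
    have hLb : ∀ P ∈ PG, ∀ i, L P.1 i ≤ bt i := by
      intro P hP i
      simp only [hbt]
      have hg := hgP P hP
      split_ifs with hie
      · subst hie
        refine (hLe P.1).trans ?_
        have := hgr1 P.1
        rw [hg] at this
        gcongr
      · have h3 := (hgr2 P.1).le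
        rw [hg] at h3
        have h4 : L P.1 i ≤ ∑ i ∈ Finset.univ.erase e, L P.1 i :=
          Finset.single_le_sum (fun i _ => hL0 P.1 i) (Finset.mem_erase.2 ⟨hie, Finset.mem_univ _⟩)
        linarith
    have hbtL : ∀ i, bt i ≤ (1 + C0) * 2 ^ (g + 1) := by
      intro i
      have h1 : (1:ℝ) ≤ 2 ^ (g + 1) := one_le_pow₀ (by norm_num)
      have h2 : ((2 ^ g) ^ K0 : ℝ)⁻¹ ≤ 1 := inv_le_one_of_one_le₀ (one_le_pow₀ (one_le_pow₀ (by norm_num)))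
      simp only [hbt]
      split_ifs
      · have : C0 * ((2 ^ g) ^ K0 : ℝ)⁻¹ ≤ C0 * 1 := by gcongr
        nlinarith
      · nlinarith
    have hΛ1 : 1 ≤ (1 + C0) * (2:ℝ) ^ (g + 1) := by
      have h1 : (1:ℝ) ≤ 2 ^ (g + 1) := one_le_pow₀ (by norm_num)
      nlinarith
    have hmain := hcore ((1 + C0) * 2 ^ (g + 1)) hΛ1 (fun i => H * aa i * bt i)
      (fun i => mul_pos (mul_pos hHp (haa i)) (hbtp i))
      (fun i P => cf (φ i) (f i) P / (b * A i))
      (fun i P => div_nonneg (cf_nonneg _ _ _) (mul_pos hbp (hA i)).le) PG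
      (geo_mono hG (Finset.filter_subset _ _)) ?_ ?_ ?_
    · have e1 : ∀ P ∈ PG, len P.1 * ∏ i, cf (φ i) (f i) (tl P i) =
          (b ^ n * ∏ i, A i) * (len P.1 * ∏ i, cf (φ i) (f i) (tl P i) / (b * A i)) := by
        intro P _
        rw [Finset.prod_div_distrib, Finset.prod_mul_distrib, Finset.prod_const, Finset.card_univ,
          Fintype.card_fin]
        have : ∏ i, A i ≠ 0 := Finset.prod_ne_zero_iff.2 fun i _ => (hA i).ne'
        have := hbp.ne'
        field_simp
      rw [Finset.sum_congr rfl e1, ← Finset.mul_sum]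
      have hAp : 0 ≤ ∏ i, A i := Finset.prod_nonneg fun i _ => (hA i).le
      refine (mul_le_mul_of_nonneg_left hmain (by positivity)).trans ?_
      have e2 : ∏ i, (H * aa i * bt i) ^ θ i = (∏ i, H ^ θ i) * (∏ i, aa i ^ θ i) * ∏ i, bt i ^ θ i := by
        rw [← Finset.prod_mul_distrib, ← Finset.prod_mul_distrib]
        refine Finset.prod_congr rfl fun i _ => ?_
        rw [Real.mul_rpow (mul_pos hHp (haa i)).le (hbtp i).le, Real.mul_rpow hHp.le (haa i).le]
      have e3 : ∏ i, bt i ^ θ i ≤ C0 * ((2 ^ g) ^ (n + k + 1))⁻¹ * (2 ^ (g + 1)) ^ n := by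
        rw [← Finset.mul_prod_erase Finset.univ _ (Finset.mem_univ e)]
        have f1 : bt e ^ θ e ≤ C0 * ((2 ^ g) ^ (n + k + 1))⁻¹ := by
          simp only [hbt, if_true]
          rw [Real.mul_rpow (by linarith) (by positivity)]
          have f2 : C0 ^ θ e ≤ C0 := by
            conv_rhs => rw [← Real.rpow_one C0]
            exact Real.rpow_le_rpow_of_exponent_le hC0 (hθ1 e).le
          have f3 : (((2:ℝ) ^ g) ^ K0)⁻¹ ^ θ e ≤ ((2 ^ g) ^ (n + k + 1))⁻¹ := by
            rw [Real.inv_rpow (by positivity), ← Real.rpow_natCast, ← Real.rpow_mul (by positivity),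
              ← Real.rpow_natCast _ (n + k + 1)]
            apply inv_anti₀ (by positivity)
            apply Real.rpow_le_rpow_of_exponent_le (one_le_pow₀ (by norm_num))
            push_cast; exact hK
          gcongr
        have f4 : ∏ i ∈ Finset.univ.erase e, bt i ^ θ i ≤ (2 ^ (g + 1)) ^ n := by
          have h1 : (1:ℝ) ≤ 2 ^ (g + 1) := one_le_pow₀ (by norm_num)
          calc ∏ i ∈ Finset.univ.erase e, bt i ^ θ i ≤ ∏ i ∈ Finset.univ.erase e, (2:ℝ) ^ (g + 1) := by
                apply Finset.prod_le_prod
                · intro i _; exact Real.rpow_nonneg (hbtp i).le _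
                · intro i hi
                  simp only [hbt, if_neg (Finset.ne_of_mem_erase hi)]
                  conv_rhs => rw [← Real.rpow_one ((2:ℝ) ^ (g + 1))]
                  exact Real.rpow_le_rpow_of_exponent_le h1 (hθ1 i).le
            _ ≤ _ := by
                rw [Finset.prod_const]
                apply pow_le_pow_right₀ h1
                refine (Finset.card_erase_le).trans ?_
                simp
        apply mul_le_mul f1 f4 (Finset.prod_nonneg fun i _ => Real.rpow_nonneg (hbtp i).le _) (by positivity)
      rw [e2]
      have haa0 : 0 ≤ ∏ i, aa i ^ θ i := Finset.prod_nonneg fun i _ => Real.rpow_nonneg (haa i).le _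
      have hHH0 : 0 ≤ ∏ i : Fin n, H ^ θ i := Finset.prod_nonneg fun i _ => Real.rpow_nonneg hHp.le _
      calc _ ≤ b ^ n * (∏ i, A i) * (C * ((1 + C0) * 2 ^ (g + 1)) ^ k * ((∏ i, H ^ θ i) * (∏ i, aa i ^ θ i) *
            (C0 * ((2 ^ g) ^ (n + k + 1))⁻¹ * (2 ^ (g + 1)) ^ n))) := by gcongr
        _ = _ := by
          have hg2 : ((2:ℝ) ^ g) ≠ 0 := by positivity
          have x1 : (2:ℝ) ^ (g + 1) = 2 ^ g * 2 := pow_succ _ _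
          have x2 : ((1:ℝ) / 2) ^ g = (2 ^ g)⁻¹ := by rw [one_div, inv_pow]
          rw [x1, x2]
          generalize (2:ℝ) ^ g = y at hg2
          simp only [mul_pow, pow_add, pow_one]
          field_simp
    · intro i
      refine ((hφ i).bes_glob (by omega) (hm i) (h2 i)).scale.mono ?_
      have hAi := hA i
      rw [div_le_one (by positivity)]
      have : (1:ℝ) ≤ 16 ^ w := one_le_pow₀ (by norm_num)
      have h4 : b ^ 2 = 4 * 16 ^ w := by
        rw [hb, mul_pow, ← pow_mul, mul_comm w 2, pow_mul]; norm_num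
      rw [mul_pow, h4]
      have := h21 i
      calc 4 * A i ^ 2 * ∫ x, ‖f i x‖ ^ 2 ≤ 4 * A i ^ 2 * 1 := by gcongr
        _ ≤ _ := by nlinarith [sq_nonneg (A i)]
    · intro i P hP
      refine ((hφ i).bes_loc le_rfl P.1 (hm i) (h2 i)).scale.mono ?_
      have hAi := hA i
      have h4 : b ^ 2 = 4 * 16 ^ w := by
        rw [hb, mul_pow, ← pow_mul, mul_comm w 2, pow_mul]; norm_num
      rw [mul_pow, h4]
      have h5 : 4 * (16:ℝ) ^ w * A i ^ 2 / (4 * 16 ^ w * A i ^ 2) = 1 := div_self (by positivity)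
      have h6 := hL2 P.1 i
      have h7 := (hLb P hP i).trans (hbtL i)
      have h8 := len_pos P.1
      calc _ = (4 * (16:ℝ) ^ w * A i ^ 2 / (4 * 16 ^ w * A i ^ 2)) * ∫ x, ‖fw w P.1 (f i) x‖ ^ 2 := by ring
        _ = ∫ x, ‖fw w P.1 (f i) x‖ ^ 2 := by rw [h5, one_mul]
        _ ≤ L P.1 i * len P.1 := h6
        _ ≤ _ := by gcongr
    · intro i s hs r
      have h5 := (hφ i).sizeLe (w := w) (Q := PG.image (fun P => tl P i)) (D := PG.image Prod.fst) le_rfl hR hs r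
        (hm i) (hi i) (a := aa i * bt i)
        (mul_pos (haa i) (hbtp i)) ?_ ?_
      · have h6 := h5.scale (b := b * A i)
        have hAi := (hA i).ne'
        have h7 : 2 ^ r * (900 * (R + w + 8) * 4 ^ w * A i * (aa i * bt i)) / (b * A i) =
            2 ^ (1 * r) * (H * aa i * bt i) := by
          rw [hH, hb, one_mul]
          have : (4:ℝ) ^ w ≠ 0 := by positivity
          field_simp
          ring
        rw [h7] at h6
        exact h6
      · intro I hI
        obtain ⟨P, hP, rfl⟩ := Finset.mem_image.1 hI
        refine (hL1 P.1 i).trans ?_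
        have := hLb P hP i
        have := len_pos P.1
        have := haa i
        gcongr
      · intro T hT
        obtain ⟨P, hP, rfl⟩ := Finset.mem_image.1 hT
        exact Finset.mem_image.2 ⟨P, hP, rfl⟩
  have hsum : ∑ P ∈ PP, len P.1 * ∏ i, cf (φ i) (f i) (tl P i) =
      ∑ g ∈ PP.image (fun P => gr P.1), ∑ P ∈ PP with gr P.1 = g, len P.1 * ∏ i, cf (φ i) (f i) (tl P i) :=
    (Finset.sum_fiberwise_of_maps_to (fun P hP => Finset.mem_image_of_mem _ hP) _).symm
  rw [hsum]
  have hAp : 0 ≤ ∏ i, A i := Finset.prod_nonneg fun i _ => (hA i).le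
  have haa0 : 0 ≤ ∏ i, aa i ^ θ i := Finset.prod_nonneg fun i _ => Real.rpow_nonneg (haa i).le _
  have hHH0 : 0 ≤ ∏ i : Fin n, H ^ θ i := Finset.prod_nonneg fun i _ => Real.rpow_nonneg hHp.le _
  refine (Finset.sum_le_sum fun g _ => key g).trans ?_
  rw [← Finset.mul_sum]
  calc _ ≤ (b ^ n * (C * (1 + C0) ^ k * (∏ i, H ^ θ i) * C0 * 2 ^ (n + k)) * (∏ i, A i) * ∏ i, aa i ^ θ i) * 2 :=
        mul_le_mul_of_nonneg_left (geom_half _) (by positivity)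
    _ = _ := by ring

end MTT

namespace MTT

lemma nondeg_bound {n k : ℕ} {Γ : Submodule ℝ (Fin n → ℝ)} (hΓ : NonDegenerate n k Γ)
    (S : Finset (Fin n)) (hS : S.card = k) :
    (∃ K : ℝ, 0 ≤ K ∧ ∀ γ ∈ Γ, ∀ ρ : ℝ, 0 ≤ ρ → (∀ s ∈ S, |γ s| ≤ ρ) → ∀ i, |γ i| ≤ K * ρ) ∧
    (∀ ξ : Fin n → ℝ, ∃ γ ∈ Γ, ∀ s ∈ S, γ s = ξ s) := by
  have hb := hΓ (S.orderEmbOfFin hS) (S.orderEmbOfFin hS).strictMono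
  have hr : Set.range (S.orderEmbOfFin hS) = S := by simp
  constructor
  · let T : Γ →ₗ[ℝ] (Fin k → ℝ) :=
      { toFun := fun ξ s => (ξ : Fin n → ℝ) (S.orderEmbOfFin hS s)
        map_add' := fun x y => by ext s; simp
        map_smul' := fun c x => by ext s; simp }
    have hT : LinearMap.ker T = ⊥ := LinearMap.ker_eq_bot.2 hb.1
    obtain ⟨K, hK, hA⟩ := LinearMap.exists_antilipschitzWith T hT
    refine ⟨K, K.2, fun γ hγ ρ hρ h i => ?_⟩
    have h1 := hA.le_mul_norm (map_zero T) ⟨γ, hγ⟩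
    have h2 : ‖T ⟨γ, hγ⟩‖ ≤ ρ := by
      rw [pi_norm_le_iff_of_nonneg hρ]
      intro s
      exact h _ (by have := Finset.orderEmbOfFin_mem S hS s; exact this)
    have h3 : |γ i| ≤ ‖γ‖ := norm_le_pi_norm γ i
    calc |γ i| ≤ ‖γ‖ := h3
      _ ≤ K * ‖T ⟨γ, hγ⟩‖ := h1
      _ ≤ K * ρ := mul_le_mul_of_nonneg_left h2 K.2
  · intro ξ
    obtain ⟨γ, hγ⟩ := hb.2 (fun s => ξ (S.orderEmbOfFin hS s))
    refine ⟨γ, γ.2, fun s hs => ?_⟩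
    have : s ∈ Set.range (S.orderEmbOfFin hS) := by rw [hr]; exact hs
    obtain ⟨t, rfl⟩ := this
    exact congrFun hγ t

/-- Whitney condition for integer frequency vectors -/
def Wh (n : ℕ) (Γ : Submodule ℝ (Fin n → ℝ)) (D1 D2 : ℝ) (q : Fin n → ℤ) : Prop :=
  (∑ i, (q i : ℝ) = 0) ∧ (∃ γ ∈ Γ, ∀ i, |(q i : ℝ) - γ i| ≤ D2) ∧ ∀ γ ∈ Γ, ∃ i, D1 ≤ |(q i : ℝ) - γ i|

lemma geo_of_wh {n k : ℕ} {Γ : Submodule ℝ (Fin n → ℝ)} (hΓ : NonDegenerate n k Γ)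
    (hG : (Γ : Set (Fin n → ℝ)) ⊆ GammaSet n) {R D1 D2 : ℝ} (hR : 1 ≤ R) (hD1 : n * bb R ≤ D1) (hD2 : 0 ≤ D2) :
    ∃ r1 : ℕ, ∀ PP : Finset (MT n), (∀ P ∈ PP, Wh n Γ D1 D2 P.2) → Geo n k R r1 PP := by
  have hK : ∀ S : Finset (Fin n), ∃ K : ℝ, 0 ≤ K ∧ (S.card = k → ∀ γ ∈ Γ, ∀ ρ : ℝ, 0 ≤ ρ → (∀ s ∈ S, |γ s| ≤ ρ) →
      ∀ i, |γ i| ≤ K * ρ) := by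
    intro S
    by_cases hS : S.card = k
    · obtain ⟨K, h0, h⟩ := (nondeg_bound hΓ S hS).1
      exact ⟨K, h0, fun _ => h⟩
    · exact ⟨0, le_rfl, fun h => absurd h hS⟩
  choose K hK0 hK using hK
  set KK := ∑ S, K S with hKK
  have hKKle : ∀ S, K S ≤ KK := fun S => Finset.single_le_sum (fun S _ => hK0 S) (Finset.mem_univ S)
  obtain ⟨r1, hr1⟩ := pow_unbounded_of_one_lt (D2 + KK * (1 + D2)) (by norm_num : (1:ℝ) < 2)
  refine ⟨r1, fun PP hPP S hS ξ => ?_⟩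
  obtain ⟨γ, hγ, hγS⟩ := (nondeg_bound hΓ S hS).2 ξ
  refine ⟨γ, fun P hP r hr => ?_⟩
  obtain ⟨hs0, ⟨γ', hγ', hd⟩, hfar⟩ := hPP P hP
  have hl := len_pos P.1
  have h2r : (1:ℝ) ≤ 2 ^ r := one_le_pow₀ (by norm_num)
  have hrat : ∀ i, rat (γ i) (tl P i) = (P.2 i : ℝ) - len P.1 * γ i := fun i => rfl
  have hdif : γ' - len P.1 • γ ∈ Γ := Γ.sub_mem hγ' (Γ.smul_mem _ hγ)
  have h1 : ∀ s ∈ S, |(γ' - len P.1 • γ) s| ≤ 2 ^ r + D2 := by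
    intro s hs
    have h3 := hr s hs
    have h4 := hd s
    have : rat (ξ s) (tl P s) = (P.2 s : ℝ) - len P.1 * γ s := by rw [hγS s hs]; rfl
    rw [this] at h3
    have e : (γ' - len P.1 • γ) s = ((P.2 s : ℝ) - len P.1 * γ s) - ((P.2 s : ℝ) - γ' s) := by
      simp only [Pi.sub_apply, Pi.smul_apply, smul_eq_mul]; ring
    rw [e]
    exact (abs_sub _ _).trans (by linarith)
  constructor
  · intro i
    have h5 := hK S hS _ hdif _ (by positivity) h1 i
    have h6 := hd i
    rw [hrat]
    have e : (P.2 i : ℝ) - len P.1 * γ i = ((P.2 i : ℝ) - γ' i) + (γ' - len P.1 • γ) i := by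
      simp only [Pi.sub_apply, Pi.smul_apply, smul_eq_mul]; ring
    rw [e]
    have h7 : K S * (2 ^ r + D2) ≤ KK * (2 ^ r + D2) := mul_le_mul_of_nonneg_right (hKKle S) (by positivity)
    have hKK0 : 0 ≤ KK := (hK0 S).trans (hKKle S)
    calc _ ≤ D2 + KK * (2 ^ r + D2) := (abs_add_le _ _).trans (by linarith)
      _ ≤ (D2 + KK * (1 + D2)) * 2 ^ r := by
        have h8 : D2 * 1 ≤ D2 * 2 ^ r := by gcongr
        have h9 : KK * (2 ^ r + D2) ≤ KK * ((1 + D2) * 2 ^ r) := by gcongr; nlinarith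
        nlinarith
      _ ≤ 2 ^ r1 * 2 ^ r := by gcongr
      _ = _ := (pow_add _ _ _).symm
  · obtain ⟨i, hi⟩ := hfar _ (Γ.smul_mem (len P.1) hγ)
    have hi : D1 ≤ |rat (γ i) (tl P i)| := hi
    have hbb : 0 < bb R := by unfold bb; linarith
    have hn1 : (1:ℝ) ≤ n := by
      have := i.pos
      exact_mod_cast this
    have hib : bb R ≤ |rat (γ i) (tl P i)| := by nlinarith
    by_contra hcon
    push Not at hcon
    have h10 : ∀ i' ∈ Finset.univ.erase i, |rat (γ i') (tl P i')| ≤ bb R := fun i' hi' =>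
      (hcon i i' (Finset.ne_of_mem_erase hi').symm hib).le
    have hsum : ∑ i, rat (γ i) (tl P i) = 0 := by
      simp_rw [hrat]
      rw [Finset.sum_sub_distrib, hs0, ← Finset.mul_sum]
      have : ∑ i, γ i = 0 := hG hγ
      rw [this]; ring
    rw [← Finset.add_sum_erase Finset.univ _ (Finset.mem_univ i)] at hsum
    have h11 : |rat (γ i) (tl P i)| ≤ ∑ i' ∈ Finset.univ.erase i, |rat (γ i') (tl P i')| := by
      have : rat (γ i) (tl P i) = -∑ i' ∈ Finset.univ.erase i, rat (γ i') (tl P i') := by linarith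
      rw [this, abs_neg]
      exact Finset.abs_sum_le_sum_abs _ _
    have h12 := Finset.sum_le_sum h10
    rw [Finset.sum_const, Finset.card_erase_of_mem (Finset.mem_univ i), Finset.card_univ, Fintype.card_fin,
      nsmul_eq_mul, Nat.cast_sub i.pos] at h12
    push_cast at h12
    nlinarith

end MTT

namespace MTT

/-- ball of radius `2^r ℓ` around `c` -/
def bl (c ℓ : ℝ) (r : ℕ) : Set ℝ := Set.Ioo (c - 2 ^ r * ℓ) (c + 2 ^ r * ℓ)

lemma mem_bl {c ℓ : ℝ} {r : ℕ} {x : ℝ} : x ∈ bl c ℓ r ↔ |x - c| < 2 ^ r * ℓ := by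
  unfold bl; rw [Set.mem_Ioo, abs_lt]; constructor <;> rintro ⟨h1, h2⟩ <;> constructor <;> linarith

lemma shell_bound {ℓ : ℝ} (hℓ : 0 < ℓ) (c : ℝ) (p R : ℕ) (x : ℝ) :
    (kw ℓ c x ^ p)⁻¹ ≤ ∑ r ∈ Finset.range (R + 1), 2 ^ p * ((2 ^ r) ^ p)⁻¹ * (bl c ℓ r).indicator (fun _ => (1:ℝ)) x
      + ((2 ^ R) ^ p)⁻¹ := by
  have h1k := one_le_kw hℓ c x
  have hnn : ∀ r : ℕ, 0 ≤ 2 ^ p * ((2 ^ r) ^ p : ℝ)⁻¹ * (bl c ℓ r).indicator (fun _ => (1:ℝ)) x := by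
    intro r
    have : 0 ≤ (bl c ℓ r).indicator (fun _ => (1:ℝ)) x := Set.indicator_nonneg (fun _ _ => zero_le_one) x
    positivity
  by_cases hx : |x - c| < 2 ^ R * ℓ
  · have hex : ∃ r : ℕ, |x - c| < 2 ^ r * ℓ := ⟨R, hx⟩
    set r := Nat.find hex with hr
    have hr1 : |x - c| < 2 ^ r * ℓ := Nat.find_spec hex
    have hrR : r ≤ R := Nat.find_min' hex hx
    have h2 : 2 ^ p * ((2 ^ r) ^ p : ℝ)⁻¹ * (bl c ℓ r).indicator (fun _ => (1:ℝ)) x ≤ _ :=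
      Finset.single_le_sum (f := fun r => 2 ^ p * ((2 ^ r) ^ p : ℝ)⁻¹ * (bl c ℓ r).indicator (fun _ => (1:ℝ)) x)
        (fun r _ => hnn r) (Finset.mem_range.2 (by omega : r < R + 1))
    rw [Set.indicator_of_mem (mem_bl.2 hr1), mul_one] at h2
    have h3 : (kw ℓ c x ^ p)⁻¹ ≤ 2 ^ p * ((2 ^ r) ^ p : ℝ)⁻¹ := by
      rcases Nat.eq_zero_or_pos r with h0 | hpos
      · rw [h0]
        simp only [pow_zero, one_pow, inv_one, mul_one]
        have : (1:ℝ) ≤ 2 ^ p := one_le_pow₀ (by norm_num)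
        exact (inv_le_one_of_one_le₀ (one_le_pow₀ h1k)).trans this
      · have h4 := Nat.find_min hex (by omega : r - 1 < r)
        push Not at h4
        have h5 : (2:ℝ) ^ (r - 1) ≤ kw ℓ c x := by
          unfold kw
          have : (2:ℝ) ^ (r - 1) ≤ |x - c| / ℓ := by rw [le_div_iff₀ hℓ]; exact h4
          linarith
        have h6 : (2:ℝ) ^ r = 2 * 2 ^ (r - 1) := by rw [← pow_succ', Nat.sub_add_cancel hpos]
        rw [h6, mul_pow, mul_inv, ← mul_assoc, mul_inv_cancel₀ (by positivity), one_mul]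
        gcongr
    have : (0:ℝ) ≤ ((2 ^ R) ^ p)⁻¹ := by positivity
    linarith
  · push Not at hx
    have h5 : (2:ℝ) ^ R ≤ kw ℓ c x := by
      unfold kw
      have : (2:ℝ) ^ R ≤ |x - c| / ℓ := by rw [le_div_iff₀ hℓ]; exact hx
      linarith
    have h6 : (kw ℓ c x ^ p)⁻¹ ≤ ((2 ^ R) ^ p)⁻¹ := by gcongr
    have := Finset.sum_nonneg (s := Finset.range (R + 1)) (fun r _ => hnn r)
    linarith

lemma avg_bound {ℓ : ℝ} (hℓ : 0 < ℓ) (c : ℝ) (q : ℕ) {h : ℝ → ℝ} (h0 : ∀ x, 0 ≤ h x) (hi : Integrable h)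
    {μ : ℝ} (hμ : 0 ≤ μ) (hu : ∀ r : ℕ, ∫ x in bl c ℓ r, h x ≤ μ * (2 ^ r * ℓ) * (2 ^ r) ^ q) :
    ∫ x, h x * (kw ℓ c x ^ (q + 2))⁻¹ ≤ 2 ^ (q + 3) * μ * ℓ := by
  set p := q + 2 with hp
  have hR : ∀ R : ℕ, ∫ x, h x * (kw ℓ c x ^ p)⁻¹ ≤ 2 ^ (q + 3) * μ * ℓ + (1 / 2) ^ R * ∫ x, h x := by
    intro R
    have hms : ∀ r, MeasurableSet (bl c ℓ r) := fun r => measurableSet_Ioo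
    have hintg : Integrable (fun x => ∑ r ∈ Finset.range (R + 1), 2 ^ p * ((2 ^ r) ^ p : ℝ)⁻¹ *
        (bl c ℓ r).indicator h x) :=
      integrable_finsetSum _ fun r _ => (hi.indicator (hms r)).const_mul _
    calc ∫ x, h x * (kw ℓ c x ^ p)⁻¹ ≤ ∫ x, ((∑ r ∈ Finset.range (R + 1), 2 ^ p * ((2 ^ r) ^ p : ℝ)⁻¹ *
          (bl c ℓ r).indicator h x) + ((2 ^ R) ^ p)⁻¹ * h x) := by
          apply integral_mono_of_nonneg
          · exact Filter.Eventually.of_forall fun x => mul_nonneg (h0 x) (kw_inv_nonneg hℓ c x p)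
          · exact hintg.add (hi.const_mul _)
          · refine Filter.Eventually.of_forall fun x => ?_
            have := mul_le_mul_of_nonneg_left (shell_bound hℓ c p R x) (h0 x)
            refine this.trans (le_of_eq ?_)
            rw [mul_add, Finset.mul_sum]
            congr 1
            · refine Finset.sum_congr rfl fun r _ => ?_
              by_cases hx : x ∈ bl c ℓ r
              · rw [Set.indicator_of_mem hx, Set.indicator_of_mem hx]; ring
              · rw [Set.indicator_of_notMem hx, Set.indicator_of_notMem hx]; ring
            · ring
      _ = (∑ r ∈ Finset.range (R + 1), 2 ^ p * ((2 ^ r) ^ p : ℝ)⁻¹ * ∫ x in bl c ℓ r, h x) +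
          ((2 ^ R) ^ p)⁻¹ * ∫ x, h x := by
          rw [integral_add hintg (hi.const_mul _), integral_const_mul,
            integral_finsetSum _ fun r _ => (hi.indicator (hms r)).const_mul _]
          congr 1
          refine Finset.sum_congr rfl fun r _ => ?_
          rw [integral_const_mul, integral_indicator (hms r)]
      _ ≤ (∑ r ∈ Finset.range (R + 1), 2 ^ p * μ * ℓ * (1 / 2) ^ r) + (1 / 2) ^ R * ∫ x, h x := by
          have hI0 : 0 ≤ ∫ x, h x := integral_nonneg h0
          have hx : ∀ r : ℕ, 2 ^ p * ((2 ^ r) ^ p : ℝ)⁻¹ * ∫ x in bl c ℓ r, h x ≤ 2 ^ p * μ * ℓ * (1 / 2) ^ r := by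
            intro r
            calc 2 ^ p * ((2 ^ r) ^ p : ℝ)⁻¹ * ∫ x in bl c ℓ r, h x
                ≤ 2 ^ p * ((2 ^ r) ^ p : ℝ)⁻¹ * (μ * (2 ^ r * ℓ) * (2 ^ r) ^ q) :=
                  mul_le_mul_of_nonneg_left (hu r) (by positivity)
              _ = 2 ^ p * μ * ℓ * (1 / 2) ^ r := by
                  rw [one_div, inv_pow, hp]
                  have : (2:ℝ) ^ r ≠ 0 := by positivity
                  generalize (2:ℝ) ^ r = y at this
                  rw [pow_add y]
                  field_simp
          have hy : ((2 ^ R) ^ p : ℝ)⁻¹ ≤ (1 / 2) ^ R := by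
            rw [one_div, inv_pow]
            have h1 : (1:ℝ) ≤ 2 ^ R := one_le_pow₀ (by norm_num)
            apply inv_anti₀ (by positivity)
            exact le_self_pow₀ h1 (by omega)
          exact add_le_add (Finset.sum_le_sum fun r _ => hx r) (mul_le_mul_of_nonneg_right hy hI0)
      _ ≤ _ := by
          rw [← Finset.mul_sum]
          have := geom_half (Finset.range (R + 1))
          have h3 : 2 ^ p * μ * ℓ * ∑ r ∈ Finset.range (R + 1), ((1:ℝ) / 2) ^ r ≤ 2 ^ p * μ * ℓ * 2 := by gcongr
          have h4 : (2:ℝ) ^ p * μ * ℓ * 2 = 2 ^ (q + 3) * μ * ℓ := by rw [hp]; ring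
          linarith
  have hlim : Filter.Tendsto (fun R : ℕ => 2 ^ (q + 3) * μ * ℓ + (1 / 2) ^ R * ∫ x, h x) Filter.atTop
      (nhds (2 ^ (q + 3) * μ * ℓ + 0 * ∫ x, h x)) := by
    apply Filter.Tendsto.const_add
    apply Filter.Tendsto.mul_const
    exact tendsto_pow_atTop_nhds_zero_of_lt_one (by norm_num) (by norm_num)
  have := ge_of_tendsto' hlim hR
  linarith

lemma transfer {n : ℕ} (e : Fin n) {K0 N : ℕ} (hK0 : 1 ≤ K0) (hN : 2 * K0 + 1 ≤ N) : ∃ C0 : ℝ, 1 ≤ C0 ∧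
    ∀ (c ℓ : ℝ), 0 < ℓ → ∀ (h : Fin n → ℝ → ℝ) (lam : ℕ → Fin n → ℝ), (∀ i x, 0 ≤ h i x) →
      (∀ i, Integrable (h i)) → (∀ r i, 0 ≤ lam r i) →
      (∀ r i, ∫ x in bl c ℓ r, h i x ≤ 4 * lam r i * (2 ^ r * ℓ)) →
      (∀ r, lam r e ≤ (1 + ∑ i ∈ Finset.univ.erase e, lam r i) ^ ((1:ℝ) - N)) →
      ∫ x, h e x * (kw ℓ c x ^ (2 * K0 + 2))⁻¹ ≤ C0 *
        ((1 + ∑ i ∈ Finset.univ.erase e, ℓ⁻¹ * ∫ x, h i x * (kw ℓ c x ^ (2 * K0 + 2))⁻¹) ^ K0)⁻¹ * ℓ := by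
  set κ : ℝ := (2 * n * 2 ^ (2 * K0 + 4) * 4)⁻¹ with hκ
  have hn : (0:ℝ) < n := by have := e.pos; exact_mod_cast this
  have hκ0 : 0 < κ := by positivity
  set C1 : ℝ := 4 * 2 ^ K0 + 4 * ((κ ^ 2) ^ K0)⁻¹ with hC1
  have h2K : (1:ℝ) ≤ 2 ^ K0 := one_le_pow₀ (by norm_num)
  have hκi : 0 < ((κ ^ 2) ^ K0)⁻¹ := by positivity
  have hC14 : 4 ≤ C1 := by linarith
  refine ⟨2 ^ (2 * K0 + 3) * C1, ?_, ?_⟩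
  · have : (1:ℝ) ≤ 2 ^ (2 * K0 + 3) := one_le_pow₀ (by norm_num)
    nlinarith
  intro c ℓ hℓ h lam h0 hi hl0 hu hle
  set V : Fin n → ℝ := fun i => ℓ⁻¹ * ∫ x, h i x * (kw ℓ c x ^ (2 * K0 + 2))⁻¹ with hV
  have hV0 : ∀ i, 0 ≤ V i := fun i => mul_nonneg (inv_nonneg.2 hℓ.le)
    (integral_nonneg fun x => mul_nonneg (h0 i x) (kw_inv_nonneg hℓ c x _))
  set S := 1 + ∑ i ∈ Finset.univ.erase e, V i with hS
  have hS1 : 1 ≤ S := by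
    have : 0 ≤ ∑ i ∈ Finset.univ.erase e, V i := Finset.sum_nonneg fun i _ => hV0 i
    linarith
  have hSK : 0 < S ^ K0 := by positivity
  have hY1 : ∀ r, 1 ≤ 1 + ∑ i ∈ Finset.univ.erase e, lam r i := fun r => by
    have : 0 ≤ ∑ i ∈ Finset.univ.erase e, lam r i := Finset.sum_nonneg fun i _ => hl0 r i
    linarith
  -- decay in a convenient form
  have hdec : ∀ r, lam r e ≤ (((1 + ∑ i ∈ Finset.univ.erase e, lam r i) ^ 2) ^ K0)⁻¹ := by
    intro r
    refine (hle r).trans ?_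
    rw [← pow_mul, ← Real.rpow_natCast, ← Real.rpow_neg (by linarith [hY1 r])]
    apply Real.rpow_le_rpow_of_exponent_le (hY1 r)
    have : ((2 * K0 + 1 : ℕ) : ℝ) ≤ N := by exact_mod_cast hN
    push_cast at this ⊢
    linarith
  have hdec1 : ∀ r, lam r e ≤ 1 := fun r => (hdec r).trans
    (inv_le_one_of_one_le₀ (one_le_pow₀ (one_le_pow₀ (hY1 r))))
  have hmono : ∀ i, ∀ r r' : ℕ, r ≤ r' → ∫ x in bl c ℓ r, h i x ≤ ∫ x in bl c ℓ r', h i x := by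
    intro i r r' hrr
    apply setIntegral_mono_set (hi i).integrableOn (Filter.Eventually.of_forall fun x => h0 i x)
    apply Filter.Eventually.of_forall
    intro x hx
    refine mem_bl.2 ((mem_bl.1 hx).trans_le ?_)
    have : (2:ℝ) ^ r ≤ 2 ^ r' := pow_le_pow_right₀ (by norm_num) hrr
    gcongr
  have goal : ∀ r : ℕ, ∫ x in bl c ℓ r, h e x ≤ C1 * (S ^ K0)⁻¹ * (2 ^ r * ℓ) * (2 ^ r) ^ (2 * K0) := by
    intro r
    have h2r : (1:ℝ) ≤ 2 ^ r := one_le_pow₀ (by norm_num)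
    have ht : ∫ x in bl c ℓ r, h e x ≤ 4 * (2 ^ r * ℓ) := by
      refine (hu r e).trans ?_
      have := hdec1 r
      have : 4 * lam r e * (2 ^ r * ℓ) ≤ 4 * 1 * (2 ^ r * ℓ) := by gcongr
      linarith
    by_cases hc1 : S ≤ (2 ^ r) ^ 2
    · have h3 : S ^ K0 ≤ (2 ^ r) ^ (2 * K0) := by rw [pow_mul]; gcongr
      have h4 : 1 ≤ (S ^ K0)⁻¹ * (2 ^ r) ^ (2 * K0) := by
        rw [← div_eq_inv_mul, le_div_iff₀ hSK]; linarith
      calc _ ≤ 4 * (2 ^ r * ℓ) := ht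
        _ ≤ C1 * (2 ^ r * ℓ) * 1 := by rw [mul_one]; gcongr
        _ ≤ C1 * (2 ^ r * ℓ) * ((S ^ K0)⁻¹ * (2 ^ r) ^ (2 * K0)) := by gcongr
        _ = _ := by ring
    push Not at hc1
    have h5 : (1:ℝ) ≤ (2 ^ r) ^ (2 * K0) := one_le_pow₀ h2r
    by_cases hc2 : S ≤ 2
    · have h3 : S ^ K0 ≤ 2 ^ K0 := by gcongr
      have h4 : 1 ≤ (S ^ K0)⁻¹ * 2 ^ K0 := by rw [← div_eq_inv_mul, le_div_iff₀ hSK]; linarith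
      calc _ ≤ 4 * (2 ^ r * ℓ) * 1 * 1 := by linarith
        _ ≤ 4 * (2 ^ r * ℓ) * ((S ^ K0)⁻¹ * 2 ^ K0) * (2 ^ r) ^ (2 * K0) := by gcongr
        _ = (4 * 2 ^ K0) * (S ^ K0)⁻¹ * (2 ^ r * ℓ) * (2 ^ r) ^ (2 * K0) := by ring
        _ ≤ _ := by gcongr; linarith
    push Not at hc2
    obtain ⟨i, hie, hVi⟩ : ∃ i ∈ Finset.univ.erase e, S / (2 * n) ≤ V i := by
      by_contra hcon
      push Not at hcon
      have h6 : ∑ i ∈ Finset.univ.erase e, V i ≤ ∑ i ∈ Finset.univ.erase e, S / (2 * n) :=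
        Finset.sum_le_sum fun i hi => (hcon i hi).le
      rw [Finset.sum_const, nsmul_eq_mul] at h6
      have h7 : ((Finset.univ.erase e).card : ℝ) ≤ n := by
        have : (Finset.univ.erase e).card ≤ n := (Finset.card_erase_le).trans (by simp)
        exact_mod_cast this
      have h8 : ((Finset.univ.erase e).card : ℝ) * (S / (2 * n)) ≤ n * (S / (2 * n)) := by gcongr
      have h9 : (n:ℝ) * (S / (2 * n)) = S / 2 := by field_simp
      linarith
    set μ := S / (2 * n) / 2 ^ (2 * K0 + 4) with hμ
    have hμ0 : 0 < μ := by positivity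
    obtain ⟨r1, hr1⟩ : ∃ r1 : ℕ, μ * (2 ^ r1 * ℓ) * (2 ^ r1) ^ (2 * K0) < ∫ x in bl c ℓ r1, h i x := by
      by_contra hcon
      push Not at hcon
      have h6 := avg_bound hℓ c (2 * K0) (h0 i) (hi i) hμ0.le hcon
      have h7 : V i ≤ 2 ^ (2 * K0 + 3) * μ := by
        simp only [hV]
        rw [inv_mul_le_iff₀ hℓ]; linarith
      have h8 : (2:ℝ) ^ (2 * K0 + 3) * μ = S / (2 * n) / 2 := by
        rw [hμ, pow_succ _ (2 * K0 + 3)]; field_simp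
      have h9 : 0 < S / (2 * n) := by positivity
      linarith
    set r' := max r r1 with hr'
    have hrr' : r ≤ r' := le_max_left _ _
    have hr1r' : r1 ≤ r' := le_max_right _ _
    have hr'le : r' ≤ r + r1 := by omega
    have h2r1 : (1:ℝ) ≤ 2 ^ r1 := one_le_pow₀ (by norm_num)
    have hpow : (2:ℝ) ^ r' ≤ 2 ^ r * 2 ^ r1 := by
      rw [← pow_add]; exact pow_le_pow_right₀ (by norm_num) hr'le
    set Y := 1 + ∑ i ∈ Finset.univ.erase e, lam r' i with hY
    have hyY : lam r' i ≤ Y := by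
      have : lam r' i ≤ ∑ i ∈ Finset.univ.erase e, lam r' i := Finset.single_le_sum (fun i _ => hl0 r' i) hie
      linarith
    have h6 : μ * (2 ^ r1 * ℓ) * (2 ^ r1) ^ (2 * K0) ≤ 4 * Y * ((2 ^ r * 2 ^ r1) * ℓ) := by
      calc _ ≤ ∫ x in bl c ℓ r1, h i x := hr1.le
        _ ≤ ∫ x in bl c ℓ r', h i x := hmono i _ _ hr1r'
        _ ≤ 4 * lam r' i * (2 ^ r' * ℓ) := hu r' i
        _ ≤ 4 * Y * ((2 ^ r * 2 ^ r1) * ℓ) := by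
            have := hl0 r' i
            have hYp : 0 ≤ Y := this.trans hyY
            gcongr
    have h7 : κ * S * (2 ^ r1) ^ (2 * K0) ≤ Y * 2 ^ r := by
      have e1 : μ = 4 * (κ * S) := by rw [hμ, hκ]; field_simp
      rw [e1] at h6
      have h8 : (0:ℝ) < 4 * 2 ^ r1 * ℓ := by positivity
      refine le_of_mul_le_mul_left ?_ h8
      calc _ = 4 * (κ * S) * (2 ^ r1 * ℓ) * (2 ^ r1) ^ (2 * K0) := by ring
        _ ≤ _ := h6
        _ = _ := by ring
    have h8 : κ * S ≤ κ * S * (2 ^ r1) ^ (2 * K0) * (2 ^ r1)⁻¹ := by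
      have : (2:ℝ) ^ r1 ≤ (2 ^ r1) ^ (2 * K0) := le_self_pow₀ h2r1 (by omega)
      have h9 : 1 ≤ (2 ^ r1) ^ (2 * K0) * ((2:ℝ) ^ r1)⁻¹ := by
        rw [← div_eq_mul_inv, le_div_iff₀ (by positivity)]; linarith
      have h10 : 0 < κ * S := by positivity
      calc κ * S = κ * S * 1 := by ring
        _ ≤ κ * S * ((2 ^ r1) ^ (2 * K0) * (2 ^ r1)⁻¹) := by gcongr
        _ = _ := by ring
    have h9 : κ * S * 2 ^ r1 ≤ Y * 2 ^ r := by
      have : (2:ℝ) ^ r1 ≤ (2 ^ r1) ^ (2 * K0) := le_self_pow₀ h2r1 (by omega)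
      refine le_trans ?_ h7
      gcongr
    have h10 : κ ^ 2 * S * (2 ^ r1) ^ 2 ≤ Y ^ 2 := by
      have h11 : (κ * S * 2 ^ r1) ^ 2 ≤ (Y * 2 ^ r) ^ 2 := by gcongr
      have h12 : (Y * 2 ^ r) ^ 2 ≤ Y ^ 2 * S := by rw [mul_pow]; gcongr
      have hSp : 0 < S := by linarith
      refine le_of_mul_le_mul_right ?_ hSp
      calc _ = (κ * S * 2 ^ r1) ^ 2 := by ring
        _ ≤ _ := h11.trans h12
    have h11 : lam r' e * 2 ^ r1 ≤ ((κ ^ 2) ^ K0)⁻¹ * (S ^ K0)⁻¹ := by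
      have h12 : (κ ^ 2 * S * (2 ^ r1) ^ 2) ^ K0 ≤ (Y ^ 2) ^ K0 := by gcongr
      have h13 : lam r' e ≤ ((κ ^ 2 * S * (2 ^ r1) ^ 2) ^ K0)⁻¹ := (hdec r').trans (by gcongr)
      have h14 : (2:ℝ) ^ r1 ≤ ((2 ^ r1) ^ 2) ^ K0 := by
        rw [← pow_mul]; exact le_self_pow₀ h2r1 (by omega)
      calc lam r' e * 2 ^ r1 ≤ ((κ ^ 2 * S * (2 ^ r1) ^ 2) ^ K0)⁻¹ * ((2 ^ r1) ^ 2) ^ K0 := by gcongr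
        _ = _ := by rw [mul_pow, mul_pow]; field_simp
    calc ∫ x in bl c ℓ r, h e x ≤ ∫ x in bl c ℓ r', h e x := hmono e _ _ hrr'
      _ ≤ 4 * lam r' e * (2 ^ r' * ℓ) := hu r' e
      _ ≤ 4 * lam r' e * ((2 ^ r * 2 ^ r1) * ℓ) := by have := hl0 r' e; gcongr
      _ = 4 * (lam r' e * 2 ^ r1) * (2 ^ r * ℓ) * 1 := by ring
      _ ≤ 4 * (((κ ^ 2) ^ K0)⁻¹ * (S ^ K0)⁻¹) * (2 ^ r * ℓ) * (2 ^ r) ^ (2 * K0) := by gcongr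
      _ = (4 * ((κ ^ 2) ^ K0)⁻¹) * (S ^ K0)⁻¹ * (2 ^ r * ℓ) * (2 ^ r) ^ (2 * K0) := by ring
      _ ≤ _ := by gcongr; linarith
  have := avg_bound hℓ c (2 * K0) (h0 e) (hi e) (by positivity) goal
  refine this.trans (le_of_eq ?_)
  ring

end MTT

namespace MTT

lemma chi_nonneg (I : Iv) (hI : 0 < I.len) (x : ℝ) : 0 ≤ I.chi x := by
  unfold Iv.chi
  have := Metric.infDist_nonneg (x := x) (s := I.set)
  positivity

lemma chi_le_one (I : Iv) (hI : 0 < I.len) (x : ℝ) : I.chi x ≤ 1 := by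
  unfold Iv.chi
  have := Metric.infDist_nonneg (x := x) (s := I.set)
  apply inv_le_one_of_one_le₀
  have : 0 ≤ Metric.infDist x I.set / I.len := by positivity
  linarith

lemma chi_meas (I : Iv) : Measurable I.chi := by
  unfold Iv.chi
  have : Measurable (fun x => Metric.infDist x I.set) := (Metric.continuous_infDist_pt _).measurable
  exact ((this.div_const _).const_add 1).inv

lemma chi_one {I : Iv} {x : ℝ} (hx : x ∈ I.set) : I.chi x = 1 := by
  unfold Iv.chi
  rw [Metric.infDist_zero_of_mem hx]; simp

lemma local_le {h : ℝ → ℝ} (h0 : ∀ x, 0 ≤ h x) (hi : Integrable h) (I : Iv) (hI : 0 < I.len) (N : ℕ) :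
    ∫ x in I.set, h x ≤ ∫ x, h x * I.chi x ^ N := by
  have hintg : Integrable (fun x => h x * I.chi x ^ N) := by
    refine hi.mono' (hi.aestronglyMeasurable.mul ((chi_meas I).pow_const N).aestronglyMeasurable) ?_
    refine Filter.Eventually.of_forall fun x => ?_
    rw [Real.norm_of_nonneg (mul_nonneg (h0 x) (pow_nonneg (chi_nonneg I hI x) N))]
    exact mul_le_of_le_one_right (h0 x) (pow_le_one₀ (chi_nonneg I hI x) (chi_le_one I hI x))
  calc ∫ x in I.set, h x = ∫ x in I.set, h x * I.chi x ^ N := by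
        apply setIntegral_congr_fun measurableSet_Ioo
        intro x hx
        simp only
        rw [chi_one hx]; simp
    _ ≤ _ := setIntegral_le_integral hintg (Filter.Eventually.of_forall fun x =>
        mul_nonneg (h0 x) (pow_nonneg (chi_nonneg I hI x) N))

lemma lam_to_L {n : ℕ} (e : Fin n) {K0 N : ℕ} (hK0 : 1 ≤ K0) (hN : 2 * K0 + 1 ≤ N) : ∃ C0 : ℝ, 1 ≤ C0 ∧
    ∀ (f : Fin n → ℝ → ℂ) (aa : Fin n → ℝ) (lam : Iv → Fin n → ℝ),
      (∀ i, Measurable (f i)) → (∀ i, Integrable (f i)) → (∀ i, MemLp (f i) 2) →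
      (∀ i, 0 < aa i) → (∀ I i, 0 ≤ lam I i) →
      (∀ I : Iv, 0 < I.len → ∀ i, (∫ x, ‖f i x‖ * I.chi x ^ N) ≤ aa i * lam I i * I.len) →
      (∀ I : Iv, 0 < I.len → ∀ i, (∫ x, ‖f i x‖ ^ 2 * I.chi x ^ N) ≤ lam I i * I.len) →
      (∀ I : Iv, 0 < I.len → lam I e ≤ (1 + ∑ i ∈ Finset.univ.erase e, lam I i) ^ ((1 : ℝ) - N)) →
      ∃ L : Dy → Fin n → ℝ, (∀ I i, 0 ≤ L I i) ∧
        (∀ I i, ∫ x, ‖fw (K0 + 1) I (f i) x‖ ≤ aa i * L I i * len I) ∧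
        (∀ I i, ∫ x, ‖fw (K0 + 1) I (f i) x‖ ^ 2 ≤ L I i * len I) ∧
        (∀ I, L I e ≤ C0 * ((1 + ∑ i ∈ Finset.univ.erase e, L I i) ^ K0)⁻¹) := by
  obtain ⟨C, hC, H⟩ := transfer e hK0 hN
  set b : ℝ := 2 ^ (K0 + 1) with hb
  have hb1 : 1 ≤ b := one_le_pow₀ (by norm_num)
  refine ⟨b * C * b ^ K0, ?_, ?_⟩
  · have : 1 ≤ b ^ K0 := one_le_pow₀ hb1
    have h2 : 1 ≤ b * C := by nlinarith
    nlinarith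
  intro f aa lam hm hi h2 haa hl0 hL1 hL2 hle
  set h : Fin n → ℝ → ℝ := fun i x => (aa i)⁻¹ * ‖f i x‖ + ‖f i x‖ ^ 2 with hh
  have hsq : ∀ i, Integrable (fun x => ‖f i x‖ ^ 2) := fun i => (h2 i).integrable_norm_pow (by norm_num)
  have h0 : ∀ i x, 0 ≤ h i x := fun i x => by have := haa i; simp only [hh]; positivity
  have hintg : ∀ i, Integrable (h i) := fun i => ((hi i).norm.const_mul _).add (hsq i)
  set V : Dy → Fin n → ℝ := fun I i => (len I)⁻¹ * ∫ x, h i x * (kw (len I) (lf I) x ^ (2 * K0 + 2))⁻¹ with hV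
  have hV0 : ∀ I i, 0 ≤ V I i := fun I i => mul_nonneg (inv_nonneg.2 (len_pos I).le)
    (integral_nonneg fun x => mul_nonneg (h0 i x) (kw_inv_nonneg (len_pos I) _ x _))
  have hhk : ∀ I i, Integrable (fun x => h i x * (kw (len I) (lf I) x ^ (2 * K0 + 2))⁻¹) := by
    intro I i
    refine (hintg i).mono' ((hintg i).aestronglyMeasurable.mul
      (kw_inv_cont (len_pos I) _ _).aestronglyMeasurable) ?_
    refine Filter.Eventually.of_forall fun x => ?_
    rw [Real.norm_of_nonneg (mul_nonneg (h0 i x) (kw_inv_nonneg (len_pos I) _ x _))]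
    exact mul_le_of_le_one_right (h0 i x)
      (inv_le_one_of_one_le₀ (one_le_pow₀ (one_le_kw (len_pos I) _ _)))
  have hVl : ∀ I i, V I i * len I = ∫ x, h i x * (kw (len I) (lf I) x ^ (2 * K0 + 2))⁻¹ := by
    intro I i
    simp only [hV]
    have := len_ne I
    field_simp
  have hwq : ∀ I x, (wq (K0 + 1) I x)⁻¹ ≤ b * (kw (len I) (lf I) x ^ (2 * K0 + 2))⁻¹ := by
    intro I x
    have h1 := kw_le_wq (K0 + 1) I x
    have e1 : 2 * (K0 + 1) = 2 * K0 + 2 := by ring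
    rw [e1] at h1
    have hk := kw_pos (len_pos I) (lf I) x
    have hw := wq_pos (K0 + 1) I x
    rw [← div_eq_mul_inv, le_div_iff₀ (by positivity), inv_mul_le_iff₀ hw]
    rw [hb]; linarith
  refine ⟨fun I i => b * V I i, fun I i => mul_nonneg (by linarith) (hV0 I i), ?_, ?_, ?_⟩
  · intro I i
    have ha := haa i
    calc ∫ x, ‖fw (K0 + 1) I (f i) x‖ ≤ ∫ x, (aa i * b) * (h i x * (kw (len I) (lf I) x ^ (2 * K0 + 2))⁻¹) := by
          apply integral_mono_of_nonneg
          · exact Filter.Eventually.of_forall fun x => norm_nonneg _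
          · exact (hhk I i).const_mul _
          · refine Filter.Eventually.of_forall fun x => ?_
            simp only
            rw [fw_norm, div_eq_mul_inv]
            have h3 : ‖f i x‖ ≤ aa i * h i x := by
              simp only [hh]
              rw [mul_add, mul_inv_cancel_left₀ ha.ne']
              have : 0 ≤ aa i * ‖f i x‖ ^ 2 := by positivity
              linarith
            have h4 := hwq I x
            have h5 := wq_pos (K0 + 1) I x
            have h6 := h0 i x
            calc _ ≤ (aa i * h i x) * (b * (kw (len I) (lf I) x ^ (2 * K0 + 2))⁻¹) := by gcongr
              _ = _ := by ring
      _ = _ := by rw [integral_const_mul, ← hVl]; ring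
  · intro I i
    calc ∫ x, ‖fw (K0 + 1) I (f i) x‖ ^ 2 ≤ ∫ x, b * (h i x * (kw (len I) (lf I) x ^ (2 * K0 + 2))⁻¹) := by
          apply integral_mono_of_nonneg
          · exact Filter.Eventually.of_forall fun x => by positivity
          · exact (hhk I i).const_mul _
          · refine Filter.Eventually.of_forall fun x => ?_
            simp only
            rw [fw_norm, div_eq_mul_inv, mul_pow]
            have h3 : ‖f i x‖ ^ 2 ≤ h i x := by
              have := haa i
              simp only [hh]
              have : 0 ≤ (aa i)⁻¹ * ‖f i x‖ := by positivity
              linarith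
            have h4 := hwq I x
            have h5 := wq_pos (K0 + 1) I x
            have h6 := h0 i x
            have h7 : (wq (K0 + 1) I x)⁻¹ ≤ 1 := inv_le_one_of_one_le₀ (one_le_wq _ _ _)
            have h8 : (wq (K0 + 1) I x)⁻¹ ^ 2 ≤ (wq (K0 + 1) I x)⁻¹ := by
              have : 0 < (wq (K0 + 1) I x)⁻¹ := by positivity
              nlinarith
            calc _ ≤ h i x * (b * (kw (len I) (lf I) x ^ (2 * K0 + 2))⁻¹) := by
                  gcongr; exact h8.trans h4
              _ = _ := by ring
      _ = _ := by rw [integral_const_mul, ← hVl]; ring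
  · intro I
    have hpI := len_pos I
    set J : ℕ → Iv := fun r => ⟨lf I - 2 ^ r * len I, 2 * (2 ^ r * len I)⟩ with hJ
    have hJl : ∀ r, 0 < (J r).len := fun r => by simp only [hJ]; positivity
    have hJs : ∀ r, (J r).set = bl (lf I) (len I) r := by
      intro r; simp only [hJ, Iv.set, bl]; congr 1; ring
    have h1 := H (lf I) (len I) hpI h (fun r i => lam (J r) i) h0 hintg (fun r i => hl0 _ i) ?_
      (fun r => hle _ (hJl r))
    · have h3 : V I e ≤ C * ((1 + ∑ i ∈ Finset.univ.erase e, V I i) ^ K0)⁻¹ := by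
        refine le_of_mul_le_mul_right ?_ hpI
        rw [hVl]; exact h1
      have hVs : 0 ≤ ∑ i ∈ Finset.univ.erase e, V I i := Finset.sum_nonneg fun i _ => hV0 I i
      have h4 : 1 + ∑ i ∈ Finset.univ.erase e, b * V I i ≤ b * (1 + ∑ i ∈ Finset.univ.erase e, V I i) := by
        rw [← Finset.mul_sum]; linarith
      have h5 : 0 < 1 + ∑ i ∈ Finset.univ.erase e, b * V I i := by
        rw [← Finset.mul_sum]; nlinarith
      have h6 : (1 + ∑ i ∈ Finset.univ.erase e, b * V I i) ^ K0 ≤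
          b ^ K0 * (1 + ∑ i ∈ Finset.univ.erase e, V I i) ^ K0 := by
        rw [← mul_pow]; gcongr
      have h7 : 0 < b ^ K0 := by positivity
      have h8 : ((1 + ∑ i ∈ Finset.univ.erase e, V I i) ^ K0)⁻¹ ≤
          b ^ K0 * ((1 + ∑ i ∈ Finset.univ.erase e, b * V I i) ^ K0)⁻¹ := by
        rw [← div_eq_mul_inv, le_div_iff₀ (by positivity), inv_mul_le_iff₀ (by positivity)]
        linarith
      calc b * V I e ≤ b * (C * ((1 + ∑ i ∈ Finset.univ.erase e, V I i) ^ K0)⁻¹) := by gcongr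
        _ ≤ b * (C * (b ^ K0 * ((1 + ∑ i ∈ Finset.univ.erase e, b * V I i) ^ K0)⁻¹)) := by gcongr
        _ = _ := by ring
    · intro r i
      have ha := haa i
      rw [← hJs]
      refine (local_le (h0 i) (hintg i) (J r) (hJl r) N).trans ?_
      have hcN : ∀ x, (J r).chi x ^ N ≤ 1 := fun x =>
        pow_le_one₀ (chi_nonneg _ (hJl r) x) (chi_le_one _ (hJl r) x)
      have i1 : Integrable (fun x => ‖f i x‖ * (J r).chi x ^ N) := by
        refine (hi i).norm.mono' ((hi i).norm.aestronglyMeasurable.mul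
          ((chi_meas _).pow_const N).aestronglyMeasurable) ?_
        refine Filter.Eventually.of_forall fun x => ?_
        rw [Real.norm_of_nonneg (mul_nonneg (norm_nonneg _) (pow_nonneg (chi_nonneg _ (hJl r) x) N))]
        exact mul_le_of_le_one_right (norm_nonneg _) (hcN x)
      have i2 : Integrable (fun x => ‖f i x‖ ^ 2 * (J r).chi x ^ N) := by
        refine (hsq i).mono' ((hsq i).aestronglyMeasurable.mul
          ((chi_meas _).pow_const N).aestronglyMeasurable) ?_
        refine Filter.Eventually.of_forall fun x => ?_
        rw [Real.norm_of_nonneg (mul_nonneg (by positivity) (pow_nonneg (chi_nonneg _ (hJl r) x) N))]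
        exact mul_le_of_le_one_right (by positivity) (hcN x)
      have e1 : ∫ x, h i x * (J r).chi x ^ N =
          (aa i)⁻¹ * (∫ x, ‖f i x‖ * (J r).chi x ^ N) + ∫ x, ‖f i x‖ ^ 2 * (J r).chi x ^ N := by
        rw [← integral_const_mul, ← integral_add (i1.const_mul _) i2]
        congr 1; ext x; simp only [hh]; ring
      rw [e1]
      have h3 := hL1 (J r) (hJl r) i
      have h4 := hL2 (J r) (hJl r) i
      have h5 : (aa i)⁻¹ * (∫ x, ‖f i x‖ * (J r).chi x ^ N) ≤ lam (J r) i * (J r).len := by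
        rw [inv_mul_le_iff₀ ha]; linarith
      have h6 : (J r).len = 2 * (2 ^ r * len I) := rfl
      rw [h6] at h4 h5
      linarith

end MTT

namespace MTT

lemma fourier_shift_flip (ψ : ℝ → ℂ) (t ξ : ℝ) :
    𝓕 (fun z => ψ (t - z)) ξ = ee (-(t * ξ)) * 𝓕 ψ (-ξ) := by
  rw [fourier_ee, fourier_ee]
  have h1 : ∀ v, ee (-(v * ξ)) * ψ (t - v) =
      (fun z => ee (-(t * ξ)) * (ee (-(z * -ξ)) * ψ z)) (t - v) := by
    intro v
    simp only
    rw [← mul_assoc, ← ee_add]; congr 2; ring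
  simp_rw [h1]
  rw [integral_sub_left_eq_self (fun z => ee (-(t * ξ)) * (ee (-(z * -ξ)) * ψ z)) volume t]
  rw [integral_const_mul]

/-- A frequency cutoff together with the wave-packet profiles it generates. -/
theorem exists_prof (d : ℕ) {r : ℝ} (hr : 0 < r) : ∃ ρ : ℝ → ℂ, Continuous ρ ∧ HasCompactSupport ρ ∧
    Integrable (𝓕⁻ ρ) ∧ Continuous (𝓕⁻ ρ) ∧
    (∀ x, |x| ≤ r → ρ x = 1) ∧ (∀ x, ‖ρ x‖ ≤ 1) ∧ ∃ C, 0 < C ∧ ∀ t, Prof d (2 * r) (C * (1 + |t|) ^ d) (fun z => 𝓕⁻ ρ (t - z)) := by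
  let b : ContDiffBump (0:ℝ) := ⟨r, 2 * r, hr, by linarith⟩
  let ρ : ℝ → ℂ := fun x => ((b x : ℝ) : ℂ)
  have hcd : ContDiff ℝ (⊤ : ℕ∞) ρ := Complex.ofRealCLM.contDiff.comp b.contDiff
  have hcs : HasCompactSupport ρ := b.hasCompactSupport.comp_left (g := fun x : ℝ => (x : ℂ)) (by simp)
  let S : SchwartzMap ℝ ℂ := hcs.toSchwartzMap hcd
  have hS : (S : ℝ → ℂ) = ρ := rfl
  have hΨ : ((𝓕⁻ S : SchwartzMap ℝ ℂ) : ℝ → ℂ) = 𝓕⁻ ρ := by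
    rw [SchwartzMap.fourierInv_coe, hS]
  have hcont : Continuous (𝓕⁻ ρ) := by rw [← hΨ]; exact (𝓕⁻ S : SchwartzMap ℝ ℂ).continuous
  have hintg : Integrable (𝓕⁻ ρ) := by rw [← hΨ]; exact (𝓕⁻ S : SchwartzMap ℝ ℂ).integrable
  have hF : 𝓕 (𝓕⁻ ρ) = ρ := by
    rw [← hΨ, ← SchwartzMap.fourier_coe]; simp [hS]
  refine ⟨ρ, hcd.continuous, hcs, hintg, hcont, ?_, ?_, ?_⟩
  · intro x hx
    have : b x = 1 := b.one_of_mem_closedBall (by simpa using hx)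
    simp [ρ, this]
  · intro x
    simp only [ρ, Complex.norm_real, Real.norm_of_nonneg b.nonneg]
    exact b.le_one
  set K := (2:ℝ) ^ d * (Finset.Iic (d, 1)).sup (fun m => SchwartzMap.seminorm ℝ m.1 m.2) (𝓕⁻ S : SchwartzMap ℝ ℂ) with hK
  have hK0 : 0 ≤ K := by positivity
  have k0 : ∀ x, (1 + |x|) ^ d * ‖𝓕⁻ ρ x‖ ≤ K := by
    intro x
    have := SchwartzMap.one_add_le_sup_seminorm_apply (𝕜 := ℝ) (m := (d, 1)) (k := d) (n := 0) le_rfl (by norm_num)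
      (𝓕⁻ S) x
    simpa [hΨ] using this
  have k1 : ∀ x, (1 + |x|) ^ d * ‖deriv (𝓕⁻ ρ) x‖ ≤ K := by
    intro x
    have := SchwartzMap.one_add_le_sup_seminorm_apply (𝕜 := ℝ) (m := (d, 1)) (k := d) (n := 1) le_rfl le_rfl
      (𝓕⁻ S) x
    rw [norm_iteratedFDeriv_eq_norm_iteratedDeriv, iteratedDeriv_one, hΨ] at this
    simpa using this
  have key : ∀ t z (w : ℝ), 0 ≤ w → (1 + |t - z|) ^ d * w ≤ K → w ≤ (K + 1) * (1 + |t|) ^ d * (kw 1 0 z ^ d)⁻¹ := by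
    intro t z w hw h
    have h1 : kw 1 0 z ≤ (1 + |t - z|) * (1 + |t|) := by
      unfold kw
      have : |z| ≤ |t - z| + |t| := by
        have := abs_sub_le z t 0
        simp at this; rw [abs_sub_comm] at this; exact this
      simp
      nlinarith [abs_nonneg (t - z), abs_nonneg t, mul_nonneg (abs_nonneg (t - z)) (abs_nonneg t)]
    have h2 : kw 1 0 z ^ d ≤ (1 + |t - z|) ^ d * (1 + |t|) ^ d := by
      rw [← mul_pow]; exact pow_le_pow_left₀ (kw_pos one_pos 0 z).le h1 d
    rw [← div_eq_mul_inv, le_div_iff₀ (pow_pos (kw_pos one_pos 0 z) d)]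
    calc w * kw 1 0 z ^ d ≤ w * ((1 + |t - z|) ^ d * (1 + |t|) ^ d) := by gcongr
      _ = ((1 + |t - z|) ^ d * w) * (1 + |t|) ^ d := by ring
      _ ≤ (K + 1) * (1 + |t|) ^ d := by gcongr; linarith
  refine ⟨K + 1, by linarith, fun t => ⟨?_, ?_, ?_, ?_⟩⟩
  · have : ContDiff ℝ 1 (𝓕⁻ ρ) := by rw [← hΨ]; exact (𝓕⁻ S : SchwartzMap ℝ ℂ).smooth 1
    exact this.comp (contDiff_const.sub contDiff_id)
  · intro z; exact key t z _ (norm_nonneg _) (k0 _)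
  · intro z
    rw [deriv_comp_const_sub, norm_neg]
    exact key t z _ (norm_nonneg _) (k1 _)
  · intro ξ hξ
    rw [fourier_shift_flip, hF]
    have : b (-ξ) = 0 := b.zero_of_le_dist (by simpa using hξ.le)
    simp [ρ, this]

end MTT

namespace MTT

/-- frequency-localised transform -/
def hh (ρ f : ℝ → ℂ) (j q : ℤ) (ζ : ℝ) : ℂ := 𝓕 f ζ * ρ ((2:ℝ) ^ j * ζ - q)

def gg (ρ f : ℝ → ℂ) (j q : ℤ) : ℝ → ℂ := 𝓕⁻ (hh ρ f j q)

section
variable {ρ f : ℝ → ℂ}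

lemma rho_cs (hc : HasCompactSupport ρ) (j q : ℤ) :
    HasCompactSupport (fun ζ : ℝ => ρ ((2:ℝ) ^ j * ζ - q)) := by
  have h2 : ((2:ℝ) ^ j) ≠ 0 := by positivity
  exact hc.comp_homeomorph ((Homeomorph.mulLeft₀ ((2:ℝ) ^ j) h2).trans (Homeomorph.subRight (q:ℝ)))

lemma hh_cont (hρ : Continuous ρ) (hf : Integrable f) (j q : ℤ) : Continuous (hh ρ f j q) := by
  unfold hh
  have := fourier_cont hf
  fun_prop

lemma hh_cs (hc : HasCompactSupport ρ) (j q : ℤ) : HasCompactSupport (hh ρ f j q) :=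
  (rho_cs hc j q).mul_left

lemma hh_int (hρ : Continuous ρ) (hc : HasCompactSupport ρ) (hf : Integrable f) (j q : ℤ) :
    Integrable (hh ρ f j q) :=
  (hh_cont hρ hf j q).integrable_of_hasCompactSupport (hh_cs hc j q)

lemma gg_cont (hρ : Continuous ρ) (hc : HasCompactSupport ρ) (hf : Integrable f) (j q : ℤ) :
    Continuous (gg ρ f j q) := by
  have : gg ρ f j q = fun x => 𝓕 (hh ρ f j q) (-x) := by
    ext x; unfold gg; rw [Real.fourierInv_eq_fourier_neg]
  rw [this]
  exact (fourier_cont (hh_int hρ hc hf j q)).comp continuous_neg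

def kr (ρ : ℝ → ℂ) (j q : ℤ) (x : ℝ) : ℂ :=
  ee (q / (2:ℝ) ^ j * x) * ((((2:ℝ) ^ j)⁻¹ : ℝ) * 𝓕⁻ ρ (x / (2:ℝ) ^ j))

lemma kr_eq (j q : ℤ) (x : ℝ) :
    ∫ ζ, ee (ζ * x) * ρ ((2:ℝ) ^ j * ζ - q) = kr ρ j q x := by
  have hp : (0:ℝ) < (2:ℝ) ^ j := by positivity
  unfold kr
  rw [fourierInv_ee]
  have h1 : ∀ ζ : ℝ, ee (ζ * x) * ρ ((2:ℝ) ^ j * ζ - q) =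
      (fun w : ℝ => (fun v : ℝ => ee (q / (2:ℝ) ^ j * x) * (ee (v * (x / (2:ℝ) ^ j)) * ρ v)) (w - q)) ((2:ℝ) ^ j * ζ) := by
    intro ζ
    simp only
    rw [← mul_assoc, ← ee_add]; congr 2; field_simp; ring
  rw [integral_congr_ae (Filter.Eventually.of_forall h1)]
  rw [Measure.integral_comp_mul_left (fun w : ℝ => (fun v : ℝ => ee (q / (2:ℝ) ^ j * x) * (ee (v * (x / (2:ℝ) ^ j)) * ρ v)) (w - q)), integral_sub_right_eq_self (fun v : ℝ => ee (q / (2:ℝ) ^ j * x) * (ee (v * (x / (2:ℝ) ^ j)) * ρ v)),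
    integral_const_mul, abs_of_pos (by positivity)]
  rw [Complex.real_smul]; ring

lemma gg_eq (hρ : Continuous ρ) (hc : HasCompactSupport ρ) (hf : Integrable f) (j q : ℤ) (x : ℝ) :
    gg ρ f j q x = ∫ y, f y * kr ρ j q (x - y) := by
  unfold gg hh
  rw [fourierInv_ee]
  have hc2 : Continuous fun ζ : ℝ => ee (ζ * x) * ρ ((2:ℝ) ^ j * ζ - q) := by
    have := ee_cont
    fun_prop
  have hi : Integrable fun ζ : ℝ => ee (ζ * x) * ρ ((2:ℝ) ^ j * ζ - q) :=
    hc2.integrable_of_hasCompactSupport (rho_cs hc j q).mul_left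
  have h := fourier_flip hf hi
  have e1 : ∀ v, ee (v * x) * (𝓕 f v * ρ ((2:ℝ) ^ j * v - q)) =
      𝓕 f v * (ee (v * x) * ρ ((2:ℝ) ^ j * v - q)) := fun v => by ring
  simp_rw [e1]
  rw [h]
  congr 1; ext y
  congr 1
  rw [fourier_ee, ← kr_eq]
  congr 1; ext v
  rw [← mul_assoc, ← ee_add]; congr 2; ring

lemma gg_cf (hρ : Continuous ρ) (hc : HasCompactSupport ρ) (hf : Integrable f) (j l q : ℤ) (t : ℝ) :
    ‖gg ρ f j q ((2:ℝ) ^ j * (l + t))‖ = cf (fun z => 𝓕⁻ ρ (t - z)) f ((j, l), q) := by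
  have hp : (0:ℝ) < (2:ℝ) ^ j := by positivity
  rw [gg_eq hρ hc hf]
  unfold cf
  have e1 : ∀ y, f y * kr ρ j q ((2:ℝ) ^ j * (l + t) - y) =
      ee (q * (l + t)) * (f y * pk (fun z => 𝓕⁻ ρ (t - z)) ((j, l), q) y) := by
    intro y
    unfold kr pk fr lf len
    simp only
    have a1 : ((2:ℝ) ^ j * (l + t) - y) / (2:ℝ) ^ j = t - (y - (2:ℝ) ^ j * l) / (2:ℝ) ^ j := by
      field_simp; ring
    have a2 : ee (q / (2:ℝ) ^ j * ((2:ℝ) ^ j * (l + t) - y)) = ee (q * (l + t)) * ee (-(q / (2:ℝ) ^ j * y)) := by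
      rw [← ee_add]; congr 1; field_simp; ring
    rw [a1, a2]; ring
  simp_rw [e1]
  rw [integral_const_mul, norm_mul, norm_ee, one_mul]

lemma kr_int (hΨ : Integrable (𝓕⁻ ρ)) (j q : ℤ) : Integrable (kr ρ j q) := by
  have hp : (2:ℝ) ^ j ≠ 0 := by positivity
  have h1 : Integrable fun x => 𝓕⁻ ρ (x / (2:ℝ) ^ j) := hΨ.comp_div hp
  have hc : Continuous fun x : ℝ => ee (q / (2:ℝ) ^ j * x) := by
    have := ee_cont
    fun_prop
  unfold kr
  exact (h1.const_mul _).bdd_mul (c := 1) hc.aestronglyMeasurable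
    (Filter.Eventually.of_forall fun x => (norm_ee _).le)

lemma gg_int (hρ : Continuous ρ) (hc : HasCompactSupport ρ) (hΨ : Integrable (𝓕⁻ ρ)) (hf : Integrable f) (j q : ℤ) :
    Integrable (gg ρ f j q) := by
  have := hf.integrable_convolution (ContinuousLinearMap.mul ℝ ℂ) (kr_int hΨ j q)
  refine this.congr (Filter.Eventually.of_forall fun x => ?_)
  rw [gg_eq hρ hc hf]; rfl

lemma fourier_gg (hρ : Continuous ρ) (hc : HasCompactSupport ρ) (hΨ : Integrable (𝓕⁻ ρ)) (hf : Integrable f) (j q : ℤ) :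
    𝓕 (gg ρ f j q) = hh ρ f j q := by
  have h := hh_cont (j := j) (q := q) hρ hf
  have h2 := gg_int hρ hc hΨ hf j q
  unfold gg at h2 ⊢
  apply h.fourier_fourierInv_eq (hh_int hρ hc hf j q)
  have : 𝓕 (hh ρ f j q) = fun x => 𝓕⁻ (hh ρ f j q) (-x) := by
    ext x; rw [Real.fourierInv_eq_fourier_neg, neg_neg]
  rw [this]
  exact h2.comp_neg

end

end MTT

namespace MTT

def gp {d : ℕ} (η : Fin d → ℝ) : Fin (d + 1) → ℝ := Fin.snoc (α := fun _ => ℝ) η (-∑ i, η i)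
def gq {d : ℕ} (q : Fin d → ℤ) : Fin (d + 1) → ℤ := Fin.snoc (α := fun _ => ℤ) q (-∑ i, q i)
def us {d : ℕ} (u : Fin d → ℝ) : Fin (d + 1) → ℝ := Fin.snoc (α := fun _ => ℝ) u 0

@[simp] lemma gp_castSucc {d : ℕ} (η : Fin d → ℝ) (i : Fin d) : gp η i.castSucc = η i := by simp [gp]
@[simp] lemma gp_last {d : ℕ} (η : Fin d → ℝ) : gp η (Fin.last d) = -∑ i, η i := by simp [gp]
@[simp] lemma gq_castSucc {d : ℕ} (η : Fin d → ℤ) (i : Fin d) : gq η i.castSucc = η i := by simp [gq]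
@[simp] lemma gq_last {d : ℕ} (η : Fin d → ℤ) : gq η (Fin.last d) = -∑ i, η i := by simp [gq]
@[simp] lemma us_castSucc {d : ℕ} (η : Fin d → ℝ) (i : Fin d) : us η i.castSucc = η i := by simp [us]
@[simp] lemma us_last {d : ℕ} (η : Fin d → ℝ) : us η (Fin.last d) = 0 := by simp [us]

lemma gammaParam_eq {d : ℕ} (η : Fin d → ℝ) : gammaParam (d + 1) η = gp η := by
  ext i
  refine Fin.lastCases ?_ (fun i => ?_) i
  · simp [gammaParam]
  · have : (i.castSucc : ℕ) < d + 1 - 1 := by simp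
    simp only [gammaParam, this, dif_pos, gp_castSucc]
    rfl

lemma gp_cont {d : ℕ} (i : Fin (d + 1)) : Continuous fun η : Fin d → ℝ => gp η i := by
  refine Fin.lastCases ?_ (fun i => ?_) i
  · simp only [gp_last]; fun_prop
  · simp only [gp_castSucc]; fun_prop

lemma enorm_prod0 {ι : Type*} (s : Finset ι) (t : ι → ℂ) : ‖∏ i ∈ s, t i‖ₑ = ∏ i ∈ s, ‖t i‖ₑ := by
  induction s using Finset.induction_on with
  | empty => simp
  | insert a s ha ih => rw [Finset.prod_insert ha, Finset.prod_insert ha, enorm_mul, ih]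

lemma ee_sum {ι : Type*} (s : Finset ι) (t : ι → ℝ) : ee (∑ i ∈ s, t i) = ∏ i ∈ s, ee (t i) := by
  induction s using Finset.induction_on with
  | empty => simp [ee_zero]
  | insert a s ha ih => rw [Finset.sum_insert ha, Finset.prod_insert ha, ee_add, ih]

section
variable {ρ : ℝ → ℂ} {d : ℕ} {f : Fin (d + 1) → ℝ → ℂ}

lemma hprod_int (hρ : Continuous ρ) (hc : HasCompactSupport ρ) (hf : ∀ i, Integrable (f i)) (j : ℤ)
    (q : Fin d → ℤ) : Integrable fun η : Fin d → ℝ =>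
      ∏ i : Fin d, hh ρ (f i.castSucc) j (q i) (η i) :=
  Integrable.fintype_prod (f := fun (i : Fin d) => hh ρ (f i.castSucc) j (q i))
    fun i => hh_int hρ hc (hf _) j (q i)

lemma inner_id (hρ : Continuous ρ) (hc : HasCompactSupport ρ) (hΨ : Integrable (𝓕⁻ ρ))
    (hf : ∀ i, Integrable (f i)) (j : ℤ) (q : Fin d → ℤ) (u : Fin d → ℝ) :
    ∫ η : Fin d → ℝ, ee ((2:ℝ) ^ j * ∑ i, u i * η i) * ∏ i, hh ρ (f i) j (gq q i) (gp η i) =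
      ∫ x, ∏ i, gg ρ (f i) j (gq q i) (x + (2:ℝ) ^ j * us u i) := by
  have hE := ee_cont
  set gl := gg ρ (f (Fin.last d)) j (gq q (Fin.last d)) with hgl
  set P : (Fin d → ℝ) → ℂ := fun η => ∏ i : Fin d, hh ρ (f i.castSucc) j (q i) (η i) with hP
  have hPi : Integrable P := hprod_int hρ hc hf j q
  have hgi : Integrable gl := gg_int hρ hc hΨ (hf _) j _
  have e1 : ∀ η : Fin d → ℝ, ee ((2:ℝ) ^ j * ∑ i, u i * η i) * ∏ i, hh ρ (f i) j (gq q i) (gp η i)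
      = ∫ x, ee ((2:ℝ) ^ j * (∑ i, u i * η i) + x * ∑ i, η i) * (P η * gl x) := by
    intro η
    rw [Fin.prod_univ_castSucc, ← fourier_gg hρ hc hΨ (hf (Fin.last d)), fourier_ee]
    simp only [gp_castSucc, gq_castSucc, gp_last]
    rw [← integral_const_mul, ← integral_const_mul]
    congr 1; ext x
    rw [ee_add]
    simp only [hP, hgl, mul_neg, neg_neg]
    ring
  simp_rw [e1]
  rw [integral_integral_swap]
  · congr 1; ext x
    rw [Fin.prod_univ_castSucc]
    simp only [gq_castSucc, us_castSucc, us_last, mul_zero, add_zero]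
    have e2 : ∀ η : Fin d → ℝ, ee ((2:ℝ) ^ j * (∑ i, u i * η i) + x * ∑ i, η i) * (P η * gl x) =
        (∏ i, (fun (i : Fin d) (t : ℝ) => ee (t * (x + (2:ℝ) ^ j * u i)) * hh ρ (f i.castSucc) j (q i) t) i (η i)) * gl x := by
      intro η
      rw [← mul_assoc, Finset.prod_mul_distrib, ← ee_sum]
      congr 3
      rw [Finset.mul_sum, Finset.mul_sum, ← Finset.sum_add_distrib]
      exact Finset.sum_congr rfl fun i _ => by ring
    simp_rw [e2]
    rw [integral_mul_const]
    congr 1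
    refine (integral_fintype_prod_volume_eq_prod (fun (i : Fin d) (t : ℝ) => ee (t * (x + (2:ℝ) ^ j * u i)) * hh ρ (f i.castSucc) j (q i) t)).trans ?_
    refine Finset.prod_congr rfl fun i _ => ?_
    unfold gg; rw [fourierInv_ee]
  · have := hPi.mul_prod hgi
    refine this.bdd_mul (c := 1) (f := fun z : (Fin d → ℝ) × ℝ => ee ((2:ℝ) ^ j * (∑ i, u i * z.1 i) + z.2 * ∑ i, z.1 i)) ?_ ?_
    · apply Continuous.aestronglyMeasurable; fun_prop
    · exact Filter.Eventually.of_forall fun z => (norm_ee _).le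

lemma hpn_int (hρ : Continuous ρ) (hc : HasCompactSupport ρ)
    (hf : ∀ i, Integrable (f i)) (j : ℤ) (q : Fin d → ℤ) :
    Integrable fun η : Fin d → ℝ => ∏ i, hh ρ (f i) j (gq q i) (gp η i) := by
  have h1 := hprod_int hρ hc hf j q
  have hcn := hh_cont (j := j) (q := gq q (Fin.last d)) hρ (hf (Fin.last d))
  have hcs := hh_cs (f := f (Fin.last d)) hc j (gq q (Fin.last d))
  obtain ⟨C, hC⟩ := hcn.bounded_above_of_compact_support hcs
  have := h1.mul_bdd (c := C) (g := fun η => hh ρ (f (Fin.last d)) j (gq q (Fin.last d)) (gp η (Fin.last d)))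
    (hcn.comp (gp_cont _)).aestronglyMeasurable (Filter.Eventually.of_forall fun η => hC _)
  refine this.congr (Filter.Eventually.of_forall fun η => ?_)
  simp only [Fin.prod_univ_castSucc (n := d), gp_castSucc, gq_castSucc]

theorem piece_le (hρ : Continuous ρ) (hc : HasCompactSupport ρ) (hΨ : Integrable (𝓕⁻ ρ))
    (hρ1 : ∀ x : ℝ, |x| ≤ 2 * (d + 1) → ρ x = 1)
    (hf : ∀ i, Integrable (f i)) (j : ℤ) (q : Fin d → ℤ)
    (M : EuclideanSpace ℝ (Fin d) → ℂ) (hM : Continuous M) (hMi : Integrable M)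
    (hMF : Integrable (𝓕 M)) (hMs : ∀ y, M y ≠ 0 → ∀ i, |y i| ≤ 2) :
    ‖∫ η : Fin d → ℝ, M (WithLp.toLp 2 (fun i => (2:ℝ) ^ j * η i - q i)) *
        ∏ i, 𝓕 (f i) (gp η i)‖ₑ ≤
      ∫⁻ u : EuclideanSpace ℝ (Fin d), ‖𝓕 M u‖ₑ *
        ∫⁻ x : ℝ, ∏ i, ‖gg ρ (f i) j (gq q i) (x + (2:ℝ) ^ j * us u.ofLp i)‖ₑ := by
  have hE := ee_cont
  set P : (Fin d → ℝ) → ℂ := fun η => ∏ i, hh ρ (f i) j (gq q i) (gp η i) with hP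
  have hPi : Integrable P := hpn_int hρ hc hf j q
  have e0 : ∀ η : Fin d → ℝ, M (WithLp.toLp 2 (fun i => (2:ℝ) ^ j * η i - q i)) *
        ∏ i, 𝓕 (f i) (gp η i) = M (WithLp.toLp 2 (fun i => (2:ℝ) ^ j * η i - q i)) * P η := by
    intro η
    by_cases h0 : M (WithLp.toLp 2 (fun i => (2:ℝ) ^ j * η i - q i)) = 0
    · simp [h0]
    have h1 := hMs _ h0
    simp only at h1
    congr 1
    refine Finset.prod_congr rfl fun i _ => ?_
    unfold hh
    rw [hρ1, mul_one]
    refine Fin.lastCases ?_ (fun i => ?_) i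
    · simp only [gp_last, gq_last]
      have : (2:ℝ) ^ j * -∑ i, η i - ((-∑ i, q i : ℤ) : ℝ) = -∑ i, ((2:ℝ) ^ j * η i - q i) := by
        rw [Finset.sum_sub_distrib, ← Finset.mul_sum]; push_cast; ring
      rw [this, abs_neg]
      refine (Finset.abs_sum_le_sum_abs _ _).trans ((Finset.sum_le_sum fun i _ => h1 i).trans ?_)
      simp; linarith
    · simp only [gp_castSucc, gq_castSucc]
      have := h1 i
      have : (0:ℝ) ≤ d := by positivity
      linarith [h1 i]
  have e1 : ∀ η : Fin d → ℝ, M (WithLp.toLp 2 (fun i => (2:ℝ) ^ j * η i - q i)) * P η =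
      ∫ u : EuclideanSpace ℝ (Fin d), ee (∑ i, u i * ((2:ℝ) ^ j * η i - q i)) * (P η * 𝓕 M u) := by
    intro η
    conv_lhs => rw [← hM.fourierInv_fourier_eq hMi hMF, Real.fourierInv_eq']
    rw [← integral_mul_const]
    congr 1; ext u
    have : (inner ℝ u (WithLp.toLp 2 (fun i => (2:ℝ) ^ j * η i - q i)) : ℝ) =
        ∑ i, u i * ((2:ℝ) ^ j * η i - q i) := by
      rw [PiLp.inner_apply]
      refine Finset.sum_congr rfl fun i _ => ?_
      simp [mul_comm]
    rw [this, smul_eq_mul]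
    unfold ee
    ring
  simp_rw [e0, e1]
  rw [integral_integral_swap]
  · refine (enorm_integral_le_lintegral_enorm _).trans (lintegral_mono fun u => ?_)
    have e2 : ∀ η : Fin d → ℝ, ee (∑ i, u i * ((2:ℝ) ^ j * η i - q i)) * (P η * 𝓕 M u) =
        (ee (-∑ i, u i * q i) * 𝓕 M u) * (ee ((2:ℝ) ^ j * ∑ i, u i * η i) * P η) := by
      intro η
      have : ∑ i, u i * ((2:ℝ) ^ j * η i - q i) = -∑ i, u i * q i + (2:ℝ) ^ j * ∑ i, u i * η i := by
        rw [Finset.mul_sum, neg_add_eq_sub, ← Finset.sum_sub_distrib]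
        exact Finset.sum_congr rfl fun i _ => by ring
      rw [this, ee_add]; ring
    simp_rw [e2]
    rw [integral_const_mul, inner_id hρ hc hΨ hf, enorm_mul, enorm_mul]
    have : ‖ee (-∑ i, u i * q i)‖ₑ = 1 := by
      rw [← ofReal_norm, norm_ee]; simp
    rw [this, one_mul]
    gcongr
    refine (enorm_integral_le_lintegral_enorm _).trans (lintegral_mono fun x => ?_)
    rw [enorm_prod0]
  · have := hPi.mul_prod hMF
    refine this.bdd_mul (c := 1) (f := fun z : (Fin d → ℝ) × EuclideanSpace ℝ (Fin d) => ee (∑ i, z.2 i * ((2:ℝ) ^ j * z.1 i - q i))) ?_ ?_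
    · apply Continuous.aestronglyMeasurable; fun_prop
    · exact Filter.Eventually.of_forall fun z => (norm_ee _).le

end
end MTT

namespace MTT

lemma lintegral_tile {F : ℝ → ℝ≥0∞} (hF : Measurable F) (j : ℤ) :
    ∫⁻ x, F x = ∫⁻ v in Set.Ioc (0:ℝ) 1, ∑' l : ℤ, ENNReal.ofReal ((2:ℝ) ^ j) * F ((2:ℝ) ^ j * (l + v)) := by
  have hp : (0:ℝ) < (2:ℝ) ^ j := by positivity
  have h1 : ∫⁻ x, F x = ENNReal.ofReal ((2:ℝ) ^ j) * ∫⁻ y, F ((2:ℝ) ^ j * y) := by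
    conv_lhs => rw [← Real.smul_map_volume_mul_left hp.ne']
    rw [lintegral_smul_measure, lintegral_map hF (by fun_prop), abs_of_pos hp, smul_eq_mul]
  have hm : Measurable fun y => F ((2:ℝ) ^ j * y) := hF.comp (by fun_prop)
  have h2 : ∫⁻ y, F ((2:ℝ) ^ j * y) = ∑' l : ℤ, ∫⁻ v in Set.Ioc (0:ℝ) 1, F ((2:ℝ) ^ j * (l + v)) := by
    rw [← setLIntegral_univ, ← iUnion_Ioc_intCast, lintegral_iUnion (fun _ => measurableSet_Ioc) (Set.pairwise_disjoint_Ioc_intCast ℝ)]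
    refine tsum_congr fun l => ?_
    have := (measurePreserving_add_left volume (l:ℝ)).setLIntegral_comp_preimage
      (s := Set.Ioc (l:ℝ) (l + 1)) measurableSet_Ioc hm
    rw [← this]
    congr 2
    ext v; simp
  rw [h1, h2, lintegral_tsum (fun l => ?_)]
  · rw [← ENNReal.tsum_mul_left]
    refine tsum_congr fun l => ?_
    have hml : Measurable fun v : ℝ => F ((2:ℝ) ^ j * ((l:ℝ) + v)) := hF.comp (by fun_prop)
    rw [lintegral_const_mul _ hml]
  · exact ((hF.comp (by fun_prop)).const_mul _).aemeasurable

section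
variable {ρ : ℝ → ℂ} {d : ℕ} {f : Fin (d + 1) → ℝ → ℂ}

theorem sum_pieces (hρ : Continuous ρ) (hc : HasCompactSupport ρ)
    (hf : ∀ i, Integrable (f i)) (d0 : ℕ) {CM : ℝ} (hCM : 0 ≤ CM) (good : (Fin (d + 1) → ℤ) → Prop)
    (hmod : ∀ t : Fin (d + 1) → ℝ, ∀ PP : Finset (MT (d + 1)), (∀ P ∈ PP, good P.2) →
      ∑ P ∈ PP, len P.1 * ∏ i, cf (fun z => 𝓕⁻ ρ (t i - z)) (f i) (tl P i) ≤ CM * ∏ i, (1 + |t i|) ^ d0)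
    (S : Finset (ℤ × (Fin d → ℤ))) (hS : ∀ s ∈ S, good (gq s.2)) (W : EuclideanSpace ℝ (Fin d) → ℝ≥0∞)
    (hW : Measurable W) :
    ∑ s ∈ S, ∫⁻ u : EuclideanSpace ℝ (Fin d), W u *
        ∫⁻ x : ℝ, ∏ i, ‖gg ρ (f i) s.1 (gq s.2 i) (x + (2:ℝ) ^ s.1 * us u.ofLp i)‖ₑ ≤
    ∫⁻ u : EuclideanSpace ℝ (Fin d), W u * ENNReal.ofReal (CM * ((2 + ‖u‖) ^ d0) ^ (d + 1)) := by
  have husc : ∀ i, Continuous fun u : EuclideanSpace ℝ (Fin d) => us u.ofLp i := by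
    intro i
    refine Fin.lastCases ?_ (fun i => ?_) i
    · simp only [us_last]; fun_prop
    · simp only [us_castSucc]; fun_prop
  have hus : ∀ i (u : EuclideanSpace ℝ (Fin d)), |us u.ofLp i| ≤ ‖u‖ := by
    intro i u
    refine Fin.lastCases ?_ (fun i => ?_) i
    · simp
    · simp only [us_castSucc]
      exact PiLp.norm_apply_le u i
  have hmeas : ∀ s : ℤ × (Fin d → ℤ), Measurable fun z : EuclideanSpace ℝ (Fin d) × ℝ =>
      ∏ i, ‖gg ρ (f i) s.1 (gq s.2 i) (z.2 + (2:ℝ) ^ s.1 * us z.1.ofLp i)‖ₑ := by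
    intro s
    refine Finset.measurable_prod _ fun i _ => ?_
    have h1 := gg_cont (j := s.1) (q := gq s.2 i) hρ hc (hf i)
    have h2 := husc i
    refine Measurable.enorm ?_
    apply Continuous.measurable
    exact h1.comp (continuous_snd.add (continuous_const.mul (h2.comp continuous_fst)))
  rw [← lintegral_finsetSum]
  · refine lintegral_mono fun u => ?_
    rw [← Finset.mul_sum]
    gcongr
    have hm2 : ∀ s : ℤ × (Fin d → ℤ), Measurable fun x : ℝ =>
      ∏ i, ‖gg ρ (f i) s.1 (gq s.2 i) (x + (2:ℝ) ^ s.1 * us u.ofLp i)‖ₑ := fun s =>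
      Measurable.comp (hmeas s) (f := fun x : ℝ => (u, x)) (measurable_const.prodMk measurable_id)
    have e1 : ∀ s : ℤ × (Fin d → ℤ), ∫⁻ x : ℝ, ∏ i, ‖gg ρ (f i) s.1 (gq s.2 i) (x + (2:ℝ) ^ s.1 * us u.ofLp i)‖ₑ =
        ∫⁻ v in Set.Ioc (0:ℝ) 1, ∑' l : ℤ, ENNReal.ofReal (len (s.1, l) *
          ∏ i, cf (fun z => 𝓕⁻ ρ ((v + us u.ofLp i) - z)) (f i) (tl ((s.1, l), gq s.2) i)) := by
      intro s
      rw [lintegral_tile (hm2 s) s.1]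
      congr 1; ext v
      refine tsum_congr fun l => ?_
      rw [ENNReal.ofReal_mul (len_pos _).le, ENNReal.ofReal_prod_of_nonneg (fun i _ => cf_nonneg _ _ _)]
      congr 1
      refine Finset.prod_congr rfl fun i _ => ?_
      unfold tl
      rw [← gg_cf hρ hc (hf i), ofReal_norm]
      congr 2; simp only; ring
    have hm3 : ∀ s : ℤ × (Fin d → ℤ), Measurable fun v : ℝ => ∑' l : ℤ, ENNReal.ofReal (len (s.1, l) *
          ∏ i, cf (fun z => 𝓕⁻ ρ ((v + us u.ofLp i) - z)) (f i) (tl ((s.1, l), gq s.2) i)) := by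
      intro s
      refine Measurable.tsum fun l => ENNReal.measurable_ofReal.comp ?_
      refine Measurable.const_mul ?_ _
      refine Finset.measurable_prod _ fun i _ => ?_
      have h1 := (gg_cont (j := s.1) (q := gq s.2 i) hρ hc (hf i)).norm
      have : (fun v => cf (fun z => 𝓕⁻ ρ ((v + us u.ofLp i) - z)) (f i) (tl ((s.1, l), gq s.2) i)) =
          fun v => ‖gg ρ (f i) s.1 (gq s.2 i) ((2:ℝ) ^ s.1 * (l + (v + us u.ofLp i)))‖ := by
        ext v; rw [gg_cf hρ hc (hf i)]; rfl
      rw [this]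
      apply Continuous.measurable
      exact h1.comp (by fun_prop)
    simp_rw [e1]
    rw [← lintegral_finsetSum _ (fun s _ => hm3 s)]
    have : ∀ v ∈ Set.Ioc (0:ℝ) 1, ∑ s ∈ S, ∑' l : ℤ, ENNReal.ofReal (len (s.1, l) *
          ∏ i, cf (fun z => 𝓕⁻ ρ ((v + us u.ofLp i) - z)) (f i) (tl ((s.1, l), gq s.2) i)) ≤
          ENNReal.ofReal (CM * ((2 + ‖u‖) ^ d0) ^ (d + 1)) := by
      intro v hv
      rw [← Summable.tsum_finsetSum (fun s _ => ENNReal.summable), ENNReal.tsum_eq_iSup_sum]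
      refine iSup_le fun T => ?_
      have hnn : ∀ (s : ℤ × (Fin d → ℤ)) (l : ℤ), 0 ≤ len (s.1, l) *
          ∏ i, cf (fun z => 𝓕⁻ ρ ((v + us u.ofLp i) - z)) (f i) (tl ((s.1, l), gq s.2) i) := fun s l =>
        mul_nonneg (len_pos _).le (Finset.prod_nonneg fun i _ => cf_nonneg _ _ _)
      have e3 : ∀ l, ∑ s ∈ S, ENNReal.ofReal (len (s.1, l) *
          ∏ i, cf (fun z => 𝓕⁻ ρ ((v + us u.ofLp i) - z)) (f i) (tl ((s.1, l), gq s.2) i)) =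
          ENNReal.ofReal (∑ s ∈ S, len (s.1, l) *
          ∏ i, cf (fun z => 𝓕⁻ ρ ((v + us u.ofLp i) - z)) (f i) (tl ((s.1, l), gq s.2) i)) := fun l =>
        (ENNReal.ofReal_sum_of_nonneg fun s _ => hnn s l).symm
      simp_rw [e3]
      rw [← ENNReal.ofReal_sum_of_nonneg (fun l _ => Finset.sum_nonneg fun s _ => hnn s l)]
      apply ENNReal.ofReal_le_ofReal
      rw [← Finset.sum_product']
      set g : ℤ × (ℤ × (Fin d → ℤ)) → MT (d + 1) := fun p => ((p.2.1, p.1), gq p.2.2) with hg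
      have hginj : Function.Injective g := by
        rintro ⟨l, j, q⟩ ⟨l', j', q'⟩ h
        simp only [hg, Prod.mk.injEq] at h
        obtain ⟨⟨h1, h2⟩, h3⟩ := h
        have : q = q' := by
          ext i
          have := congrFun h3 i.castSucc
          simpa using this
        simp [h1, h2, this]
      have := hmod (fun i => v + us u.ofLp i) ((T ×ˢ S).image g) (by
        intro P hP
        obtain ⟨p, hp, rfl⟩ := Finset.mem_image.1 hP
        exact hS _ (Finset.mem_product.1 hp).2)
      rw [Finset.sum_image (fun a _ b _ h => hginj h)] at this
      refine this.trans ?_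
      gcongr
      calc ∏ i : Fin (d + 1), (1 + |v + us u.ofLp i|) ^ d0 ≤ ∏ i : Fin (d + 1), (2 + ‖u‖) ^ d0 := by
            refine Finset.prod_le_prod (fun i _ => by positivity) fun i _ => ?_
            refine pow_le_pow_left₀ (by positivity) ?_ _
            have h1 := abs_add_le v (us u.ofLp i)
            have h2 := hus i u
            have h3 : |v| ≤ 1 := by rw [abs_of_pos hv.1]; exact hv.2
            linarith
        _ = ((2 + ‖u‖) ^ d0) ^ (d + 1) := by simp
    refine (setLIntegral_mono measurable_const this).trans ?_
    simp
  · intro s _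
    exact hW.mul (hmeas s).lintegral_prod_right'

end
end MTT

namespace MTT

lemma bdd_deriv {V : Type*} [NormedAddCommGroup V] [NormedSpace ℝ V] {h : V → ℂ}
    (hs : ContDiff ℝ (⊤ : ℕ∞) h) (hc : HasCompactSupport h) (a : ℕ) :
    ∃ C, ∀ x, ‖iteratedFDeriv ℝ a h x‖ ≤ C := by
  obtain ⟨C, hC⟩ := (hs.continuous_iteratedFDeriv (m := a) (by exact_mod_cast le_top)).bounded_above_of_compact_support
    (hc.iteratedFDeriv (𝕜 := ℝ) a)
  exact ⟨C, hC⟩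

lemma comp_deriv {V W : Type*} [NormedAddCommGroup V] [NormedSpace ℝ V] [NormedAddCommGroup W] [NormedSpace ℝ W]
    {h : V → ℂ} (hs : ContDiff ℝ (⊤ : ℕ∞) h) {a : ℕ} {C : ℝ} (hC : ∀ x, ‖iteratedFDeriv ℝ a h x‖ ≤ C)
    (T : W →L[ℝ] V) (x : W) : ‖iteratedFDeriv ℝ a (fun y => h (T y)) x‖ ≤ C * ‖T‖ ^ a := by
  have h1 : iteratedFDeriv ℝ a (fun y => h (T y)) x = (iteratedFDeriv ℝ a h (T x)).compContinuousLinearMap fun _ => T :=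
    T.iteratedFDeriv_comp_right hs x (by exact_mod_cast le_top)
  rw [h1]
  refine (ContinuousMultilinearMap.norm_compContinuousLinearMap_le _ _).trans ?_
  simp only [Finset.prod_const, Finset.card_univ, Fintype.card_fin]
  gcongr
  exact hC _

/-- A smooth cutoff adapted to the distance to a subspace. -/
theorem exists_chi {n : ℕ} (Γ : Submodule ℝ (Fin n → ℝ)) : ∃ χ : (Fin n → ℝ) → ℂ,
    ContDiff ℝ (⊤ : ℕ∞) χ ∧ (∀ ξ, Metric.infDist ξ (Γ : Set (Fin n → ℝ)) ≤ 1 → χ ξ = 1) ∧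
    (∀ ξ, 2 ≤ Metric.infDist ξ (Γ : Set (Fin n → ℝ)) → χ ξ = 0) ∧ (∀ ξ, ‖χ ξ‖ ≤ 1) ∧
    ∀ a : ℕ, ∃ C, ∀ ξ, ‖iteratedFDeriv ℝ a χ ξ‖ ≤ C := by
  have : IsClosed (Γ : Set (Fin n → ℝ)) := Submodule.closed_of_finiteDimensional Γ
  let V := (Fin n → ℝ) ⧸ Γ
  let pr : (Fin n → ℝ) →L[ℝ] V := Γ.mkQL
  have hpr : ∀ ξ, ‖pr ξ‖ = Metric.infDist ξ (Γ : Set (Fin n → ℝ)) := fun ξ =>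
    QuotientAddGroup.norm_mk (S := Γ.toAddSubgroup) ξ
  let b : ContDiffBump (0 : V) := ⟨1, 2, one_pos, by norm_num⟩
  have hcd : ContDiff ℝ (⊤ : ℕ∞) (fun x : V => ((b x : ℝ) : ℂ)) := Complex.ofRealCLM.contDiff.comp b.contDiff
  have hcs : HasCompactSupport (fun x : V => ((b x : ℝ) : ℂ)) :=
    b.hasCompactSupport.comp_left (g := fun x : ℝ => (x : ℂ)) (by simp)
  refine ⟨fun ξ => ((b (pr ξ) : ℝ) : ℂ), hcd.comp pr.contDiff, ?_, ?_, ?_, ?_⟩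
  · intro ξ h
    have : b (pr ξ) = 1 := b.one_of_mem_closedBall (by simpa [hpr] using h)
    simp [this]
  · intro ξ h
    have : b (pr ξ) = 0 := b.zero_of_le_dist (by simpa [hpr] using h)
    simp [this]
  · intro ξ
    simp only [Complex.norm_real, Real.norm_of_nonneg b.nonneg]
    exact b.le_one
  · intro a
    obtain ⟨C, hC⟩ := bdd_deriv hcd hcs a
    exact ⟨_, fun ξ => comp_deriv hcd hC pr ξ⟩

lemma infDist_smul {n : ℕ} (Γ : Submodule ℝ (Fin n → ℝ)) {c : ℝ} (hc : 0 < c) (ξ : Fin n → ℝ) :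
    Metric.infDist (c • ξ) (Γ : Set (Fin n → ℝ)) = c * Metric.infDist ξ (Γ : Set (Fin n → ℝ)) := by
  have : IsClosed (Γ : Set (Fin n → ℝ)) := Submodule.closed_of_finiteDimensional Γ
  let pr : (Fin n → ℝ) →L[ℝ] ((Fin n → ℝ) ⧸ Γ) := Γ.mkQL
  have hpr : ∀ ξ, ‖pr ξ‖ = Metric.infDist ξ (Γ : Set (Fin n → ℝ)) := fun ξ =>
    QuotientAddGroup.norm_mk (S := Γ.toAddSubgroup) ξ
  rw [← hpr, ← hpr, map_smul, norm_smul, Real.norm_of_nonneg hc.le]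

/-- parametrisation of the hyperplane as a continuous linear map -/
def GLin (d : ℕ) : EuclideanSpace ℝ (Fin d) →L[ℝ] (Fin (d + 1) → ℝ) :=
  LinearMap.toContinuousLinearMap
    { toFun := fun y => gp y.ofLp
      map_add' := by
        intro x y; ext i
        refine Fin.lastCases ?_ (fun i => ?_) i
        · simp [Finset.sum_add_distrib]; ring
        · simp
      map_smul' := by
        intro c x; ext i
        refine Fin.lastCases ?_ (fun i => ?_) i
        · simp [Finset.mul_sum]
        · simp }

lemma GLin_apply {d : ℕ} (y : EuclideanSpace ℝ (Fin d)) : GLin d y = gp y.ofLp := rfl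

lemma GLin_mem {d : ℕ} (y : EuclideanSpace ℝ (Fin d)) : GLin d y ∈ GammaSet (d + 1) := by
  rw [GLin_apply]
  simp [GammaSet, Fin.sum_univ_castSucc]

lemma sym_deriv {d M : ℕ} {Γ : Submodule ℝ (Fin (d + 1) → ℝ)} {B : ℝ} {m : (Fin (d + 1) → ℝ) → ℂ}
    (hm : SymbolEst (d + 1) Γ M B m) {c : ℝ} (hc : 0 < c) {a : ℕ} (ha : a ≤ M)
    {W : Set (EuclideanSpace ℝ (Fin d))} (hW : W = {y | GLin d y ∉ Γ}) {y} (hy : y ∈ W) :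
    ‖iteratedFDerivWithin ℝ a (fun y => m (c • GLin d y)) W y‖ ≤
      B * (‖GLin d‖ / Metric.infDist (GLin d y) (Γ : Set (Fin (d + 1) → ℝ))) ^ a := by
  have hcl : IsClosed (Γ : Set (Fin (d + 1) → ℝ)) := Submodule.closed_of_finiteDimensional Γ
  have hcm : ∀ ξ, c • ξ ∈ Γ ↔ ξ ∈ Γ := fun ξ => Submodule.smul_mem_iff _ hc.ne'
  set T : EuclideanSpace ℝ (Fin d) →L[ℝ] (Fin (d + 1) → ℝ) := c • GLin d with hT
  have hWT : W = T ⁻¹' ((Γ : Set (Fin (d + 1) → ℝ))ᶜ) := by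
    rw [hW]; ext y; simp [hT, hcm]
  have hTo : IsOpen (T ⁻¹' ((Γ : Set (Fin (d + 1) → ℝ))ᶜ)) := hcl.isOpen_compl.preimage T.continuous
  have hyT : T y ∈ ((Γ : Set (Fin (d + 1) → ℝ))ᶜ) := by rw [hWT] at hy; exact hy
  have hpos : 0 < Metric.infDist (GLin d y) (Γ : Set (Fin (d + 1) → ℝ)) := by
    rw [← hcl.notMem_iff_infDist_pos ⟨0, Γ.zero_mem⟩]
    have := hyT; simpa [hT, hcm] using this
  have h1 : iteratedFDerivWithin ℝ a (fun y => m (c • GLin d y)) W y =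
      (iteratedFDerivWithin ℝ a m ((Γ : Set (Fin (d + 1) → ℝ))ᶜ) (T y)).compContinuousLinearMap fun _ => T := by
    rw [hWT]
    exact T.iteratedFDerivWithin_comp_right hm.2.1 hcl.isOpen_compl.uniqueDiffOn hTo.uniqueDiffOn hyT
      (by exact_mod_cast ha)
  have hB : 0 ≤ B := (norm_nonneg _).trans (hm.1 0 (by simp [GammaSet]))
  rw [h1]
  refine ContinuousMultilinearMap.opNorm_le_bound (by positivity) fun v => ?_
  rw [ContinuousMultilinearMap.compContinuousLinearMap_apply]
  set r : Fin a → ℝ := fun s => c * (‖GLin d‖ * ‖v s‖) with hr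
  have hr0 : ∀ s, 0 ≤ r s := fun s => by positivity
  have hTv : ∀ s, ‖T (v s)‖ ≤ r s := by
    intro s
    simp only [hT, smul_apply, norm_smul, Real.norm_of_nonneg hc.le, hr]
    gcongr
    exact (GLin d).le_opNorm _
  have hTe : (fun s => T (v s)) = fun s => r s • ((r s)⁻¹ • T (v s)) := by
    ext1 s
    by_cases h0 : r s = 0
    · have := hTv s
      rw [h0] at this
      have : T (v s) = 0 := norm_le_zero_iff.1 this
      rw [this]; simp
    · rw [smul_smul, mul_inv_cancel₀ h0, one_smul]
  rw [hTe, ContinuousMultilinearMap.map_smul_univ, norm_smul]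
  have h2 := hm.2.2 a ha (T y) hyT (fun s => (r s)⁻¹ • T (v s)) (fun s => by
      have h3 := GLin_mem (v s)
      simp only [GammaSet, Set.mem_ofPred_eq] at h3 ⊢
      simp only [hT, smul_apply, Pi.smul_apply, smul_eq_mul]
      rw [← Finset.mul_sum, ← Finset.mul_sum, h3]; simp) (fun s => by
      rw [norm_smul, norm_inv, Real.norm_of_nonneg (hr0 s)]
      exact inv_mul_le_one_of_le₀ (hTv s) (hr0 s))
  have h4 : Metric.infDist (T y) (Γ : Set (Fin (d + 1) → ℝ)) = c * Metric.infDist (GLin d y) (Γ : Set (Fin (d + 1) → ℝ)) :=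
    infDist_smul Γ hc _
  rw [h4] at h2
  have h5 : ‖∏ s, r s‖ = c ^ a * ‖GLin d‖ ^ a * ∏ s, ‖v s‖ := by
    rw [Real.norm_of_nonneg (Finset.prod_nonneg fun s _ => hr0 s)]
    simp only [hr, Finset.prod_mul_distrib, Finset.prod_const, Finset.card_univ, Fintype.card_fin]
    ring
  rw [h5]
  refine (mul_le_mul_of_nonneg_left h2 (by positivity)).trans (le_of_eq ?_)
  rw [mul_pow, div_pow]
  field_simp

/-- product of the symbol with a cutoff supported away from the singularity. -/
lemma sym_cut {d M : ℕ} {Γ : Submodule ℝ (Fin (d + 1) → ℝ)} {B c0 CX : ℝ} (hc0 : 0 < c0) :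
    ∃ C, 0 ≤ C ∧ ∀ m : (Fin (d + 1) → ℝ) → ℂ, SymbolEst (d + 1) Γ M B m → ∀ c : ℝ, 0 < c →
    ∀ Xs : EuclideanSpace ℝ (Fin d) → ℂ, ContDiff ℝ (⊤ : ℕ∞) Xs → 
    (∀ a ≤ M, ∀ y, ‖iteratedFDeriv ℝ a Xs y‖ ≤ CX) →
    (∀ y, Xs y ≠ 0 → c0 ≤ Metric.infDist (GLin d y) (Γ : Set (Fin (d + 1) → ℝ))) →
    ContDiff ℝ M (fun y => m (c • GLin d y) * Xs y) ∧
    ∀ a ≤ M, ∀ y, ‖iteratedFDeriv ℝ a (fun y => m (c • GLin d y) * Xs y) y‖ ≤ C := by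
  refine ⟨∑ a ∈ Finset.range (M + 1), ∑ i ∈ Finset.range (a + 1), |(a.choose i : ℝ) * (B * (‖GLin d‖ / c0) ^ i) * CX|,
    by positivity, ?_⟩
  intro m hm c hc Xs hX hXb hXs
  have hB : 0 ≤ B := (norm_nonneg _).trans (hm.1 0 (by simp [GammaSet]))
  have hcl : IsClosed (Γ : Set (Fin (d + 1) → ℝ)) := Submodule.closed_of_finiteDimensional Γ
  set W : Set (EuclideanSpace ℝ (Fin d)) := {y | GLin d y ∉ Γ} with hW
  have hWo : IsOpen W := hcl.isOpen_compl.preimage (GLin d).continuous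
  have hts : ∀ y ∈ tsupport Xs, c0 ≤ Metric.infDist (GLin d y) (Γ : Set (Fin (d + 1) → ℝ)) := by
    have : IsClosed {y | c0 ≤ Metric.infDist (GLin d y) (Γ : Set (Fin (d + 1) → ℝ))} :=
      isClosed_le continuous_const ((Metric.continuous_infDist_pt _).comp (GLin d).continuous)
    intro y hy
    exact closure_minimal (s := Function.support Xs) (fun y hy => hXs y hy) this hy
  have htsW : tsupport Xs ⊆ W := by
    intro y hy h
    have := hts y hy
    rw [Metric.infDist_zero_of_mem h] at this
    linarith
  have hU : ContDiffOn ℝ M (fun y => m (c • GLin d y)) W := by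
    have h1 := hm.2.1
    refine h1.comp (c • GLin d).contDiff.contDiffOn ?_
    intro y hy h
    exact hy ((Submodule.smul_mem_iff _ hc.ne').1 h)
  have hXM : ContDiff ℝ M Xs := hX.of_le (by exact_mod_cast le_top)
  constructor
  · rw [contDiff_iff_contDiffAt]
    intro y
    by_cases hy : y ∈ W
    · exact ((hU.contDiffAt (hWo.mem_nhds hy)).mul hXM.contDiffAt)
    · have hn : y ∉ tsupport Xs := fun h => hy (htsW h)
      have : (fun y => m (c • GLin d y) * Xs y) =ᶠ[nhds y] fun _ => 0 := by
        filter_upwards [notMem_tsupport_iff_eventuallyEq.1 hn] with z hz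
        simp [hz]
      exact contDiffAt_const.congr_of_eventuallyEq this
  · intro a ha y
    by_cases hy : y ∈ tsupport Xs
    · have hyW := htsW hy
      rw [← iteratedFDerivWithin_of_isOpen a hWo hyW]
      have h1 := norm_iteratedFDerivWithin_mul_le (n := a) hU hXM.contDiffOn hWo.uniqueDiffOn hyW (by exact_mod_cast ha)
      refine h1.trans ?_
      refine le_trans ?_ (Finset.single_le_sum (f := fun a => ∑ i ∈ Finset.range (a + 1), |(a.choose i : ℝ) * (B * (‖GLin d‖ / c0) ^ i) * CX|) (fun _ _ => by positivity)
        (Finset.mem_range.2 (Nat.lt_succ_of_le ha)))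
      refine Finset.sum_le_sum fun i hi => ?_
      have hia : i ≤ a := Nat.lt_succ_iff.1 (Finset.mem_range.1 hi)
      refine le_trans ?_ (le_abs_self _)
      have h2 := sym_deriv hm hc (hia.trans ha) hW hyW
      have h3 := hXb (a - i) ((Nat.sub_le _ _).trans ha) y
      rw [iteratedFDerivWithin_of_isOpen (a - i) hWo hyW]
      have h4 : (‖GLin d‖ / Metric.infDist (GLin d y) (Γ : Set (Fin (d + 1) → ℝ))) ^ i ≤ (‖GLin d‖ / c0) ^ i := by
        have := hts y hy
        gcongr
        exact div_nonneg (norm_nonneg _) Metric.infDist_nonneg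
      have h5 := h2.trans (mul_le_mul_of_nonneg_left h4 hB)
      exact mul_le_mul (mul_le_mul_of_nonneg_left h5 (by positivity)) h3 (norm_nonneg _) (by positivity)
    · have : iteratedFDeriv ℝ a (fun y => m (c • GLin d y) * Xs y) y = 0 := by
        have h1 : y ∉ tsupport (fun y => m (c • GLin d y) * Xs y) := fun h => hy (tsupport_mul_subset_right h)
        by_contra h
        exact h1 (support_iteratedFDeriv_subset a h)
      rw [this, norm_zero]
      positivity

end MTT

namespace MTT

/-- integer partition of unity -/
def ph0 (t : ℝ) : ℝ := smoothTransition t - smoothTransition (t - 1)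

lemma ph0_zero {t : ℝ} (h : 2 < |t|) : ph0 t = 0 := by
  unfold ph0
  rcases lt_abs.1 h with h | h
  · rw [smoothTransition.one_of_one_le (by linarith), smoothTransition.one_of_one_le (by linarith), sub_self]
  · rw [smoothTransition.zero_of_nonpos (by linarith), smoothTransition.zero_of_nonpos (by linarith), sub_self]

lemma ph0_smooth : ContDiff ℝ (⊤ : ℕ∞) ph0 := by
  unfold ph0
  exact smoothTransition.contDiff.sub (smoothTransition.contDiff.comp (contDiff_id.sub contDiff_const))

def Ph {d : ℕ} (y : EuclideanSpace ℝ (Fin d)) : ℂ := ∏ i, ((ph0 (y i) : ℝ) : ℂ)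

lemma Ph_smooth {d : ℕ} : ContDiff ℝ (⊤ : ℕ∞) (Ph (d := d)) := by
  unfold Ph
  refine contDiff_prod fun i _ => ?_
  have h1 : ContDiff ℝ (⊤ : ℕ∞) (fun y : EuclideanSpace ℝ (Fin d) => y i) := by fun_prop
  exact Complex.ofRealCLM.contDiff.comp (ph0_smooth.comp h1)

lemma Ph_supp {d : ℕ} (y : EuclideanSpace ℝ (Fin d)) (h : Ph y ≠ 0) (i : Fin d) : |y i| ≤ 2 := by
  by_contra hc
  push Not at hc
  exact h (Finset.prod_eq_zero (Finset.mem_univ i) (by rw [ph0_zero hc]; simp))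

lemma Ph_cs {d : ℕ} : HasCompactSupport (Ph (d := d)) := by
  apply HasCompactSupport.of_support_subset_isCompact (isCompact_closedBall (0 : EuclideanSpace ℝ (Fin d)) (d * 2))
  intro y hy
  rw [mem_closedBall_zero_iff]
  have h1 := Ph_supp y hy
  rw [EuclideanSpace.norm_eq]
  rw [Real.sqrt_le_left (by positivity)]
  calc ∑ i, ‖y i‖ ^ 2 ≤ ∑ i : Fin d, (2:ℝ) ^ 2 := Finset.sum_le_sum fun i _ => by
        rw [Real.norm_eq_abs]; exact pow_le_pow_left₀ (abs_nonneg _) (h1 i) 2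
    _ = d * 4 := by simp; norm_num
    _ ≤ (d * 2) ^ 2 := by
        rcases Nat.eq_zero_or_pos d with h | h
        · subst h; simp
        · have : (1:ℝ) ≤ d := by exact_mod_cast h
          nlinarith

/-- decay of the Fourier transform of a compactly supported function with bounded derivatives -/
lemma fourier_decay {d K : ℕ} (hK : d + 1 ≤ K) (S : Set (EuclideanSpace ℝ (Fin d))) (hS : IsCompact S) (C : ℝ) :
    ∃ C1, 0 ≤ C1 ∧ ∀ M : EuclideanSpace ℝ (Fin d) → ℂ, ContDiff ℝ K M → tsupport M ⊆ S →
    (∀ a ≤ K, ∀ y, ‖iteratedFDeriv ℝ a M y‖ ≤ C) →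
    Continuous M ∧ Integrable M ∧ Integrable (𝓕 M) ∧ ∀ u, ‖𝓕 M u‖ ≤ C1 * ((1 + ‖u‖) ^ K)⁻¹ := by
  set V := volume.real S
  set C2 := |(2:ℝ) ^ K * ∑ p ∈ Finset.range (0 + 1) ×ˢ Finset.range (K + 1), C * V| +
    |∑ p ∈ Finset.range (0 + 1) ×ˢ Finset.range (0 + 1), C * V| with hC2
  refine ⟨2 ^ K * C2, by positivity, ?_⟩
  intro M hM hMS hb
  have hcs : HasCompactSupport M := hS.of_isClosed_subset (isClosed_tsupport M) hMS
  have hcont : Continuous M := hM.continuous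
  have hintg : Integrable M := hcont.integrable_of_hasCompactSupport hcs
  have hDc : ∀ a ≤ K, Continuous (iteratedFDeriv ℝ a M) := fun a ha =>
    hM.continuous_iteratedFDeriv (by exact_mod_cast ha)
  have hDcs : ∀ a, HasCompactSupport (iteratedFDeriv ℝ a M) := fun a => hcs.iteratedFDeriv a
  have hI : ∀ (k a : ℕ), (k:ℕ∞) ≤ (0:ℕ∞) → (a:ℕ∞) ≤ (K:ℕ∞) → Integrable (fun v => ‖v‖ ^ k * ‖iteratedFDeriv ℝ a M v‖) := by
    intro k a _ ha
    have ha' : a ≤ K := by exact_mod_cast ha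
    have h1 := hDc a ha'
    exact ((continuous_norm.pow k).mul h1.norm).integrable_of_hasCompactSupport ((hDcs a).norm.mul_left)
  have hIb : ∀ a ≤ K, ∫ v, ‖iteratedFDeriv ℝ a M v‖ ≤ C * V := by
    intro a ha
    have h1 : ∫ v, ‖iteratedFDeriv ℝ a M v‖ = ∫ v in S, ‖iteratedFDeriv ℝ a M v‖ := by
      rw [setIntegral_eq_integral_of_forall_compl_eq_zero]
      intro x hx
      rw [norm_eq_zero]
      by_contra h
      exact hx (hMS (support_iteratedFDeriv_subset a h))
    rw [h1]
    calc ∫ v in S, ‖iteratedFDeriv ℝ a M v‖ ≤ ∫ v in S, C := by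
          refine integral_mono ((((hDc a ha).norm).integrable_of_hasCompactSupport (hDcs a).norm).integrableOn) ?_ (fun y => hb a ha y)
          exact integrableOn_const hS.measure_lt_top.ne
      _ = C * V := by simp [V, mul_comm]
  have key : ∀ a ≤ K, ∀ u, ‖u‖ ^ a * ‖𝓕 M u‖ ≤ (2:ℝ) ^ a * ∑ p ∈ Finset.range (0 + 1) ×ˢ Finset.range (a + 1), C * V := by
    intro a ha u
    have h := Real.pow_mul_norm_iteratedFDeriv_fourier_le (K := 0) (N := (K:ℕ∞)) (f := M) (by exact_mod_cast hM) hI (k := 0) (n := a) (by simp)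
      (by exact_mod_cast ha) u
    rw [norm_iteratedFDeriv_zero] at h
    refine h.trans ?_
    simp only [pow_zero, one_mul, Nat.cast_zero, mul_zero, zero_add]
    gcongr with p hp
    rw [Finset.mem_product, Finset.mem_range, Finset.mem_range] at hp
    have h0 : p.1 = 0 := by omega
    rw [h0]; simp only [pow_zero, one_mul]
    exact hIb _ (by omega)
  have hdec : ∀ u, ‖𝓕 M u‖ ≤ 2 ^ K * C2 * ((1 + ‖u‖) ^ K)⁻¹ := by
    intro u
    have h1 := (key K le_rfl u).trans (le_abs_self _)
    have h2 := (key 0 (Nat.zero_le _) u).trans (le_abs_self _)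
    simp only [pow_zero, one_mul] at h2
    rw [← div_eq_mul_inv, le_div_iff₀ (by positivity)]
    have h3 : (1 + ‖u‖) ^ K ≤ 2 ^ K * (1 + ‖u‖ ^ K) := by
      rcases le_total ‖u‖ 1 with h | h
      · calc (1 + ‖u‖) ^ K ≤ 2 ^ K := pow_le_pow_left₀ (by positivity) (by linarith) K
          _ ≤ 2 ^ K * (1 + ‖u‖ ^ K) := le_mul_of_one_le_right (by positivity) (by have := pow_nonneg (norm_nonneg u) K; linarith)
      · calc (1 + ‖u‖) ^ K ≤ (2 * ‖u‖) ^ K := pow_le_pow_left₀ (by positivity) (by linarith) K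
          _ = 2 ^ K * ‖u‖ ^ K := mul_pow _ _ _
          _ ≤ 2 ^ K * (1 + ‖u‖ ^ K) := by gcongr; linarith
    calc ‖𝓕 M u‖ * (1 + ‖u‖) ^ K ≤ ‖𝓕 M u‖ * (2 ^ K * (1 + ‖u‖ ^ K)) := by gcongr
      _ = 2 ^ K * (‖u‖ ^ K * ‖𝓕 M u‖ + ‖𝓕 M u‖) := by ring
      _ ≤ 2 ^ K * C2 := by rw [hC2]; gcongr
  refine ⟨hcont, hintg, ?_, hdec⟩
  have hFc : Continuous (𝓕 M) := VectorFourier.fourierIntegral_continuous Real.continuous_fourierChar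
    (by exact continuous_inner) hintg
  have h4 : Integrable (fun u : EuclideanSpace ℝ (Fin d) => (1 + ‖u‖) ^ (-(K:ℝ))) := by
    apply integrable_one_add_norm
    simp only [finrank_euclideanSpace, Fintype.card_fin]
    have : ((d + 1 : ℕ) : ℝ) ≤ K := by exact_mod_cast hK
    push_cast at this; linarith
  refine (h4.const_mul (2 ^ K * C2)).mono' hFc.aestronglyMeasurable (Filter.Eventually.of_forall fun u => ?_)
  rw [Real.rpow_neg (by positivity), Real.rpow_natCast]
  exact hdec u

/-- the localised symbol pieces -/
def Mq {d : ℕ} (χ m : (Fin (d + 1) → ℝ) → ℂ) (D c : ℝ) (q y : EuclideanSpace ℝ (Fin d)) : ℂ :=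
  m (c • GLin d (y + q)) * (χ (D⁻¹ • GLin d (y + q)) - χ ((2 * D⁻¹) • GLin d (y + q))) * Ph y

theorem Mq_decay {d K : ℕ} (hK : d + 1 ≤ K) {Γ : Submodule ℝ (Fin (d + 1) → ℝ)} {χ : (Fin (d + 1) → ℝ) → ℂ}
    (hχ : ContDiff ℝ (⊤ : ℕ∞) χ) (hχ1 : ∀ ξ, Metric.infDist ξ (Γ : Set (Fin (d + 1) → ℝ)) ≤ 1 → χ ξ = 1)
    (hχd : ∀ a : ℕ, ∃ C, ∀ ξ, ‖iteratedFDeriv ℝ a χ ξ‖ ≤ C) {D : ℝ} (hD : 0 < D) (B : ℝ) :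
    ∃ C1, 0 ≤ C1 ∧ ∀ m : (Fin (d + 1) → ℝ) → ℂ, SymbolEst (d + 1) Γ K B m → ∀ c : ℝ, 0 < c → ∀ q,
      Continuous (Mq χ m D c q) ∧ Integrable (Mq χ m D c q) ∧ Integrable (𝓕 (Mq χ m D c q)) ∧
      ∀ u, ‖𝓕 (Mq χ m D c q) u‖ ≤ C1 * ((1 + ‖u‖) ^ K)⁻¹ := by
  choose Cχ hCχ using hχd
  have hCχ0 : ∀ a, 0 ≤ Cχ a := fun a => (norm_nonneg _).trans (hCχ a 0)
  set Xs : EuclideanSpace ℝ (Fin d) → ℂ := fun y => χ (D⁻¹ • GLin d y) - χ ((2 * D⁻¹) • GLin d y) with hXs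
  have hX1 : ContDiff ℝ (⊤ : ℕ∞) (fun y => χ (D⁻¹ • GLin d y)) := hχ.comp (D⁻¹ • GLin d).contDiff
  have hX2 : ContDiff ℝ (⊤ : ℕ∞) (fun y => χ ((2 * D⁻¹) • GLin d y)) := hχ.comp ((2 * D⁻¹) • GLin d).contDiff
  set CX := ∑ a ∈ Finset.range (K + 1), (Cχ a * ‖D⁻¹ • GLin d‖ ^ a + Cχ a * ‖(2 * D⁻¹) • GLin d‖ ^ a) with hCX
  have hXb : ∀ a ≤ K, ∀ y, ‖iteratedFDeriv ℝ a Xs y‖ ≤ CX := by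
    intro a ha y
    have e : iteratedFDeriv ℝ a Xs y = iteratedFDeriv ℝ a (fun y => χ (D⁻¹ • GLin d y)) y -
        iteratedFDeriv ℝ a (fun y => χ ((2 * D⁻¹) • GLin d y)) y := by
      have h1 : ContDiff ℝ (a : WithTop ℕ∞) (fun y => χ (D⁻¹ • GLin d y)) := hX1.of_le (by exact_mod_cast le_top)
      have h2 : ContDiff ℝ (a : WithTop ℕ∞) (fun y => χ ((2 * D⁻¹) • GLin d y)) := hX2.of_le (by exact_mod_cast le_top)
      have := iteratedFDeriv_sub h1 h2
      exact congrFun this y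
    rw [e]
    refine (norm_sub_le _ _).trans ?_
    refine le_trans (add_le_add (comp_deriv hχ (hCχ a) (D⁻¹ • GLin d) y) (comp_deriv hχ (hCχ a) ((2 * D⁻¹) • GLin d) y)) ?_
    exact Finset.single_le_sum (f := fun a => Cχ a * ‖D⁻¹ • GLin d‖ ^ a + Cχ a * ‖(2 * D⁻¹) • GLin d‖ ^ a)
      (fun a _ => add_nonneg (mul_nonneg (hCχ0 a) (by positivity)) (mul_nonneg (hCχ0 a) (by positivity))) (Finset.mem_range.2 (by omega))
  obtain ⟨C, hC0, hC⟩ := sym_cut (d := d) (M := K) (Γ := Γ) (B := B) (c0 := D / 2) (CX := CX) (by positivity)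
  choose CP hCP using fun a => bdd_deriv (Ph_smooth (d := d)) Ph_cs a
  have hCP0 : ∀ a, 0 ≤ CP a := fun a => (norm_nonneg _).trans (hCP a 0)
  obtain ⟨C1, hC10, hC1⟩ := fourier_decay hK (tsupport (Ph (d := d))) Ph_cs
    (∑ a ∈ Finset.range (K + 1), ∑ i ∈ Finset.range (a + 1), (a.choose i : ℝ) * C * CP (a - i))
  refine ⟨C1, hC10, fun m hm c hc q => ?_⟩
  obtain ⟨h1, h2⟩ := hC m hm c hc Xs (hX1.sub hX2) hXb (by
    intro y hy
    by_contra hcon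
    push Not at hcon
    apply hy
    simp only [hXs]
    rw [hχ1, hχ1, sub_self]
    · rw [infDist_smul Γ (by positivity)]
      calc 2 * D⁻¹ * _ ≤ 2 * D⁻¹ * (D / 2) := by gcongr
        _ = 1 := by field_simp
    · rw [infDist_smul Γ (by positivity)]
      rw [inv_mul_le_iff₀ hD]; linarith)
  set N : EuclideanSpace ℝ (Fin d) → ℂ := fun y => m (c • GLin d y) * Xs y with hN
  have hNq : ContDiff ℝ K (fun y => N (y + q)) := h1.comp (contDiff_id.add contDiff_const)
  have hNb : ∀ a ≤ K, ∀ y, ‖iteratedFDeriv ℝ a (fun y => N (y + q)) y‖ ≤ C := by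
    intro a ha y
    rw [iteratedFDeriv_comp_add_right]
    exact h2 a ha _
  have hMe : Mq χ m D c q = fun y => N (y + q) * Ph y := rfl
  have hPK : ContDiff ℝ K (Ph (d := d)) := Ph_smooth.of_le (by exact_mod_cast le_top)
  rw [hMe]
  apply hC1
  · exact hNq.mul hPK
  · exact tsupport_mul_subset_right
  · intro a ha y
    refine (norm_iteratedFDeriv_mul_le hNq hPK y (n := a) (by exact_mod_cast ha)).trans ?_
    refine le_trans ?_ (Finset.single_le_sum (f := fun a => ∑ i ∈ Finset.range (a + 1), (a.choose i : ℝ) * C * CP (a - i))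
      (fun a _ => Finset.sum_nonneg fun i _ => mul_nonneg (by positivity) (hCP0 _)) (Finset.mem_range.2 (Nat.lt_succ_of_le ha)))
    refine Finset.sum_le_sum fun i hi => ?_
    have hia : i ≤ a := Nat.lt_succ_iff.1 (Finset.mem_range.1 hi)
    exact mul_le_mul (mul_le_mul_of_nonneg_left (hNb i (hia.trans ha) y) (by positivity)) (hCP _ y) (norm_nonneg _) (by positivity)

end MTT

namespace MTT

/-- integer vector as a point of Euclidean space -/
def qv {d : ℕ} (q : Fin d → ℤ) : EuclideanSpace ℝ (Fin d) := WithLp.toLp 2 (fun i => (q i : ℝ))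

lemma Mq_wh {d : ℕ} {Γ : Submodule ℝ (Fin (d + 1) → ℝ)} {χ : (Fin (d + 1) → ℝ) → ℂ}
    (hχ1 : ∀ ξ, Metric.infDist ξ (Γ : Set (Fin (d + 1) → ℝ)) ≤ 1 → χ ξ = 1)
    (hχ2 : ∀ ξ, 2 ≤ Metric.infDist ξ (Γ : Set (Fin (d + 1) → ℝ)) → χ ξ = 0)
    {D : ℝ} (hD : 0 < D) (m : (Fin (d + 1) → ℝ) → ℂ) (c : ℝ) (q : Fin d → ℤ) (y : EuclideanSpace ℝ (Fin d))
    (h : Mq χ m D c (qv q) y ≠ 0) :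
    Wh (d + 1) Γ (D / 2 - 2 * (d + 1)) (2 * D + 2 * (d + 1)) (gq q) := by
  unfold Mq at h
  have hP : Ph y ≠ 0 := right_ne_zero_of_mul h
  have hX := right_ne_zero_of_mul (left_ne_zero_of_mul h)
  have hy := Ph_supp y hP
  set ξ := GLin d (y + qv q) with hξ
  have hne : ((Γ : Set (Fin (d + 1) → ℝ))).Nonempty := ⟨0, Γ.zero_mem⟩
  have hlo : D / 2 < Metric.infDist ξ (Γ : Set (Fin (d + 1) → ℝ)) := by
    by_contra hc
    push Not at hc
    apply hX
    rw [hχ1, hχ1, sub_self]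
    · rw [infDist_smul Γ (by positivity)]
      calc 2 * D⁻¹ * _ ≤ 2 * D⁻¹ * (D / 2) := by gcongr
        _ = 1 := by field_simp
    · rw [infDist_smul Γ (by positivity)]
      rw [inv_mul_le_iff₀ hD]; linarith
  have hhi : Metric.infDist ξ (Γ : Set (Fin (d + 1) → ℝ)) < 2 * D := by
    by_contra hc
    push Not at hc
    apply hX
    rw [hχ2, hχ2, sub_self]
    · rw [infDist_smul Γ (by positivity)]
      calc (2:ℝ) ≤ 2 * D⁻¹ * (2 * D) := by field_simp; norm_num
        _ ≤ _ := by gcongr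
    · rw [infDist_smul Γ (by positivity)]
      calc (2:ℝ) = D⁻¹ * (2 * D) := by field_simp
        _ ≤ _ := by gcongr
  have hdiff : ∀ i, |(gq q i : ℝ) - ξ i| ≤ 2 * (d + 1) := by
    intro i
    rw [hξ, GLin_apply]
    refine Fin.lastCases ?_ (fun i => ?_) i
    · have e : ((gq q (Fin.last d) : ℤ) : ℝ) - gp (y + qv q).ofLp (Fin.last d) = ∑ i, y i := by
        simp [qv, Finset.sum_add_distrib]
      rw [e]
      calc |∑ i, y i| ≤ ∑ i, |y i| := Finset.abs_sum_le_sum_abs _ _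
        _ ≤ ∑ i : Fin d, 2 := Finset.sum_le_sum fun i _ => hy i
        _ = d * 2 := by simp
        _ ≤ 2 * (d + 1) := by linarith
    · have e : ((gq q i.castSucc : ℤ) : ℝ) - gp (y + qv q).ofLp i.castSucc = - y i := by
        simp [qv]
      rw [e, abs_neg]
      have := hy i
      have : (0:ℝ) ≤ d := by positivity
      linarith [hy i]
  refine ⟨?_, ?_, ?_⟩
  · rw [Fin.sum_univ_castSucc]; simp
  · obtain ⟨γ, hγ, hlt⟩ := (Metric.infDist_lt_iff hne).1 hhi
    refine ⟨γ, hγ, fun i => ?_⟩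
    have h1 : |ξ i - γ i| ≤ 2 * D := (dist_le_pi_dist ξ γ i).trans hlt.le
    have h2 := hdiff i
    calc |(gq q i : ℝ) - γ i| = |((gq q i : ℝ) - ξ i) + (ξ i - γ i)| := by ring_nf
      _ ≤ _ := abs_add_le _ _
      _ ≤ _ := by linarith
  · intro γ hγ
    by_contra hc
    push Not at hc
    have h1 : dist ξ γ ≤ D / 2 := by
      refine (dist_pi_le_iff (by positivity)).2 fun i => ?_
      rw [Real.dist_eq]
      calc |ξ i - γ i| = |(-((gq q i : ℝ) - ξ i)) + ((gq q i : ℝ) - γ i)| := by ring_nf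
        _ ≤ |-((gq q i : ℝ) - ξ i)| + |(gq q i : ℝ) - γ i| := abs_add_le _ _
        _ ≤ D / 2 := by rw [abs_neg]; linarith [hdiff i, hc i]
    have h2 := Metric.infDist_le_dist_of_mem (x := ξ) hγ
    linarith

lemma W_fin (d d0 : ℕ) {C1 : ℝ} (hC1 : 0 ≤ C1) : ∃ C3 : ℝ, 0 ≤ C3 ∧ ∀ CM : ℝ, 0 ≤ CM →
    ∫⁻ u : EuclideanSpace ℝ (Fin d), ENNReal.ofReal (C1 * ((1 + ‖u‖) ^ (d0 * (d + 1) + (d + 1)))⁻¹) *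
      ENNReal.ofReal (CM * ((2 + ‖u‖) ^ d0) ^ (d + 1)) ≤ ENNReal.ofReal (C3 * CM) := by
  have h4 : Integrable (fun u : EuclideanSpace ℝ (Fin d) => (1 + ‖u‖) ^ (-((d + 1 : ℕ):ℝ))) := by
    apply integrable_one_add_norm
    simp only [finrank_euclideanSpace, Fintype.card_fin]
    push_cast; linarith
  refine ⟨C1 * 2 ^ (d0 * (d + 1)) * ∫ u : EuclideanSpace ℝ (Fin d), (1 + ‖u‖) ^ (-((d + 1 : ℕ):ℝ)), ?_, ?_⟩
  · refine mul_nonneg (by positivity) (integral_nonneg fun u => by positivity)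
  intro CM hCM
  calc _ ≤ ∫⁻ u : EuclideanSpace ℝ (Fin d), ENNReal.ofReal (C1 * 2 ^ (d0 * (d + 1)) * CM * (1 + ‖u‖) ^ (-((d + 1 : ℕ):ℝ))) := by
        refine lintegral_mono fun u => ?_
        rw [← ENNReal.ofReal_mul (by positivity)]
        apply ENNReal.ofReal_le_ofReal
        rw [Real.rpow_neg (by positivity), Real.rpow_natCast, ← pow_mul]
        have h5 : (2 + ‖u‖) ^ (d0 * (d + 1)) ≤ 2 ^ (d0 * (d + 1)) * (1 + ‖u‖) ^ (d0 * (d + 1)) := by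
          rw [← mul_pow]
          exact pow_le_pow_left₀ (by positivity) (by linarith [norm_nonneg u]) _
        calc C1 * ((1 + ‖u‖) ^ (d0 * (d + 1) + (d + 1)))⁻¹ * (CM * (2 + ‖u‖) ^ (d0 * (d + 1)))
            ≤ C1 * ((1 + ‖u‖) ^ (d0 * (d + 1) + (d + 1)))⁻¹ * (CM * (2 ^ (d0 * (d + 1)) * (1 + ‖u‖) ^ (d0 * (d + 1)))) := by gcongr
          _ = _ := by
            rw [pow_add]
            have : (1 + ‖u‖) ^ (d0 * (d + 1)) ≠ 0 := by positivity
            have : (1 + ‖u‖) ^ ((d + 1)) ≠ 0 := by positivity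
            field_simp
    _ = ENNReal.ofReal (∫ u : EuclideanSpace ℝ (Fin d), C1 * 2 ^ (d0 * (d + 1)) * CM * (1 + ‖u‖) ^ (-((d + 1 : ℕ):ℝ))) := by
        rw [ofReal_integral_eq_lintegral_ofReal (h4.const_mul _) (Filter.Eventually.of_forall fun u => by positivity)]
    _ = _ := by rw [integral_const_mul]; congr 1; ring

/-- one piece of the form -/
def pc {d : ℕ} (χ m : (Fin (d + 1) → ℝ) → ℂ) (D : ℝ) (s : ℤ × (Fin d → ℤ)) (η : Fin d → ℝ) : ℂ :=
  Mq χ m D ((2:ℝ) ^ (-s.1)) (qv s.2) (WithLp.toLp 2 (fun i => (2:ℝ) ^ s.1 * η i - s.2 i))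

lemma pc_eq {d : ℕ} (χ m : (Fin (d + 1) → ℝ) → ℂ) (D : ℝ) (s : ℤ × (Fin d → ℤ)) (η : Fin d → ℝ) :
    pc χ m D s η = m (gp η) * (χ ((D⁻¹ * (2:ℝ) ^ s.1) • gp η) - χ ((D⁻¹ * (2:ℝ) ^ (s.1 + 1)) • gp η)) *
      ∏ i, ((ph0 ((2:ℝ) ^ s.1 * η i - s.2 i) : ℝ) : ℂ) := by
  have e : GLin d (WithLp.toLp 2 (fun i => (2:ℝ) ^ s.1 * η i - s.2 i) + qv s.2) = (2:ℝ) ^ s.1 • gp η := by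
    have : WithLp.toLp 2 (fun i => (2:ℝ) ^ s.1 * η i - s.2 i) + qv s.2 = (2:ℝ) ^ s.1 • WithLp.toLp 2 η := by
      ext i; simp [qv]
    rw [this, map_smul, GLin_apply]
  have e2 : (2:ℝ) ^ (-s.1) * 2 ^ s.1 = 1 := by rw [← zpow_add₀ (by norm_num)]; simp
  have e3 : 2 * D⁻¹ * (2:ℝ) ^ s.1 = D⁻¹ * 2 ^ (s.1 + 1) := by rw [zpow_add_one₀ (by norm_num)]; ring
  unfold pc Mq
  rw [e, smul_smul, smul_smul, smul_smul, e2, e3, one_smul]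
  rfl

theorem fin_bound {ρ : ℝ → ℂ} {d : ℕ} {f : Fin (d + 1) → ℝ → ℂ} (hρ : Continuous ρ) (hc : HasCompactSupport ρ)
    (hΨ : Integrable (𝓕⁻ ρ)) (hρ1 : ∀ x : ℝ, |x| ≤ 2 * (d + 1) → ρ x = 1)
    (hf : ∀ i, Integrable (f i)) (d0 : ℕ) {CM : ℝ} (hCM : 0 ≤ CM) {Γ : Submodule ℝ (Fin (d + 1) → ℝ)}
    {χ m : (Fin (d + 1) → ℝ) → ℂ}
    (hχ1 : ∀ ξ, Metric.infDist ξ (Γ : Set (Fin (d + 1) → ℝ)) ≤ 1 → χ ξ = 1)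
    (hχ2 : ∀ ξ, 2 ≤ Metric.infDist ξ (Γ : Set (Fin (d + 1) → ℝ)) → χ ξ = 0)
    {D : ℝ} (hD : 0 < D)
    (hmod : ∀ t : Fin (d + 1) → ℝ, ∀ PP : Finset (MT (d + 1)),
      (∀ P ∈ PP, Wh (d + 1) Γ (D / 2 - 2 * (d + 1)) (2 * D + 2 * (d + 1)) P.2) →
      ∑ P ∈ PP, len P.1 * ∏ i, cf (fun z => 𝓕⁻ ρ (t i - z)) (f i) (tl P i) ≤ CM * ∏ i, (1 + |t i|) ^ d0)
    {C1 C3 : ℝ} (hC3 : 0 ≤ C3)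
    (hMq : ∀ c : ℝ, 0 < c → ∀ q, Continuous (Mq χ m D c q) ∧ Integrable (Mq χ m D c q) ∧ Integrable (𝓕 (Mq χ m D c q)) ∧
      ∀ u, ‖𝓕 (Mq χ m D c q) u‖ ≤ C1 * ((1 + ‖u‖) ^ (d0 * (d + 1) + (d + 1)))⁻¹)
    (hW : ∫⁻ u : EuclideanSpace ℝ (Fin d), ENNReal.ofReal (C1 * ((1 + ‖u‖) ^ (d0 * (d + 1) + (d + 1)))⁻¹) *
      ENNReal.ofReal (CM * ((2 + ‖u‖) ^ d0) ^ (d + 1)) ≤ ENNReal.ofReal (C3 * CM))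
    (S : Finset (ℤ × (Fin d → ℤ))) :
    ‖∑ s ∈ S, ∫ η : Fin d → ℝ, pc χ m D s η * ∏ i, 𝓕 (f i) (gp η i)‖ ≤ C3 * CM := by
  set G := fun s : ℤ × (Fin d → ℤ) => Wh (d + 1) Γ (D / 2 - 2 * (d + 1)) (2 * D + 2 * (d + 1)) (gq s.2) with hGd
  have e1 : ∑ s ∈ S, ∫ η : Fin d → ℝ, pc χ m D s η * ∏ i, 𝓕 (f i) (gp η i) =
      ∑ s ∈ S.filter G, ∫ η : Fin d → ℝ, pc χ m D s η * ∏ i, 𝓕 (f i) (gp η i) := by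
    symm
    apply Finset.sum_subset (Finset.filter_subset _ _)
    intro s hs hn
    have hng : ¬ G s := fun h => hn (Finset.mem_filter.2 ⟨hs, h⟩)
    have : ∀ η, pc χ m D s η = 0 := by
      intro η
      by_contra h
      exact hng (Mq_wh hχ1 hχ2 hD m _ _ _ h)
    simp [this]
  rw [e1]
  have h2 : ‖∑ s ∈ S.filter G, ∫ η : Fin d → ℝ, pc χ m D s η * ∏ i, 𝓕 (f i) (gp η i)‖ₑ ≤ ENNReal.ofReal (C3 * CM) := by
    calc _ ≤ ∑ s ∈ S.filter G, ‖∫ η : Fin d → ℝ, pc χ m D s η * ∏ i, 𝓕 (f i) (gp η i)‖ₑ := enorm_sum_le _ _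
      _ ≤ ∑ s ∈ S.filter G, ∫⁻ u : EuclideanSpace ℝ (Fin d), ENNReal.ofReal (C1 * ((1 + ‖u‖) ^ (d0 * (d + 1) + (d + 1)))⁻¹) *
        ∫⁻ x : ℝ, ∏ i, ‖gg ρ (f i) s.1 (gq s.2 i) (x + (2:ℝ) ^ s.1 * us u.ofLp i)‖ₑ := by
          refine Finset.sum_le_sum fun s _ => ?_
          obtain ⟨a1, a2, a3, a4⟩ := hMq ((2:ℝ) ^ (-s.1)) (by positivity) (qv s.2)
          refine (piece_le hρ hc hΨ hρ1 hf s.1 s.2 _ a1 a2 a3 ?_).trans ?_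
          · intro y hy i
            exact Ph_supp y (right_ne_zero_of_mul hy) i
          · refine lintegral_mono fun u => ?_
            gcongr
            rw [← ofReal_norm]
            exact ENNReal.ofReal_le_ofReal (a4 u)
      _ ≤ _ := sum_pieces hρ hc hf d0 hCM _ hmod (S.filter G) (fun s hs => (Finset.mem_filter.1 hs).2) _ (by fun_prop)
      _ ≤ _ := hW
  rw [← ofReal_norm] at h2
  exact (ENNReal.ofReal_le_ofReal_iff (by positivity)).1 h2

end MTT

namespace MTT

def IJ (J : ℕ) : Finset ℤ := (Finset.range (2 * J + 1)).image (fun k : ℕ => (k : ℤ) - J)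

lemma IJ_sum {E : Type*} [AddCommGroup E] (J : ℕ) (g : ℤ → E) :
    ∑ q ∈ IJ J, (g q - g (q + 1)) = g (-J) - g (J + 1) := by
  unfold IJ
  rw [Finset.sum_image (by intro a _ b _ h; simpa using h)]
  have := Finset.sum_range_sub' (fun k : ℕ => g ((k : ℤ) - J)) (2 * J + 1)
  simp only [Nat.cast_zero, zero_sub] at this
  have e : ∀ k : ℕ, g ((k : ℤ) - J + 1) = g (((k + 1 : ℕ) : ℤ) - J) := fun k => by push_cast; congr 1; ring
  simp only [e]
  rw [this]
  congr 2
  push_cast; ring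

lemma ph_sum (Q : ℕ) (t : ℝ) : ∑ q ∈ IJ Q, ph0 (t - q) = smoothTransition (t + Q) - smoothTransition (t - Q - 1) := by
  have := IJ_sum Q (fun q : ℤ => smoothTransition (t - q))
  calc ∑ q ∈ IJ Q, ph0 (t - q) = ∑ q ∈ IJ Q, (smoothTransition (t - q) - smoothTransition (t - (q + 1 : ℤ))) := by
        refine Finset.sum_congr rfl fun q _ => ?_
        unfold ph0; push_cast; congr 2; ring
    _ = _ := by rw [this]; push_cast; congr 2 <;> ring

lemma ph_sum_norm (Q : ℕ) (t : ℝ) : ‖((∑ q ∈ IJ Q, ph0 (t - q) : ℝ) : ℂ)‖ ≤ 1 := by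
  rw [Complex.norm_real, ph_sum, Real.norm_eq_abs, abs_le]
  have h1 := smoothTransition.nonneg (t + Q)
  have h2 := smoothTransition.le_one (t + Q)
  have h3 := smoothTransition.nonneg (t - Q - 1)
  have h4 := smoothTransition.le_one (t - Q - 1)
  constructor <;> linarith

lemma ph_sum_one (t : ℝ) : ∀ᶠ Q : ℕ in Filter.atTop, ((∑ q ∈ IJ Q, ph0 (t - q) : ℝ) : ℂ) = 1 := by
  filter_upwards [(tendsto_natCast_atTop_atTop (R := ℝ)).eventually_ge_atTop (1 + |t|)] with Q hQ
  have h1 := le_abs_self t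
  have h2 := neg_abs_le t
  rw [ph_sum, smoothTransition.one_of_one_le (by linarith), smoothTransition.zero_of_nonpos (by linarith)]
  simp

lemma null_Γ {d k : ℕ} (Γ : Submodule ℝ (Fin (d + 1) → ℝ)) (hk : Module.finrank ℝ Γ = k) (hkd : k < d) :
    ∀ᵐ η : Fin d → ℝ, gp η ∉ Γ := by
  set L : (Fin d → ℝ) →ₗ[ℝ] (Fin (d + 1) → ℝ) :=
    (GLin d).toLinearMap ∘ₗ (WithLp.linearEquiv 2 ℝ (Fin d → ℝ)).symm.toLinearMap with hL
  have hLe : ∀ η, L η = gp η := fun η => rfl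
  have hinj : Function.Injective L := by
    intro a b h
    funext i
    have := congrFun h i.castSucc
    simpa [hLe] using this
  have hne : Γ.comap L ≠ ⊤ := by
    intro h
    have h1 : ∀ x, L x ∈ Γ := fun x => by
      have : x ∈ Γ.comap L := h ▸ Submodule.mem_top
      exact this
    have h2 := LinearMap.finrank_le_finrank_of_injective (f := L.codRestrict Γ h1)
      (fun a b hab => hinj (congrArg Subtype.val hab))
    rw [hk] at h2
    simp at h2
    omega
  have h3 := Measure.addHaar_submodule (volume : Measure (Fin d → ℝ)) (Γ.comap L) hne
  rw [ae_iff]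
  convert h3 using 2
  ext η
  simp [hLe]

theorem lim_bound {d k : ℕ} {Γ : Submodule ℝ (Fin (d + 1) → ℝ)} (hk : Module.finrank ℝ Γ = k) (hkd : k < d)
    {χ m : (Fin (d + 1) → ℝ) → ℂ} (hχc : Continuous χ) (hχb : ∀ ξ, ‖χ ξ‖ ≤ 1)
    (hχ1 : ∀ ξ, Metric.infDist ξ (Γ : Set (Fin (d + 1) → ℝ)) ≤ 1 → χ ξ = 1)
    (hχ2 : ∀ ξ, 2 ≤ Metric.infDist ξ (Γ : Set (Fin (d + 1) → ℝ)) → χ ξ = 0)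
    {D : ℝ} (hD : 0 < D) (F : (Fin d → ℝ) → ℂ) (hG : Integrable fun η : Fin d → ℝ => m (gp η) * F η) {A : ℝ}
    (hA : ∀ S : Finset (ℤ × (Fin d → ℤ)), ‖∑ s ∈ S, ∫ η : Fin d → ℝ, pc χ m D s η * F η‖ ≤ A) :
    ‖∫ η : Fin d → ℝ, m (gp η) * F η‖ ≤ A := by
  have hgp : Continuous (gp (d := d)) := continuous_pi fun i => gp_cont i
  set X : ℤ → (Fin d → ℝ) → ℂ := fun j η => χ ((D⁻¹ * (2:ℝ) ^ j) • gp η) with hX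
  have hXc : ∀ j, Continuous (X j) := fun j => hχc.comp (hgp.const_smul (D⁻¹ * (2:ℝ) ^ j))
  have hXb : ∀ j η, ‖X j η‖ ≤ 1 := fun j η => hχb _
  have hXs : ∀ j η, ‖X j η - X (j + 1) η‖ ≤ 2 := fun j η => (norm_sub_le _ _).trans (by linarith [hXb j η, hXb (j + 1) η])
  have hph : Continuous ph0 := ph0_smooth.continuous
  set P : ℤ → (Fin d → ℤ) → (Fin d → ℝ) → ℂ := fun j q η => ∏ i, ((ph0 ((2:ℝ) ^ j * η i - q i) : ℝ) : ℂ) with hP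
  have hPc : ∀ j q, Continuous (P j q) := fun j q => by
    refine continuous_finsetProd _ fun i _ => ?_
    exact Complex.continuous_ofReal.comp (hph.comp (by fun_prop))
  have hPb : ∀ j q η, ‖P j q η‖ ≤ 1 := fun j q η => by
    rw [hP]; simp only
    rw [norm_prod]
    refine Finset.prod_le_one (fun i _ => norm_nonneg _) fun i _ => ?_
    rw [Complex.norm_real, Real.norm_eq_abs, abs_le]
    unfold ph0
    have h1 := smoothTransition.nonneg ((2:ℝ) ^ j * η i - q i)
    have h2 := smoothTransition.le_one ((2:ℝ) ^ j * η i - q i)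
    have h3 := smoothTransition.nonneg ((2:ℝ) ^ j * η i - q i - 1)
    have h4 := smoothTransition.le_one ((2:ℝ) ^ j * η i - q i - 1)
    constructor <;> linarith
  have hpc : ∀ s : ℤ × (Fin d → ℤ), ∀ η, pc χ m D s η * F η = ((X s.1 η - X (s.1 + 1) η) * P s.1 s.2 η) * (m (gp η) * F η) := by
    intro s η
    rw [pc_eq]; ring
  have hpi : ∀ s : ℤ × (Fin d → ℤ), Integrable fun η => pc χ m D s η * F η := by
    intro s
    simp only [hpc]
    refine hG.bdd_mul (c := 2 * 1) (((hXc s.1).sub (hXc (s.1 + 1))).mul (hPc s.1 s.2)).aestronglyMeasurable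
      (Filter.Eventually.of_forall fun η => ?_)
    rw [norm_mul]
    exact mul_le_mul (hXs _ _) (hPb _ _ _) (norm_nonneg _) (by norm_num)
  -- the inner limit
  have step1 : ∀ J : ℕ, ‖∫ η : Fin d → ℝ, (∑ j ∈ IJ J, (X j η - X (j + 1) η)) * (m (gp η) * F η)‖ ≤ A := by
    intro J
    have hQ : ∀ Q : ℕ, ∑ s ∈ (IJ J) ×ˢ (Fintype.piFinset fun _ : Fin d => IJ Q), ∫ η : Fin d → ℝ, pc χ m D s η * F η =
        ∫ η : Fin d → ℝ, (∑ j ∈ IJ J, (X j η - X (j + 1) η) * ∏ i, ((∑ q ∈ IJ Q, ph0 ((2:ℝ) ^ j * η i - q) : ℝ) : ℂ)) * (m (gp η) * F η) := by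
      intro Q
      rw [← integral_finsetSum _ (fun s _ => hpi s)]
      congr 1
      funext η
      simp only [hpc]
      rw [← Finset.sum_mul, Finset.sum_product]
      congr 1
      refine Finset.sum_congr rfl fun j _ => ?_
      dsimp only
      rw [← Finset.mul_sum]
      congr 1
      simp only [Complex.ofReal_sum]
      rw [Finset.prod_univ_sum]
    have hlim : Filter.Tendsto (fun Q : ℕ => ∫ η : Fin d → ℝ, (∑ j ∈ IJ J, (X j η - X (j + 1) η) * ∏ i, ((∑ q ∈ IJ Q, ph0 ((2:ℝ) ^ j * η i - q) : ℝ) : ℂ)) * (m (gp η) * F η))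
        Filter.atTop (nhds (∫ η : Fin d → ℝ, (∑ j ∈ IJ J, (X j η - X (j + 1) η)) * (m (gp η) * F η))) := by
      refine tendsto_integral_of_dominated_convergence (fun η => (∑ j ∈ IJ J, 2) * ‖m (gp η) * F η‖) ?_ (hG.norm.const_mul _) ?_ ?_
      · intro Q
        refine AEStronglyMeasurable.mul (Continuous.aestronglyMeasurable ?_) hG.aestronglyMeasurable
        refine continuous_finsetSum _ fun j _ => ((hXc j).sub (hXc (j + 1))).mul ?_
        refine continuous_finsetProd _ fun i _ => Complex.continuous_ofReal.comp ?_
        exact continuous_finsetSum _ fun q _ => hph.comp (by fun_prop)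
      · intro Q
        refine Filter.Eventually.of_forall fun η => ?_
        rw [norm_mul]
        refine mul_le_mul_of_nonneg_right ?_ (norm_nonneg _)
        refine (norm_sum_le _ _).trans (Finset.sum_le_sum fun j _ => ?_)
        rw [norm_mul, norm_prod]
        calc _ ≤ (2:ℝ) * 1 := mul_le_mul (hXs _ _) (Finset.prod_le_one (fun i _ => norm_nonneg _) fun i _ => ph_sum_norm Q _)
              (Finset.prod_nonneg fun i _ => norm_nonneg _) (by norm_num)
          _ = 2 := by norm_num
      · refine Filter.Eventually.of_forall fun η => ?_
        refine Filter.Tendsto.mul_const _ (tendsto_finsetSum _ fun j _ => ?_)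
        have : ∀ᶠ Q : ℕ in Filter.atTop, ∀ i : Fin d, ((∑ q ∈ IJ Q, ph0 ((2:ℝ) ^ j * η i - q) : ℝ) : ℂ) = 1 :=
          Filter.eventually_all.2 fun i => ph_sum_one _
        refine tendsto_const_nhds.congr' ?_
        filter_upwards [this] with Q hQ1
        rw [Finset.prod_congr rfl (fun i _ => hQ1 i)]
        simp
    refine le_of_tendsto hlim.norm (Filter.Eventually.of_forall fun Q => ?_)
    rw [← hQ Q]
    exact hA _
  have hlim2 : Filter.Tendsto (fun J : ℕ => ∫ η : Fin d → ℝ, (∑ j ∈ IJ J, (X j η - X (j + 1) η)) * (m (gp η) * F η))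
      Filter.atTop (nhds (∫ η : Fin d → ℝ, m (gp η) * F η)) := by
    have hs : ∀ J : ℕ, ∀ η, ∑ j ∈ IJ J, (X j η - X (j + 1) η) = X (-J) η - X (J + 1) η := fun J η =>
      IJ_sum J (fun j => X j η)
    simp only [hs]
    refine tendsto_integral_of_dominated_convergence (fun η => 2 * ‖m (gp η) * F η‖) ?_ (hG.norm.const_mul _) ?_ ?_
    · intro J
      exact AEStronglyMeasurable.mul ((hXc _).sub (hXc _)).aestronglyMeasurable hG.aestronglyMeasurable
    · intro J
      refine Filter.Eventually.of_forall fun η => ?_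
      rw [norm_mul]
      refine mul_le_mul_of_nonneg_right ?_ (norm_nonneg _)
      exact (norm_sub_le _ _).trans (by linarith [hXb (-J) η, hXb (J + 1) η])
    · filter_upwards [null_Γ Γ hk hkd] with η hη
      have hpos : 0 < Metric.infDist (gp η) (Γ : Set (Fin (d + 1) → ℝ)) := by
        refine ((Submodule.closed_of_finiteDimensional Γ).notMem_iff_infDist_pos ⟨0, Γ.zero_mem⟩).1 hη
      set r := Metric.infDist (gp η) (Γ : Set (Fin (d + 1) → ℝ)) with hr
      refine tendsto_const_nhds.congr' ?_
      have ht := tendsto_pow_atTop_atTop_of_one_lt (r := (2:ℝ)) (by norm_num)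
      filter_upwards [ht.eventually_ge_atTop (D⁻¹ * r), ht.eventually_ge_atTop (2 * D / r)] with J h1 h2
      have e1 : X (-J) η = 1 := by
        apply hχ1
        rw [infDist_smul Γ (by positivity), ← hr, zpow_neg, zpow_natCast]
        rw [mul_right_comm, ← div_eq_mul_inv]
        exact div_le_one_of_le₀ h1 (by positivity)
      have e2 : X (J + 1) η = 0 := by
        apply hχ2
        rw [infDist_smul Γ (by positivity), ← hr, zpow_add_one₀ (by norm_num), zpow_natCast]
        rw [div_le_iff₀ hpos] at h2
        calc (2:ℝ) = D⁻¹ * (2 * D) := by field_simp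
          _ ≤ D⁻¹ * (2 ^ J * 2 * r) := by
              refine mul_le_mul_of_nonneg_left ?_ (by positivity)
              nlinarith
          _ = _ := by ring
      rw [e1, e2]; simp
  exact le_of_tendsto hlim2.norm (Filter.Eventually.of_forall step1)

end MTT

namespace MTT

theorem main10 {d k : ℕ} (hk : 1 ≤ k) (hkn : 2 * k < d + 1)
    (θ : Fin (d + 1) → ℝ) (hθ0 : ∀ i, 0 < θ i) (hθ1 : ∀ i, θ i < 1)
    (hθs : (∑ i, θ i) = ((d + 1 : ℕ) : ℝ) - 2 * k) :
    ∃ M N₀ : ℕ, ∀ N : ℕ, N₀ ≤ N →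
      ∀ (Γ' : Submodule ℝ (Fin (d + 1) → ℝ)),
        (Γ' : Set (Fin (d + 1) → ℝ)) ⊆ GammaSet (d + 1) →
        Module.finrank ℝ Γ' = k →
        NonDegenerate (d + 1) k Γ' →
        ∀ B : ℝ, ∃ C : ℝ, 0 ≤ C ∧ ∀ m : (Fin (d + 1) → ℝ) → ℂ,
          SymbolEst (d + 1) Γ' M B m →
          ∀ (f : Fin (d + 1) → ℝ → ℂ) (aa : Fin (d + 1) → ℝ) (lam : Iv → Fin (d + 1) → ℝ),
            (∀ i, Measurable (f i)) → (∀ i, Integrable (f i)) → (∀ i, MemLp (f i) 2) →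
            (∀ i, ∫ x, ‖f i x‖ ^ 2 ≤ 1) →
            (∀ i, 0 < aa i) →
            (∀ I i, 0 ≤ lam I i) →
            (∀ I : Iv, 0 < I.len → ∀ i,
              (∫ x, ‖f i x‖ * I.chi x ^ N) ≤ aa i * lam I i * I.len) →
            (∀ I : Iv, 0 < I.len → ∀ i,
              (∫ x, ‖f i x‖ ^ 2 * I.chi x ^ N) ≤ lam I i * I.len) →
            (∀ I : Iv, 0 < I.len → lam I (Fin.last d) ≤
              (1 + ∑ i ∈ Finset.univ.erase (Fin.last d), lam I i) ^ ((1 : ℝ) - N)) →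
            ‖∫ η : Fin d → ℝ, m (gp η) * ∏ i, 𝓕 (f i) (gp η i)‖ ≤ C * ∏ i, aa i ^ θ i := by
  obtain ⟨K0, hK0⟩ := exists_nat_ge (((d + 1 : ℕ) + k + 1 : ℝ) / θ (Fin.last d))
  have hθe := hθ0 (Fin.last d)
  have hK : ((d + 1 : ℕ) + k + 1 : ℝ) ≤ K0 * θ (Fin.last d) := by rwa [div_le_iff₀ hθe] at hK0
  have hK1 : 1 ≤ K0 := by
    by_contra h
    have h0 : K0 = 0 := by omega
    rw [h0] at hK
    push_cast at hK
    have : (0:ℝ) ≤ d := by positivity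
    have : (0:ℝ) ≤ k := by positivity
    linarith
  set w := K0 + 1 with hw
  set d0 := 4 * w + 6 with hd0
  refine ⟨d0 * (d + 1) + (d + 1), 2 * K0 + 1, ?_⟩
  intro N hN Γ hΓG hfr hnd B
  set r : ℝ := 2 * (d + 1) with hr
  have hd0' : (0:ℝ) ≤ d := by positivity
  have hrp : 0 < r := by rw [hr]; positivity
  have hR : 1 ≤ 2 * r := by rw [hr]; linarith
  obtain ⟨ρ, hρ, hρc, hΨ, -, hρ1, -, Cρ, hCρ, hprof⟩ := exists_prof d0 hrp
  set D : ℝ := 2 * (((d + 1 : ℕ) : ℝ) * bb (2 * r) + 2 * (d + 1)) with hDd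
  have hbb : 0 < bb (2 * r) := by unfold bb; linarith
  have hD : 0 < D := by rw [hDd]; positivity
  obtain ⟨r1, hgeo⟩ := geo_of_wh hnd hΓG hR (D1 := D / 2 - 2 * (d + 1)) (D2 := 2 * D + 2 * (d + 1))
    (by rw [hDd]; linarith) (by positivity)
  obtain ⟨C0, hC0, hL⟩ := lam_to_L (Fin.last d) hK1 hN
  obtain ⟨Cm, hCm, hmodel⟩ := model hk (by omega) θ hθ0 hθ1 hθs hR r1 w K0 (Fin.last d) hK hC0
  obtain ⟨χ, hχs, hχ1, hχ2, hχb, hχd⟩ := exists_chi Γ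
  obtain ⟨C1, hC1, hMq⟩ := Mq_decay (K := d0 * (d + 1) + (d + 1)) (by omega) hχs hχ1 hχd hD B
  obtain ⟨C3, hC3, hW⟩ := W_fin d d0 hC1
  refine ⟨C3 * (Cm * Cρ ^ (d + 1)), by positivity, ?_⟩
  intro m hm f aa lam hfm hfi hf2 hf21 haa hl0 hl1 hl2 hle
  obtain ⟨L, hL0, hL1, hL2, hLe⟩ := hL f aa lam hfm hfi hf2 haa hl0 hl1 hl2 hle
  have hpa : 0 ≤ ∏ i, aa i ^ θ i := Finset.prod_nonneg fun i _ => Real.rpow_nonneg (haa i).le _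
  by_cases hG : Integrable fun η : Fin d → ℝ => m (gp η) * ∏ i, 𝓕 (f i) (gp η i)
  swap
  · rw [integral_undef hG, norm_zero]; positivity
  set CM := Cm * Cρ ^ (d + 1) * ∏ i, aa i ^ θ i with hCMd
  have hCM : 0 ≤ CM := by positivity
  rw [show C3 * (Cm * Cρ ^ (d + 1)) * ∏ i, aa i ^ θ i = C3 * CM by rw [hCMd]; ring]
  refine lim_bound hfr (by omega) hχs.continuous hχb hχ1 hχ2 hD _ hG ?_
  refine fin_bound hρ hρc hΨ hρ1 hfi d0 hCM hχ1 hχ2 hD ?_ hC3 (hMq m hm) (hW CM hCM)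
  intro t PP hPP
  have h := hmodel f aa L hfm hfi hf2 hf21 haa hL0 hL1 hL2 hLe (fun i z => 𝓕⁻ ρ (t i - z))
    (fun i => Cρ * (1 + |t i|) ^ d0) (fun i => hprof (t i)) (fun i => by positivity) PP (hgeo PP hPP)
  refine h.trans (le_of_eq ?_)
  rw [Finset.prod_mul_distrib, Finset.prod_const, Finset.card_univ, Fintype.card_fin, hCMd]
  ring

end MTT

/-- Theorem 4.2 (`abstract`): the bound `|Λ(f₁,…,fₙ)| ≲ ∏ aᵢ^{θᵢ}` for
L²-normalized functions whose localized L¹ and L² averages are controlled by weights `λᵢ(I)`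
satisfying the decay estimate. -/
theorem statement10 (n k : ℕ) (hn : 2 ≤ n) (hk : 1 ≤ k) (hkn : 2 * k < n)
    (θ : Fin n → ℝ) (hθ0 : ∀ i, 0 < θ i) (hθ1 : ∀ i, θ i < 1)
    (hθs : (∑ i, θ i) = (n : ℝ) - 2 * k) :
    ∃ M N₀ : ℕ, ∀ N : ℕ, N₀ ≤ N →
      ∀ (Γ' : Submodule ℝ (Fin n → ℝ)),
        (Γ' : Set (Fin n → ℝ)) ⊆ GammaSet n →
        Module.finrank ℝ Γ' = k →
        NonDegenerate n k Γ' →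
        ∀ B : ℝ, ∃ C : ℝ, ∀ m : (Fin n → ℝ) → ℂ,
          SymbolEst n Γ' M B m →
          ∀ (f : Fin n → ℝ → ℂ) (aa : Fin n → ℝ) (lam : Iv → Fin n → ℝ),
            (∀ i, Measurable (f i)) →
            (∀ i, eLpNorm (f i) 2 volume ≤ 1) →
            (∀ i, 0 < aa i) →
            (∀ I i, 0 ≤ lam I i) →
            (∀ I : Iv, 0 < I.len → ∀ i,
              (∫ x, ‖f i x‖ * I.chi x ^ N) ≤ aa i * lam I i * I.len) →
            (∀ I : Iv, 0 < I.len → ∀ i,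
              (∫ x, ‖f i x‖ ^ 2 * I.chi x ^ N) ≤ lam I i * I.len) →
            (∀ I : Iv, 0 < I.len →
              lam I ⟨n - 1, by omega⟩ ≤
                (1 + ∑ i ∈ Finset.univ.filter (fun i : Fin n => (i : ℕ) < n - 1),
                  lam I i) ^ ((1 : ℝ) - N)) →
            ‖Lam n m f‖ ≤ C * ∏ i, aa i ^ θ i := by
  obtain ⟨d, rfl⟩ : ∃ d, n = d + 1 := ⟨n - 1, by omega⟩
  obtain ⟨M, N₀, H⟩ := MTT.main10 hk hkn θ hθ0 hθ1 hθs
  refine ⟨M, N₀, ?_⟩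
  intro N hN Γ hΓ hfr hnd B
  obtain ⟨C, hC, HC⟩ := H N hN Γ hΓ hfr hnd B
  refine ⟨C, ?_⟩
  intro m hm f aa lam hfm hf2 haa hl0 hl1 hl2 hle
  have hpa : 0 ≤ ∏ i, aa i ^ θ i := Finset.prod_nonneg fun i _ => Real.rpow_nonneg (haa i).le _
  have hLam : Lam (d + 1) m f = ∫ η : Fin d → ℝ, m (MTT.gp η) * ∏ i, 𝓕 (f i) (MTT.gp η i) := by
    unfold Lam
    have : ∀ η : Fin d → ℝ, gammaParam (d + 1) η = MTT.gp η := MTT.gammaParam_eq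
    change (∫ η : Fin d → ℝ, m (gammaParam (d + 1) η) * ∏ i, 𝓕 (f i) (gammaParam (d + 1) η i)) = _
    simp only [this]
  rw [hLam]
  by_cases hfi : ∀ i, Integrable (f i)
  swap
  · push Not at hfi
    obtain ⟨i, hi⟩ := hfi
    have h0 : ∀ ξ : ℝ, 𝓕 (f i) ξ = 0 := by
      intro ξ
      rw [Real.fourier_eq]
      apply integral_undef
      intro h
      apply hi
      refine (Real.fourierIntegral_convergent_iff ξ).1 ?_
      exact h
    have h1 : ∀ η : Fin d → ℝ, m (MTT.gp η) * ∏ i, 𝓕 (f i) (MTT.gp η i) = 0 := by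
      intro η
      rw [Finset.prod_eq_zero (Finset.mem_univ i) (h0 _), mul_zero]
    simp only [h1, integral_zero, norm_zero]
    positivity
  have hm2 : ∀ i, MemLp (f i) 2 := fun i => ⟨(hfm i).aestronglyMeasurable, (hf2 i).trans_lt (by simp)⟩
  have h21 : ∀ i, ∫ x, ‖f i x‖ ^ 2 ≤ 1 := by
    intro i
    have h1 := hf2 i
    rw [(hm2 i).eLpNorm_eq_integral_rpow_norm (by norm_num) (by norm_num)] at h1
    have h2 : ∫ x, ‖f i x‖ ^ (ENNReal.toReal 2) = ∫ x, ‖f i x‖ ^ 2 := by simp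
    rw [h2] at h1
    rw [← ENNReal.ofReal_one, ENNReal.ofReal_le_ofReal_iff (by norm_num)] at h1
    have h0 : 0 ≤ ∫ x, ‖f i x‖ ^ 2 := integral_nonneg fun x => by positivity
    by_contra hc
    push Not at hc
    have := Real.one_lt_rpow hc (z := (ENNReal.toReal 2)⁻¹) (by norm_num)
    linarith
  refine HC m hm f aa lam hfm hfi hm2 h21 haa hl0 hl1 hl2 ?_
  intro I hI
  have h := hle I hI
  have e1 : (Finset.univ.filter (fun i : Fin (d + 1) => (i : ℕ) < d + 1 - 1)) = Finset.univ.erase (Fin.last d) := by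
    ext i
    simp only [Finset.mem_filter, Finset.mem_univ, true_and, Finset.mem_erase, and_true, ne_eq, Fin.ext_iff, Fin.val_last]
    have := i.2
    omega
  rw [e1] at h
  exact h
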